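/- Let Σ be a rational pointed fan in ℝ^d with k = dim Σ. If |Γ_Σ| is homeomorphic to a (k−1)-dimensional sphere, then Σ is an Euler fan and K[Σ] is Gorenstein, for every field K. -/

import Mathlib

open scoped BigOperators Classical

noncomputable section

/-- The coercion of an integer point to a real point. -/
def Z2R {d : ℕ} (a : Fin d → ℤ) : Fin d → ℝ := fun i => (a i : ℝ)

/-- The conical hull of a finite set of vectors. -/
def conicalHull {d : ℕ} (S : Finset (Fin d → ℝ)) : Set (Fin d → ℝ) :=
  {x | ∃ c : (Fin d → ℝ) → ℝ, (∀ v, 0 ≤ c v) ∧ x = ∑ v ∈ S, c v • v}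

/-- A rational (polyhedral) cone: the conical hull of finitely many rational vectors. -/
def IsRatCone {d : ℕ} (C : Set (Fin d → ℝ)) : Prop :=
  ∃ S : Finset (Fin d → ℝ), (∀ v ∈ S, ∀ i, ∃ q : ℚ, v i = (q : ℝ)) ∧ C = conicalHull S

/-- A pointed cone contains no line. -/
def IsPointedSet {d : ℕ} (C : Set (Fin d → ℝ)) : Prop :=
  ∀ x ∈ C, -x ∈ C → x = 0

/-- A rational pointed cone. -/
def IsRatPointedCone {d : ℕ} (C : Set (Fin d → ℝ)) : Prop :=
  IsRatCone C ∧ IsPointedSet C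

/-- A convex cone (containing the origin). -/
def IsConvexCone {d : ℕ} (C : Set (Fin d → ℝ)) : Prop :=
  0 ∈ C ∧ (∀ x ∈ C, ∀ y ∈ C, x + y ∈ C) ∧ ∀ x ∈ C, ∀ t : ℝ, 0 ≤ t → t • x ∈ C

/-- `C'` is a face of the cone `C`. -/
def IsFaceOf {d : ℕ} (C' C : Set (Fin d → ℝ)) : Prop :=
  IsConvexCone C' ∧ C' ⊆ C ∧ ∀ x ∈ C, ∀ y ∈ C, x + y ∈ C' → x ∈ C' ∧ y ∈ C'

/-- A rational pointed fan in `ℝ^d`. -/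
structure Fan (d : ℕ) where
  cones : Set (Set (Fin d → ℝ))
  finite : cones.Finite
  pointed : ∀ C ∈ cones, IsRatPointedCone C
  faces_mem : ∀ C ∈ cones, ∀ C', IsFaceOf C' C → C' ∈ cones
  inter_face : ∀ C ∈ cones, ∀ C' ∈ cones, IsFaceOf (C ∩ C') C ∧ IsFaceOf (C ∩ C') C'

/-- The dimension of a cone. -/
def coneDim {d : ℕ} (C : Set (Fin d → ℝ)) : ℕ :=
  Module.finrank ℝ (Submodule.span ℝ C)

/-- The dimension of a fan. -/
def Fan.dim {d : ℕ} (Φ : Fan d) : ℕ := sSup (coneDim '' Φ.cones)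

/-- The set of lattice points in the support of a fan. -/
def Fan.supp {d : ℕ} (Φ : Fan d) : Set (Fin d → ℤ) :=
  {a | ∃ C ∈ Φ.cones, Z2R a ∈ C}

/-- The relative interior of a cone. -/
def relint {d : ℕ} (C : Set (Fin d → ℝ)) : Set (Fin d → ℝ) := intrinsicInterior ℝ C

section ToricFaceRing

variable (K : Type) [Field K] {d : ℕ} (Φ : Fan d)

/-- The ambient polynomial ring: the monoid algebra of the free commutative
monoid on the lattice points of the support of the fan. -/
abbrev Fan.polyRing := AddMonoidAlgebra K (↥Φ.supp →₀ ℕ)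

/-- The monomial of the ambient polynomial ring corresponding to a lattice point. -/
def Fan.X (m : ↥Φ.supp) : Φ.polyRing K :=
  AddMonoidAlgebra.single (Finsupp.single m 1) (1 : K)

/-- Auxiliary monomial: zero if the point is not in the support. -/
def Fan.Xaux (a : Fin d → ℤ) : Φ.polyRing K :=
  if h : a ∈ Φ.supp then Φ.X K ⟨a, h⟩ else 0

/-- The defining relations of the toric face ring. -/
def Fan.relIdeal : Ideal (Φ.polyRing K) :=
  Ideal.span
    ({z | ∃ a b : ↥Φ.supp, (∃ C ∈ Φ.cones, Z2R a.1 ∈ C ∧ Z2R b.1 ∈ C) ∧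
        z = Φ.X K a * Φ.X K b - Φ.Xaux K (a.1 + b.1)} ∪
     {z | ∃ a b : ↥Φ.supp, (¬ ∃ C ∈ Φ.cones, Z2R a.1 ∈ C ∧ Z2R b.1 ∈ C) ∧
        z = Φ.X K a * Φ.X K b} ∪
     {z | ∃ a : ↥Φ.supp, a.1 = 0 ∧ z = Φ.X K a - 1})

/-- The toric face ring `K[Φ]` of a rational pointed fan `Φ`. -/
def ToricFaceRing := Φ.polyRing K ⧸ Φ.relIdeal K

instance : CommRing (ToricFaceRing K Φ) := Ideal.Quotient.commRing _
instance : Algebra K (ToricFaceRing K Φ) := Ideal.Quotient.algebra K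

/-- The monomial `x^a` of the toric face ring. -/
def xpow (a : Fin d → ℤ) : ToricFaceRing K Φ :=
  Ideal.Quotient.mk (Φ.relIdeal K) (Φ.Xaux K a)

/-- A `ℤ^d`-graded (monomial) ideal of the toric face ring. -/
def IsMonomialIdeal (I : Ideal (ToricFaceRing K Φ)) : Prop :=
  ∃ S : Set (Fin d → ℤ), I = Ideal.span (xpow K Φ '' S)

/-- The graded prime ideal `𝔭_C` associated to a cone. -/
def conePrime (C : Set (Fin d → ℝ)) : Ideal (ToricFaceRing K Φ) :=
  Ideal.span (xpow K Φ '' {a | Z2R a ∉ C})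

/-- The graded radical ideal `𝔮_{Σ'}` associated to a collection of cones. -/
def subfanIdeal (T : Set (Set (Fin d → ℝ))) : Ideal (ToricFaceRing K Φ) :=
  Ideal.span (xpow K Φ '' {a | Z2R a ∉ ⋃₀ T})

/-- The graded maximal ideal of the toric face ring. -/
def gradedMaxIdeal : Ideal (ToricFaceRing K Φ) :=
  Ideal.span (xpow K Φ '' {a | a ≠ 0})

end ToricFaceRing
/-- Auxiliary fuelled definition of a regular sequence contained in an ideal. -/
def RegSeqAux : ℕ → (R : Type) → [inst : CommRing R] → Ideal R → List R → Prop
  | 0, _, _, _, l => l = []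
  | n + 1, R, _, I, l =>
      ∃ (x : R) (xs : List R), l = x :: xs ∧ x ∈ I ∧ x ∈ nonZeroDivisors R ∧
        RegSeqAux n (R ⧸ Ideal.span {x}) (Ideal.map (Ideal.Quotient.mk (Ideal.span {x})) I)
          (xs.map (Ideal.Quotient.mk (Ideal.span {x})))

/-- `l` is a regular sequence of `R` contained in the ideal `I`. -/
def IsRegSeqIn (R : Type) [CommRing R] (I : Ideal R) (l : List R) : Prop :=
  RegSeqAux l.length R I l

/-- A (graded or local) ring is Cohen--Macaulay with respect to the (maximal) ideal `I` if
there is a regular sequence inside `I` whose length equals the Krull dimension. -/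
def IsCMRingWrt (R : Type) [CommRing R] (I : Ideal R) : Prop :=
  ∃ l : List R, IsRegSeqIn R I l ∧ (l.length : WithBot (WithTop ℕ)) = ringKrullDim R

/-- Gorenstein with respect to the (maximal) ideal `I`: Cohen--Macaulay, and the quotient by
some maximal regular sequence has irreducible zero ideal. -/
def IsGorensteinRingWrt (R : Type) [CommRing R] (I : Ideal R) : Prop :=
  IsCMRingWrt R I ∧
    ∃ l : List R, IsRegSeqIn R I l ∧ (l.length : WithBot (WithTop ℕ)) = ringKrullDim R ∧
      ∀ A B : Ideal (R ⧸ Ideal.span {x | x ∈ l}), A ⊓ B = ⊥ → A = ⊥ ∨ B = ⊥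
/-- The unit sphere in `ℝ^n`. -/
def unitSphere (n : ℕ) : Set (Fin n → ℝ) := {x | ∑ i, (x i) ^ 2 = 1}

/-- The standard `m`-dimensional closed ball. -/
def ballModel (m : ℕ) : Set (Fin m → ℝ) := {x | ∑ i, (x i) ^ 2 ≤ 1}

/-- The standard `m`-dimensional sphere. -/
def sphereModel (m : ℕ) : Set (Fin (m + 1) → ℝ) := {x | ∑ i, (x i) ^ 2 = 1}

/-- The underlying space `|Γ_T|` of the cell complex cut out on the unit sphere by a
collection `T` of cones. -/
def GammaSet {d : ℕ} (T : Set (Set (Fin d → ℝ))) : Set (Fin d → ℝ) :=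
  ⋃₀ T ∩ unitSphere d
/-- A facet of a fan: a maximal cone. -/
def IsFacet {d : ℕ} (Φ : Fan d) (C : Set (Fin d → ℝ)) : Prop :=
  C ∈ Φ.cones ∧ ∀ D ∈ Φ.cones, C ⊆ D → D = C

/-- The number `ρ_Φ(C) = Σ_i (−1)^{i+1} f_i(star_Φ(C))`. -/
def fanRho {d : ℕ} (Φ : Fan d) (C : Set (Fin d → ℝ)) : ℤ :=
  ∑ i ∈ Finset.range (Fan.dim Φ + 1),
    (-1 : ℤ) ^ (i + 1) *
      (Nat.card {D : Set (Fin d → ℝ) // D ∈ Φ.cones ∧ C ⊆ D ∧ coneDim D = i} : ℤ)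

/-- An Euler fan: pure, with `ρ_Φ(C) = (−1)^{dim Φ − 1}` for every cone `C`. -/
def IsEulerFan {d : ℕ} (Φ : Fan d) : Prop :=
  (∀ C, IsFacet Φ C → coneDim C = Fan.dim Φ) ∧
    ∀ C ∈ Φ.cones, fanRho Φ C = (-1 : ℤ) ^ (Fan.dim Φ - 1)

section OrderedChains

variable (K : Type) [Field K]

/-- Prepending an entry to every list of a chain. -/
def chCons {E : Type} (x : E) : (List E →₀ K) →ₗ[K] (List E →₀ K) :=
  Finsupp.lmapDomain K K (List.cons x)

/-- Linear extension of a function on lists. -/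
abbrev chLin {E W : Type} [AddCommGroup W] [Module K W] (f : List E → W) :
    (List E →₀ K) →ₗ[K] W :=
  Finsupp.linearCombination K f

/-- The boundary of an ordered simplex (augmented version). -/
def lbd {E : Type} : List E → (List E →₀ K)
  | [] => 0
  | x :: l => Finsupp.single l 1 - chCons K x (lbd l)

/-- The boundary operator on ordered chains. -/
abbrev chD {E : Type} : (List E →₀ K) →ₗ[K] (List E →₀ K) := chLin K (lbd K)

/-- Chains supported on lists satisfying a predicate. -/
abbrev chSupp {E : Type} (P : List E → Prop) : Submodule K (List E →₀ K) :=
  Finsupp.supported K K {l | P l}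

variable {K}

@[simp] lemma chCons_single {E : Type} (x : E) (l : List E) (r : K) :
    chCons K x (Finsupp.single l r) = Finsupp.single (x :: l) r := by
  simp [chCons, Finsupp.lmapDomain_apply]

lemma chLin_ext {E W : Type} [AddCommGroup W] [Module K W]
    {f g : (List E →₀ K) →ₗ[K] W} {P : List E → Prop}
    (h : ∀ l, P l → f (Finsupp.single l 1) = g (Finsupp.single l 1))
    {c : List E →₀ K} (hc : c ∈ chSupp K P) : f c = g c := by
  have : c = c.sum fun l r => r • Finsupp.single l (1 : K) := by
    simp [Finsupp.smul_single]
  rw [this, Finsupp.sum, map_sum, map_sum]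
  refine Finset.sum_congr rfl fun l hl => ?_
  rw [map_smul, map_smul, h l (hc hl)]

lemma chSupp_map {E E' : Type} {f : (List E →₀ K) →ₗ[K] (List E' →₀ K)}
    {P : List E → Prop} {Q : List E' → Prop}
    (h : ∀ l, P l → f (Finsupp.single l 1) ∈ chSupp K Q)
    {c : List E →₀ K} (hc : c ∈ chSupp K P) : f c ∈ chSupp K Q := by
  have : c = c.sum fun l r => r • Finsupp.single l (1 : K) := by
    simp [Finsupp.smul_single]
  rw [this, Finsupp.sum, map_sum]
  refine Submodule.sum_mem _ fun l hl => ?_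
  rw [map_smul]
  exact Submodule.smul_mem _ _ (h l (hc hl))

lemma single_mem_chSupp {E : Type} {P : List E → Prop} {l : List E} (h : P l) (r : K) :
    Finsupp.single l r ∈ chSupp K P := Finsupp.single_mem_supported K r h

lemma chSupp_mono {E : Type} {P Q : List E → Prop} (h : ∀ l, P l → Q l)
    {c : List E →₀ K} (hc : c ∈ chSupp K P) : c ∈ chSupp K Q :=
  Finsupp.supported_mono (fun _ hl => h _ hl) hc

lemma chCons_mem {E : Type} {P Q : List E → Prop} {x : E} (h : ∀ l, P l → Q (x :: l))
    {c : List E →₀ K} (hc : c ∈ chSupp K P) : chCons K x c ∈ chSupp K Q := by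
  refine chSupp_map (P := P) (fun l hl => ?_) hc
  rw [chCons_single]
  exact single_mem_chSupp (h l hl) 1

lemma chD_cons {E : Type} (x : E) (c : List E →₀ K) :
    chD K (chCons K x c) = c - chCons K x (chD K c) := by
  have := chLin_ext (f := chD K ∘ₗ chCons K x) (g := LinearMap.id - chCons K x ∘ₗ chD K)
    (P := fun _ => True) (c := c) (by intro l _; simp [lbd]) (by simp [Finsupp.mem_supported])
  simpa using this

lemma chD_lbd {E : Type} (l : List E) : chD K (lbd K l) = 0 := by
  induction l with
  | nil => simp [lbd]
  | cons x l ih => simp [lbd, chD_cons, ih]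

/-- The boundary of a list only involves sublists with one entry less. -/
lemma lbd_mem {E : Type} (l : List E) :
    lbd K l ∈ chSupp K (fun l' => l'.length + 1 = l.length ∧ ∀ x ∈ l', x ∈ l) := by
  induction l with
  | nil => simp [lbd]
  | cons x l ih =>
    refine Submodule.sub_mem _ (single_mem_chSupp (by simp +contextual) 1) ?_
    refine chCons_mem (fun l' hl' => ?_) ih
    refine ⟨by simp [hl'.1], ?_⟩
    simp only [List.mem_cons]
    rintro y (rfl | hy)
    · simp
    · exact Or.inr (hl'.2 y hy)

/-- Pushing forward chains along a map of points. -/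
def chMap (K : Type) [Field K] {E E' : Type} (f : E → E') :
    (List E →₀ K) →ₗ[K] (List E' →₀ K) := Finsupp.lmapDomain K K (List.map f)

@[simp] lemma chMap_single {E E' : Type} (f : E → E') (l : List E) (r : K) :
    chMap K f (Finsupp.single l r) = Finsupp.single (l.map f) r := by
  simp [chMap, Finsupp.lmapDomain_apply]

lemma chMap_cons {E E' : Type} (f : E → E') (x : E) (c : List E →₀ K) :
    chMap K f (chCons K x c) = chCons K (f x) (chMap K f c) := by
  have := chLin_ext (f := chMap K f ∘ₗ chCons K x) (g := chCons K (f x) ∘ₗ chMap K f)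
    (P := fun _ => True) (c := c) (by intro l _; simp) (by simp [Finsupp.mem_supported])
  simpa using this

lemma lbd_map {E E' : Type} (f : E → E') (l : List E) :
    lbd K (l.map f) = chMap K f (lbd K l) := by
  induction l with
  | nil => simp [lbd]
  | cons x l ih => simp [lbd, ih, chMap_cons]

lemma chD_chMap {E E' : Type} (f : E → E') (c : List E →₀ K) :
    chD K (chMap K f c) = chMap K f (chD K c) := by
  have := chLin_ext (f := chD K ∘ₗ chMap K f) (g := chMap K f ∘ₗ chD K)
    (P := fun _ => True) (c := c) (by intro l _; simp [lbd_map]) (by simp [Finsupp.mem_supported])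
  simpa using this

/-- The prism on an ordered simplex between two vertex maps. -/
def lprism (K : Type) [Field K] {E E' : Type} (f g : E → E') : List E → (List E' →₀ K)
  | [] => 0
  | x :: l => chCons K (f x) (Finsupp.single ((x :: l).map g) 1) - chCons K (f x) (lprism K f g l)

lemma lprism_cons {E E' : Type} (f g : E → E') (x : E) (c : List E →₀ K) :
    chLin K (lprism K f g) (chCons K x c) =
      chCons K (f x) (chCons K (g x) (chMap K g c)) -
        chCons K (f x) (chLin K (lprism K f g) c) := by
  have := chLin_ext (f := chLin K (lprism K f g) ∘ₗ chCons K x)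
    (g := chCons K (f x) ∘ₗ chCons K (g x) ∘ₗ chMap K g -
        chCons K (f x) ∘ₗ chLin K (lprism K f g))
    (P := fun _ => True) (c := c) (by intro l _; simp [lprism]) (by simp [Finsupp.mem_supported])
  simpa using this

lemma lprism_homotopy {E E' : Type} (f g : E → E') (l : List E) :
    chD K (lprism K f g l) + chLin K (lprism K f g) (lbd K l) =
      Finsupp.single (l.map g) 1 - Finsupp.single (l.map f) 1 := by
  induction l with
  | nil => simp [lprism, lbd]
  | cons x l ih =>
    have ih' := eq_sub_of_add_eq ih
    rw [lprism, lbd, map_sub, chD_cons, chD_cons, ih', map_sub (chLin K (lprism K f g)), lprism_cons]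
    simp only [List.map_cons, Finsupp.linearCombination_single, one_smul, lbd, map_sub,
      chCons_single, lbd_map]
    abel

lemma lprism_mem {E E' : Type} (f g : E → E') (l : List E) :
    lprism K f g l ∈ chSupp K (fun l' => ∀ y ∈ l', ∃ x ∈ l, y = f x ∨ y = g x) := by
  induction l with
  | nil => simp [lprism]
  | cons x l ih =>
    refine Submodule.sub_mem _ ?_ ?_
    · rw [chCons_single]
      refine single_mem_chSupp ?_ 1
      intro y hy
      simp only [List.map_cons, List.mem_cons, List.mem_map] at hy
      rcases hy with rfl | rfl | ⟨z, hz, rfl⟩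
      · exact ⟨x, by simp⟩
      · exact ⟨x, by simp⟩
      · exact ⟨z, by simp [hz]⟩
    · refine chCons_mem (fun l' hl' => ?_) ih
      intro y hy
      rcases List.mem_cons.1 hy with rfl | hy
      · exact ⟨x, by simp⟩
      · obtain ⟨z, hz, h⟩ := hl' y hy
        exact ⟨z, by simp [hz], h⟩

end OrderedChains

section Subdivision

variable {K : Type} [Field K] {E : Type}

/-- Subdivision of ordered chains of a given length. -/
def sdN (K : Type) [Field K] {E : Type} (b : List E → E) : ℕ → ((List E →₀ K) →ₗ[K] (List E →₀ K))
  | 0 => LinearMap.id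
  | n + 1 => chLin K fun l => chCons K (b l) (sdN K b n (lbd K l))

/-- The homotopy between subdivision and the identity on chains of a given length. -/
def sdT (K : Type) [Field K] {E : Type} (b : List E → E) : ℕ → ((List E →₀ K) →ₗ[K] (List E →₀ K))
  | 0 => 0
  | n + 1 => chLin K fun l => chCons K (b l) (Finsupp.single l 1 - sdT K b n (lbd K l))

lemma lbd_mem_length {n : ℕ} {l : List E} (h : l.length = n + 1) :
    lbd K l ∈ chSupp K (fun l' => l'.length = n) :=
  chSupp_mono (fun l' hl' => by omega) (lbd_mem (K := K) l)

lemma sdN_mem_length (b : List E → E) (n : ℕ) {c : List E →₀ K}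
    (hc : c ∈ chSupp K (fun l => l.length = n)) :
    sdN K b n c ∈ chSupp K (fun l => l.length = n) := by
  induction n generalizing c with
  | zero => simpa [sdN] using hc
  | succ n ih =>
    refine chSupp_map (fun l hl => ?_) hc
    rw [sdN, Finsupp.linearCombination_single, one_smul]
    exact chCons_mem (fun l' hl' => by simp [hl']) (ih (lbd_mem_length hl))

lemma chD_sdN (b : List E → E) (n : ℕ) {c : List E →₀ K}
    (hc : c ∈ chSupp K (fun l => l.length = n + 1)) :
    chD K (sdN K b (n + 1) c) = sdN K b n (chD K c) := by
  induction n generalizing c with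
  | zero =>
    refine chLin_ext (f := chD K ∘ₗ sdN K b 1) (g := sdN K b 0 ∘ₗ chD K) (fun l hl => ?_) hc
    obtain ⟨x, rfl⟩ := List.length_eq_one_iff.1 hl
    simp [sdN, lbd]
  | succ n ih =>
    refine chLin_ext (f := chD K ∘ₗ sdN K b (n + 2)) (g := sdN K b (n + 1) ∘ₗ chD K)
      (fun l hl => ?_) hc
    have := ih (lbd_mem_length (K := K) hl)
    rw [chD_lbd, map_zero] at this
    simp only [LinearMap.coe_comp, Function.comp_apply, Finsupp.linearCombination_single, one_smul]
    rw [sdN, Finsupp.linearCombination_single, one_smul, chD_cons, this, map_zero, sub_zero]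

lemma sdT_homotopy (b : List E → E) (n : ℕ) {c : List E →₀ K}
    (hc : c ∈ chSupp K (fun l => l.length = n + 1)) :
    chD K (sdT K b (n + 1) c) + sdT K b n (chD K c) = c - sdN K b (n + 1) c := by
  induction n generalizing c with
  | zero =>
    refine chLin_ext (f := chD K ∘ₗ sdT K b 1 + sdT K b 0 ∘ₗ chD K)
      (g := LinearMap.id - sdN K b 1) (fun l hl => ?_) hc
    obtain ⟨x, rfl⟩ := List.length_eq_one_iff.1 hl
    simp [sdN, sdT, lbd]
  | succ n ih =>
    refine chLin_ext (f := chD K ∘ₗ sdT K b (n + 2) + sdT K b (n + 1) ∘ₗ chD K)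
      (g := LinearMap.id - sdN K b (n + 2)) (fun l hl => ?_) hc
    have := ih (lbd_mem_length (K := K) hl)
    rw [chD_lbd, map_zero, add_zero] at this
    simp only [LinearMap.coe_comp, Function.comp_apply, LinearMap.add_apply, LinearMap.sub_apply,
      LinearMap.id_apply, Finsupp.linearCombination_single, one_smul]
    rw [sdT, sdN, Finsupp.linearCombination_single, one_smul, chD_cons, map_sub, this,
      Finsupp.linearCombination_single, one_smul, Finsupp.linearCombination_single, one_smul]
    simp only [sub_sub_cancel]
    abel

/-- Iterated homotopy between iterated subdivision and the identity. -/
def sdTT (K : Type) [Field K] {E : Type} (b : List E → E) (n : ℕ) :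
    ℕ → ((List E →₀ K) →ₗ[K] (List E →₀ K))
  | 0 => 0
  | m + 1 => sdTT K b n m + sdT K b n ∘ₗ ((sdN K b n) ^ m)

lemma sdN_pow_mem_length (b : List E → E) (n m : ℕ) {c : List E →₀ K}
    (hc : c ∈ chSupp K (fun l => l.length = n)) :
    ((sdN K b n) ^ m) c ∈ chSupp K (fun l => l.length = n) := by
  induction m with
  | zero => simpa using hc
  | succ m ih => rw [pow_succ']; exact sdN_mem_length b n ih

lemma chD_sdN_pow (b : List E → E) (n m : ℕ) {c : List E →₀ K}
    (hc : c ∈ chSupp K (fun l => l.length = n + 1)) :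
    chD K (((sdN K b (n + 1)) ^ m) c) = ((sdN K b n) ^ m) (chD K c) := by
  induction m with
  | zero => simp
  | succ m ih =>
    rw [pow_succ', pow_succ', Module.End.mul_apply, Module.End.mul_apply,
      chD_sdN b n (sdN_pow_mem_length b _ m hc), ih]

lemma sdTT_homotopy (b : List E → E) (n m : ℕ) {c : List E →₀ K}
    (hc : c ∈ chSupp K (fun l => l.length = n + 1)) :
    chD K (sdTT K b (n + 1) m c) + sdTT K b n m (chD K c) = c - ((sdN K b (n + 1)) ^ m) c := by
  induction m with
  | zero => simp [sdTT]
  | succ m ih =>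
    have h2 := sdT_homotopy b n (sdN_pow_mem_length b _ m hc)
    rw [chD_sdN_pow b n m hc] at h2
    simp only [sdTT, LinearMap.add_apply, map_add, LinearMap.coe_comp, Function.comp_apply]
    rw [pow_succ', Module.End.mul_apply]
    rw [add_add_add_comm, ih, h2]
    abel

end Subdivision

section SmallSubdivision

variable {K : Type} [Field K] {E : Type} [NormedAddCommGroup E] [NormedSpace ℝ E]

/-- The barycentre of a list of points. -/
def listBary (l : List E) : E := (l.length : ℝ)⁻¹ • l.sum

lemma norm_sum_sub_le (l : List E) (x : E) {δ : ℝ} (h : ∀ y ∈ l, dist y x ≤ δ) :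
    ‖l.sum - (l.length : ℝ) • x‖ ≤ l.length * δ := by
  induction l with
  | nil => simp
  | cons y l ih =>
    have h1 := ih fun z hz => h z (by simp [hz])
    have h2 := h y (by simp)
    rw [dist_eq_norm] at h2
    have : (y :: l).sum - ((y :: l).length : ℝ) • x = (y - x) + (l.sum - (l.length : ℝ) • x) := by
      simp only [List.sum_cons, List.length_cons]; push_cast; module
    rw [this]
    refine (norm_add_le _ _).trans ?_
    simp only [List.length_cons]; push_cast; linarith

lemma listBary_dist {l : List E} {δ : ℝ} {n : ℕ} (hl : l.length = n + 1)
    (h : ∀ x ∈ l, ∀ y ∈ l, dist x y ≤ δ) {x : E} (hx : x ∈ l) :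
    dist (listBary l) x ≤ n / (n + 1) * δ := by
  have hp := List.perm_cons_erase hx
  have h1 : (l.erase x).length = n := by
    rw [List.length_erase_of_mem hx, hl]; rfl
  have h2 := norm_sum_sub_le (l.erase x) x (δ := δ)
    fun y hy => h y (List.mem_of_mem_erase hy) x hx
  have h3 : l.sum = x + (l.erase x).sum := by rw [hp.sum_eq, List.sum_cons]
  have hn : (0 : ℝ) < n + 1 := by positivity
  have : listBary l - x = ((n : ℝ) + 1)⁻¹ • ((l.erase x).sum - ((l.erase x).length : ℝ) • x) := by
    have hx' : x = ((n : ℝ) + 1)⁻¹ • (((n : ℝ) + 1) • x) := by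
      rw [smul_smul, inv_mul_cancel₀ hn.ne', one_smul]
    have h4 : x + (l.erase x).sum - ((n : ℝ) + 1) • x = (l.erase x).sum - (n : ℝ) • x := by
      module
    rw [listBary, hl, h3, h1, ← h4, smul_sub, ← hx']
    push_cast
    rfl
  rw [dist_eq_norm, this, norm_smul, Real.norm_of_nonneg (by positivity)]
  rw [h1] at h2
  rw [h1]
  calc ((n : ℝ) + 1)⁻¹ * _ ≤ ((n : ℝ) + 1)⁻¹ * (n * δ) := by gcongr
    _ = _ := by ring

lemma listBary_mem_hull {l : List E} (hl : l ≠ []) : listBary l ∈ convexHull ℝ {x | x ∈ l} := by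
  have key : ∀ (l : List E), l ≠ [] → ∀ S : Set E, Convex ℝ S → (∀ x ∈ l, x ∈ S) →
      (l.length : ℝ)⁻¹ • l.sum ∈ S := by
    intro l
    induction l with
    | nil => intro h; exact absurd rfl h
    | cons x l ih =>
      intro _ S hS hl
      by_cases h0 : l = []
      · subst h0; simpa using hl x (by simp)
      · have h1 := ih h0 S hS fun y hy => hl y (by simp [hy])
        have h2 := hl x (by simp)
        have hn : (0 : ℝ) < l.length := by
          exact_mod_cast List.length_pos_iff.2 h0
        have h3 := hS h2 h1 (a := ((l.length : ℝ) + 1)⁻¹) (b := l.length * ((l.length : ℝ) + 1)⁻¹)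
          (by positivity) (by positivity) (by field_simp; ring)
        convert h3 using 1
        simp only [List.length_cons, List.sum_cons, Nat.cast_add, Nat.cast_one, smul_add,
          smul_smul]
        congr 2
        field_simp
  exact key l hl _ (convex_convexHull ℝ _) fun x hx => subset_convexHull ℝ _ hx

lemma hull_dist_le {l : List E} {c : E} {δ : ℝ} (h : ∀ x ∈ l, dist c x ≤ δ) {y : E}
    (hy : y ∈ convexHull ℝ {x | x ∈ l}) : dist c y ≤ δ := by
  have : convexHull ℝ {x | x ∈ l} ⊆ Metric.closedBall c δ :=
    convexHull_min (fun x hx => by rw [Metric.mem_closedBall, dist_comm]; exact h x hx)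
      (convex_closedBall c δ)
  have := this hy
  rwa [Metric.mem_closedBall, dist_comm] at this

lemma sdN_hull (n : ℕ) {l : List E} (hl : l.length = n) :
    sdN K listBary n (Finsupp.single l 1) ∈
      chSupp K (fun l' => ∀ x ∈ l', x ∈ convexHull ℝ {x | x ∈ l}) := by
  induction n generalizing l with
  | zero =>
    exact single_mem_chSupp (fun x hx => subset_convexHull ℝ {x | x ∈ l} hx) 1
  | succ n ih =>
    rw [sdN, Finsupp.linearCombination_single, one_smul]
    refine chCons_mem (P := fun l' => ∀ x ∈ l', x ∈ convexHull ℝ {x | x ∈ l}) ?_ ?_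
    · intro l' hl' x hx
      rcases List.mem_cons.1 hx with rfl | hx
      · exact listBary_mem_hull (by rintro rfl; simp at hl)
      · exact hl' x hx
    · refine chSupp_map (fun l' hl' => ?_) (lbd_mem (K := K) l)
      exact chSupp_mono (fun l'' h'' x hx => convexHull_mono hl'.2 (h'' x hx))
        (ih (l := l') (by omega))

lemma sdT_hull (n : ℕ) {l : List E} (hl : l.length = n) :
    sdT K listBary n (Finsupp.single l 1) ∈
      chSupp K (fun l' => ∀ x ∈ l', x ∈ convexHull ℝ {x | x ∈ l}) := by
  induction n generalizing l with
  | zero => simp [sdT]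
  | succ n ih =>
    rw [sdT, Finsupp.linearCombination_single, one_smul]
    refine chCons_mem (P := fun l' => ∀ x ∈ l', x ∈ convexHull ℝ {x | x ∈ l}) ?_ ?_
    · intro l' hl' x hx
      rcases List.mem_cons.1 hx with rfl | hx
      · exact listBary_mem_hull (by rintro rfl; simp at hl)
      · exact hl' x hx
    · refine Submodule.sub_mem _ (single_mem_chSupp (fun x hx => subset_convexHull ℝ {x | x ∈ l} hx) 1) ?_
      refine chSupp_map (fun l' hl' => ?_) (lbd_mem (K := K) l)
      exact chSupp_mono (fun l'' h'' x hx => convexHull_mono hl'.2 (h'' x hx))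
        (ih (l := l') (by omega))

lemma sdN_small (n : ℕ) {δ r : ℝ} (hδ : 0 ≤ δ) (hr : (n : ℝ) / (n + 1) ≤ r) {l : List E}
    (hl : l.length = n) (h : ∀ x ∈ l, ∀ y ∈ l, dist x y ≤ δ) :
    sdN K listBary n (Finsupp.single l 1) ∈
      chSupp K (fun l' => ∀ x ∈ l', ∀ y ∈ l', dist x y ≤ r * δ) := by
  induction n generalizing l with
  | zero =>
    rw [List.length_eq_zero_iff] at hl
    subst hl
    exact single_mem_chSupp (by simp) 1
  | succ n ih =>
    have hr' : (n : ℝ) / (n + 1) ≤ r := by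
      refine le_trans ?_ hr
      push_cast
      rw [div_le_div_iff₀ (by positivity) (by positivity)]
      nlinarith
    have hr0 : 0 ≤ r := le_trans (by positivity) hr'
    rw [sdN, Finsupp.linearCombination_single, one_smul]
    refine chCons_mem (P := fun l' => (∀ x ∈ l', ∀ y ∈ l', dist x y ≤ r * δ) ∧
      ∀ x ∈ l', x ∈ convexHull ℝ {x | x ∈ l}) ?_ ?_
    · rintro l' ⟨h1, h2⟩
      have hb : ∀ y ∈ l', dist (listBary l) y ≤ r * δ := fun y hy =>
        (hull_dist_le (fun x hx => listBary_dist hl h hx) (h2 y hy)).trans (by gcongr)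
      simp only [List.mem_cons]
      rintro x (rfl | hx) y (rfl | hy)
      · rw [dist_self]; positivity
      · exact hb y hy
      · rw [dist_comm]; exact hb x hx
      · exact h1 x hx y hy
    · refine chSupp_map (fun l' hl' => ?_) (lbd_mem (K := K) l)
      have e1 := ih hr' (l := l') (by omega) fun x hx y hy => h x (hl'.2 x hx) y (hl'.2 y hy)
      have e2 := sdN_hull (K := K) n (l := l') (by omega)
      intro l'' h''
      exact ⟨e1 h'', fun x hx => convexHull_mono hl'.2 (e2 h'' x hx)⟩

/-- Iterated subdivisions are small and stay in convex sets. -/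
lemma sdN_pow_small (n m : ℕ) {δ r : ℝ} (hδ : 0 ≤ δ) (hr : (n : ℝ) / (n + 1) ≤ r) {l : List E}
    (hl : l.length = n) (h : ∀ x ∈ l, ∀ y ∈ l, dist x y ≤ δ) :
    ((sdN K listBary n) ^ m) (Finsupp.single l 1) ∈
      chSupp K (fun l' => l'.length = n ∧ (∀ x ∈ l', ∀ y ∈ l', dist x y ≤ r ^ m * δ) ∧
        ∀ x ∈ l', x ∈ convexHull ℝ {x | x ∈ l}) := by
  have hr0 : 0 ≤ r := le_trans (by positivity) hr
  induction m with
  | zero =>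
    exact single_mem_chSupp ⟨hl, by simpa using h, fun x hx => subset_convexHull ℝ _ hx⟩ 1
  | succ m ih =>
    rw [pow_succ' (sdN K listBary n), Module.End.mul_apply]
    refine chSupp_map (fun l' hl' => ?_) ih
    have e1 := sdN_small (K := K) n (δ := r ^ m * δ) (by positivity) hr hl'.1 hl'.2.1
    have e2 := sdN_hull (K := K) n hl'.1
    have e3 := sdN_mem_length (K := K) (c := Finsupp.single l' 1) listBary n
      (single_mem_chSupp hl'.1 1)
    intro l'' h''
    refine ⟨e3 h'', ?_, fun x hx => convexHull_min hl'.2.2 (convex_convexHull ℝ _) (e2 h'' x hx)⟩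
    rw [pow_succ', mul_assoc]
    exact e1 h''

lemma sdTT_hull (n m : ℕ) {l : List E} (hl : l.length = n) :
    sdTT K listBary n m (Finsupp.single l 1) ∈
      chSupp K (fun l' => ∀ x ∈ l', x ∈ convexHull ℝ {x | x ∈ l}) := by
  induction m with
  | zero => simp [sdTT]
  | succ m ih =>
    refine Submodule.add_mem _ ih ?_
    rw [LinearMap.comp_apply]
    have hd : ∃ δ : ℝ, 0 ≤ δ ∧ ∀ x ∈ l, ∀ y ∈ l, dist x y ≤ δ := by
      have hb : Bornology.IsBounded {x | x ∈ l} := (List.finite_toSet l).isBounded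
      refine ⟨Metric.diam {x | x ∈ l}, Metric.diam_nonneg, fun x hx y hy =>
        Metric.dist_le_diam_of_mem hb hx hy⟩
    obtain ⟨δ, h0, h1⟩ := hd
    refine chSupp_map (fun l' hl' => ?_) (sdN_pow_small (K := K) n m h0 le_rfl hl h1)
    exact chSupp_mono (fun l'' h'' x hx =>
      convexHull_min hl'.2.2 (convex_convexHull ℝ _) (h'' x hx)) (sdT_hull (K := K) n hl'.1)

end SmallSubdivision

section Contractible

variable {K : Type} [Field K] {V : Type} [Fintype V]

/-- The closed simplex spanned by a set of vertices, in barycentric coordinates. -/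
def simplexOf (G : Finset V) : Set (V → ℝ) :=
  {x | (∀ v, 0 ≤ x v) ∧ ∑ v, x v = 1 ∧ ∀ v, v ∉ G → x v = 0}

/-- The geometric realization of a simplicial complex, in barycentric coordinates. -/
def realization (M : Set (Finset V)) : Set (V → ℝ) := {x | ∃ G ∈ M, x ∈ simplexOf G}

/-- Lists whose entries lie in a common simplex. -/
def InComplex (M : Set (Finset V)) (l : List V) : Prop := ∃ G ∈ M, ∀ x ∈ l, x ∈ G

lemma convex_simplexOf (G : Finset V) : Convex ℝ (simplexOf G) := by
  rintro x ⟨hx, hx', hx''⟩ y ⟨hy, hy', hy''⟩ a b ha hb hab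
  refine ⟨fun v => ?_, ?_, fun v hv => ?_⟩
  · have := hx v; have := hy v
    simp only [Pi.add_apply, Pi.smul_apply, smul_eq_mul]; positivity
  · simp only [Pi.add_apply, Pi.smul_apply, smul_eq_mul]
    rw [Finset.sum_add_distrib, ← Finset.mul_sum, ← Finset.mul_sum, hx', hy']; linarith
  · simp [hx'' v hv, hy'' v hv]

lemma simplexOf_le_one {G : Finset V} {x : V → ℝ} (hx : x ∈ simplexOf G) (v : V) : x v ≤ 1 := by
  rw [← hx.2.1]
  exact Finset.single_le_sum (f := x) (fun w _ => hx.1 w) (Finset.mem_univ v)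

lemma isClosed_simplexOf (G : Finset V) : IsClosed (simplexOf G) := by
  have : simplexOf G = (⋂ v, {x | 0 ≤ x v}) ∩ {x | ∑ v, x v = 1} ∩
      ⋂ v, ⋂ (_ : v ∉ G), {x | x v = 0} := by
    ext x; simp [simplexOf, and_assoc]
  rw [this]
  refine IsClosed.inter (IsClosed.inter ?_ ?_) ?_
  · exact isClosed_iInter fun v => isClosed_le continuous_const (continuous_apply v)
  · exact isClosed_eq (by fun_prop) continuous_const
  · exact isClosed_iInter fun v => isClosed_iInter fun _ =>
      isClosed_eq (continuous_apply v) continuous_const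

lemma isCompact_simplexOf (G : Finset V) : IsCompact (simplexOf G) := by
  refine Metric.isCompact_of_isClosed_isBounded (isClosed_simplexOf G) ?_
  refine (Metric.isBounded_closedBall (x := (0 : V → ℝ)) (r := 1)).subset fun x hx => ?_
  rw [mem_closedBall_zero_iff, pi_norm_le_iff_of_nonneg zero_le_one]
  intro v
  rw [Real.norm_of_nonneg (hx.1 v)]
  exact simplexOf_le_one hx v

lemma isCompact_realization (M : Set (Finset V)) : IsCompact (realization M) := by
  have : realization M = ⋃ G ∈ M, simplexOf G := by ext x; simp [realization]
  rw [this]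
  exact (Set.toFinite M).isCompact_biUnion fun G _ => isCompact_simplexOf G

lemma exists_large_coord [Nonempty V] (x : V → ℝ) :
    ∃ v : V, (∑ w, x w = 1 → 1 / (Fintype.card V : ℝ) ≤ x v) := by
  obtain ⟨v, -, hv⟩ := Finset.exists_max_image Finset.univ x Finset.univ_nonempty
  refine ⟨v, fun h => ?_⟩
  have : ∑ w, x w ≤ Fintype.card V * x v := by
    simpa using Finset.sum_le_card_nsmul Finset.univ x (x v) fun w hw => hv w hw
  rw [h] at this
  rw [div_le_iff₀ (by exact_mod_cast Fintype.card_pos)]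
  linarith

/-- A vertex with large barycentric coordinate. -/
def nearVertex [Nonempty V] (x : V → ℝ) : V := (exists_large_coord x).choose

lemma nearVertex_spec [Nonempty V] {x : V → ℝ} (h : ∑ w, x w = 1) :
    1 / (Fintype.card V : ℝ) ≤ x (nearVertex x) := (exists_large_coord x).choose_spec h

lemma nearVertex_mem [Nonempty V] {G : Finset V} {x : V → ℝ} (h : x ∈ simplexOf G) :
    nearVertex x ∈ G := by
  by_contra hc
  have h1 := nearVertex_spec h.2.1
  rw [h.2.2 _ hc] at h1
  have : (0 : ℝ) < 1 / Fintype.card V := by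
    have : 0 < Fintype.card V := Fintype.card_pos
    positivity
  linarith

/-- The point of the realization given by a vertex. -/
def vertexPt (v : V) : V → ℝ := Pi.single v 1

lemma vertexPt_mem {v : V} {G : Finset V} (h : v ∈ G) : vertexPt v ∈ simplexOf G := by
  refine ⟨fun w => ?_, ?_, fun w hw => ?_⟩
  · by_cases hvw : w = v
    · subst hvw; simp [vertexPt]
    · simp [vertexPt, hvw]
  · simp [vertexPt]
  · have : w ≠ v := by rintro rfl; exact hw h
    simp [vertexPt, this]

lemma nearVertex_vertexPt [Nonempty V] (v : V) : nearVertex (vertexPt v) = v := by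
  simpa using nearVertex_mem (vertexPt_mem (Finset.mem_singleton_self v))

lemma inComplex_of_close [Nonempty V] {M : Set (Finset V)} (he : ∅ ∈ M) {l : List (V → ℝ)}
    (hl : ∀ x ∈ l, x ∈ realization M)
    (hc : ∀ x ∈ l, ∀ y ∈ l, dist x y < 1 / (Fintype.card V : ℝ)) :
    InComplex M (l.map nearVertex) := by
  cases l with
  | nil => exact ⟨∅, he, by simp⟩
  | cons x l =>
    obtain ⟨G, hG, hx⟩ := hl x (by simp)
    refine ⟨G, hG, ?_⟩
    simp only [List.mem_map]
    rintro _ ⟨y, hy, rfl⟩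
    by_contra hn
    obtain ⟨G', -, hy'⟩ := hl y hy
    have h1 := nearVertex_spec hy'.2.1
    have h2 := hc y hy x (by simp)
    have h3 := (dist_le_pi_dist y x (nearVertex y)).trans_lt h2
    rw [hx.2.2 _ hn, Real.dist_eq, sub_zero] at h3
    have := le_abs_self (y (nearVertex y))
    linarith

lemma chSupp_sum {E ι : Type} {P : List E → Prop} {s : Finset ι} {f : ι → (List E →₀ K)}
    (h : ∀ i ∈ s, f i ∈ chSupp K P) : ∑ i ∈ s, f i ∈ chSupp K P := Submodule.sum_mem _ h

lemma chMap_mem {E E' : Type} {P : List E → Prop} {Q : List E' → Prop} {f : E → E'}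
    (h : ∀ l, P l → Q (l.map f)) {c : List E →₀ K} (hc : c ∈ chSupp K P) :
    chMap K f c ∈ chSupp K Q := by
  refine chSupp_map (fun l hl => ?_) hc
  rw [chMap_single]
  exact single_mem_chSupp (h l hl) 1

lemma lprism_homotopy_ch {E E' : Type} (f g : E → E') (c : List E →₀ K) :
    chD K (chLin K (lprism K f g) c) + chLin K (lprism K f g) (chD K c) =
      chMap K g c - chMap K f c := by
  have := chLin_ext (f := chD K ∘ₗ chLin K (lprism K f g) + chLin K (lprism K f g) ∘ₗ chD K)
    (g := chMap K g - chMap K f)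
    (P := fun _ => True) (c := c) (by intro l _; simp [lprism_homotopy])
    (by simp [Finsupp.mem_supported])
  simpa using this

/-- A contraction of the realization yields contracting homotopies on ordered chains. -/
theorem exists_chain_contraction {M : Set (Finset V)} (he : ∅ ∈ M)
    (hne : (realization M).Nonempty) (g : (V → ℝ) × ℝ → (V → ℝ))
    (hg : ContinuousOn g (realization M ×ˢ Set.Icc 0 1))
    (hm : Set.MapsTo g (realization M ×ˢ Set.Icc 0 1) (realization M))
    (h0 : ∀ x ∈ realization M, g (x, 0) = x) {p : V → ℝ}
    (h1 : ∀ x ∈ realization M, g (x, 1) = p) (N : ℕ) :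
    ∃ B : ℕ → ((List V →₀ K) →ₗ[K] (List V →₀ K)),
      (∀ n ≤ N, ∀ l, l.length = n → InComplex M l →
        B n (Finsupp.single l 1) ∈ chSupp K (InComplex M)) ∧
      ∀ n < N, ∀ l, l.length = n + 1 → InComplex M l →
        chD K (B (n + 1) (Finsupp.single l 1)) + B n (lbd K l) = Finsupp.single l 1 := by
  obtain ⟨x₀, G₀, hG₀, hx₀⟩ := hne
  have hV : Nonempty V := by
    by_contra hV
    rw [not_nonempty_iff] at hV
    have := hx₀.2.1
    simp at this
  have hcard : (0 : ℝ) < 1 / Fintype.card V := by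
    have : 0 < Fintype.card V := Fintype.card_pos
    positivity
  have huc := ((isCompact_realization M).prod (isCompact_Icc (a := (0 : ℝ)) (b := 1))).uniformContinuousOn_of_continuous hg
  rw [Metric.uniformContinuousOn_iff] at huc
  obtain ⟨η, hη, hclose⟩ := huc _ hcard
  set r : ℝ := (N : ℝ) / (N + 1) with hr
  have hr0 : 0 ≤ r := by positivity
  have hr1 : r < 1 := by rw [hr, div_lt_one (by positivity)]; linarith
  obtain ⟨m, hmm⟩ := exists_pow_lt_of_lt_one hη hr1
  obtain ⟨q, hq⟩ := exists_nat_gt (1 / η)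
  have hq0 : (0 : ℝ) < q := lt_trans (by positivity) hq
  -- the interpolating vertex maps
  let α : ℕ → (V → ℝ) → V := fun j x => nearVertex (g (x, (j : ℝ) / q))
  let v₀ : V := nearVertex p
  let S : ℕ → ((List V →₀ K) →ₗ[K] (List (V → ℝ) →₀ K)) := fun n =>
    ((sdN K listBary n) ^ m : (List (V → ℝ) →₀ K) →ₗ[K] (List (V → ℝ) →₀ K)) ∘ₗ chMap K vertexPt
  let P : (List (V → ℝ) →₀ K) →ₗ[K] (List V →₀ K) :=
    ∑ j ∈ Finset.range q, chLin K (lprism K (α j) (α (j + 1)))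
  let Q : (List (V → ℝ) →₀ K) → Prop := fun c => c ∈ chSupp K (fun l =>
      (∃ G ∈ M, ∀ x ∈ l, x ∈ simplexOf G) ∧ ∀ x ∈ l, ∀ y ∈ l, dist x y < η)
  let B : ℕ → ((List V →₀ K) →ₗ[K] (List V →₀ K)) := fun n =>
    chMap K nearVertex ∘ₗ sdTT K listBary n m ∘ₗ chMap K vertexPt - P ∘ₗ S n +
      chCons K v₀ ∘ₗ chMap K (fun _ => v₀) ∘ₗ S n
  have hS : ∀ n ≤ N, ∀ l, l.length = n → InComplex M l →
      S n (Finsupp.single l 1) ∈ chSupp K (fun l =>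
      (∃ G ∈ M, ∀ x ∈ l, x ∈ simplexOf G) ∧ ∀ x ∈ l, ∀ y ∈ l, dist x y < η) := by
    rintro n hn l hl ⟨G, hG, hlG⟩
    have hmem : ∀ x ∈ l.map vertexPt, x ∈ simplexOf G := by
      simp only [List.mem_map]; rintro _ ⟨v, hv, rfl⟩; exact vertexPt_mem (hlG v hv)
    have hrn : (n : ℝ) / (n + 1) ≤ r := by
      rw [hr, div_le_div_iff₀ (by positivity) (by positivity)]
      have : (n : ℝ) ≤ N := by exact_mod_cast hn
      nlinarith
    have := sdN_pow_small (K := K) n m (δ := 1) zero_le_one hrn (l := l.map vertexPt) (by simpa)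
      (fun x hx y hy => by
        have hx := hmem x hx
        have hy := hmem y hy
        rw [dist_pi_le_iff zero_le_one]
        intro v
        have a1 := hx.1 v; have a2 := simplexOf_le_one hx v
        have a3 := hy.1 v; have a4 := simplexOf_le_one hy v
        rw [Real.dist_eq, abs_le]; constructor <;> linarith)
    simp only [S, LinearMap.comp_apply, chMap_single]
    refine chSupp_mono (fun l' hl' => ⟨⟨G, hG, fun x hx => ?_⟩, fun x hx y hy => ?_⟩) this
    · exact convexHull_min hmem (convex_simplexOf G) (hl'.2.2 x hx)
    · exact (hl'.2.1 x hx y hy).trans_lt (by simpa using hmm)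
  have hαclose : ∀ j < q, ∀ l : List (V → ℝ), ((∃ G ∈ M, ∀ x ∈ l, x ∈ simplexOf G) ∧
      ∀ x ∈ l, ∀ y ∈ l, dist x y < η) → ∀ l' : List V,
      (∀ y ∈ l', ∃ x ∈ l, y = α j x ∨ y = α (j + 1) x) → InComplex M l' := by
    rintro j hj l ⟨⟨G, hG, hlG⟩, hld⟩ l' hl'
    have hb : ∀ i ≤ q, (i : ℝ) / q ∈ Set.Icc (0 : ℝ) 1 := fun i hi =>
      ⟨by positivity, by rw [div_le_one hq0]; exact_mod_cast hi⟩
    have hpt : ∀ y ∈ l', ∃ x ∈ l, ∃ i, (i = j ∨ i = j + 1) ∧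
        y = nearVertex (g (x, (i : ℝ) / q)) := by
      intro y hy
      obtain ⟨x, hx, h | h⟩ := hl' y hy
      · exact ⟨x, hx, j, Or.inl rfl, h⟩
      · exact ⟨x, hx, j + 1, Or.inr rfl, h⟩
    choose! f hf i hi hfi using hpt
    have hl'' : l' = (l'.map fun y => g (f y, (i y : ℝ) / q)).map nearVertex := by
      rw [List.map_map]
      conv_lhs => rw [← List.map_id l']
      exact List.map_congr_left fun y hy => hfi y hy
    have hd : ∀ y ∈ l', (f y, (i y : ℝ) / q) ∈ realization M ×ˢ Set.Icc (0 : ℝ) 1 := fun y hy =>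
      ⟨⟨G, hG, hlG _ (hf y hy)⟩, hb _ (by rcases hi y hy with h | h <;> omega)⟩
    rw [hl'']
    refine inComplex_of_close he ?_ ?_
    · simp only [List.mem_map]
      rintro _ ⟨y, hy, rfl⟩
      exact hm (hd y hy)
    · simp only [List.mem_map]
      rintro _ ⟨y, hy, rfl⟩ _ ⟨z, hz, rfl⟩
      refine hclose _ (hd y hy) _ (hd z hz) ?_
      rw [Prod.dist_eq, max_lt_iff]
      refine ⟨hld _ (hf y hy) _ (hf z hz), ?_⟩
      have : dist ((i y : ℝ) / q) ((i z : ℝ) / q) ≤ 1 / q := by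
        rw [Real.dist_eq, ← sub_div, abs_div, abs_of_pos hq0]
        gcongr
        rcases hi y hy with h | h <;> rcases hi z hz with h' | h' <;> rw [h, h'] <;> simp
      refine this.trans_lt ?_
      rw [div_lt_iff₀ hq0]
      rw [div_lt_iff₀ hη] at hq
      linarith
  have hp : p ∈ realization M := by
    rw [← h1 x₀ ⟨G₀, hG₀, hx₀⟩]; exact hm ⟨⟨G₀, hG₀, hx₀⟩, by simp⟩
  obtain ⟨Gp, hGp, hpG⟩ := hp
  refine ⟨B, ?_, ?_⟩
  · rintro n hn l hl hlM
    have hSl := hS n hn l hl hlM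
    refine Submodule.add_mem _ (Submodule.sub_mem _ ?_ ?_) ?_
    · obtain ⟨G, hG, hlG⟩ := hlM
      have hmem : ∀ x ∈ l.map vertexPt, x ∈ simplexOf G := by
        simp only [List.mem_map]; rintro _ ⟨v, hv, rfl⟩; exact vertexPt_mem (hlG v hv)
      simp only [LinearMap.comp_apply, chMap_single]
      refine chMap_mem (fun l' hl' => ?_)
        (sdTT_hull (K := K) n m (l := l.map vertexPt) (by simpa))
      refine ⟨G, hG, ?_⟩
      simp only [List.mem_map]
      rintro _ ⟨y, hy, rfl⟩
      exact nearVertex_mem (convexHull_min hmem (convex_simplexOf G) (hl' y hy))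
    · simp only [P, LinearMap.comp_apply, LinearMap.sum_apply]
      refine chSupp_sum fun j hj => ?_
      refine chSupp_map (fun l' hl' => ?_) hSl
      rw [Finsupp.linearCombination_single, one_smul]
      exact chSupp_mono (fun l'' h'' => hαclose j (Finset.mem_range.1 hj) l' hl' l'' h'')
        (lprism_mem _ _ l')
    · simp only [LinearMap.comp_apply]
      have hc : chMap K (fun _ => v₀) (S n (Finsupp.single l 1)) ∈
          chSupp K (fun l => ∀ x ∈ l, x = v₀) :=
        chMap_mem (P := fun _ => True) (fun l _ => by simp) (by simp [Finsupp.mem_supported])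
      refine chCons_mem (Q := InComplex M) (fun l hl => ?_) hc
      refine ⟨Gp, hGp, ?_⟩
      simp only [List.mem_cons]
      rintro x (rfl | hx)
      · exact nearVertex_mem hpG
      · rw [hl x hx]; exact nearVertex_mem hpG
  · rintro n hn l hl hlM
    have hlen : chMap K vertexPt (Finsupp.single l 1) ∈
        chSupp K (fun l => l.length = n + 1) := by
      rw [chMap_single]; exact single_mem_chSupp (by simpa) 1
    have hbd : chD K (Finsupp.single l (1 : K)) = lbd K l := by simp
    have hι : chMap K vertexPt (lbd K l) = chD K (chMap K vertexPt (Finsupp.single l 1)) := by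
      rw [chD_chMap, hbd]
    have e1 := sdTT_homotopy listBary n m hlen
    have hSbd : S n (lbd K l) = chD K (S (n + 1) (Finsupp.single l 1)) := by
      simp only [S, LinearMap.comp_apply]
      rw [chD_sdN_pow listBary n m hlen, hι]
    have hSl := hS (n + 1) hn l hl hlM
    have e2 : chD K (P (S (n + 1) (Finsupp.single l 1))) + P (S n (lbd K l)) =
        chMap K (α q) (S (n + 1) (Finsupp.single l 1)) -
          chMap K (α 0) (S (n + 1) (Finsupp.single l 1)) := by
      rw [hSbd]
      simp only [P, LinearMap.sum_apply, map_sum]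
      rw [← Finset.sum_add_distrib, ← Finset.sum_range_sub (fun j =>
        chMap K (α j) (S (n + 1) (Finsupp.single l 1)))]
      exact Finset.sum_congr rfl fun j _ => lprism_homotopy_ch _ _ _
    have e0 : chMap K (α 0) (S (n + 1) (Finsupp.single l 1)) =
        chMap K nearVertex (S (n + 1) (Finsupp.single l 1)) := by
      refine chLin_ext (fun l' hl' => ?_) hSl
      rw [chMap_single, chMap_single]
      congr 1
      refine List.map_congr_left fun x hx => ?_
      obtain ⟨⟨G, hG, hG'⟩, -⟩ := hl'
      simp only [α, Nat.cast_zero, zero_div]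
      rw [h0 x ⟨G, hG, hG' x hx⟩]
    have eq' : chMap K (α q) (S (n + 1) (Finsupp.single l 1)) =
        chMap K (fun _ => v₀) (S (n + 1) (Finsupp.single l 1)) := by
      refine chLin_ext (fun l' hl' => ?_) hSl
      rw [chMap_single, chMap_single]
      congr 1
      refine List.map_congr_left fun x hx => ?_
      obtain ⟨⟨G, hG, hG'⟩, -⟩ := hl'
      simp only [α, v₀]
      rw [div_self hq0.ne', h1 x ⟨G, hG, hG' x hx⟩]
    have e3 := chD_cons (K := K) v₀ (chMap K (fun _ => v₀) (S (n + 1) (Finsupp.single l 1)))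
    rw [chD_chMap, ← hSbd] at e3
    have e4 : chMap K nearVertex (chMap K vertexPt (Finsupp.single l 1)) =
        (Finsupp.single l 1 : List V →₀ K) := by
      rw [chMap_single, chMap_single, List.map_map]
      congr 1
      conv_rhs => rw [← List.map_id l]
      exact List.map_congr_left fun x _ => nearVertex_vertexPt x
    have e5 := congrArg (chMap K nearVertex) e1
    rw [map_add, map_sub, ← chD_chMap, e4, ← hι] at e5
    simp only [B, LinearMap.add_apply, LinearMap.sub_apply, LinearMap.comp_apply, map_add, map_sub]
    rw [e3]
    rw [e0, eq'] at e2
    have e6 : chMap K nearVertex (S (n + 1) (Finsupp.single l 1)) = chMap K nearVertex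
        ((sdN K listBary (n + 1) ^ m) (chMap K vertexPt (Finsupp.single l 1))) := rfl
    rw [← e6] at e5
    have e7 := eq_sub_of_add_eq e5
    have e8 := eq_sub_of_add_eq e2
    rw [e7, e8]
    abel

end Contractible

section Cochains

variable (K : Type) [Field K] {V : Type} [LinearOrder V]

/-- The sign of a vertex relative to a finite set of vertices. -/
def vsgn (v : V) (G : Finset V) : K := (-1) ^ (G.filter (· < v)).card

/-- The simplicial coboundary on functions of finite sets. -/
def cobd (f : Finset V → K) (G : Finset V) : K := ∑ v ∈ G, vsgn K v G * f (G.erase v)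

/-- Contraction of a cochain with a vertex. -/
def ctr (x : V) (f : Finset V → K) (G : Finset V) : K :=
  if x ∈ G then 0 else vsgn K x G * f (insert x G)

/-- The cohomology of a simplicial complex (augmented, reduced) vanishes. -/
def Acyc (M : Set (Finset V)) : Prop :=
  ∀ f : Finset V → K, (∀ G ∈ M, cobd K f G = 0) → ∃ g : Finset V → K, ∀ G ∈ M, f G = cobd K g G

variable {K}

lemma vsgn_sq (v : V) (G : Finset V) : vsgn K v G * vsgn K v G = 1 := by
  rw [vsgn, ← mul_pow]; simp

lemma vsgn_ne_zero (v : V) (G : Finset V) : vsgn K v G ≠ 0 := by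
  rw [vsgn]; exact pow_ne_zero _ (by simp)

lemma vsgn_insert {x v : V} {G : Finset V} (hx : x ∉ G) :
    vsgn K v (insert x G) = (if x < v then -1 else 1) * vsgn K v G := by
  rw [vsgn, vsgn, Finset.filter_insert]
  split_ifs with h
  · rw [Finset.card_insert_of_notMem (by simp [hx]), pow_succ]; ring
  · ring

lemma vsgn_erase {x v : V} {G : Finset V} (hx : x ∈ G) :
    vsgn K v (G.erase x) = (if x < v then -1 else 1) * vsgn K v G := by
  have := vsgn_insert (K := K) (x := x) (v := v) (G := G.erase x) (by simp)
  rw [Finset.insert_erase hx] at this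
  rw [this]; split_ifs <;> ring

lemma vsgn_swap {x v : V} {G : Finset V} (hx : x ∉ G) (hv : v ∈ G) :
    vsgn K x G * vsgn K v (insert x G) = -(vsgn K v G * vsgn K x (G.erase v)) := by
  have hne : x ≠ v := by rintro rfl; exact hx hv
  rw [vsgn_insert hx, vsgn_erase hv]
  rcases lt_or_gt_of_ne hne with h | h
  · simp [h, h.not_gt]; ring
  · simp [h, h.not_gt]; ring

lemma ctr_cobd (x : V) (f : Finset V → K) (G : Finset V) :
    ctr K x (cobd K f) G + cobd K (ctr K x f) G = f G := by
  by_cases hx : x ∈ G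
  · rw [ctr, if_pos hx, zero_add, cobd, Finset.sum_eq_single_of_mem x hx]
    · have : x ∉ G.erase x := by simp
      rw [ctr, if_neg this, Finset.insert_erase hx, vsgn_erase hx, if_neg (lt_irrefl x), one_mul,
        ← mul_assoc, vsgn_sq, one_mul]
    · intro v _ hvx
      rw [ctr, if_pos (Finset.mem_erase.2 ⟨hvx.symm, hx⟩), mul_zero]
  · rw [ctr, if_neg hx, cobd, Finset.sum_insert hx, Finset.erase_insert hx, mul_add, ← mul_assoc,
      vsgn_insert hx, if_neg (lt_irrefl x), one_mul, vsgn_sq, one_mul, cobd, add_assoc,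
      Finset.mul_sum, ← Finset.sum_add_distrib]
    rw [Finset.sum_eq_zero, add_zero]
    intro v hv
    have hne : x ≠ v := by rintro rfl; exact hx hv
    have : x ∉ G.erase v := fun h => hx (Finset.mem_of_mem_erase h)
    rw [ctr, if_neg this, ← mul_assoc, vsgn_swap hx hv, ← mul_assoc,
      ← Finset.erase_insert_of_ne hne]
    ring

lemma cobd_cobd (f : Finset V → K) (G : Finset V) : cobd K (cobd K f) G = 0 := by
  induction hn : G.card generalizing f G with
  | zero =>
    rw [Finset.card_eq_zero] at hn
    subst hn; simp [cobd]
  | succ n ih =>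
    obtain ⟨x, hx⟩ : G.Nonempty := by rw [← Finset.card_pos]; omega
    have h1 : ∀ f : Finset V → K, ∀ G, cobd K (ctr K x f) G = f G - ctr K x (cobd K f) G :=
      fun f G => eq_sub_of_add_eq' (ctr_cobd x f G)
    have h2 : ∀ f : Finset V → K, f G = vsgn K x G * ctr K x f (G.erase x) := by
      intro f
      have : x ∉ G.erase x := by simp
      rw [ctr, if_neg this, Finset.insert_erase hx, vsgn_erase hx, if_neg (lt_irrefl x), one_mul,
        ← mul_assoc, vsgn_sq, one_mul]
    have h3 : ctr K x (cobd K (cobd K f)) (G.erase x) =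
        cobd K (cobd K (ctr K x f)) (G.erase x) := by
      have e1 := ctr_cobd x (cobd K f) (G.erase x)
      have e2 : cobd K (cobd K (ctr K x f)) (G.erase x) =
          cobd K f (G.erase x) - cobd K (ctr K x (cobd K f)) (G.erase x) := by
        have : cobd K (ctr K x f) = f - ctr K x (cobd K f) := by
          funext G; exact h1 f G
        rw [this]
        simp [cobd, mul_sub, Finset.sum_sub_distrib]
      rw [e2]; linear_combination e1
    rw [h2 (cobd K (cobd K f)), h3, ih, mul_zero]
    rw [Finset.card_erase_of_mem hx, hn]; rfl

/-- The alternating extension of a cochain to lists. -/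
def altExt : List V → (Finset V → K) → K
  | [], f => f ∅
  | x :: l, f => altExt l (ctr K x f)

lemma altExt_congr (l : List V) {f g : Finset V → K} (h : f l.toFinset = g l.toFinset) :
    altExt l f = altExt l g := by
  induction l generalizing f g with
  | nil => simpa [altExt] using h
  | cons x l ih =>
    refine ih ?_
    rw [ctr, ctr]
    split_ifs
    · rfl
    · rw [List.toFinset_cons] at h; rw [h]

lemma altExt_add (l : List V) (f g : Finset V → K) :
    altExt l (f + g) = altExt l f + altExt l g := by
  induction l generalizing f g with
  | nil => simp [altExt]
  | cons x l ih =>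
    rw [altExt, altExt, altExt, ← ih]
    congr 1
    funext G
    simp only [ctr, Pi.add_apply]; split_ifs <;> ring

lemma altExt_zero (l : List V) : altExt l (0 : Finset V → K) = 0 := by
  have := altExt_add l (0 : Finset V → K) 0
  simpa using this

lemma altExt_lbd (l : List V) (f : Finset V → K) :
    chLin K (fun l => altExt l f) (lbd K l) = altExt l (cobd K f) := by
  induction l generalizing f with
  | nil => simp [lbd, altExt, cobd]
  | cons x l ih =>
    have h1 : chLin K (fun l => altExt l f) (chCons K x (lbd K l)) =
        chLin K (fun l => altExt l (ctr K x f)) (lbd K l) := by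
      refine chLin_ext (f := chLin K (fun l => altExt l f) ∘ₗ chCons K x)
        (P := fun _ => True) (fun l _ => ?_) (by simp [Finsupp.mem_supported])
      simp [altExt]
    have h2 : f = ctr K x (cobd K f) + cobd K (ctr K x f) := by
      funext G; exact (ctr_cobd x f G).symm
    have h3 : altExt l f = altExt l (ctr K x (cobd K f)) + altExt l (cobd K (ctr K x f)) := by
      conv_lhs => rw [h2]
      exact altExt_add _ _ _
    rw [lbd, map_sub, h1, ih, Finsupp.linearCombination_single, one_smul, altExt, h3]
    ring

lemma altExt_sorted (l : List V) (hl : l.Pairwise (· < ·)) (f : Finset V → K) :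
    altExt l f = f l.toFinset := by
  induction l generalizing f with
  | nil => simp [altExt]
  | cons x l ih =>
    rw [List.pairwise_cons] at hl
    have hx : x ∉ l.toFinset := by
      rw [List.mem_toFinset]; intro h; exact lt_irrefl _ (hl.1 x h)
    rw [altExt, ih hl.2, ctr, if_neg hx, List.toFinset_cons, vsgn, Finset.filter_false_of_mem]
    · simp
    · intro y hy; rw [List.mem_toFinset] at hy; exact (hl.1 y hy).not_gt

lemma lbd_sorted {W : Type} [AddCommGroup W] [Module K W] (l : List V)
    (hl : l.Pairwise (· < ·)) (h : List V → W) :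
    chLin K h (lbd K l) = ∑ v ∈ l.toFinset, vsgn K v l.toFinset • h (l.erase v) := by
  induction l generalizing h with
  | nil => simp [lbd]
  | cons x l ih =>
    rw [List.pairwise_cons] at hl
    have hx : x ∉ l.toFinset := by
      rw [List.mem_toFinset]; intro h; exact lt_irrefl _ (hl.1 x h)
    have h1 : chLin K h (chCons K x (lbd K l)) = chLin K (fun l => h (x :: l)) (lbd K l) := by
      refine chLin_ext (f := chLin K h ∘ₗ chCons K x)
        (P := fun _ => True) (fun l _ => ?_) (by simp [Finsupp.mem_supported])
      simp
    rw [lbd, map_sub, h1, ih hl.2, List.toFinset_cons, Finset.sum_insert hx,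
      Finsupp.linearCombination_single, one_smul, sub_eq_add_neg, List.erase_cons_head,
      ← Finset.sum_neg_distrib]
    congr 1
    · rw [vsgn_insert hx, if_neg (lt_irrefl x), vsgn, Finset.filter_false_of_mem]
      · simp
      · intro y hy; rw [List.mem_toFinset] at hy; exact (hl.1 y hy).not_gt
    · refine Finset.sum_congr rfl fun v hv => ?_
      have hxv := hl.1 v (List.mem_toFinset.1 hv)
      rw [vsgn_insert hx, if_pos hxv, List.erase_cons_tail (by simpa using hxv.ne)]
      simp

lemma sort_erase (G : Finset V) (v : V) :
    (G.sort (· ≤ ·)).erase v = (G.erase v).sort (· ≤ ·) := by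
  refine List.Perm.eq_of_pairwise' ?_ (Finset.pairwise_sort _ _) ?_ (r := (· ≤ ·))
  · exact (Finset.pairwise_sort G _).sublist List.erase_sublist
  · refine (List.perm_ext_iff_of_nodup ((Finset.sort_nodup G _).erase v)
      (Finset.sort_nodup _ _)).2 fun w => ?_
    rw [(Finset.sort_nodup G _).mem_erase_iff]
    simp

theorem acyc_of_contraction [Fintype V] {M : Set (Finset V)} (hdown : ∀ G ∈ M, ∀ H ⊆ G, H ∈ M)
    (hne : (realization M).Nonempty) (g : (V → ℝ) × ℝ → (V → ℝ))
    (hg : ContinuousOn g (realization M ×ˢ Set.Icc 0 1))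
    (hm : Set.MapsTo g (realization M ×ˢ Set.Icc 0 1) (realization M))
    (h0 : ∀ x ∈ realization M, g (x, 0) = x) {p : V → ℝ}
    (h1 : ∀ x ∈ realization M, g (x, 1) = p) : Acyc K M := by
  have hv : ∃ v, {v} ∈ M := by
    obtain ⟨x, G, hG, hx⟩ := hne
    have : ∃ v ∈ G, x v ≠ 0 := by
      by_contra hc
      push Not at hc
      have : ∑ v, x v = 0 := Finset.sum_eq_zero fun v _ => by
        by_cases hv : v ∈ G
        · exact hc v hv
        · exact hx.2.2 v hv
      rw [hx.2.1] at this
      exact one_ne_zero this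
    obtain ⟨v, hv, -⟩ := this
    exact ⟨v, hdown G hG _ (by simpa using hv)⟩
  obtain ⟨v₁, hv₁⟩ := hv
  have he : ∅ ∈ M := hdown _ hv₁ _ (by simp)
  obtain ⟨B, hB, hB'⟩ := exists_chain_contraction (K := K) he hne g hg hm h0 h1 (Fintype.card V)
  intro f hf
  let F : (List V →₀ K) →ₗ[K] K := chLin K fun l => altExt l f
  have hF : ∀ c ∈ chSupp K (InComplex M), F (chD K c) = 0 := by
    intro c hc
    refine chLin_ext (f := F ∘ₗ chD K) (g := 0) (fun l hl => ?_) hc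
    obtain ⟨G, hG, hlG⟩ := hl
    simp only [LinearMap.comp_apply, Finsupp.linearCombination_single, one_smul, F]
    rw [altExt_lbd, altExt_congr l (g := 0), altExt_zero]; · rfl
    rw [hf _ (hdown G hG _ (by intro x hx; exact hlG x (List.mem_toFinset.1 hx)))]; rfl
  refine ⟨fun G => F (B G.card (Finsupp.single (G.sort (· ≤ ·)) 1)), fun G hG => ?_⟩
  rcases Finset.eq_empty_or_nonempty G with rfl | hGne
  · have := hf _ hv₁
    simp [cobd, vsgn_ne_zero] at this
    rw [this]; simp [cobd]
  obtain ⟨n, hn⟩ : ∃ n, G.card = n + 1 := ⟨G.card - 1, by have := hGne.card_pos; omega⟩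
  have hnN : n < Fintype.card V := by
    have := Finset.card_le_univ G; omega
  have hlen : (G.sort (· ≤ ·)).length = n + 1 := by rw [Finset.length_sort, hn]
  have hin : InComplex M (G.sort (· ≤ ·)) := ⟨G, hG, fun x hx => (Finset.mem_sort _).1 hx⟩
  have key := congrArg F (hB' n hnN _ hlen hin)
  rw [map_add, hF _ (hB _ (by omega) _ hlen hin), zero_add] at key
  have hs : (G.sort (· ≤ ·)).Pairwise (· < ·) := Finset.sortedLT_sort G |>.pairwise
  have e1 : F (Finsupp.single (G.sort (· ≤ ·)) 1) = f G := by
    simp only [F, Finsupp.linearCombination_single, one_smul]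
    rw [altExt_sorted _ hs, Finset.sort_toFinset]
  rw [e1] at key
  have e2 : F (B n (lbd K (G.sort (· ≤ ·)))) =
      chLin K (fun l => F (B n (Finsupp.single l 1))) (lbd K (G.sort (· ≤ ·))) := by
    refine chLin_ext (f := F ∘ₗ B n) (P := fun _ => True) (fun l _ => ?_)
      (by simp [Finsupp.mem_supported])
    simp
  rw [← key, e2, lbd_sorted _ hs, Finset.sort_toFinset, cobd]
  refine Finset.sum_congr rfl fun v hv => ?_
  rw [sort_erase, Finset.card_erase_of_mem hv, hn, smul_eq_mul]
  rfl

end Cochains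

section StarCohomology

variable {K : Type} [Field K] {V : Type} [LinearOrder V]

lemma cobd_congr {f g : Finset V → K} {G : Finset V} (h : ∀ v ∈ G, f (G.erase v) = g (G.erase v)) :
    cobd K f G = cobd K g G := Finset.sum_congr rfl fun v hv => by rw [h v hv]

lemma cobd_sub (f g : Finset V → K) (G : Finset V) :
    cobd K (fun G => f G - g G) G = cobd K f G - cobd K g G := by
  simp [cobd, mul_sub, Finset.sum_sub_distrib]

lemma cobd_sum {ι : Type} (s : Finset ι) (f : ι → Finset V → K) (G : Finset V) :
    cobd K (fun G => ∑ i ∈ s, f i G) G = ∑ i ∈ s, cobd K (f i) G := by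
  simp only [cobd, Finset.mul_sum]
  rw [Finset.sum_comm]

lemma cobd_card (f : Finset V → K) (j : ℕ) (G : Finset V) :
    cobd K (fun G => if G.card = j then f G else 0) G =
      if G.card = j + 1 then cobd K f G else 0 := by
  split_ifs with h
  · refine cobd_congr fun v hv => ?_
    rw [if_pos]; rw [Finset.card_erase_of_mem hv, h]; rfl
  · refine Finset.sum_eq_zero fun v hv => ?_
    dsimp only
    rw [if_neg, mul_zero]
    have := Finset.card_pos.2 ⟨v, hv⟩
    rw [Finset.card_erase_of_mem hv]; omega

/-- A complex all of whose nonempty faces have acyclic deletions. -/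
structure AcycDel (K : Type) [Field K] (Δ : Set (Finset V)) : Prop where
  down : ∀ G ∈ Δ, ∀ H ⊆ G, H ∈ Δ
  acyc : ∀ F ∈ Δ, F.Nonempty → Acyc K {G | G ∈ Δ ∧ ¬ F ⊆ G}

variable {Δ : Set (Finset V)}

lemma AcycDel.star_coboundary (h : AcycDel K Δ) {F : Finset V} (hF : F ∈ Δ)
    {f g : Finset V → K} (hf : ∀ G, ¬ F ⊆ G → f G = 0) (hg : ∀ G ∈ Δ, f G = cobd K g G) :
    ∃ g' : Finset V → K, (∀ G, ¬ F ⊆ G → g' G = 0) ∧ ∀ G ∈ Δ, f G = cobd K g' G := by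
  rcases F.eq_empty_or_nonempty with rfl | hne
  · exact ⟨g, by simp, hg⟩
  obtain ⟨u, hu⟩ := h.acyc F hF hne g fun G hG => by rw [← hg G hG.1, hf G hG.2]
  refine ⟨fun G => if F ⊆ G then g G - cobd K u G else 0, fun G hG => if_neg hG, fun G hG => ?_⟩
  have : cobd K (fun G => if F ⊆ G then g G - cobd K u G else 0) G =
      cobd K (fun G => g G - cobd K u G) G := by
    refine cobd_congr fun v _ => ?_
    split_ifs with hc
    · rfl
    · rw [hu _ ⟨h.down G hG _ (Finset.erase_subset _ _), hc⟩, sub_self]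
  rw [this, cobd_sub, cobd_cobd, sub_zero, hg G hG]

lemma AcycDel.exists_star_rep (h : AcycDel K Δ) {F : Finset V} (hF : F ∈ Δ) (hne : F.Nonempty)
    {f : Finset V → K} (hf : ∀ G ∈ Δ, cobd K f G = 0) :
    ∃ e u : Finset V → K, (∀ G, ¬ F ⊆ G → e G = 0) ∧ ∀ G ∈ Δ, f G = e G + cobd K u G := by
  obtain ⟨u, hu⟩ := h.acyc F hF hne f fun G hG => hf G hG.1
  refine ⟨fun G => if F ⊆ G then f G - cobd K u G else 0, u, fun G hG => if_neg hG, fun G hG => ?_⟩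
  by_cases hc : F ⊆ G
  · simp [hc]
  · simp [hc, hu G ⟨hG, hc⟩]

/-- A maximal face of a complex. -/
def IsMaxFace (Δ : Set (Finset V)) (H : Finset V) : Prop := H ∈ Δ ∧ ∀ G ∈ Δ, H ⊆ G → G = H

lemma cobd_indicator_eq_zero {H G : Finset V} (hH : IsMaxFace Δ H) (hG : G ∈ Δ) :
    cobd K (fun G => if G = H then (1 : K) else 0) G = 0 := by
  refine Finset.sum_eq_zero fun v hv => ?_
  dsimp only
  rw [if_neg, mul_zero]
  intro he
  have h1 := hH.2 G hG (he ▸ Finset.erase_subset _ _)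
  rw [h1] at he hv
  exact Finset.notMem_erase v H (he.symm ▸ hv)

lemma AcycDel.indicator_not_coboundary (h : AcycDel K Δ) {H : Finset V} (hH : IsMaxFace Δ H) :
    ¬ ∃ g : Finset V → K, ∀ G ∈ Δ, (if G = H then (1 : K) else 0) = cobd K g G := by
  rintro ⟨g, hg⟩
  obtain ⟨g', hg', hg''⟩ := h.star_coboundary hH.1
    (f := fun G => if G = H then (1 : K) else 0)
    (fun G hG => if_neg (by rintro rfl; exact hG subset_rfl)) hg
  have := hg'' H hH.1
  rw [if_pos rfl, cobd, Finset.sum_eq_zero] at this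
  · exact one_ne_zero this
  · intro v hv
    rw [hg', mul_zero]
    intro hc
    exact Finset.notMem_erase v H (hc hv)

lemma AcycDel.maxFace_rep (h : AcycDel K Δ) {H : Finset V} (hH : IsMaxFace Δ H) (hne : H.Nonempty)
    {f : Finset V → K} (hf : ∀ G ∈ Δ, cobd K f G = 0) :
    ∃ (c : K) (u : Finset V → K), ∀ G ∈ Δ, f G = c * (if G = H then 1 else 0) + cobd K u G := by
  obtain ⟨e, u, he, hu⟩ := h.exists_star_rep hH.1 hne hf
  refine ⟨e H, u, fun G hG => ?_⟩
  rw [hu G hG]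
  split_ifs with hc
  · rw [hc, mul_one]
  · rw [he G fun hs => hc (hH.2 G hG hs), mul_zero]

lemma coboundary_of_card {j : ℕ} {f u : Finset V → K} {M : Set (Finset V)}
    (hf : ∀ G, G.card ≠ j → f G = 0) (hu : ∀ G ∈ M, G.card = j → f G = cobd K u G) :
    ∃ g : Finset V → K, (∀ G, g G ≠ 0 → u G ≠ 0 ∧ G.card + 1 = j) ∧
      ∀ G ∈ M, f G = cobd K g G := by
  refine ⟨fun G => if G.card + 1 = j then u G else 0, fun G hG => ?_, fun G hG => ?_⟩
  · by_contra hc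
    apply hG
    dsimp only
    split_ifs with h1
    · by_contra h2; exact hc ⟨h2, h1⟩
    · rfl
  · cases j with
    | zero =>
      have : cobd K (fun G : Finset V => if G.card + 1 = 0 then u G else 0) G = 0 :=
        Finset.sum_eq_zero fun v hv => by dsimp only; rw [if_neg (by omega), mul_zero]
      rw [this]
      by_cases hG0 : G.card = 0
      · rw [hu G hG hG0]
        rw [Finset.card_eq_zero] at hG0
        subst hG0; simp [cobd]
      · exact hf G hG0
    | succ j =>
      have := cobd_card u j G
      simp only [Nat.add_right_cancel_iff]
      rw [this]
      split_ifs with h1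
      · exact hu G hG h1
      · exact hf G h1

lemma AcycDel.maxFace_card_eq (h : AcycDel K Δ) {H H' : Finset V} (hH : IsMaxFace Δ H)
    (hH' : IsMaxFace Δ H') (hne : H'.Nonempty) : H.card = H'.card := by
  by_contra hc
  obtain ⟨c, u, hu⟩ := h.maxFace_rep hH' hne (f := fun G => if G = H then (1 : K) else 0)
    fun G hG => cobd_indicator_eq_zero hH hG
  obtain ⟨g, -, hg⟩ := coboundary_of_card (j := H.card) (M := Δ) (u := u)
    (f := fun G => if G = H then (1 : K) else 0)
    (fun G hG => if_neg (by rintro rfl; exact hG rfl)) (fun G hG hGc => by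
      rw [hu G hG, if_neg, mul_zero, zero_add]
      rintro rfl; exact hc hGc.symm)
  exact h.indicator_not_coboundary hH ⟨g, hg⟩

/-- A balanced complex with acyclic deletions; colours are compatible with the vertex order. -/
structure BalancedSphere (K : Type) [Field K] (Δ : Set (Finset V)) (κ : V → ℕ) (C : Finset ℕ) :
    Prop extends AcycDel K Δ where
  inj : ∀ G ∈ Δ, Set.InjOn κ G
  mono : ∀ v w, κ v < κ w → v < w
  sub : ∀ G ∈ Δ, ∀ v ∈ G, κ v ∈ C
  ext : ∀ G ∈ Δ, ∃ H ∈ Δ, G ⊆ H ∧ H.image κ = C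
  empty_mem : ∅ ∈ Δ
  nonempty : C.Nonempty

variable {κ : V → ℕ} {C : Finset ℕ}

lemma BalancedSphere.card_image (h : BalancedSphere K Δ κ C) {G : Finset V} (hG : G ∈ Δ) :
    (G.image κ).card = G.card := Finset.card_image_of_injOn (h.inj G hG)

lemma BalancedSphere.isMaxFace (h : BalancedSphere K Δ κ C) {H : Finset V} (hH : H ∈ Δ)
    (hC : H.image κ = C) : IsMaxFace Δ H := by
  refine ⟨hH, fun G hG hs => (Finset.eq_of_subset_of_card_le hs ?_).symm⟩
  rw [← h.card_image hG, ← h.card_image hH, hC]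
  refine Finset.card_le_card fun c hc => ?_
  obtain ⟨v, hv, rfl⟩ := Finset.mem_image.1 hc
  exact h.sub G hG v hv

lemma BalancedSphere.star_vanishing (h : BalancedSphere K Δ κ C) {F : Finset V} (hF : F ∈ Δ)
    {j : ℕ} (hj : j < C.card) {f : Finset V → K} (hf : ∀ G, f G ≠ 0 → F ⊆ G ∧ G.card = j)
    (hc : ∀ G ∈ Δ, cobd K f G = 0) :
    ∃ g : Finset V → K, (∀ G, g G ≠ 0 → F ⊆ G ∧ G.card + 1 = j) ∧
      ∀ G ∈ Δ, f G = cobd K g G := by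
  obtain ⟨H, hH, -, hHC⟩ := h.ext ∅ h.empty_mem
  have hcard : H.card = C.card := by rw [← hHC, h.card_image hH]
  have hne : H.Nonempty := by
    rw [← Finset.card_pos, hcard, Finset.card_pos]; exact h.nonempty
  obtain ⟨c, u, hu⟩ := h.maxFace_rep (h.isMaxFace hH hHC) hne hc
  have hf' : ∀ G, G.card ≠ j → f G = 0 := fun G hG => by
    by_contra h0; exact hG (hf G h0).2
  obtain ⟨g, -, hg⟩ := coboundary_of_card (j := j) (M := Δ) (u := u) hf' (fun G hG hGc => by
      rw [hu G hG, if_neg, mul_zero, zero_add]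
      rintro rfl; omega)
  obtain ⟨g', hg', hg''⟩ := h.star_coboundary hF (f := f) (fun G hG => by
    by_contra h0; exact hG (hf G h0).1) hg
  obtain ⟨g₂, h1, h2⟩ := coboundary_of_card (j := j) (M := Δ) (u := g') hf'
    (fun G hG _ => hg'' G hG)
  refine ⟨g₂, fun G hG => ⟨?_, (h1 G hG).2⟩, h2⟩
  by_contra h0
  exact (h1 G hG).1 (hg' G h0)

/-- The rank-selected subcomplex. -/
def rankSel (Δ : Set (Finset V)) (κ : V → ℕ) (S : Finset ℕ) : Set (Finset V) :=
  {G | G ∈ Δ ∧ ∀ v ∈ G, κ v ∈ S}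

lemma BalancedSphere.rank_vanishing [Fintype V] (h : BalancedSphere K Δ κ C) (n : ℕ) :
    ∀ S : Finset ℕ, S ⊆ C → (C \ S).card = n → ∀ F ∈ rankSel Δ κ S,
    ∀ j < S.card, ∀ f : Finset V → K, (∀ G, f G ≠ 0 → F ⊆ G ∧ G.card = j) →
    (∀ G ∈ rankSel Δ κ S, cobd K f G = 0) →
    ∃ g : Finset V → K, (∀ G, g G ≠ 0 → F ⊆ G ∧ G.card + 1 = j) ∧
      ∀ G ∈ rankSel Δ κ S, f G = cobd K g G := by
  induction n with
  | zero =>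
    intro S hS hn F hF j hj f hf hc
    have hSC : S = C := by
      rw [Finset.card_eq_zero, Finset.sdiff_eq_empty_iff_subset] at hn
      exact subset_antisymm hS hn
    subst hSC
    obtain ⟨g, h1, h2⟩ := h.star_vanishing hF.1 hj hf fun G hG => hc G ⟨hG, h.sub G hG⟩
    exact ⟨g, h1, fun G hG => h2 G hG.1⟩
  | succ n ih =>
    intro S hS hn F hF j hj f₀ hf₀ hc₀
    obtain ⟨i, hi⟩ : (C \ S).Nonempty := by rw [← Finset.card_pos]; omega
    rw [Finset.mem_sdiff] at hi
    have hS'C : insert i S ⊆ C := Finset.insert_subset hi.1 hS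
    have hn' : (C \ insert i S).card = n := by
      have e : C \ insert i S = (C \ S).erase i := by ext x; simp; tauto
      rw [e, Finset.card_erase_of_mem (by simp [hi])]; omega
    have hScard : (insert i S).card = S.card + 1 := Finset.card_insert_of_notMem hi.2
    -- extend by zero
    let f : Finset V → K := fun G => if ∀ v ∈ G, κ v ≠ i then f₀ G else 0
    have hfG : ∀ G, f G ≠ 0 → f₀ G ≠ 0 ∧ ∀ v ∈ G, κ v ≠ i := by
      intro G hG
      by_cases hc : ∀ v ∈ G, κ v ≠ i
      · simp only [f, if_pos hc] at hG; exact ⟨hG, hc⟩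
      · simp only [f, if_neg hc] at hG; exact absurd rfl hG
    have hff : ∀ G ∈ rankSel Δ κ S, f G = f₀ G := by
      intro G hG
      exact if_pos fun v hv hvi => hi.2 (by rw [← hvi]; exact hG.2 v hv)
    have hsub : ∀ G ∈ rankSel Δ κ S, ∀ H ⊆ G, H ∈ rankSel Δ κ S := fun G hG H hs =>
      ⟨h.down G hG.1 H hs, fun v hv => hG.2 v (hs hv)⟩
    have hsub' : ∀ G ∈ rankSel Δ κ (insert i S), ∀ H ⊆ G, H ∈ rankSel Δ κ (insert i S) :=
      fun G hG H hs => ⟨h.down G hG.1 H hs, fun v hv => hG.2 v (hs hv)⟩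
    have hfc : ∀ G ∈ rankSel Δ κ S, cobd K f G = 0 := fun G hG => by
      rw [← hc₀ G hG]
      exact cobd_congr fun v _ => hff _ (hsub G hG _ (Finset.erase_subset _ _))
    let W : Finset V := Finset.univ.filter fun v => κ v = i
    let e : V → Finset V → K := fun v G => if v ∈ G then cobd K f G else 0
    have hone : ∀ G ∈ rankSel Δ κ (insert i S), ∀ v ∈ W, ∀ w ∈ W, v ∈ G → w ∈ G → v = w := by
      intro G hG v hv w hw hvG hwG
      simp only [W, Finset.mem_filter, Finset.mem_univ, true_and] at hv hw
      exact h.inj G hG.1 hvG hwG (by rw [hv, hw])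
    have hdef : ∀ G ∈ rankSel Δ κ (insert i S), cobd K f G = ∑ v ∈ W, e v G := by
      intro G hG
      by_cases hex : ∃ v ∈ W, v ∈ G
      · obtain ⟨v, hv, hvG⟩ := hex
        rw [Finset.sum_eq_single_of_mem v hv]
        · simp [e, hvG]
        · intro w hw hwv
          exact if_neg fun hwG => hwv (hone G hG w hw v hv hwG hvG)
      · push Not at hex
        rw [Finset.sum_eq_zero fun v hv => if_neg (hex v hv)]
        refine hfc G ⟨hG.1, fun v hv => ?_⟩
        rcases Finset.mem_insert.1 (hG.2 v hv) with h1 | h1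
        · exact absurd hv (hex v (by simp [W, h1]))
        · exact h1
    have hec : ∀ v ∈ W, ∀ G ∈ rankSel Δ κ (insert i S), cobd K (e v) G = 0 := by
      intro v hv G hG
      by_cases hvG : v ∈ G
      · have h1 : cobd K (cobd K f) G = cobd K (e v) G := by
          refine Finset.sum_congr rfl fun w hw => ?_
          congr 1
          rw [hdef _ (hsub' G hG _ (Finset.erase_subset _ _))]
          rw [Finset.sum_eq_single_of_mem v hv]
          intro x hx hxv
          exact if_neg fun hxG => hxv (hone G hG x hx v hv (Finset.mem_of_mem_erase hxG) hvG)
        rw [← h1, cobd_cobd]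
      · exact Finset.sum_eq_zero fun w _ => by
          rw [show e v (G.erase w) = 0 from if_neg fun hc => hvG (Finset.mem_of_mem_erase hc),
            mul_zero]
    have hcob : ∀ G, cobd K f G ≠ 0 → F ⊆ G ∧ G.card = j + 1 := by
      intro G hG
      obtain ⟨w, hw, hw0⟩ := Finset.exists_ne_zero_of_sum_ne_zero hG
      have h1 := hf₀ _ (hfG _ (right_ne_zero_of_mul hw0)).1
      refine ⟨h1.1.trans (Finset.erase_subset _ _), ?_⟩
      have := Finset.card_pos.2 ⟨w, hw⟩
      rw [Finset.card_erase_of_mem hw] at h1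
      omega
    have hg : ∀ v ∈ W, ∃ g : Finset V → K,
        (∀ G, g G ≠ 0 → insert v F ⊆ G ∧ G.card + 1 = j + 1) ∧
        ∀ G ∈ rankSel Δ κ (insert i S), e v G = cobd K g G := by
      intro v hv
      have hvi : κ v = i := by simpa [W] using hv
      by_cases hvF : insert v F ∈ Δ
      · refine ih (insert i S) hS'C hn' (insert v F) ⟨hvF, ?_⟩ (j + 1) (by omega) (e v) ?_
          (hec v hv)
        · intro w hw
          rcases Finset.mem_insert.1 hw with rfl | hw
          · simp [hvi]
          · exact Finset.mem_insert_of_mem (hF.2 w hw)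
        · intro G hG
          by_cases hvG : v ∈ G
          · simp only [e, if_pos hvG] at hG
            have := hcob G hG
            exact ⟨Finset.insert_subset hvG this.1, this.2⟩
          · simp only [e, if_neg hvG] at hG; exact absurd rfl hG
      · refine ⟨0, by simp, fun G hG => ?_⟩
        rw [show cobd K (0 : Finset V → K) G = 0 by simp [cobd]]
        by_contra h0
        by_cases hvG : v ∈ G
        · simp only [e, if_pos hvG] at h0
          exact hvF (h.down G hG.1 _ (Finset.insert_subset hvG (hcob G h0).1))
        · exact h0 (if_neg hvG)
    choose! g hg1 hg2 using hg
    obtain ⟨u, hu1, hu2⟩ := ih (insert i S) hS'C hn' F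
      ⟨hF.1, fun v hv => Finset.mem_insert_of_mem (hF.2 v hv)⟩ j (by omega)
      (fun G => f G - ∑ v ∈ W, g v G) (fun G hG => by
        by_cases h0 : f G = 0
        · rw [h0, zero_sub, neg_ne_zero] at hG
          obtain ⟨v, hv, hv0⟩ := Finset.exists_ne_zero_of_sum_ne_zero hG
          have := hg1 v hv G hv0
          exact ⟨(Finset.subset_insert _ _).trans this.1, by omega⟩
        · exact hf₀ G (hfG G h0).1)
      (fun G hG => by
        rw [cobd_sub, cobd_sum, hdef G hG, sub_eq_zero]
        exact Finset.sum_congr rfl fun v hv => hg2 v hv G hG)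
    refine ⟨u, hu1, fun G hG => ?_⟩
    rw [← hu2 G ⟨hG.1, fun v hv => Finset.mem_insert_of_mem (hG.2 v hv)⟩, hff G hG,
      Finset.sum_eq_zero, sub_zero]
    intro v hv
    by_contra h0
    have hvi : κ v = i := by simpa [W] using hv
    have := (hg1 v hv G h0).1 (Finset.mem_insert_self v F)
    exact hi.2 (hvi ▸ hG.2 v this)

end StarCohomology

section ColorDuality

variable {K : Type} [Field K] {V : Type} [LinearOrder V]

/-- Remove the vertices of a given colour. -/
def colErase (κ : V → ℕ) (l : ℕ) (G : Finset V) : Finset V := G.filter fun v => κ v ≠ l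

/-- The sign of a colour relative to a set of colours. -/
def csgn (K : Type) [Field K] (c : ℕ) (T : Finset ℕ) : K := (-1) ^ (T.filter (· < c)).card

lemma csgn_sq (c : ℕ) (T : Finset ℕ) : csgn K c T * csgn K c T = 1 := by
  rw [csgn, ← mul_pow]; simp

variable {Δ : Set (Finset V)} {κ : V → ℕ} {C : Finset ℕ}

lemma mem_colErase {l : ℕ} {G : Finset V} {v : V} : v ∈ colErase κ l G ↔ v ∈ G ∧ κ v ≠ l := by
  simp [colErase]

lemma colErase_image (l : ℕ) (G : Finset V) : (colErase κ l G).image κ = (G.image κ).erase l := by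
  ext c
  simp only [Finset.mem_image, mem_colErase, Finset.mem_erase]
  constructor
  · rintro ⟨v, ⟨h1, h2⟩, rfl⟩; exact ⟨h2, v, h1, rfl⟩
  · rintro ⟨h1, v, h2, rfl⟩; exact ⟨v, ⟨h2, h1⟩, rfl⟩

lemma colErase_subset (l : ℕ) (G : Finset V) : colErase κ l G ⊆ G := Finset.filter_subset _ _

lemma BalancedSphere.erase_eq (h : BalancedSphere K Δ κ C) {G : Finset V} (hG : G ∈ Δ) {v : V}
    (hv : v ∈ G) : G.erase v = colErase κ (κ v) G := by
  ext w
  rw [Finset.mem_erase, mem_colErase]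
  constructor
  · rintro ⟨h1, h2⟩; exact ⟨h2, fun he => h1 (h.inj G hG h2 hv he)⟩
  · rintro ⟨h1, h2⟩; exact ⟨by rintro rfl; exact h2 rfl, h1⟩

lemma BalancedSphere.vsgn_eq (h : BalancedSphere K Δ κ C) {G : Finset V} (hG : G ∈ Δ) {v : V}
    (hv : v ∈ G) : vsgn K v G = csgn K (κ v) (G.image κ) := by
  rw [vsgn, csgn]
  congr 1
  have : (G.image κ).filter (· < κ v) = (G.filter (· < v)).image κ := by
    ext c
    simp only [Finset.mem_filter, Finset.mem_image]
    constructor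
    · rintro ⟨⟨w, hw, rfl⟩, hc⟩; exact ⟨w, ⟨hw, h.mono _ _ hc⟩, rfl⟩
    · rintro ⟨w, ⟨hw, hwv⟩, rfl⟩
      refine ⟨⟨w, hw, rfl⟩, ?_⟩
      rcases lt_trichotomy (κ w) (κ v) with h1 | h1 | h1
      · exact h1
      · exact absurd (h.inj G hG hw hv h1) hwv.ne
      · exact absurd (h.mono _ _ h1) hwv.not_gt
  rw [this, Finset.card_image_of_injOn]
  exact (h.inj G hG).mono (by intro w hw; exact (Finset.mem_filter.1 hw).1)

lemma BalancedSphere.cobd_color (h : BalancedSphere K Δ κ C) {G : Finset V} (hG : G ∈ Δ)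
    (f : Finset V → K) :
    cobd K f G = ∑ c ∈ G.image κ, csgn K c (G.image κ) * f (colErase κ c G) := by
  rw [Finset.sum_image (h.inj G hG), cobd]
  exact Finset.sum_congr rfl fun v hv => by rw [h.vsgn_eq hG hv, h.erase_eq hG hv]

lemma not_subset_colErase {F G : Finset V} {c : ℕ} (hc : c ∈ F.image κ) :
    ¬ F ⊆ colErase κ c G := by
  obtain ⟨v, hv, rfl⟩ := Finset.mem_image.1 hc
  intro hs
  exact (mem_colErase.1 (hs hv)).2 rfl

lemma subset_colErase {F G : Finset V} {c : ℕ} (hc : c ∉ F.image κ) (hs : F ⊆ G) :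
    F ⊆ colErase κ c G := fun v hv => mem_colErase.2
  ⟨hs hv, fun he => hc (he ▸ Finset.mem_image_of_mem κ hv)⟩

/-- Combinatorial regularity of the colour parameters on stars. -/
lemma BalancedSphere.color_regular [Fintype V] (h : BalancedSphere K Δ κ C) {F : Finset V}
    (hF : F ∈ Δ) {S : Finset ℕ} {i : ℕ} (hS : S ⊆ C) (hi : i ∈ C) (hiS : i ∉ S)
    (hSF : Disjoint S (F.image κ)) (hiF : i ∉ F.image κ) (z : Finset V → K)
    (u : ℕ → Finset V → K)
    (hz : ∀ G ∈ Δ, F ⊆ G → G.image κ = F.image κ ∪ insert i S →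
      z (colErase κ i G) = ∑ l ∈ S, u l (colErase κ l G)) :
    ∃ y : ℕ → Finset V → K, ∀ G ∈ Δ, F ⊆ G → G.image κ = F.image κ ∪ S →
      z G = ∑ l ∈ S, y l (colErase κ l G) := by
  set B := F.image κ with hB
  set T := B ∪ insert i S with hT
  have hBC : B ⊆ C := by
    intro c hc
    obtain ⟨v, hv, rfl⟩ := Finset.mem_image.1 hc
    exact h.sub F hF v hv
  have hTC : T ⊆ C := Finset.union_subset hBC (Finset.insert_subset hi hS)
  have hiT : i ∈ T := by simp [hT]
  let f : Finset V → K := fun G => if F ⊆ G ∧ G.card = T.card - 1 then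
    (if i ∈ G.image κ then 0 else csgn K i T * z G) -
      ∑ l ∈ S, (if l ∈ G.image κ then 0 else csgn K l T * u l G) else 0
  have hTpos : 0 < T.card := Finset.card_pos.2 ⟨i, hiT⟩
  have hdisj : ∀ l ∈ S, l ∉ B := fun l hl hl' => Finset.disjoint_left.1 hSF hl hl'
  obtain ⟨g, hg1, hg2⟩ := h.rank_vanishing _ T hTC rfl F
    ⟨hF, fun v hv => by simp [hT, hB, Finset.mem_image_of_mem κ hv]⟩ (T.card - 1) (by omega) f
    (fun G hG => by
      by_contra hc
      exact hG (if_neg hc))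
    (fun G hG => by
      by_cases hcard : G.card = T.card
      · have hGT : G.image κ = T := by
          refine Finset.eq_of_subset_of_card_le ?_ ?_
          · intro c hc
            obtain ⟨v, hv, rfl⟩ := Finset.mem_image.1 hc
            exact hG.2 v hv
          · rw [h.card_image hG.1, hcard]
        by_cases hFG : F ⊆ G
        · have hcardE : ∀ c ∈ T, (colErase κ c G).card = T.card - 1 := by
            intro c hc
            rw [← h.card_image (h.down G hG.1 _ (colErase_subset c G)), colErase_image, hGT,
              Finset.card_erase_of_mem hc]
          rw [h.cobd_color hG.1, hGT, hT, Finset.sum_union, Finset.sum_insert hiS]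
          · rw [Finset.sum_eq_zero fun c hc => ?_, zero_add]
            · have e1 : f (colErase κ i G) = csgn K i T * z (colErase κ i G) := by
                simp only [f]
                rw [if_pos ⟨subset_colErase hiF hFG, hcardE i hiT⟩, colErase_image, hGT,
                  if_neg (by simp), Finset.sum_eq_zero, sub_zero]
                intro l hl
                rw [if_pos]
                simp only [Finset.mem_erase, hT, Finset.mem_union, Finset.mem_insert, hl, or_true,
                  and_true]
                rintro rfl; exact hiS hl
              have e2 : ∀ l ∈ S, f (colErase κ l G) = -(csgn K l T * u l (colErase κ l G)) := by
                intro l hl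
                have hli : l ≠ i := by rintro rfl; exact hiS hl
                have hlT : l ∈ T := by simp [hT, hl]
                simp only [f]
                rw [if_pos ⟨subset_colErase (hdisj l hl) hFG, hcardE l hlT⟩, colErase_image, hGT,
                  if_pos (by simp [hiT, hli.symm]), zero_sub, Finset.sum_eq_single_of_mem l hl,
                  if_neg (by simp)]
                intro m hm hml
                rw [if_pos]
                simp [hT, hm, hml]
              rw [← hT, e1, ← mul_assoc, csgn_sq, one_mul, hz G hG.1 hFG hGT,
                ← Finset.sum_add_distrib]
              refine Finset.sum_eq_zero fun l hl => ?_
              rw [e2 l hl]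
              linear_combination (-u l (colErase κ l G)) * csgn_sq (K := K) l T
            · rw [show f (colErase κ c G) = 0 from if_neg fun hc' => not_subset_colErase hc hc'.1,
                mul_zero]
          · rw [Finset.disjoint_insert_right]
            exact ⟨hiF, hSF.symm⟩
        · refine Finset.sum_eq_zero fun v hv => ?_
          rw [show f (G.erase v) = 0 from
            if_neg fun hc' => hFG (hc'.1.trans (Finset.erase_subset _ _)), mul_zero]
      · refine Finset.sum_eq_zero fun v hv => ?_
        rw [show f (G.erase v) = 0 from if_neg fun hc' => hcard ?_, mul_zero]
        have := hc'.2
        have h2 := Finset.card_pos.2 ⟨v, hv⟩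
        rw [Finset.card_erase_of_mem hv] at this
        omega)
  refine ⟨fun l G => csgn K i T * (csgn K l (B ∪ S) * g G), fun G hG hFG hGS => ?_⟩
  have hGr : G ∈ rankSel Δ κ T := ⟨hG, fun v hv => by
    have := Finset.mem_image_of_mem κ hv
    rw [hGS] at this
    simp only [hT, Finset.mem_union, Finset.mem_insert] at this ⊢
    tauto⟩
  have hkey := hg2 G hGr
  have hcard : G.card = T.card - 1 := by
    rw [← h.card_image hG, hGS, hT, Finset.union_insert, Finset.card_insert_of_notMem]
    · rfl
    · simp [hiF, hiS]
  have e1 : f G = csgn K i T * z G := by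
    simp only [f]
    rw [if_pos ⟨hFG, hcard⟩, hGS, if_neg (by simp [hiF, hiS]), Finset.sum_eq_zero, sub_zero]
    intro l hl
    rw [if_pos (by simp [hl])]
  rw [e1, h.cobd_color hG, hGS, Finset.sum_union hSF.symm, Finset.sum_eq_zero (s := B), zero_add]
    at hkey
  · rw [← Finset.mul_sum, ← hkey, ← mul_assoc, csgn_sq, one_mul]
  · intro c hc
    have : g (colErase κ c G) = 0 := by
      by_contra h0
      exact not_subset_colErase hc (hg1 _ h0).1
    rw [this, mul_zero]

/-- Nonzero classes modulo the colour parameters are detected by top cohomology. -/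
lemma BalancedSphere.color_duality [Fintype V] (h : BalancedSphere K Δ κ C) (n : ℕ) :
    ∀ F ∈ Δ, ∀ T ⊆ C, Disjoint T (F.image κ) → (C \ (F.image κ ∪ T)).card = n →
    ∀ α : Finset V → K,
    (¬ ∃ y : ℕ → Finset V → K, ∀ G ∈ Δ, F ⊆ G → G.image κ = F.image κ ∪ T →
      α G = ∑ l ∈ T, y l (colErase κ l G)) →
    ∃ G' : Finset V, G'.image κ = C \ (F.image κ ∪ T) ∧
      ¬ ∃ g : Finset V → K, ∀ H ∈ Δ,
        (if F ⊆ H ∧ G' ⊆ H ∧ H.image κ = C then α (H \ G') else 0) = cobd K g H := by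
  induction n with
  | zero =>
    intro F hF T hT hTF hn α hα
    rw [Finset.card_eq_zero] at hn
    have hFC : F.image κ ⊆ C := by
      intro c hc
      obtain ⟨v, hv, rfl⟩ := Finset.mem_image.1 hc
      exact h.sub F hF v hv
    have hCe : F.image κ ∪ T = C := subset_antisymm (Finset.union_subset hFC hT)
      (Finset.sdiff_eq_empty_iff_subset.1 hn)
    refine ⟨∅, by rw [hn]; rfl, ?_⟩
    rintro ⟨g, hg⟩
    obtain ⟨g', hg1, hg2⟩ := h.star_coboundary hF
      (f := fun H => if F ⊆ H ∧ ∅ ⊆ H ∧ H.image κ = C then α (H \ ∅) else 0)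
      (fun G hG => if_neg fun hc => hG hc.1) hg
    refine hα ⟨fun l G => csgn K l C * g' G, fun G hG hFG hGi => ?_⟩
    have key := hg2 G hG
    rw [hCe] at hGi
    rw [if_pos ⟨hFG, by simp, hGi⟩, h.cobd_color hG, hGi, Finset.sdiff_empty] at key
    conv at key => enter [2, 1]; rw [← hCe]
    rw [Finset.sum_union hTF.symm, Finset.sum_eq_zero, zero_add] at key
    · exact key
    · intro c hc
      rw [hg1 _ (not_subset_colErase hc), mul_zero]
  | succ n ih =>
    intro F hF T hT hTF hn α hα
    obtain ⟨i, hi⟩ : (C \ (F.image κ ∪ T)).Nonempty := by rw [← Finset.card_pos]; omega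
    have hi' := hi
    simp only [Finset.mem_sdiff, Finset.mem_union, not_or] at hi
    obtain ⟨hiC, hiF, hiT⟩ := hi
    let αv : V → Finset V → K := fun v G => if v ∈ G then α (G.erase v) else 0
    have hex : ∃ v, κ v = i ∧ insert v F ∈ Δ ∧ ¬ ∃ y : ℕ → Finset V → K, ∀ G ∈ Δ,
        insert v F ⊆ G → G.image κ = (insert v F).image κ ∪ T →
        αv v G = ∑ l ∈ T, y l (colErase κ l G) := by
      by_contra hcon
      push Not at hcon
      choose! y hy using hcon
      refine hα (h.color_regular hF hT hiC hiT hTF hiF α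
        (fun l G => ∑ v ∈ Finset.univ.filter (fun v => κ v = i), if v ∈ G then y v l G else 0) ?_)
      intro G hG hFG hGi
      have hiG : i ∈ G.image κ := by rw [hGi]; simp
      obtain ⟨v, hvG, hvi⟩ := Finset.mem_image.1 hiG
      have h1 : insert v F ⊆ G := Finset.insert_subset hvG hFG
      have h2 := hy v hvi (h.down G hG _ h1) G hG h1 (by
        rw [hGi, Finset.image_insert, hvi]; simp)
      simp only [αv, if_pos hvG] at h2
      rw [h.erase_eq hG hvG, hvi] at h2
      rw [h2]
      refine Finset.sum_congr rfl fun l hl => ?_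
      have hli : i ≠ l := by rintro rfl; exact hiT hl
      rw [Finset.sum_eq_single_of_mem v (by simp [hvi]), if_pos (mem_colErase.2 ⟨hvG, by rwa [hvi]⟩)]
      intro w hw hwv
      refine if_neg fun hwG => hwv (h.inj G hG (mem_colErase.1 hwG).1 hvG ?_)
      rw [hvi]; simpa using hw
    obtain ⟨v, hvi, hvF, hv⟩ := hex
    have hn' : (C \ ((insert v F).image κ ∪ T)).card = n := by
      rw [Finset.image_insert, hvi]
      have : C \ (insert i (F.image κ) ∪ T) = (C \ (F.image κ ∪ T)).erase i := by
        ext c; simp; tauto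
      rw [this, Finset.card_erase_of_mem hi']; omega
    have hdis : Disjoint T ((insert v F).image κ) := by
      rw [Finset.image_insert, hvi, Finset.disjoint_insert_right]
      exact ⟨hiT, hTF⟩
    obtain ⟨G', hG'1, hG'2⟩ := ih (insert v F) hvF T hT hdis hn' (αv v) hv
    have hvG' : v ∉ G' := by
      intro hc
      have := Finset.mem_image_of_mem κ hc
      rw [hG'1] at this
      simp at this
    refine ⟨insert v G', ?_, ?_⟩
    · rw [Finset.image_insert, hG'1, Finset.image_insert, hvi]
      ext c; simp only [Finset.mem_insert, Finset.mem_sdiff, Finset.mem_union]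
      by_cases hci : c = i
      · subst hci; simp [hiC, hiF, hiT]
      · simp [hci]
    · rintro ⟨g, hg⟩
      refine hG'2 ⟨g, fun H hH => ?_⟩
      rw [← hg H hH]
      by_cases hc : F ⊆ H ∧ insert v G' ⊆ H ∧ H.image κ = C
      · obtain ⟨c1, c2, c3⟩ := hc
        have hvH := c2 (Finset.mem_insert_self _ _)
        rw [if_pos ⟨Finset.insert_subset hvH c1, (Finset.subset_insert _ _).trans c2, c3⟩,
          if_pos ⟨c1, c2, c3⟩]
        simp only [αv]
        rw [if_pos (by simp [hvH, hvG'])]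
        congr 1
        ext w; simp; tauto
      · rw [if_neg hc, if_neg]
        rintro ⟨c1, c2, c3⟩
        exact hc ⟨(Finset.subset_insert _ _).trans c1,
          Finset.insert_subset (c1 (Finset.mem_insert_self _ _)) c2, c3⟩

end ColorDuality

section ConeBasics

variable {d : ℕ}

lemma isConvexCone_conicalHull (S : Finset (Fin d → ℝ)) : IsConvexCone (conicalHull S) := by
  refine ⟨⟨0, by simp, by simp⟩, ?_, ?_⟩
  · rintro x ⟨c, hc, rfl⟩ y ⟨c', hc', rfl⟩
    exact ⟨c + c', fun v => add_nonneg (hc v) (hc' v), by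
      simp [add_smul, Finset.sum_add_distrib]⟩
  · rintro x ⟨c, hc, rfl⟩ t ht
    exact ⟨fun v => t * c v, fun v => mul_nonneg ht (hc v), by simp [Finset.smul_sum, mul_smul]⟩

lemma mem_conicalHull {S : Finset (Fin d → ℝ)} {v : Fin d → ℝ} (hv : v ∈ S) :
    v ∈ conicalHull S :=
  ⟨fun w => if w = v then 1 else 0, fun w => by
    dsimp only
    split_ifs <;> simp, by simp [ite_smul, hv]⟩

lemma IsConvexCone.sum_mem {C : Set (Fin d → ℝ)} (hC : IsConvexCone C) {ι : Type*}
    (s : Finset ι) (f : ι → Fin d → ℝ) (hf : ∀ i ∈ s, f i ∈ C) : ∑ i ∈ s, f i ∈ C := by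
  induction s using Finset.induction_on with
  | empty => simpa using hC.1
  | insert i s hi ih =>
    rw [Finset.sum_insert hi]
    exact hC.2.1 _ (hf i (by simp)) _ (ih fun j hj => hf j (by simp [hj]))

lemma IsConvexCone.pos_smul_mem {C : Set (Fin d → ℝ)} (hC : IsConvexCone C) {x : Fin d → ℝ}
    {t : ℝ} (ht : 0 < t) (h : t • x ∈ C) : x ∈ C := by
  have := hC.2.2 _ h t⁻¹ (by positivity)
  rwa [smul_smul, inv_mul_cancel₀ ht.ne', one_smul] at this

/-- A face contains the summands of any of its points. -/
lemma IsFaceOf.of_sum_mem {F C : Set (Fin d → ℝ)} (hC : IsConvexCone C) (hF : IsFaceOf F C)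
    {ι : Type*} (s : Finset ι) (f : ι → Fin d → ℝ) (hf : ∀ i ∈ s, f i ∈ C)
    (hs : ∑ i ∈ s, f i ∈ F) : ∀ i ∈ s, f i ∈ F := by
  intro i hi
  rw [← Finset.add_sum_erase s f hi] at hs
  exact (hF.2.2 _ (hf i hi) _ (hC.sum_mem _ _ fun j hj => hf j (Finset.mem_of_mem_erase hj)) hs).1

lemma IsFaceOf.eq_of_span {F C : Set (Fin d → ℝ)} (hF : IsFaceOf F C)
    (h : C ⊆ Submodule.span ℝ F) : C ⊆ F := by
  have key : ∀ x ∈ Submodule.span ℝ F, ∃ p ∈ F, ∃ q ∈ F, x = p - q := by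
    intro x hx
    induction hx using Submodule.span_induction with
    | mem x hx => exact ⟨x, hx, 0, hF.1.1, by simp⟩
    | zero => exact ⟨0, hF.1.1, 0, hF.1.1, by simp⟩
    | add x y _ _ hx hy =>
      obtain ⟨p, hp, q, hq, rfl⟩ := hx
      obtain ⟨p', hp', q', hq', rfl⟩ := hy
      exact ⟨p + p', hF.1.2.1 _ hp _ hp', q + q', hF.1.2.1 _ hq _ hq', by abel⟩
    | smul t x _ hx =>
      obtain ⟨p, hp, q, hq, rfl⟩ := hx
      rcases le_total 0 t with ht | ht
      · exact ⟨t • p, hF.1.2.2 _ hp _ ht, t • q, hF.1.2.2 _ hq _ ht, smul_sub _ _ _⟩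
      · exact ⟨(-t) • q, hF.1.2.2 _ hq _ (by linarith), (-t) • p,
          hF.1.2.2 _ hp _ (by linarith), by module⟩
  intro x hx
  obtain ⟨p, hp, q, hq, rfl⟩ := key x (h hx)
  exact (hF.2.2 _ hx _ (hF.2.1 hq) (by simpa using hp)).1

lemma IsFaceOf.coneDim_lt {F C : Set (Fin d → ℝ)} (hF : IsFaceOf F C) (hne : F ≠ C) :
    coneDim F < coneDim C := by
  refine Submodule.finrank_lt_finrank_of_lt (lt_of_le_of_ne (Submodule.span_mono hF.2.1) ?_)
  intro h
  refine hne (subset_antisymm hF.2.1 (hF.eq_of_span ?_))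
  rw [h]; exact Submodule.subset_span

/-- The smallest face through a point, described by feasible backward directions. -/
lemma isFaceOf_feasible {C : Set (Fin d → ℝ)} (hC : IsConvexCone C) {b : Fin d → ℝ}
    (hb : b ∈ C) : IsFaceOf {x | x ∈ C ∧ ∃ ε : ℝ, 0 < ε ∧ b - ε • x ∈ C} C := by
  refine ⟨⟨⟨hC.1, 1, one_pos, by simpa using hb⟩, ?_, ?_⟩, fun x hx => hx.1, ?_⟩
  · rintro x ⟨hx, ε, hε, h⟩ y ⟨hy, ε', hε', h'⟩
    refine ⟨hC.2.1 _ hx _ hy, (ε⁻¹ + ε'⁻¹)⁻¹, by positivity, ?_⟩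
    have h1 := hC.2.1 _ (hC.2.2 _ h (ε' / (ε + ε')) (by positivity)) _
      (hC.2.2 _ h' (ε / (ε + ε')) (by positivity))
    convert h1 using 1
    ext i
    simp only [Pi.sub_apply, Pi.smul_apply, Pi.add_apply, smul_eq_mul]
    field_simp
    ring
  · rintro x ⟨hx, ε, hε, h⟩ t ht
    refine ⟨hC.2.2 _ hx _ ht, ε / (t + 1), by positivity, ?_⟩
    have h1 := hC.2.1 _ (hC.2.2 _ h (t / (t + 1)) (by positivity)) _
      (hC.2.2 _ hb (1 / (t + 1)) (by positivity))
    convert h1 using 1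
    ext i
    simp only [Pi.sub_apply, Pi.smul_apply, Pi.add_apply, smul_eq_mul]
    field_simp
    ring
  · rintro x hx y hy ⟨-, ε, hε, h⟩
    refine ⟨⟨hx, ε, hε, ?_⟩, ⟨hy, ε, hε, ?_⟩⟩
    · have := hC.2.1 _ h _ (hC.2.2 _ hy ε hε.le)
      convert this using 1; module
    · have := hC.2.1 _ h _ (hC.2.2 _ hx ε hε.le)
      convert this using 1; module

lemma isFaceOf_zero {C : Set (Fin d → ℝ)} (hC : IsConvexCone C) (hp : IsPointedSet C) :
    IsFaceOf {0} C := by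
  refine ⟨⟨rfl, ?_, ?_⟩, by simpa using hC.1, ?_⟩
  · rintro x rfl y rfl; simp
  · rintro x rfl t _; simp
  · intro x hx y hy hxy
    have h1 : y = -x := by
      have : x + y = 0 := hxy
      exact (neg_eq_of_add_eq_zero_right this).symm
    have hx0 := hp x hx (h1 ▸ hy)
    subst hx0
    simp [h1]

lemma IsPointedSet.sum_eq_zero {C : Set (Fin d → ℝ)} (hC : IsConvexCone C) (hp : IsPointedSet C)
    {ι : Type*} (s : Finset ι) (f : ι → Fin d → ℝ) (hf : ∀ i ∈ s, f i ∈ C)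
    (hs : ∑ i ∈ s, f i = 0) : ∀ i ∈ s, f i = 0 :=
  (isFaceOf_zero hC hp).of_sum_mem hC s f hf hs

/-- Coefficients of a nonnegative combination of nonzero vectors in a pointed cone are
controlled by its norm. -/
lemma exists_coeff_bound {C : Set (Fin d → ℝ)} (hC : IsConvexCone C) (hp : IsPointedSet C)
    {ι : Type*} [Fintype ι] (u : ι → Fin d → ℝ) (hu : ∀ i, u i ≠ 0) :
    ∃ B : ℝ, 0 < B ∧ ∀ t : ι → ℝ, (∀ i, 0 ≤ t i) → (∀ i, t i ≠ 0 → u i ∈ C) →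
      ∑ i, t i ≤ B * ‖∑ i, t i • u i‖ := by
  let P : Set (ι → ℝ) := {t | (∀ i, 0 ≤ t i) ∧ (∀ i, u i ∉ C → t i = 0) ∧ ∑ i, t i = 1}
  have hclosed : IsClosed P := by
    have : P = (⋂ i, {t | 0 ≤ t i}) ∩ ((⋂ i, {t | u i ∉ C → t i = 0}) ∩ {t | ∑ i, t i = 1}) := by
      ext t; simp [P]
    rw [this]
    refine (isClosed_iInter fun i => isClosed_le continuous_const (continuous_apply i)).inter
      ((isClosed_iInter fun i => ?_).inter (isClosed_eq (by fun_prop) continuous_const))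
    by_cases h : u i ∈ C
    · simp [h]
    · simpa [h] using isClosed_eq (continuous_apply i) continuous_const
  have hcomp : IsCompact P := by
    refine (isCompact_univ_pi fun _ : ι => isCompact_Icc (a := (0 : ℝ)) (b := 1)).of_isClosed_subset
      hclosed ?_
    rintro t ⟨h0, -, h1⟩ i -
    exact ⟨h0 i, h1 ▸ Finset.single_le_sum (fun j _ => h0 j) (Finset.mem_univ i)⟩
  have hscale : ∀ t : ι → ℝ, (∀ i, 0 ≤ t i) → (∀ i, t i ≠ 0 → u i ∈ C) → ∑ i, t i ≠ 0 →
      (∑ i, t i)⁻¹ • t ∈ P := by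
    intro t ht htC hs
    have : 0 ≤ ∑ i, t i := Finset.sum_nonneg fun i _ => ht i
    refine ⟨fun i => mul_nonneg (by positivity) (ht i), fun i hi => ?_, ?_⟩
    · have : t i = 0 := by by_contra h; exact hi (htC i h)
      simp [this]
    · simp [← Finset.mul_sum, inv_mul_cancel₀ hs]
  rcases P.eq_empty_or_nonempty with hP | hP
  · refine ⟨1, one_pos, fun t ht htC => ?_⟩
    by_cases hs : ∑ i, t i = 0
    · rw [hs]; positivity
    · exact absurd (hscale t ht htC hs) (by simp [hP])
  obtain ⟨t0, ht0, hmin⟩ := hcomp.exists_isMinOn hP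
    (f := fun t => ‖∑ i, t i • u i‖) (by fun_prop)
  have hpos : 0 < ‖∑ i, t0 i • u i‖ := by
    rw [norm_pos_iff]
    intro h0
    have := hp.sum_eq_zero hC Finset.univ (fun i => t0 i • u i) (fun i _ => by
      by_cases hi : u i ∈ C
      · exact hC.2.2 _ hi _ (ht0.1 i)
      · simpa [ht0.2.1 i hi] using hC.1) h0
    have h1 : ∀ i, t0 i = 0 := fun i => by simpa [hu i] using this i (Finset.mem_univ i)
    have := ht0.2.2
    simp [h1] at this
  refine ⟨‖∑ i, t0 i • u i‖⁻¹, by positivity, fun t ht htC => ?_⟩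
  by_cases hs : ∑ i, t i = 0
  · rw [hs]; positivity
  · have hs' : 0 < ∑ i, t i := lt_of_le_of_ne (Finset.sum_nonneg fun i _ => ht i) (Ne.symm hs)
    have := hmin (hscale t ht htC hs)
    simp only [Set.mem_ofPred_eq, Pi.smul_apply, smul_eq_mul, mul_smul, ← Finset.smul_sum,
      norm_smul, norm_inv, Real.norm_eq_abs, abs_of_pos hs'] at this
    rw [inv_mul_eq_div] at this ⊢
    rw [le_div_iff₀ hs'] at this
    rw [le_div_iff₀ hpos]
    linarith

/-- A pointed finitely generated cone is closed. -/
lemma isClosed_conicalHull {S : Finset (Fin d → ℝ)} (hp : IsPointedSet (conicalHull S)) :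
    IsClosed (conicalHull S) := by
  let ι := {v // v ∈ S ∧ v ≠ 0}
  have hfin : Finite ι := Set.Finite.subset S.finite_toSet (fun v hv => hv.1)
  have := Fintype.ofFinite ι
  obtain ⟨B, hB, hbd⟩ := exists_coeff_bound (isConvexCone_conicalHull S) hp (fun v : ι => v.1)
    (fun v => v.2.2)
  have himg : ∀ x ∈ conicalHull S, ∃ t : ι → ℝ, (∀ i, 0 ≤ t i) ∧ x = ∑ i : ι, t i • i.1 := by
    rintro x ⟨c, hc, rfl⟩
    refine ⟨fun i => c i.1, fun i => hc _, ?_⟩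
    have h1 : ∑ v ∈ S, c v • v = ∑ v ∈ S.filter (fun v => v ≠ 0), c v • v := by
      rw [Finset.sum_filter]
      refine Finset.sum_congr rfl fun v _ => ?_
      split_ifs with h
      · rfl
      · simp [not_not.1 h]
    rw [h1]
    exact Finset.sum_subtype (p := fun v => v ∈ S ∧ v ≠ 0) _ (fun v => by simp)
      (fun v => c v • v)
  refine isClosed_of_closure_subset fun x hx => ?_
  obtain ⟨r, hr, hr'⟩ := mem_closure_iff_seq_limit.1 hx
  let P : Set (ι → ℝ) := Set.pi Set.univ fun _ => Set.Icc 0 (B * (‖x‖ + 1))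
  have hP : IsCompact P := isCompact_univ_pi fun _ => isCompact_Icc
  have himP : IsClosed ((fun t : ι → ℝ => ∑ i : ι, t i • (i.1 : Fin d → ℝ)) '' P) :=
    (hP.image (continuous_finsetSum _ fun i _ =>
      (continuous_apply i).smul continuous_const)).isClosed
  have hxmem : x ∈ (fun t : ι → ℝ => ∑ i : ι, t i • i.1) '' P := by
    refine himP.mem_of_tendsto hr' ?_
    have hev : ∀ᶠ n in Filter.atTop, ‖r n‖ < ‖x‖ + 1 :=
      hr'.norm.eventually (gt_mem_nhds (by linarith))
    filter_upwards [hev] with n hn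
    obtain ⟨t, ht, hrt⟩ := himg _ (hr n)
    refine ⟨t, fun i _ => ⟨ht i, ?_⟩, hrt.symm⟩
    have h1 := hbd t ht (fun i _ => mem_conicalHull i.2.1)
    rw [← hrt] at h1
    have h2 := Finset.single_le_sum (fun j _ => ht j) (Finset.mem_univ i)
    have h3 : B * ‖r n‖ ≤ B * (‖x‖ + 1) := by gcongr
    linarith
  obtain ⟨t, ht, rfl⟩ := hxmem
  exact (isConvexCone_conicalHull S).sum_mem _ _ fun i _ =>
    (isConvexCone_conicalHull S).2.2 _ (mem_conicalHull i.2.1) _ (ht i trivial).1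

lemma Fan.convex (Φ : Fan d) {C : Set (Fin d → ℝ)} (hC : C ∈ Φ.cones) : IsConvexCone C := by
  obtain ⟨S, -, rfl⟩ := (Φ.pointed C hC).1
  exact isConvexCone_conicalHull S

lemma Fan.isClosed (Φ : Fan d) {C : Set (Fin d → ℝ)} (hC : C ∈ Φ.cones) : IsClosed C := by
  obtain ⟨⟨S, -, rfl⟩, hp⟩ := Φ.pointed C hC
  exact isClosed_conicalHull hp

lemma Fan.isPointed (Φ : Fan d) {C : Set (Fin d → ℝ)} (hC : C ∈ Φ.cones) : IsPointedSet C :=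
  (Φ.pointed C hC).2

/-- Every rational cone has a lattice point that lies in no proper face. -/
lemma exists_interior_lattice {C : Set (Fin d → ℝ)} (hC : IsRatCone C) :
    ∃ a : Fin d → ℤ, Z2R a ∈ C ∧ ∀ F, IsFaceOf F C → Z2R a ∈ F → C ⊆ F := by
  obtain ⟨S, hS, rfl⟩ := hC
  choose! q hq using hS
  let M : ℕ := ∏ v ∈ S, ∏ i, (q v i).den
  have hM : 0 < M := Finset.prod_pos fun v _ => Finset.prod_pos fun i _ => (q v i).den_pos
  have hz : ∀ v ∈ S, ∀ i, ∃ z : ℤ, (M : ℝ) * v i = z := by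
    intro v hv i
    have hdvd : (q v i).den ∣ M :=
      (Finset.dvd_prod_of_mem (fun i => (q v i).den) (Finset.mem_univ i)).trans
        (Finset.dvd_prod_of_mem (fun v => ∏ i, (q v i).den) hv)
    obtain ⟨m, hm⟩ := hdvd
    refine ⟨m * (q v i).num, ?_⟩
    rw [hq v hv i, hm]
    have : ((q v i : ℚ) : ℝ) * (q v i).den = (q v i).num := by
      exact_mod_cast Rat.mul_den_eq_num (q v i)
    push_cast
    rw [← this]; ring
  choose! z hz using hz
  have hsum : Z2R (∑ v ∈ S, z v) = ∑ v ∈ S, (M : ℝ) • v := by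
    ext i
    simp only [Z2R, Finset.sum_apply, Int.cast_sum, Pi.smul_apply, smul_eq_mul]
    exact Finset.sum_congr rfl fun v hv => (hz v hv i).symm
  have hCc := isConvexCone_conicalHull S
  have hmem : ∀ v ∈ S, (M : ℝ) • v ∈ conicalHull S := fun v hv =>
    hCc.2.2 _ (mem_conicalHull hv) _ (by positivity)
  refine ⟨∑ v ∈ S, z v, ?_, fun F hF ha => ?_⟩
  · rw [hsum]; exact hCc.sum_mem _ _ hmem
  · rw [hsum] at ha
    have h1 : ∀ v ∈ S, v ∈ F := fun v hv => hF.1.pos_smul_mem (t := M) (by exact_mod_cast hM)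
      (hF.of_sum_mem hCc S _ hmem ha v hv)
    rintro x ⟨c, hc, rfl⟩
    exact hF.1.sum_mem _ _ fun v hv => hF.1.2.2 _ (h1 v hv) _ (hc v)

end ConeBasics

/-- An enumeration of the nonzero cones of a fan by increasing dimension, with an interior
lattice point in each of them. -/
structure FanData {d : ℕ} (Φ : Fan d) (N : ℕ) where
  e : Fin N → Set (Fin d → ℝ)
  a : Fin N → Fin d → ℤ
  mem : ∀ v, e v ∈ Φ.cones
  surj : ∀ C ∈ Φ.cones, C ≠ {0} → ∃ v, e v = C
  inj : Function.Injective e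
  ne : ∀ v, e v ≠ {0}
  mono : Monotone fun v => coneDim (e v)
  a_mem : ∀ v, Z2R (a v) ∈ e v
  a_int : ∀ v F, IsFaceOf F (e v) → Z2R (a v) ∈ F → e v ⊆ F

theorem Fan.exists_fanData {d : ℕ} (Φ : Fan d) : ∃ N, Nonempty (FanData Φ N) := by
  let ι := {C // C ∈ Φ.cones ∧ C ≠ {0}}
  have hfin : Finite ι := Φ.finite.subset fun C hC => hC.1
  obtain ⟨N, ⟨E⟩⟩ := Finite.exists_equiv_fin ι
  let f : Fin N → ℕ := fun i => coneDim (E.symm i).1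
  let p := Tuple.sort f
  have hp : Monotone (f ∘ p) := Tuple.monotone_sort f
  have hmem : ∀ v, (E.symm (p v)).1 ∈ Φ.cones := fun v => (E.symm (p v)).2.1
  choose a ha1 ha2 using fun v => exists_interior_lattice (Φ.pointed _ (hmem v)).1
  exact ⟨N, ⟨{
    e := fun v => (E.symm (p v)).1
    a := a
    mem := hmem
    surj := fun C hC h0 => ⟨p.symm (E ⟨C, hC, h0⟩), by simp⟩
    inj := fun v w h => p.injective (E.symm.injective (Subtype.ext h))
    ne := fun v => (E.symm (p v)).2.2
    mono := hp
    a_mem := ha1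
    a_int := ha2 }⟩⟩

lemma Fan.exists_carrier {d : ℕ} (Φ : Fan d) {x : Fin d → ℝ} (hx : x ∈ ⋃₀ Φ.cones) :
    ∃ E ∈ Φ.cones, x ∈ E ∧ ∀ C ∈ Φ.cones, x ∈ C → E ⊆ C := by
  obtain ⟨E, ⟨hE, hxE⟩, hmin⟩ := (Φ.finite.subset (Set.sep_subset _ fun C => x ∈ C)).exists_minimalFor
    coneDim _ (by obtain ⟨C, hC, hxC⟩ := hx; exact ⟨C, hC, hxC⟩)
  refine ⟨E, hE, hxE, fun C hC hxC => ?_⟩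
  have hf := (Φ.inter_face E hE C hC).1
  by_contra hn
  have hlt := hf.coneDim_lt (fun h => hn (h ▸ Set.inter_subset_right))
  have := hmin ⟨Φ.faces_mem E hE _ hf, hxE, hxC⟩ hlt.le
  omega

lemma Fan.isFaceOf_of_subset {d : ℕ} (Φ : Fan d) {C E : Set (Fin d → ℝ)} (hC : C ∈ Φ.cones)
    (hE : E ∈ Φ.cones) (h : C ⊆ E) : IsFaceOf C E := by
  have := (Φ.inter_face C hC E hE).2
  rwa [Set.inter_eq_left.2 h] at this

namespace FanData

variable {d N : ℕ} {Φ : Fan d} (D : FanData Φ N)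

/-- The colour of a nonzero cone is its dimension. -/
def κ (v : Fin N) : ℕ := coneDim (D.e v)

/-- The chosen interior lattice point as a real vector. -/
def vec (v : Fin N) : Fin d → ℝ := Z2R (D.a v)

/-- The real combination of the chosen points with given coefficients. -/
def comb (t : Fin N → ℝ) : Fin d → ℝ := ∑ v, t v • D.vec v

/-- The order complex of the poset of nonzero cones. -/
def chains : Set (Finset (Fin N)) := {G | ∀ v ∈ G, ∀ w ∈ G, D.e v ⊆ D.e w ∨ D.e w ⊆ D.e v}

lemma chains_down {G H : Finset (Fin N)} (hG : G ∈ D.chains) (h : H ⊆ G) : H ∈ D.chains :=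
  fun v hv w hw => hG v (h hv) w (h hw)

lemma vec_mem (v : Fin N) : D.vec v ∈ D.e v := D.a_mem v

lemma vec_ne_zero (v : Fin N) : D.vec v ≠ 0 := by
  intro h
  have hC := Φ.convex (D.mem v)
  refine D.ne v (subset_antisymm ?_ (by simpa using hC.1))
  exact D.a_int v _ (isFaceOf_zero hC (Φ.isPointed (D.mem v))) h

lemma κ_lt {v w : Fin N} (h : D.e v ⊆ D.e w) (hne : v ≠ w) : D.κ v < D.κ w :=
  (Φ.isFaceOf_of_subset (D.mem v) (D.mem w) h).coneDim_lt fun h => hne (D.inj h)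

lemma lt_of_κ_lt {v w : Fin N} (h : D.κ v < D.κ w) : v < w := by
  by_contra hn
  exact absurd (D.mono (not_lt.1 hn)) (not_le.2 h)

lemma le_of_subset {v w : Fin N} (h : D.e v ⊆ D.e w) : v ≤ w := by
  by_cases hvw : v = w
  · exact hvw.le
  · exact (D.lt_of_κ_lt (D.κ_lt h hvw)).le

lemma subset_of_vec_mem {v : Fin N} {C : Set (Fin d → ℝ)} (hC : C ∈ Φ.cones)
    (h : D.vec v ∈ C) : D.e v ⊆ C :=
  fun _ hx => (D.a_int v _ (Φ.inter_face C hC _ (D.mem v)).2 ⟨h, D.a_mem v⟩ hx).1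

lemma comb_mem {t : Fin N → ℝ} (h0 : ∀ v, 0 ≤ t v) {C : Set (Fin d → ℝ)} (hC : C ∈ Φ.cones)
    (h : ∀ v, t v ≠ 0 → D.e v ⊆ C) : D.comb t ∈ C := by
  refine (Φ.convex hC).sum_mem _ _ fun v _ => ?_
  by_cases hv : t v = 0
  · simpa [hv] using (Φ.convex hC).1
  · exact (Φ.convex hC).2.2 _ (h v hv (D.vec_mem v)) _ (h0 v)

lemma subset_of_comb_mem {t : Fin N → ℝ} (h0 : ∀ v, 0 ≤ t v) {C C' : Set (Fin d → ℝ)}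
    (hC : C ∈ Φ.cones) (hC' : C' ∈ Φ.cones) (h : ∀ v, t v ≠ 0 → D.e v ⊆ C')
    (hm : D.comb t ∈ C) : ∀ v, t v ≠ 0 → D.e v ⊆ C := by
  intro v hv
  have h1 := (Φ.inter_face C hC C' hC').2.of_sum_mem (Φ.convex hC') Finset.univ
    (fun v => t v • D.vec v) (fun w _ => by
      by_cases hw : t w = 0
      · simpa [hw] using (Φ.convex hC').1
      · exact (Φ.convex hC').2.2 _ (h w hw (D.vec_mem w)) _ (h0 w))
    ⟨hm, D.comb_mem h0 hC' h⟩ v (Finset.mem_univ v)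
  exact D.subset_of_vec_mem hC ((Φ.convex hC).pos_smul_mem
    (lt_of_le_of_ne (h0 v) (Ne.symm hv)) h1.1)

lemma comb_eq_zero {t : Fin N → ℝ} (h0 : ∀ v, 0 ≤ t v) {C : Set (Fin d → ℝ)}
    (hC : C ∈ Φ.cones) (h : ∀ v, t v ≠ 0 → D.e v ⊆ C) (hz : D.comb t = 0) : t = 0 := by
  ext v
  have := (Φ.isPointed hC).sum_eq_zero (Φ.convex hC) Finset.univ (fun v => t v • D.vec v)
    (fun w _ => by
      by_cases hw : t w = 0
      · simpa [hw] using (Φ.convex hC).1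
      · exact (Φ.convex hC).2.2 _ (h w hw (D.vec_mem w)) _ (h0 w)) hz v (Finset.mem_univ v)
  simpa [D.vec_ne_zero v] using this

/-- A nonnegative coefficient vector supported on a chain. -/
structure IsRep (t : Fin N → ℝ) : Prop where
  nonneg : ∀ v, 0 ≤ t v
  chain : ∀ v w, t v ≠ 0 → t w ≠ 0 → D.e v ⊆ D.e w ∨ D.e w ⊆ D.e v

/-- The top cone of a finite nonempty chain. -/
lemma chain_top {G : Finset (Fin N)} (hG : G ∈ D.chains) (hne : G.Nonempty) :
    ∃ v ∈ G, ∀ w ∈ G, D.e w ⊆ D.e v := by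
  refine ⟨G.max' hne, G.max'_mem hne, fun w hw => ?_⟩
  rcases hG w hw _ (G.max'_mem hne) with h | h
  · exact h
  · rw [le_antisymm (D.le_of_subset h) (G.le_max' w hw)]

lemma comb_single (v : Fin N) (s : ℝ) : D.comb (Pi.single v s) = s • D.vec v := by
  rw [comb, Finset.sum_eq_single_of_mem v (Finset.mem_univ v)]
  · simp
  · intro w _ hw; simp [Pi.single_eq_of_ne hw]

lemma comb_add (t t' : Fin N → ℝ) : D.comb (t + t') = D.comb t + D.comb t' := by
  simp [comb, add_smul, Finset.sum_add_distrib]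

lemma comb_sub (t t' : Fin N → ℝ) : D.comb (t - t') = D.comb t - D.comb t' := by
  simp [comb, sub_smul, Finset.sum_sub_distrib]

lemma comb_smul (s : ℝ) (t : Fin N → ℝ) : D.comb (s • t) = s • D.comb t := by
  simp [comb, mul_smul, Finset.smul_sum]

lemma comb_zero : D.comb 0 = 0 := by simp [comb]

namespace IsRep

variable {D}

lemma supp_mem {t : Fin N → ℝ} (h : D.IsRep t) :
    (Finset.univ.filter fun v => t v ≠ 0) ∈ D.chains := fun v hv w hw =>
  h.chain v w (by simpa using hv) (by simpa using hw)

lemma top {t : Fin N → ℝ} (h : D.IsRep t) (hne : t ≠ 0) :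
    ∃ v, t v ≠ 0 ∧ ∀ w, t w ≠ 0 → D.e w ⊆ D.e v := by
  obtain ⟨v, hv, hv'⟩ := D.chain_top h.supp_mem (by
    obtain ⟨v, hv⟩ := Function.ne_iff.1 hne
    exact ⟨v, by simpa using hv⟩)
  exact ⟨v, by simpa using hv, fun w hw => hv' w (by simpa using hw)⟩

lemma zero : D.IsRep 0 := ⟨fun _ => le_rfl, fun _ _ h => absurd rfl h⟩

lemma exists_cone (hne : Φ.cones.Nonempty) {t : Fin N → ℝ} (h : D.IsRep t) :
    ∃ C ∈ Φ.cones, ∀ v, t v ≠ 0 → D.e v ⊆ C := by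
  by_cases h0 : t = 0
  · obtain ⟨C, hC⟩ := hne
    exact ⟨C, hC, fun v hv => absurd (by simp [h0]) hv⟩
  · obtain ⟨v, -, hv⟩ := h.top h0
    exact ⟨_, D.mem v, hv⟩

/-- Coefficients along chains are uniquely determined. -/
theorem unique {t t' : Fin N → ℝ} (h : D.IsRep t) (h' : D.IsRep t')
    (he : D.comb t = D.comb t') : t = t' := by
  suffices H : ∀ n (t t' : Fin N → ℝ), D.IsRep t → D.IsRep t' → D.comb t = D.comb t' →
      (Finset.univ.filter fun v => t v ≠ 0).card + (Finset.univ.filter fun v => t' v ≠ 0).card ≤ n →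
      t = t' from H _ t t' h h' he le_rfl
  clear h h' he t t'
  intro n
  induction n with
  | zero =>
    intro t t' _ _ _ hn
    have h1 : (Finset.univ.filter fun v => t v ≠ 0) = ∅ := Finset.card_eq_zero.1 (by omega)
    have h2 : (Finset.univ.filter fun v => t' v ≠ 0) = ∅ := Finset.card_eq_zero.1 (by omega)
    ext v
    have h3 := Finset.eq_empty_iff_forall_notMem.1 h1 v
    have h4 := Finset.eq_empty_iff_forall_notMem.1 h2 v
    simp only [Finset.mem_filter, Finset.mem_univ, true_and, not_not] at h3 h4
    rw [h3, h4]
  | succ n ih =>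
    intro t t' h h' he hn
    by_cases ht : t = 0
    · subst ht
      by_contra hne
      obtain ⟨v, hv, hv'⟩ := h'.top (Ne.symm hne)
      exact hne (D.comb_eq_zero h'.nonneg (D.mem v) hv' (by rw [← he, comb_zero])).symm
    by_cases ht' : t' = 0
    · subst ht'
      obtain ⟨v, hv, hv'⟩ := h.top ht
      exact D.comb_eq_zero h.nonneg (D.mem v) hv' (by rw [he, comb_zero])
    obtain ⟨v, hv, hv'⟩ := h.top ht
    obtain ⟨w, hw, hw'⟩ := h'.top ht'
    have hvw : v = w := by
      refine D.inj (subset_antisymm ?_ ?_)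
      · exact D.subset_of_comb_mem h.nonneg (D.mem w) (D.mem v) hv'
          (he ▸ D.comb_mem h'.nonneg (D.mem w) hw') v hv
      · exact D.subset_of_comb_mem h'.nonneg (D.mem v) (D.mem w) hw'
          (he ▸ D.comb_mem h.nonneg (D.mem v) hv') w hw
    subst hvw
    have step : ∀ t t' : Fin N → ℝ, D.IsRep t → D.IsRep t' → D.comb t = D.comb t' →
        (Finset.univ.filter fun v => t v ≠ 0).card +
          (Finset.univ.filter fun v => t' v ≠ 0).card ≤ n + 1 →
        t v ≠ 0 → t v ≤ t' v → t = t' := by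
      intro t t' h h' he hn hv hle
      have hs : ∀ w, (t - Pi.single v (t v) : Fin N → ℝ) w ≠ 0 → t w ≠ 0 ∧ w ≠ v := by
        intro w hw
        by_cases hwv : w = v
        · subst hwv; simp at hw
        · simpa [hwv] using hw
      have h1 : D.IsRep (t - Pi.single v (t v)) := by
        refine ⟨fun w => ?_, fun w u hw hu => h.chain w u (hs w hw).1 (hs u hu).1⟩
        by_cases hwv : w = v
        · subst hwv; simp
        · simpa [hwv] using h.nonneg w
      have hs' : ∀ w, (t' - Pi.single v (t v) : Fin N → ℝ) w ≠ 0 → t' w ≠ 0 := by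
        intro w hw
        by_cases hwv : w = v
        · subst hwv
          intro h0
          rw [h0] at hle
          exact hv (le_antisymm hle (h.nonneg w))
        · simpa [hwv] using hw
      have h1' : D.IsRep (t' - Pi.single v (t v)) := by
        refine ⟨fun w => ?_, fun w u hw hu => h'.chain w u (hs' w hw) (hs' u hu)⟩
        by_cases hwv : w = v
        · subst hwv; simpa using hle
        · simpa [hwv] using h'.nonneg w
      have := ih _ _ h1 h1' (by rw [comb_sub, comb_sub, he]) (by
        have c1 : (Finset.univ.filter fun w => (t - Pi.single v (t v) : Fin N → ℝ) w ≠ 0).card <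
            (Finset.univ.filter fun w => t w ≠ 0).card := by
          refine Finset.card_lt_card ⟨fun w hw => ?_, fun hc => ?_⟩
          · simpa using (hs w (by simpa using hw)).1
          · have := hc (show v ∈ _ by simpa using hv)
            simp at this
        have c2 : (Finset.univ.filter fun w => (t' - Pi.single v (t v) : Fin N → ℝ) w ≠ 0).card ≤
            (Finset.univ.filter fun w => t' w ≠ 0).card := by
          refine Finset.card_le_card fun w hw => ?_
          simpa using hs' w (by simpa using hw)
        omega)
      simpa using this
    rcases le_total (t v) (t' v) with hle | hle
    · exact step t t' h h' he hn hv hle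
    · exact (step t' t h' h he.symm (by omega) hw hle).symm

end IsRep

/-- Every point of the support is a nonnegative combination along a chain. -/
theorem exists_rep {x : Fin d → ℝ} (hx : x ∈ ⋃₀ Φ.cones) :
    ∃ t, D.IsRep t ∧ D.comb t = x := by
  suffices H : ∀ n, ∀ E ∈ Φ.cones, coneDim E ≤ n → ∀ x ∈ E, (∀ C ∈ Φ.cones, x ∈ C → E ⊆ C) →
      ∃ t, D.IsRep t ∧ D.comb t = x ∧ ∀ v, t v ≠ 0 → D.e v ⊆ E by
    obtain ⟨E, hE, hxE, hmin⟩ := Φ.exists_carrier hx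
    obtain ⟨t, h1, h2, -⟩ := H _ E hE le_rfl x hxE hmin
    exact ⟨t, h1, h2⟩
  intro n
  induction n using Nat.strong_induction_on with
  | _ n ih =>
  intro E hE hEn x hxE hmin
  have hCE := Φ.convex hE
  by_cases hE0 : E = {0}
  · refine ⟨0, IsRep.zero, ?_, fun v hv => absurd rfl hv⟩
    rw [comb_zero]
    rw [hE0] at hxE
    exact hxE.symm
  obtain ⟨v, rfl⟩ := D.surj E hE hE0
  let T : Set ℝ := {s | 0 ≤ s ∧ x - s • D.vec v ∈ D.e v}
  have hTdown : ∀ s ∈ T, ∀ r, 0 ≤ r → r ≤ s → r ∈ T := by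
    rintro s ⟨hs, hs'⟩ r hr hrs
    refine ⟨hr, ?_⟩
    have := hCE.2.1 _ hs' _ (hCE.2.2 _ (D.vec_mem v) (s - r) (by linarith))
    convert this using 1; module
  have hTclosed : IsClosed T := by
    refine isClosed_Ici.inter ?_
    exact (Φ.isClosed hE).preimage (by fun_prop : Continuous fun s : ℝ => x - s • D.vec v)
  have hTbdd : BddAbove T := by
    by_contra hb
    rw [not_bddAbove_iff] at hb
    have h1 : ∀ n : ℕ, (1 / ((n : ℝ) + 1)) • x - D.vec v ∈ D.e v := by
      intro n
      obtain ⟨s, hs, hns⟩ := hb (n + 1)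
      have := (hTdown s hs (n + 1) (by positivity) hns.le).2
      have := hCE.2.2 _ this (1 / ((n : ℝ) + 1)) (by positivity)
      convert this using 1
      rw [smul_sub, smul_smul, one_div, inv_mul_cancel₀ (by positivity), one_smul]
    have h2 : Filter.Tendsto (fun n : ℕ => (1 / ((n : ℝ) + 1)) • x - D.vec v) Filter.atTop
        (nhds ((0 : ℝ) • x - D.vec v)) :=
      (tendsto_one_div_add_atTop_nhds_zero_nat.smul_const x).sub_const _
    have h3 := (Φ.isClosed hE).mem_of_tendsto h2 (Filter.Eventually.of_forall h1)
    rw [zero_smul, zero_sub] at h3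
    exact D.vec_ne_zero v (Φ.isPointed hE _ (D.vec_mem v) h3)
  have hTne : T.Nonempty := ⟨0, le_rfl, by simpa using hxE⟩
  have hsT := hTclosed.csSup_mem hTne hTbdd
  set s := sSup T with hs
  set y := x - s • D.vec v with hy
  obtain ⟨E', hE', hyE', hmin'⟩ := Φ.exists_carrier (x := y) ⟨_, hE, hsT.2⟩
  have hsub : E' ⊆ D.e v := hmin' _ hE hsT.2
  have hne : E' ≠ D.e v := by
    intro heq
    have hface := Φ.faces_mem _ hE _ (isFaceOf_feasible hCE hsT.2)
    have := hmin' _ hface ⟨hsT.2, 1, one_pos, by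
      change y - (1 : ℝ) • y ∈ _
      rw [one_smul, sub_self]
      exact hCE.1⟩
    rw [heq] at this
    obtain ⟨-, ε, hε, h⟩ := this (D.vec_mem v)
    have hmem : s + ε ∈ T := ⟨by linarith [hsT.1], by
      convert h using 1
      module⟩
    linarith [le_csSup hTbdd hmem]
  have hlt := (Φ.isFaceOf_of_subset hE' hE hsub).coneDim_lt hne
  obtain ⟨t, ht1, ht2, ht3⟩ := ih (coneDim E') (by omega) E' hE' le_rfl y hyE' hmin'
  have hs1 : ∀ w, (t + Pi.single v s : Fin N → ℝ) w ≠ 0 → D.e w ⊆ D.e v := by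
    intro w hw
    by_cases hwv : w = v
    · rw [hwv]
    · exact (ht3 w (by simpa [hwv] using hw)).trans hsub
  refine ⟨t + Pi.single v s, ⟨fun w => ?_, fun w u hw hu => ?_⟩, ?_, hs1⟩
  · by_cases hwv : w = v
    · subst hwv; simpa using add_nonneg (ht1.nonneg w) hsT.1
    · simpa [hwv] using ht1.nonneg w
  · by_cases hwv : w = v
    · exact Or.inr (hwv ▸ hs1 u hu)
    · by_cases huv : u = v
      · exact Or.inl (huv ▸ hs1 w hw)
      · exact ht1.chain w u (by simpa [hwv] using hw) (by simpa [huv] using hu)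
  · rw [comb_add, comb_single, ht2, hy]; module

end FanData

section EuclideanNorm

variable {n : ℕ}

/-- The Euclidean norm on coordinate space. -/
def nrm (x : Fin n → ℝ) : ℝ := Real.sqrt (∑ i, x i ^ 2)

lemma continuous_nrm : Continuous (nrm : (Fin n → ℝ) → ℝ) := by
  unfold nrm; fun_prop

lemma nrm_eq_zero {x : Fin n → ℝ} : nrm x = 0 ↔ x = 0 := by
  rw [nrm, Real.sqrt_eq_zero (Finset.sum_nonneg fun i _ => sq_nonneg _),
    Finset.sum_eq_zero_iff_of_nonneg fun i _ => sq_nonneg _]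
  simp [funext_iff]

lemma nrm_nonneg (x : Fin n → ℝ) : 0 ≤ nrm x := Real.sqrt_nonneg _

lemma nrm_pos {x : Fin n → ℝ} (h : x ≠ 0) : 0 < nrm x :=
  lt_of_le_of_ne (nrm_nonneg x) fun h0 => h (nrm_eq_zero.1 h0.symm)

lemma nrm_smul {s : ℝ} (hs : 0 ≤ s) (x : Fin n → ℝ) : nrm (s • x) = s * nrm x := by
  simp only [nrm, Pi.smul_apply, smul_eq_mul, mul_pow, ← Finset.mul_sum]
  rw [Real.sqrt_mul (sq_nonneg s), Real.sqrt_sq hs]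

lemma nrm_neg (x : Fin n → ℝ) : nrm (-x) = nrm x := by simp [nrm]

lemma nrm_eq_one {x : Fin n → ℝ} : nrm x = 1 ↔ ∑ i, x i ^ 2 = 1 := Real.sqrt_eq_one

/-- Radial projection to the unit sphere. -/
def normalize' (x : Fin n → ℝ) : Fin n → ℝ := (nrm x)⁻¹ • x

lemma nrm_normalize' {x : Fin n → ℝ} (h : x ≠ 0) : nrm (normalize' x) = 1 := by
  rw [normalize', nrm_smul (inv_nonneg.2 (nrm_nonneg x)), inv_mul_cancel₀ (nrm_pos h).ne']

lemma normalize'_of_nrm {x : Fin n → ℝ} (h : nrm x = 1) : normalize' x = x := by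
  simp [normalize', h]

lemma continuousOn_normalize' : ContinuousOn (normalize' : (Fin n → ℝ) → _) {x | x ≠ 0} :=
  (continuous_nrm.continuousOn.inv₀ fun _ hx => (nrm_pos hx).ne').smul continuousOn_id

end EuclideanNorm

section SphereAcyclic

variable {V : Type} [LinearOrder V] [Fintype V]

/-- The least barycentric coordinate along a face. -/
def faceMin (F : Finset V) (hF : F.Nonempty) (t : V → ℝ) : ℝ := F.inf' hF t

/-- Radial retraction away from the barycentre of a face. -/
def awayRetract (F : Finset V) (hF : F.Nonempty) (t : V → ℝ) : V → ℝ :=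
  fun v => (t v - if v ∈ F then faceMin F hF t else 0) / (1 - faceMin F hF t * F.card)

lemma continuous_faceMin (F : Finset V) (hF : F.Nonempty) : Continuous (faceMin F hF) := by
  unfold faceMin
  exact Continuous.finset_inf'_apply hF fun v _ => continuous_apply v

variable {Δ : Set (Finset V)} {F : Finset V} (hF : F.Nonempty)

lemma faceMin_eq_zero {t : V → ℝ} (h0 : ∀ v, 0 ≤ t v) {v : V} (hv : v ∈ F) (hv0 : t v = 0) :
    faceMin F hF t = 0 :=
  le_antisymm (hv0 ▸ Finset.inf'_le t hv) (Finset.le_inf' hF _ fun w _ => h0 w)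

lemma faceMin_mul_card_le {t : V → ℝ} (h0 : ∀ v, 0 ≤ t v) (h1 : ∑ v, t v = 1) :
    faceMin F hF t * F.card ≤ 1 := by
  rw [← h1]
  calc faceMin F hF t * F.card = ∑ v ∈ F, faceMin F hF t := by simp [mul_comm]
    _ ≤ ∑ v ∈ F, t v := Finset.sum_le_sum fun v hv => Finset.inf'_le t hv
    _ ≤ ∑ v, t v := Finset.sum_le_univ_sum_of_nonneg h0

lemma eq_barycenter {t : V → ℝ} (h0 : ∀ v, 0 ≤ t v) (h1 : ∑ v, t v = 1)
    (h : faceMin F hF t * F.card = 1) : t = fun v => if v ∈ F then (F.card : ℝ)⁻¹ else 0 := by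
  have hc : (0 : ℝ) < F.card := by exact_mod_cast hF.card_pos
  have hm : faceMin F hF t = (F.card : ℝ)⁻¹ := eq_inv_of_mul_eq_one_left h
  have hle : ∀ v, (if v ∈ F then (F.card : ℝ)⁻¹ else 0) ≤ t v := by
    intro v
    split_ifs with hv
    · rw [← hm]; exact Finset.inf'_le t hv
    · exact h0 v
  have := (Finset.sum_eq_sum_iff_of_le fun v _ => hle v).1 (by
    rw [h1]; simp [Finset.sum_ite_mem, hc.ne'])
  ext v
  exact (this v (Finset.mem_univ v)).symm

lemma awayRetract_mem (hdown : ∀ G ∈ Δ, ∀ H ⊆ G, H ∈ Δ)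
    {t : V → ℝ} (ht : t ∈ realization Δ)
    (hne : t ≠ fun v => if v ∈ F then (F.card : ℝ)⁻¹ else 0) :
    awayRetract F hF t ∈ realization {G | G ∈ Δ ∧ ¬ F ⊆ G} := by
  obtain ⟨G, hG, h0, h1, h2⟩ := ht
  have hlt : 0 < 1 - faceMin F hF t * F.card := by
    have := lt_of_le_of_ne (faceMin_mul_card_le hF h0 h1) fun h => hne (eq_barycenter hF h0 h1 h)
    linarith
  obtain ⟨v0, hv0, hmin⟩ := F.exists_mem_eq_inf' hF t
  have hmin' : faceMin F hF t = t v0 := hmin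
  refine ⟨G.erase v0, ⟨hdown G hG _ (Finset.erase_subset _ _),
    fun h => Finset.notMem_erase v0 G (h hv0)⟩, fun v => div_nonneg ?_ hlt.le, ?_, fun v hv => ?_⟩
  · split_ifs with hv
    · exact sub_nonneg.2 (Finset.inf'_le t hv)
    · simpa using h0 v
  · simp only [awayRetract]
    rw [← Finset.sum_div, Finset.sum_sub_distrib, h1, Finset.sum_ite_mem, Finset.univ_inter,
      Finset.sum_const, nsmul_eq_mul, mul_comm, div_self hlt.ne']
  · simp only [awayRetract]
    by_cases hvv : v = v0
    · subst hvv; simp [hv0, hmin']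
    · have hvG : v ∉ G := fun h => hv (Finset.mem_erase.2 ⟨hvv, h⟩)
      rw [h2 v hvG]
      split_ifs with hvF
      · rw [faceMin_eq_zero hF h0 hvF (h2 v hvG)]; simp
      · simp

lemma awayRetract_eq {t : V → ℝ} (ht : t ∈ realization {G | G ∈ Δ ∧ ¬ F ⊆ G}) :
    awayRetract F hF t = t := by
  obtain ⟨G, ⟨-, hFG⟩, h0, h1, h2⟩ := ht
  obtain ⟨v, hv, hvG⟩ := Finset.not_subset.1 hFG
  ext w
  simp [awayRetract, faceMin_eq_zero hF h0 hv (h2 v hvG)]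

/-- Deleting a face from a triangulated sphere leaves an acyclic complex. -/
theorem acyc_deletion_of_sphere (hdown : ∀ G ∈ Δ, ∀ H ⊆ G, H ∈ Δ)
    (hF : F.Nonempty) (K : Type) [Field K] (hFΔ : F ∈ Δ) {m : ℕ}
    (H : ↥(realization Δ) ≃ₜ ↥(sphereModel m)) : Acyc K {G | G ∈ Δ ∧ ¬ F ⊆ G} := by
  have hsub : realization {G | G ∈ Δ ∧ ¬ F ⊆ G} ⊆ realization Δ := by
    rintro x ⟨G, hG, hx⟩; exact ⟨G, hG.1, hx⟩
  have hc : (0 : ℝ) < F.card := by exact_mod_cast hF.card_pos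
  set xF : V → ℝ := fun v => if v ∈ F then (F.card : ℝ)⁻¹ else 0 with hxF
  have hxFΔ : xF ∈ realization Δ := by
    refine ⟨F, hFΔ, fun v => ?_, ?_, fun v hv => by simp [hxF, hv]⟩
    · simp only [hxF]; split_ifs <;> positivity
    · simp [hxF, Finset.sum_ite_mem, hc.ne']
  have hxFn : xF ∉ realization {G | G ∈ Δ ∧ ¬ F ⊆ G} := by
    rintro ⟨G, ⟨-, hFG⟩, -, -, h2⟩
    obtain ⟨v, hv, hvG⟩ := Finset.not_subset.1 hFG
    have := h2 v hvG
    simp [hxF, hv, hc.ne'] at this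
  set p : Fin (m + 1) → ℝ := (H ⟨xF, hxFΔ⟩).1 with hp
  have hnp : nrm p = 1 := nrm_eq_one.2 (H ⟨xF, hxFΔ⟩).2
  let Hf : (V → ℝ) → (Fin (m + 1) → ℝ) := fun t => if h : t ∈ realization Δ then (H ⟨t, h⟩).1 else 0
  let Hi : (Fin (m + 1) → ℝ) → (V → ℝ) := fun y => if h : y ∈ sphereModel m then (H.symm ⟨y, h⟩).1
    else 0
  have hHf : ∀ t (h : t ∈ realization Δ), Hf t = (H ⟨t, h⟩).1 := fun t h => dif_pos h
  have hHi : ∀ y (h : y ∈ sphereModel m), Hi y = (H.symm ⟨y, h⟩).1 := fun y h => dif_pos h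
  have hHfc : ContinuousOn Hf (realization Δ) := by
    rw [continuousOn_iff_continuous_domRestrict]
    have : (realization Δ).domRestrict Hf = fun t => (H t).1 := by
      ext1 t; exact hHf t.1 t.2
    rw [this]
    exact continuous_subtype_val.comp H.continuous
  have hHic : ContinuousOn Hi (sphereModel m) := by
    rw [continuousOn_iff_continuous_domRestrict]
    have : (sphereModel m).domRestrict Hi = fun t => (H.symm t).1 := by
      ext1 t; exact hHi t.1 t.2
    rw [this]
    exact continuous_subtype_val.comp H.symm.continuous
  have hHiΔ : ∀ y ∈ sphereModel m, Hi y ∈ realization Δ := fun y hy => by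
    rw [hHi y hy]; exact (H.symm ⟨y, hy⟩).2
  have hHin : ∀ y ∈ sphereModel m, y ≠ p → Hi y ≠ xF := by
    intro y hy hyp he
    rw [hHi y hy] at he
    apply hyp
    have : H.symm ⟨y, hy⟩ = ⟨xF, hxFΔ⟩ := Subtype.ext he
    rw [hp, ← this, H.apply_symm_apply]
  have hHfm : ∀ t ∈ realization Δ, nrm (Hf t) = 1 := fun t h => by
    rw [hHf t h]; exact nrm_eq_one.2 (H ⟨t, h⟩).2
  have hHfp : ∀ t ∈ realization {G | G ∈ Δ ∧ ¬ F ⊆ G}, Hf t ≠ p := by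
    intro t ht he
    rw [hHf t (hsub ht)] at he
    have := H.injective (Subtype.ext he)
    have h2 : t = xF := Subtype.ext_iff.1 this
    exact hxFn (h2 ▸ ht)
  have hHiHf : ∀ t ∈ realization Δ, Hi (Hf t) = t := by
    intro t ht
    have h1 : Hf t ∈ sphereModel m := nrm_eq_one.1 (hHfm t ht)
    rw [hHi _ h1]
    have : (⟨Hf t, h1⟩ : sphereModel m) = H ⟨t, ht⟩ := Subtype.ext (hHf t ht)
    rw [this, H.symm_apply_apply]
  let c : (V → ℝ) × ℝ → (Fin (m + 1) → ℝ) := fun q => (1 - q.2) • Hf q.1 - q.2 • p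
  have key : ∀ q ∈ realization {G | G ∈ Δ ∧ ¬ F ⊆ G} ×ˢ Set.Icc (0 : ℝ) 1, ∀ l : ℝ, 0 ≤ l →
      c q ≠ l • p := by
    rintro ⟨t, s⟩ ⟨ht, hs0, hs1⟩ l hl he
    simp only at ht hs0 hs1
    have h1 : (1 - s) • Hf t = (l + s) • p := by
      have : (1 - s) • Hf t - s • p = l • p := he
      rw [sub_eq_iff_eq_add] at this
      rw [this]; module
    have h2 := congrArg nrm h1
    rw [nrm_smul (by linarith), nrm_smul (by linarith), hHfm t (hsub ht), hnp] at h2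
    have h3 : (1 : ℝ) - s ≠ 0 := by intro h; linarith
    rw [show l + s = 1 - s by linarith] at h1
    exact hHfp t ht (smul_right_injective _ h3 h1)
  have hc0 : ∀ q ∈ realization {G | G ∈ Δ ∧ ¬ F ⊆ G} ×ˢ Set.Icc (0 : ℝ) 1, c q ≠ 0 :=
    fun q hq => by simpa using key q hq 0 le_rfl
  have hcs : ∀ q ∈ realization {G | G ∈ Δ ∧ ¬ F ⊆ G} ×ˢ Set.Icc (0 : ℝ) 1,
      normalize' (c q) ∈ sphereModel m := fun q hq => nrm_eq_one.1 (nrm_normalize' (hc0 q hq))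
  have hcp : ∀ q ∈ realization {G | G ∈ Δ ∧ ¬ F ⊆ G} ×ˢ Set.Icc (0 : ℝ) 1,
      normalize' (c q) ≠ p := by
    intro q hq he
    refine key q hq (nrm (c q)) (nrm_nonneg _) ?_
    rw [← he, normalize', smul_smul, mul_inv_cancel₀ (nrm_pos (hc0 q hq)).ne', one_smul]
  have hcc : ContinuousOn c (realization {G | G ∈ Δ ∧ ¬ F ⊆ G} ×ˢ Set.Icc (0 : ℝ) 1) := by
    have h1 : ContinuousOn (fun q : (V → ℝ) × ℝ => Hf q.1)
        (realization {G | G ∈ Δ ∧ ¬ F ⊆ G} ×ˢ Set.Icc (0 : ℝ) 1) :=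
      hHfc.comp continuousOn_fst fun q hq => hsub hq.1
    exact ((continuous_const.sub continuous_snd).continuousOn.smul h1).sub
      (continuous_snd.smul continuous_const).continuousOn
  have hr : ContinuousOn (awayRetract F hF) {t | t ∈ realization Δ ∧ t ≠ xF} := by
    refine continuousOn_pi.2 fun v => ContinuousOn.div ?_ ?_ ?_
    · refine ContinuousOn.sub (continuous_apply v).continuousOn ?_
      split_ifs
      · exact (continuous_faceMin F hF).continuousOn
      · exact continuousOn_const
    · exact (continuous_const.sub ((continuous_faceMin F hF).mul continuous_const)).continuousOn
    · rintro t ⟨⟨G, hG, h0, h1, h2⟩, hne⟩ h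
      exact hne (eq_barycenter hF h0 h1 (by linarith))
  have hnegp : -p ∈ sphereModel m := nrm_eq_one.1 (by rw [nrm_neg, hnp])
  have hnegp' : -p ≠ p := by
    intro h
    have : p = 0 := by
      have h2 : (2 : ℝ) • p = 0 := by rw [two_smul]; nth_rewrite 1 [← h]; simp
      simpa using h2
    rw [this, nrm_eq_zero.2 rfl] at hnp
    exact zero_ne_one hnp
  refine acyc_of_contraction (p := awayRetract F hF (Hi (-p)))
    (fun G hG G' hG' => ⟨hdown G hG.1 G' hG', fun h => hG.2 (h.trans hG')⟩)
    ⟨_, awayRetract_mem hF hdown (hHiΔ _ hnegp) (hHin _ hnegp hnegp')⟩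
    (fun q => awayRetract F hF (Hi (normalize' (c q)))) ?_ ?_ ?_ ?_
  · refine hr.comp (hHic.comp (continuousOn_normalize'.comp hcc hc0) hcs) ?_
    exact fun q hq => ⟨hHiΔ _ (hcs q hq), hHin _ (hcs q hq) (hcp q hq)⟩
  · exact fun q hq => awayRetract_mem hF hdown (hHiΔ _ (hcs q hq)) (hHin _ (hcs q hq) (hcp q hq))
  · intro x hx
    have : c (x, 0) = Hf x := by simp [c]
    simp only [this]
    rw [normalize'_of_nrm (hHfm x (hsub hx)), hHiHf x (hsub hx), awayRetract_eq hF hx]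
  · intro x hx
    have : c (x, 1) = -p := by simp [c]
    simp only [this]
    rw [normalize'_of_nrm (by rw [nrm_neg, hnp])]

end SphereAcyclic

namespace FanData

variable {d N : ℕ} {Φ : Fan d} (D : FanData Φ N)

lemma isRep_of_mem {t : Fin N → ℝ} (ht : t ∈ realization D.chains) : D.IsRep t := by
  obtain ⟨G, hG, h0, -, h2⟩ := ht
  exact ⟨h0, fun v w hv hw => hG v (by_contra fun h => hv (h2 v h)) w
    (by_contra fun h => hw (h2 w h))⟩

lemma IsRep.smul {D : FanData Φ N} {t : Fin N → ℝ} (ht : D.IsRep t) {s : ℝ} (hs : 0 ≤ s) :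
    D.IsRep (s • t) :=
  ⟨fun v => mul_nonneg hs (ht.nonneg v), fun v w hv hw => ht.chain v w
    (fun h => hv (by simp [h])) (fun h => hw (by simp [h]))⟩

lemma IsRep.comb_ne_zero {D : FanData Φ N} {t : Fin N → ℝ} (ht : D.IsRep t) (h0 : t ≠ 0) :
    D.comb t ≠ 0 := by
  obtain ⟨v, -, hv⟩ := ht.top h0
  exact fun h => h0 (D.comb_eq_zero ht.nonneg (D.mem v) hv h)

lemma continuous_comb : Continuous D.comb := by
  unfold comb; fun_prop

lemma ne_zero_of_mem {t : Fin N → ℝ} (ht : t ∈ realization D.chains) : t ≠ 0 := by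
  rintro rfl
  obtain ⟨G, -, -, h1, -⟩ := ht
  simp at h1

/-- The order complex of the fan triangulates the cell complex. -/
theorem exists_homeo : Nonempty (↥(realization D.chains) ≃ₜ ↥(GammaSet Φ.cones)) := by
  let f : realization D.chains → GammaSet Φ.cones := fun t =>
    ⟨normalize' (D.comb t.1), by
      have hr := D.isRep_of_mem t.2
      obtain ⟨v, -, hv⟩ := hr.top (D.ne_zero_of_mem t.2)
      exact ⟨⟨_, D.mem v, (Φ.convex (D.mem v)).2.2 _ (D.comb_mem hr.nonneg (D.mem v) hv) _
        (inv_nonneg.2 (nrm_nonneg _))⟩,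
        nrm_eq_one.1 (nrm_normalize' (hr.comb_ne_zero (D.ne_zero_of_mem t.2)))⟩⟩
  have hf : Continuous f := by
    refine Continuous.subtype_mk (continuousOn_normalize'.comp_continuous
      (D.continuous_comb.comp continuous_subtype_val) fun t =>
      (D.isRep_of_mem t.2).comb_ne_zero (D.ne_zero_of_mem t.2)) _
  have hb : Function.Bijective f := by
    constructor
    · rintro ⟨t, ht⟩ ⟨t', ht'⟩ h
      have h1 : normalize' (D.comb t) = normalize' (D.comb t') := Subtype.ext_iff.1 h
      simp only [normalize', ← comb_smul] at h1
      have hr := D.isRep_of_mem ht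
      have hr' := D.isRep_of_mem ht'
      have h2 := (hr.smul (inv_nonneg.2 (nrm_nonneg _))).unique
        (hr'.smul (inv_nonneg.2 (nrm_nonneg _))) h1
      have hp := nrm_pos (hr.comb_ne_zero (D.ne_zero_of_mem ht))
      have h3 : ∑ v, ((nrm (D.comb t))⁻¹ • t) v = ∑ v, ((nrm (D.comb t'))⁻¹ • t') v := by rw [h2]
      obtain ⟨-, -, -, h4, -⟩ := ht
      obtain ⟨-, -, -, h5, -⟩ := ht'
      simp only [Pi.smul_apply, smul_eq_mul, ← Finset.mul_sum, h4, h5, mul_one] at h3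
      rw [← h3] at h2
      exact Subtype.ext (smul_right_injective _ (inv_pos.2 hp).ne' h2)
    · rintro ⟨x, hx, hx1⟩
      obtain ⟨t, ht, rfl⟩ := D.exists_rep hx
      have hn : nrm (D.comb t) = 1 := nrm_eq_one.2 hx1
      have h0 : t ≠ 0 := by
        rintro rfl
        rw [comb_zero, nrm_eq_zero.2 rfl] at hn
        exact zero_ne_one hn
      have hs : 0 < ∑ v, t v := by
        obtain ⟨v, hv⟩ := Function.ne_iff.1 h0
        exact Finset.sum_pos' (fun v _ => ht.nonneg v)
          ⟨v, Finset.mem_univ v, lt_of_le_of_ne (ht.nonneg v) (Ne.symm hv)⟩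
      refine ⟨⟨(∑ v, t v)⁻¹ • t, _, ht.supp_mem, fun v => ?_, ?_, fun v hv => ?_⟩, Subtype.ext ?_⟩
      · exact mul_nonneg (inv_nonneg.2 hs.le) (ht.nonneg v)
      · simp [← Finset.mul_sum, inv_mul_cancel₀ hs.ne']
      · have : t v = 0 := by simpa using hv
        simp [this]
      · change normalize' (D.comb ((∑ v, t v)⁻¹ • t)) = _
        rw [comb_smul, normalize', nrm_smul (inv_nonneg.2 hs.le), hn, smul_smul]
        simp [hs.ne']
  have : CompactSpace (realization D.chains) := isCompact_iff_compactSpace.1 (isCompact_realization _)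
  exact ⟨Continuous.homeoOfEquivCompactToT2 (f := Equiv.ofBijective f hb) hf⟩

/-- Deletions in the order complex of a spherical fan are acyclic. -/
theorem acycDel {m : ℕ} (h : Nonempty (↥(GammaSet Φ.cones) ≃ₜ ↥(sphereModel m)))
    (K : Type) [Field K] : AcycDel K D.chains := by
  obtain ⟨H1⟩ := D.exists_homeo
  obtain ⟨H2⟩ := h
  exact ⟨fun G hG G' hG' => D.chains_down hG hG', fun F hF hne =>
    acyc_deletion_of_sphere (fun G hG G' hG' => D.chains_down hG hG') hne K hF (H1.trans H2)⟩

end FanData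

/-- A convex cone covered by finitely many subspaces lies in one of them. -/
lemma IsConvexCone.exists_subset_of_cover {d : ℕ} {E : Set (Fin d → ℝ)} (hE : IsConvexCone E)
    {ι : Type*} (s : Finset ι) (W : ι → Submodule ℝ (Fin d → ℝ))
    (h : ∀ x ∈ E, ∃ i ∈ s, x ∈ W i) : ∃ i ∈ s, E ⊆ W i := by
  induction s using Finset.induction_on with
  | empty =>
    obtain ⟨i, hi, -⟩ := h 0 hE.1
    simp at hi
  | insert i s hi ih =>
    by_cases h1 : ∀ x ∈ E, ∃ i ∈ s, x ∈ W i
    · obtain ⟨j, hj, hj'⟩ := ih h1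
      exact ⟨j, by simp [hj], hj'⟩
    by_cases h2 : E ⊆ W i
    · exact ⟨i, by simp, h2⟩
    exfalso
    push Not at h1
    obtain ⟨x, hx, hxs⟩ := h1
    have hxi : x ∈ W i := by
      obtain ⟨j, hj, hxj⟩ := h x hx
      rcases Finset.mem_insert.1 hj with rfl | hj
      · exact hxj
      · exact absurd hxj (hxs j hj)
    obtain ⟨y, hy, hyi⟩ := Set.not_subset.1 h2
    have h3 : ∀ m : ℕ, ∃ j ∈ s, y + (m : ℝ) • x ∈ W j := by
      intro m
      obtain ⟨j, hj, hj'⟩ := h _ (hE.2.1 _ hy _ (hE.2.2 _ hx m (Nat.cast_nonneg m)))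
      rcases Finset.mem_insert.1 hj with rfl | hj
      · exact absurd ((Submodule.add_mem_iff_left _ (Submodule.smul_mem _ _ hxi)).1 hj') hyi
      · exact ⟨j, hj, hj'⟩
    choose f hf hf' using h3
    obtain ⟨m, m', hne, hmm⟩ : ∃ m m', m ≠ m' ∧ f m = f m' := by
      let g : ℕ → s := fun m => ⟨f m, hf m⟩
      obtain ⟨m, m', h4, h5⟩ := Finite.exists_ne_map_eq_of_infinite g
      exact ⟨m, m', h4, congrArg Subtype.val h5⟩
    have h6 := Submodule.sub_mem _ (hf' m) (hmm ▸ hf' m')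
    have h7 : y + (m : ℝ) • x - (y + (m' : ℝ) • x) = ((m : ℝ) - m') • x := by module
    rw [h7] at h6
    have h8 : ((m : ℝ) - m') ≠ 0 := sub_ne_zero.2 (by exact_mod_cast hne)
    exact hxs _ (hf m) ((Submodule.smul_mem_iff _ h8).1 h6)

lemma Fan.coneDim_le {d : ℕ} (Φ : Fan d) {C : Set (Fin d → ℝ)} (hC : C ∈ Φ.cones) :
    coneDim C ≤ Φ.dim :=
  le_csSup (Φ.finite.image coneDim).bddAbove ⟨C, hC, rfl⟩

lemma Fan.exists_dim {d : ℕ} (Φ : Fan d) (h : Φ.cones.Nonempty) :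
    ∃ C ∈ Φ.cones, coneDim C = Φ.dim :=
  Nat.sSup_mem (h.image coneDim) (Φ.finite.image coneDim).bddAbove

lemma coneDim_eq_zero {d : ℕ} {C : Set (Fin d → ℝ)} (hC : IsConvexCone C) :
    coneDim C = 0 ↔ C = {0} := by
  rw [coneDim, Submodule.finrank_eq_zero, Submodule.span_eq_bot]
  constructor
  · exact fun h => subset_antisymm h (by simpa using hC.1)
  · rintro rfl; simp

lemma Fan.gamma_nonempty {d m : ℕ} {Φ : Fan d}
    (h : Nonempty (↥(GammaSet Φ.cones) ≃ₜ ↥(sphereModel m))) : (GammaSet Φ.cones).Nonempty := by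
  obtain ⟨H⟩ := h
  have h1 : (Pi.single 0 1 : Fin (m + 1) → ℝ) ∈ sphereModel m := by
    simp only [sphereModel, Set.mem_ofPred_eq]
    rw [Finset.sum_eq_single_of_mem 0 (Finset.mem_univ _)]
    · simp
    · intro i _ hi; simp [hi]
  exact ⟨_, (H.symm ⟨_, h1⟩).2⟩

lemma Fan.one_le_dim {d : ℕ} {Φ : Fan d} (h : (GammaSet Φ.cones).Nonempty) : 1 ≤ Φ.dim := by
  obtain ⟨x, ⟨C, hC, hxC⟩, hx⟩ := h
  refine le_trans ?_ (Φ.coneDim_le hC)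
  rw [Nat.one_le_iff_ne_zero, Ne, coneDim_eq_zero (Φ.convex hC)]
  rintro rfl
  rw [Set.mem_singleton_iff.1 hxC] at hx
  simp [unitSphere] at hx

namespace FanData

variable {d N : ℕ} {Φ : Fan d} (D : FanData Φ N)

lemma κ_pos (v : Fin N) : 1 ≤ D.κ v := by
  rw [Nat.one_le_iff_ne_zero]
  exact fun h => D.ne v ((coneDim_eq_zero (Φ.convex (D.mem v))).1 h)

lemma κ_le (v : Fin N) : D.κ v ≤ Φ.dim := Φ.coneDim_le (D.mem v)

lemma κ_injOn {G : Finset (Fin N)} (hG : G ∈ D.chains) : Set.InjOn D.κ G := by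
  intro v hv w hw h
  by_contra hne
  rcases hG v hv w hw with h1 | h1
  · exact absurd h (D.κ_lt h1 hne).ne
  · exact absurd h (D.κ_lt h1 (Ne.symm hne)).ne'

lemma image_κ_subset (G : Finset (Fin N)) : G.image D.κ ⊆ Finset.Icc 1 Φ.dim := by
  intro c hc
  obtain ⟨v, -, rfl⟩ := Finset.mem_image.1 hc
  exact Finset.mem_Icc.2 ⟨D.κ_pos v, D.κ_le v⟩

lemma exists_long_chain (hne : Φ.cones.Nonempty) : ∃ G ∈ D.chains, Φ.dim ≤ G.card := by
  obtain ⟨E, hE, hdim⟩ := Φ.exists_dim hne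
  obtain ⟨G, hG, hsub⟩ := (Φ.convex hE).exists_subset_of_cover
    (Finset.univ.filter fun G => G ∈ D.chains)
    (fun G => Submodule.span ℝ ((G.image D.vec : Finset _) : Set (Fin d → ℝ))) (by
      intro x hx
      obtain ⟨t, ht, rfl⟩ := D.exists_rep ⟨E, hE, hx⟩
      refine ⟨_, by simpa using ht.supp_mem, Submodule.sum_mem _ fun v _ => ?_⟩
      by_cases hv : t v = 0
      · simp [hv]
      · exact Submodule.smul_mem _ _ (Submodule.subset_span (by
          simp only [Finset.coe_image]
          exact ⟨v, by simpa using hv, rfl⟩)))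
  refine ⟨G, by simpa using hG, ?_⟩
  rw [← hdim]
  calc coneDim E ≤ Module.finrank ℝ
        (Submodule.span ℝ ((G.image D.vec : Finset _) : Set (Fin d → ℝ))) :=
        Submodule.finrank_mono (Submodule.span_le.2 hsub)
    _ ≤ (G.image D.vec).card := finrank_span_finset_le_card _
    _ ≤ G.card := Finset.card_image_le

/-- The order complex of a spherical fan is a balanced homology sphere. -/
theorem balancedSphere {m : ℕ} (h : Nonempty (↥(GammaSet Φ.cones) ≃ₜ ↥(sphereModel m)))
    (K : Type) [Field K] : BalancedSphere K D.chains D.κ (Finset.Icc 1 Φ.dim) := by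
  have hΓ := Fan.gamma_nonempty h
  have hne : Φ.cones.Nonempty := by obtain ⟨x, ⟨C, hC, -⟩, -⟩ := hΓ; exact ⟨C, hC⟩
  have hA := D.acycDel h K
  have hmax : ∀ G ∈ D.chains, ∃ H, IsMaxFace D.chains H ∧ G ⊆ H := by
    intro G hG
    obtain ⟨H, hGH, hH⟩ := (Set.toFinite D.chains).exists_le_maximal hG
    exact ⟨H, ⟨hH.1, fun G' hG' h => le_antisymm (hH.2 hG' h) h⟩, hGH⟩
  obtain ⟨G0, hG0, hc0⟩ := D.exists_long_chain hne
  obtain ⟨H0, hH0, hGH0⟩ := hmax G0 hG0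
  refine ⟨hA, fun G hG => D.κ_injOn hG, fun v w h => D.lt_of_κ_lt h,
    fun G _ v _ => Finset.mem_Icc.2 ⟨D.κ_pos v, D.κ_le v⟩, fun G hG => ?_,
    by intro v hv; simp at hv, ⟨1, Finset.mem_Icc.2 ⟨le_rfl, Fan.one_le_dim hΓ⟩⟩⟩
  obtain ⟨H, hH, hGH⟩ := hmax G hG
  refine ⟨H, hH.1, hGH, Finset.eq_of_subset_of_card_le (D.image_κ_subset H) ?_⟩
  rw [Finset.card_image_of_injOn (D.κ_injOn hH.1), Nat.card_Icc, Nat.add_sub_cancel,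
    hA.maxFace_card_eq hH hH0 (Finset.card_pos.1 ((Fan.one_le_dim hΓ).trans
      (hc0.trans (Finset.card_le_card hGH0))))]
  exact hc0.trans (Finset.card_le_card hGH0)

end FanData

section EulerCount

variable {V : Type} [LinearOrder V] {K : Type} [Field K]

/-- Extension of a cochain by zero. -/
def extZero (A : Set (Finset V)) (f : A → K) (G : Finset V) : K :=
  if h : G ∈ A then f ⟨G, h⟩ else 0

lemma extZero_of_mem {A : Set (Finset V)} (f : A → K) {G : Finset V} (h : G ∈ A) :
    extZero A f G = f ⟨G, h⟩ := dif_pos h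

/-- The coboundary between two halves of a complex. -/
def halfCobd (K : Type) [Field K] (A B : Set (Finset V)) : (A → K) →ₗ[K] (B → K) where
  toFun f G := cobd K (extZero A f) G
  map_add' f g := by
    ext G
    simp only [cobd, Pi.add_apply, ← Finset.sum_add_distrib, ← mul_add]
    refine Finset.sum_congr rfl fun v _ => ?_
    congr 1
    simp only [extZero]
    split_ifs <;> simp
  map_smul' c f := by
    ext G
    simp only [cobd, Pi.smul_apply, smul_eq_mul, RingHom.id_apply, Finset.mul_sum]
    refine Finset.sum_congr rfl fun v _ => ?_
    simp only [extZero]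
    split_ifs
    · simp; ring
    · simp

lemma ker_halfCobd {M A B : Set (Finset V)} (hM : Acyc K M)
    (hABM : M = A ∪ B) (hdis : ∀ G ∈ A, G ∉ B) (hA : ∀ G ∈ A, ∀ v ∈ G, G.erase v ∈ B)
    (hB : ∀ G ∈ B, ∀ v ∈ G, G.erase v ∈ A) :
    LinearMap.ker (halfCobd K A B) = LinearMap.range (halfCobd K B A) := by
  ext f
  constructor
  · intro hf
    rw [LinearMap.mem_ker] at hf
    obtain ⟨g, hg⟩ := hM (extZero A f) fun G hG => by
      rw [hABM] at hG
      rcases hG with hG | hG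
      · refine Finset.sum_eq_zero fun v hv => ?_
        rw [extZero, dif_neg fun h => hdis _ h (hA G hG v hv), mul_zero]
      · exact congrFun hf ⟨G, hG⟩
    refine ⟨fun G => g G.1, ?_⟩
    ext ⟨G, hG⟩
    have h1 := hg G (hABM ▸ Or.inl hG)
    rw [extZero_of_mem f hG] at h1
    rw [h1]
    refine Finset.sum_congr rfl fun v hv => ?_
    rw [extZero_of_mem _ (hA G hG v hv)]
  · rintro ⟨g, rfl⟩
    rw [LinearMap.mem_ker]
    ext ⟨G, hG⟩
    have : cobd K (extZero A (halfCobd K B A g)) G = cobd K (cobd K (extZero B g)) G := by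
      refine Finset.sum_congr rfl fun v hv => ?_
      rw [extZero_of_mem _ (hB G hG v hv)]
      rfl
    change cobd K (extZero A (halfCobd K B A g)) G = 0
    rw [this, cobd_cobd]

/-- The Euler characteristic of an acyclic complex vanishes. -/
lemma Acyc.euler [Fintype V] {M : Set (Finset V)} (hM : Acyc K M)
    (hdown : ∀ G ∈ M, ∀ H ⊆ G, H ∈ M) :
    ∑ G with G ∈ M, (-1 : ℤ) ^ G.card = 0 := by
  let A : Set (Finset V) := {G | G ∈ M ∧ Even G.card}
  let B : Set (Finset V) := {G | G ∈ M ∧ ¬ Even G.card}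
  have hpar : ∀ (G : Finset V), ∀ v ∈ G, (Even (G.erase v).card ↔ ¬ Even G.card) := by
    intro G v hv
    rw [← Finset.card_erase_add_one hv, Nat.even_add_one, not_not]
  have hA : ∀ G ∈ A, ∀ v ∈ G, G.erase v ∈ B := fun G hG v hv =>
    ⟨hdown G hG.1 _ (Finset.erase_subset _ _), by rw [hpar G v hv, not_not]; exact hG.2⟩
  have hB : ∀ G ∈ B, ∀ v ∈ G, G.erase v ∈ A := fun G hG v hv =>
    ⟨hdown G hG.1 _ (Finset.erase_subset _ _), by rw [hpar G v hv]; exact hG.2⟩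
  have hAB : M = A ∪ B := by
    ext G; simp only [A, B, Set.mem_union, Set.mem_ofPred_eq]; tauto
  have k1 := ker_halfCobd hM hAB (fun G h h' => h'.2 h.2) hA hB
  have k2 := ker_halfCobd hM (hAB.trans (Set.union_comm A B)) (fun G h h' => h.2 h'.2) hB hA
  have r1 := LinearMap.finrank_range_add_finrank_ker (halfCobd K A B)
  have r2 := LinearMap.finrank_range_add_finrank_ker (halfCobd K B A)
  rw [k1, Module.finrank_fintype_fun_eq_card] at r1
  rw [k2, Module.finrank_fintype_fun_eq_card] at r2
  have hc : Fintype.card A = Fintype.card B := by omega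
  have h1 : ∑ G with G ∈ M, (-1 : ℤ) ^ G.card =
      ∑ G with G ∈ A, (1 : ℤ) + ∑ G with G ∈ B, (-1 : ℤ) := by
    rw [← Finset.sum_filter_add_sum_filter_not _ (fun G => Even G.card), Finset.filter_filter,
      Finset.filter_filter]
    refine congrArg₂ (· + ·) (Finset.sum_congr rfl fun G hG => ?_)
      (Finset.sum_congr rfl fun G hG => ?_)
    · simp only [Finset.mem_filter] at hG
      exact hG.2.2.neg_one_pow
    · simp only [Finset.mem_filter] at hG
      exact (Nat.not_even_iff_odd.1 hG.2.2).neg_one_pow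
  rw [h1, Finset.sum_const, Finset.sum_const]
  rw [Fintype.card_subtype, Fintype.card_subtype] at hc
  have hc' : (Finset.univ.filter fun G => G ∈ A).card = (Finset.univ.filter fun G => G ∈ B).card :=
    hc
  rw [hc']; simp

variable {Δ : Set (Finset V)} {κ : V → ℕ} {C : Finset ℕ}

lemma BalancedSphere.star_euler [Fintype V] (h : BalancedSphere K Δ κ C) {F : Finset V}
    (hF : F ∈ Δ) : ∑ G with G ∈ Δ ∧ F ⊆ G, (-1 : ℤ) ^ G.card = (-1) ^ C.card := by
  have key : ∀ F ∈ Δ, ∑ G with G ∈ Δ ∧ F ⊆ G, (-1 : ℤ) ^ G.card =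
      ∑ G with G ∈ Δ, (-1 : ℤ) ^ G.card := by
    intro F hF
    rcases F.eq_empty_or_nonempty with rfl | hne
    · simp
    have := (h.acyc F hF hne).euler fun G hG G' hG' =>
      ⟨h.down G hG.1 G' hG', fun hc => hG.2 (hc.trans hG')⟩
    rw [← Finset.sum_filter_add_sum_filter_not (Finset.univ.filter fun G => G ∈ Δ)
      (fun G => F ⊆ G), Finset.filter_filter, Finset.filter_filter]
    simp only [Set.mem_ofPred_eq] at this
    rw [this, add_zero]
  obtain ⟨H, hH, -, hHC⟩ := h.ext ∅ h.empty_mem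
  rw [key F hF, ← key H hH, ← hHC, h.card_image hH]
  have : (Finset.univ.filter fun G => G ∈ Δ ∧ H ⊆ G) = {H} := by
    ext G
    simp only [Finset.mem_filter, Finset.mem_univ, true_and, Finset.mem_singleton]
    constructor
    · rintro ⟨hG, hs⟩; exact (h.isMaxFace hH hHC).2 G hG hs
    · rintro rfl; exact ⟨hH, subset_rfl⟩
  rw [this, Finset.sum_singleton]

lemma BalancedSphere.link_euler [Fintype V] (h : BalancedSphere K Δ κ C) {F X : Finset V}
    (hF : F ∈ Δ) (hX : ∀ G ∈ Δ, G ⊆ X → F ∪ G ∈ Δ) (hFX : Disjoint F X)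
    (hG : ∀ G ∈ Δ, F ⊆ G → G \ F ⊆ X) :
    (-1) ^ F.card * ∑ G with G ∈ Δ ∧ G ⊆ X, (-1 : ℤ) ^ G.card = (-1) ^ C.card := by
  rw [← h.star_euler hF, Finset.mul_sum]
  refine Finset.sum_bij' (fun G _ => F ∪ G) (fun G _ => G \ F) ?_ ?_ ?_ ?_ ?_
  · intro G hG'
    simp only [Finset.mem_filter, Finset.mem_univ, true_and] at hG' ⊢
    exact ⟨hX G hG'.1 hG'.2, Finset.subset_union_left⟩
  · intro G hG'
    simp only [Finset.mem_filter, Finset.mem_univ, true_and] at hG' ⊢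
    exact ⟨h.down G hG'.1 _ Finset.sdiff_subset, hG G hG'.1 hG'.2⟩
  · intro G hG'
    simp only [Finset.mem_filter, Finset.mem_univ, true_and] at hG'
    exact Finset.union_sdiff_cancel_left (hFX.mono_right hG'.2)
  · intro G hG'
    simp only [Finset.mem_filter, Finset.mem_univ, true_and] at hG'
    exact Finset.union_sdiff_of_subset hG'.2
  · intro G hG'
    simp only [Finset.mem_filter, Finset.mem_univ, true_and] at hG'
    rw [Finset.card_union_of_disjoint (hFX.mono_right hG'.2), pow_add]

end EulerCount

namespace FanData

variable {d N : ℕ} {Φ : Fan d} (D : FanData Φ N)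

/-- The cones strictly containing `C` and strictly contained in the cones indexed by `U`. -/
def between (C : Set (Fin d → ℝ)) (U : Finset (Fin N)) : Finset (Fin N) :=
  Finset.univ.filter fun w => C ⊂ D.e w ∧ ∀ u ∈ U, D.e w ⊂ D.e u

lemma ssubset_of_ne {v w : Fin N} (h : D.e v ⊆ D.e w) (hne : v ≠ w) : D.e v ⊂ D.e w :=
  lt_of_le_of_ne h fun h' => hne (D.inj h')

lemma zero_ssubset (w : Fin N) : ({0} : Set (Fin d → ℝ)) ⊂ D.e w :=
  lt_of_le_of_ne (by simpa using (Φ.convex (D.mem w)).1) (D.ne w).symm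

variable {K : Type} [Field K]

lemma between_euler (h : BalancedSphere K D.chains D.κ (Finset.Icc 1 Φ.dim))
    {C : Set (Fin d → ℝ)} {H U : Finset (Fin N)} (hH : H ∈ D.chains)
    (hHi : H.image D.κ = Finset.Icc 1 Φ.dim) (hC : C = {0} ∨ ∃ v ∈ H, D.e v = C) (hU : U ⊆ H) :
    (-1) ^ ((Finset.Icc 1 Φ.dim).filter fun c => c ≤ coneDim C ∨ ∃ u ∈ U, D.κ u ≤ c).card *
      ∑ G with G ∈ D.chains ∧ G ⊆ D.between C U, (-1 : ℤ) ^ G.card = (-1) ^ Φ.dim := by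
  set F := H.filter fun w => D.κ w ≤ coneDim C ∨ ∃ u ∈ U, D.κ u ≤ D.κ w with hF
  have hFC : ∀ w ∈ H, D.κ w ≤ coneDim C → D.e w ⊆ C := by
    intro w hw hle
    rcases hC with rfl | ⟨v, hv, rfl⟩
    · rw [(coneDim_eq_zero (isFaceOf_zero (Φ.convex (D.mem w)) (Φ.isPointed (D.mem w))).1).2 rfl]
        at hle
      have := D.κ_pos w
      omega
    · by_cases hvw : w = v
      · rw [hvw]
      · rcases hH w hw v hv with h1 | h1
        · exact h1
        · have := D.κ_lt h1 (Ne.symm hvw)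
          unfold κ at *
          omega
  have hFU : ∀ w ∈ H, ∀ u ∈ U, D.κ u ≤ D.κ w → D.e u ⊆ D.e w := by
    intro w hw u hu hle
    by_cases huw : u = w
    · rw [huw]
    · rcases hH u (hU hu) w hw with h1 | h1
      · exact h1
      · have := D.κ_lt h1 (Ne.symm huw)
        omega
  have hFH : F ∈ D.chains := D.chains_down hH (Finset.filter_subset _ _)
  have hcard : F.card = ((Finset.Icc 1 Φ.dim).filter fun c => c ≤ coneDim C ∨
      ∃ u ∈ U, D.κ u ≤ c).card := by
    rw [← hHi, Finset.filter_image, Finset.card_image_of_injOn]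
    exact fun v hv w hw hvw => D.κ_injOn hH (Finset.mem_filter.1 hv).1 (Finset.mem_filter.1 hw).1 hvw
  have hFX : ∀ w ∈ F, ∀ x ∈ D.between C U, (D.e w ⊂ D.e x ∨ D.e x ⊂ D.e w) := by
    intro w hw x hx
    obtain ⟨hwH, hw⟩ := Finset.mem_filter.1 hw
    obtain ⟨-, hx1, hx2⟩ := Finset.mem_filter.1 hx
    rcases hw with hw | ⟨u, hu, hw⟩
    · exact Or.inl (lt_of_le_of_lt (hFC w hwH hw) hx1)
    · exact Or.inr (lt_of_lt_of_le (hx2 u hu) (hFU w hwH u hu hw))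
  have main := h.link_euler (F := F) (X := D.between C U) hFH ?_ ?_ ?_
  · rw [← hcard, main, Nat.card_Icc, Nat.add_sub_cancel]
  · intro G hG hGX v hv w hw
    rcases Finset.mem_union.1 hv with hv | hv <;> rcases Finset.mem_union.1 hw with hw | hw
    · exact hFH v hv w hw
    · exact (hFX v hv w (hGX hw)).imp (fun h => h.1) fun h => h.1
    · exact ((hFX w hw v (hGX hv)).imp (fun h => h.1) fun h => h.1).symm
    · exact hG v hv w hw
  · rw [Finset.disjoint_left]
    intro w hw hw'
    rcases hFX w hw w hw' with h1 | h1 <;> exact h1.2 h1.1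
  · intro G hG hFG w hw
    obtain ⟨hwG, hwF⟩ := Finset.mem_sdiff.1 hw
    have hcol : ∀ p : ℕ → Prop, (∀ c, p c → c ≤ coneDim C ∨ ∃ u ∈ U, D.κ u ≤ c) → ¬ p (D.κ w) := by
      intro p hp hpw
      obtain ⟨w', hw', hκ⟩ := Finset.mem_image.1 (hHi ▸ D.image_κ_subset {w}
        (Finset.mem_image_of_mem _ (Finset.mem_singleton_self w)))
      have hw'F : w' ∈ F := Finset.mem_filter.2 ⟨hw', by rw [hκ]; exact hp _ hpw⟩
      have : w' = w := D.κ_injOn hG (hFG hw'F) hwG hκ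
      exact hwF (this ▸ hw'F)
    have hcC := hcol (fun c => c ≤ coneDim C) fun c hc => Or.inl hc
    refine Finset.mem_filter.2 ⟨Finset.mem_univ _, ?_, fun u hu => ?_⟩
    · rcases hC with rfl | ⟨v, hv, rfl⟩
      · exact D.zero_ssubset w
      · have hvF : v ∈ F := Finset.mem_filter.2 ⟨hv, Or.inl le_rfl⟩
        have hne : v ≠ w := fun h => hwF (h ▸ hvF)
        rcases hG v (hFG hvF) w hwG with h1 | h1
        · exact D.ssubset_of_ne h1 hne
        · exact absurd (D.κ_lt h1 hne.symm).le hcC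
    · have hcU := hcol (fun c => D.κ u ≤ c) fun c hc => Or.inr ⟨u, hu, hc⟩
      have huF : u ∈ F := Finset.mem_filter.2 ⟨hU hu, Or.inr ⟨u, hu, le_rfl⟩⟩
      have hne : w ≠ u := fun h => hwF (h ▸ huF)
      rcases hG w hwG u (hFG huF) with h1 | h1
      · exact D.ssubset_of_ne h1 hne
      · exact absurd (D.κ_lt h1 hne.symm).le hcU

/-- Grouping the chains above a cone by their largest element. -/
lemma sum_chains_above (C : Set (Fin d → ℝ)) :
    ∑ G with G ∈ D.chains ∧ G ⊆ D.between C ∅, (-1 : ℤ) ^ G.card =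
      1 - ∑ v ∈ D.between C ∅,
        ∑ G with G ∈ D.chains ∧ G ⊆ D.between C {v}, (-1 : ℤ) ^ G.card := by
  let top : Finset (Fin N) → Fin N → Prop := fun G v => v ∈ G ∧ ∀ w ∈ G, D.e w ⊆ D.e v
  have h1 : ∑ G with G ∈ D.chains ∧ G ⊆ D.between C ∅, (-1 : ℤ) ^ G.card =
      ∑ G with G ∈ D.chains ∧ G ⊆ D.between C ∅, ((if G = ∅ then 1 else 0) +
        ∑ v ∈ D.between C ∅, if top G v then (-1 : ℤ) ^ G.card else 0) := by
    refine Finset.sum_congr rfl fun G hG => ?_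
    simp only [Finset.mem_filter, Finset.mem_univ, true_and] at hG
    rcases G.eq_empty_or_nonempty with rfl | hne
    · simp [top]
    · obtain ⟨v, hv, hv'⟩ := D.chain_top hG.1 hne
      rw [if_neg hne.ne_empty, Finset.sum_eq_single_of_mem v (hG.2 hv),
        if_pos (show top G v from ⟨hv, hv'⟩), zero_add]
      intro w _ hwv
      refine if_neg fun hw => hwv (D.inj (subset_antisymm (hv' w hw.1) (hw.2 v hv)))
  rw [h1, Finset.sum_add_distrib, Finset.sum_comm, sub_eq_add_neg, ← Finset.sum_neg_distrib]
  congr 1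
  · rw [Finset.sum_ite_eq' , if_pos]
    exact Finset.mem_filter.2 ⟨Finset.mem_univ _, fun v hv => absurd hv (Finset.notMem_empty v),
      Finset.empty_subset _⟩
  refine Finset.sum_congr rfl fun v hv => ?_
  obtain ⟨-, hvC, -⟩ := Finset.mem_filter.1 hv
  rw [← Finset.sum_filter, Finset.filter_filter, ← Finset.sum_neg_distrib]
  refine Finset.sum_bij' (fun G _ => G.erase v) (fun G _ => insert v G) ?_ ?_ ?_ ?_ ?_
  · intro G hG
    simp only [Finset.mem_filter, Finset.mem_univ, true_and] at hG ⊢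
    refine ⟨D.chains_down hG.1.1 (Finset.erase_subset _ _), fun w hw => ?_⟩
    have hwG := Finset.mem_of_mem_erase hw
    refine Finset.mem_filter.2 ⟨Finset.mem_univ _, (Finset.mem_filter.1 (hG.1.2 hwG)).2.1, ?_⟩
    simp only [Finset.mem_singleton, forall_eq]
    exact D.ssubset_of_ne (hG.2.2 w hwG) (Finset.ne_of_mem_erase hw)
  · intro G hG
    simp only [Finset.mem_filter, Finset.mem_univ, true_and] at hG ⊢
    have hsub : ∀ w ∈ G, C ⊂ D.e w ∧ D.e w ⊂ D.e v := fun w hw => by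
      have := (Finset.mem_filter.1 (hG.2 hw)).2
      simpa using this
    refine ⟨⟨?_, ?_⟩, by simp, ?_⟩
    · intro x hx y hy
      rcases Finset.mem_insert.1 hx with hx1 | hx1 <;>
        rcases Finset.mem_insert.1 hy with hy1 | hy1
      · exact Or.inl (by rw [hx1, hy1])
      · exact Or.inr (hx1 ▸ (hsub y hy1).2.1)
      · exact Or.inl (hy1 ▸ (hsub x hx1).2.1)
      · exact hG.1 x hx1 y hy1
    · refine Finset.insert_subset hv fun w hw => ?_
      exact Finset.mem_filter.2 ⟨Finset.mem_univ _, (hsub w hw).1, by simp⟩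
    · intro w hw
      rcases Finset.mem_insert.1 hw with rfl | hw
      · exact subset_rfl
      · exact (hsub w hw).2.1
  · intro G hG
    simp only [Finset.mem_filter, Finset.mem_univ, true_and] at hG
    exact Finset.insert_erase hG.2.1
  · intro G hG
    simp only [Finset.mem_filter, Finset.mem_univ, true_and] at hG
    refine Finset.erase_insert fun hvG => ?_
    have := (Finset.mem_filter.1 (hG.2 hvG)).2.2 v (by simp)
    exact this.2 this.1
  · intro G hG
    simp only [Finset.mem_filter, Finset.mem_univ, true_and] at hG
    rw [← Finset.card_erase_add_one hG.2.1, pow_succ]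
    simp

lemma filter_card (k c e : ℕ) (hc : c < e) (he : e ≤ k) :
    ((Finset.Icc 1 k).filter fun x => x ≤ c ∨ e ≤ x).card = c + (k + 1 - e) := by
  have : ((Finset.Icc 1 k).filter fun x => x ≤ c ∨ e ≤ x) = Finset.Icc 1 c ∪ Finset.Icc e k := by
    ext x; simp only [Finset.mem_filter, Finset.mem_Icc, Finset.mem_union]; omega
  rw [this, Finset.card_union_of_disjoint, Nat.card_Icc, Nat.card_Icc]
  · omega
  · rw [Finset.disjoint_left]; intro x hx hx'
    simp only [Finset.mem_Icc] at hx hx'; omega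

lemma sum_cones_above (h : BalancedSphere K D.chains D.κ (Finset.Icc 1 Φ.dim))
    {C : Set (Fin d → ℝ)} (hC : C ∈ Φ.cones) :
    (-1) ^ coneDim C + ∑ v ∈ D.between C ∅, (-1 : ℤ) ^ D.κ v = (-1) ^ Φ.dim := by
  have hfac : ∀ U : Finset (Fin N), U ⊆ D.between C ∅ → U ∈ D.chains → ∃ H ∈ D.chains,
      H.image D.κ = Finset.Icc 1 Φ.dim ∧ (C = {0} ∨ ∃ v ∈ H, D.e v = C) ∧ U ⊆ H := by
    intro U hU hUc
    by_cases h0 : C = {0}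
    · obtain ⟨H, h1, h2, h3⟩ := h.ext U hUc
      exact ⟨H, h1, h3, Or.inl h0, h2⟩
    · obtain ⟨v, rfl⟩ := D.surj C hC h0
      have hvU : ∀ w ∈ U, D.e v ⊆ D.e w := fun w hw => (Finset.mem_filter.1 (hU hw)).2.1.1
      obtain ⟨H, h1, h2, h3⟩ := h.ext (insert v U) (by
        intro x hx y hy
        rcases Finset.mem_insert.1 hx with hx1 | hx1 <;>
        rcases Finset.mem_insert.1 hy with hy1 | hy1
        · exact Or.inl (by rw [hx1, hy1])
        · exact Or.inl (hx1 ▸ hvU y hy1)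
        · exact Or.inr (hy1 ▸ hvU x hx1)
        · exact hUc x hx1 y hy1)
      exact ⟨H, h1, h3, Or.inr ⟨v, h2 (by simp), rfl⟩, (Finset.subset_insert _ _).trans h2⟩
  have hcle := Φ.coneDim_le hC
  have hin : ∀ v ∈ D.between C ∅, ∑ G with G ∈ D.chains ∧ G ⊆ D.between C {v},
      (-1 : ℤ) ^ G.card = - ((-1) ^ coneDim C * (-1) ^ D.κ v) := by
    intro v hv
    obtain ⟨H, h1, h2, h3, h4⟩ := hfac {v} (by simpa using hv) (by
      intro x hx y hy
      rw [Finset.mem_singleton.1 hx, Finset.mem_singleton.1 hy]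
      exact Or.inl subset_rfl)
    have key := D.between_euler h h1 h2 h3 h4
    have hlt : coneDim C < D.κ v := by
      have := (Finset.mem_filter.1 hv).2.1
      exact (Φ.isFaceOf_of_subset hC (D.mem v) this.1).coneDim_lt this.ne
    have hκ := D.κ_le v
    simp only [Finset.mem_singleton, exists_eq_left] at key
    rw [filter_card _ _ _ hlt hκ] at key
    have e1 : (-1 : ℤ) ^ Φ.dim = -((-1) ^ (Φ.dim + 1 - D.κ v) * (-1) ^ D.κ v) := by
      rw [← pow_add, Nat.sub_add_cancel (by omega), pow_succ]; ring
    rw [e1, pow_add] at key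
    have s1 : ∀ n : ℕ, (-1 : ℤ) ^ n * (-1) ^ n = 1 := fun n => by rw [← mul_pow]; simp
    linear_combination ((-1) ^ coneDim C * (-1) ^ (Φ.dim + 1 - D.κ v)) * key -
      (∑ G with G ∈ D.chains ∧ G ⊆ D.between C {v}, (-1 : ℤ) ^ G.card) *
        ((-1) ^ (Φ.dim + 1 - D.κ v) * (-1) ^ (Φ.dim + 1 - D.κ v)) * s1 (coneDim C) -
      (∑ G with G ∈ D.chains ∧ G ⊆ D.between C {v}, (-1 : ℤ) ^ G.card) *
        s1 (Φ.dim + 1 - D.κ v) -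
      ((-1) ^ coneDim C * (-1) ^ D.κ v) * s1 (Φ.dim + 1 - D.κ v)
  obtain ⟨H, h1, h2, h3, h4⟩ := hfac ∅ (by simp) (by intro x hx; simp at hx)
  have key := D.between_euler h h1 h2 h3 h4
  rw [D.sum_chains_above, Finset.sum_congr rfl hin] at key
  have hf : ((Finset.Icc 1 Φ.dim).filter fun c => c ≤ coneDim C ∨
      ∃ u ∈ (∅ : Finset (Fin N)), D.κ u ≤ c).card = coneDim C := by
    have : ((Finset.Icc 1 Φ.dim).filter fun c => c ≤ coneDim C ∨
      ∃ u ∈ (∅ : Finset (Fin N)), D.κ u ≤ c) = Finset.Icc 1 (coneDim C) := by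
      ext x; simp only [Finset.mem_filter, Finset.mem_Icc, Finset.notMem_empty, false_and,
        exists_false, or_false]; omega
    rw [this, Nat.card_Icc, Nat.add_sub_cancel]
  rw [hf, Finset.sum_neg_distrib, sub_neg_eq_add, ← Finset.mul_sum] at key
  rw [← key]
  have s1 : (-1 : ℤ) ^ coneDim C * (-1) ^ coneDim C = 1 := by rw [← mul_pow]; simp
  linear_combination (-∑ v ∈ D.between C ∅, (-1 : ℤ) ^ D.κ v) * s1

/-- A fan whose order complex is a balanced sphere is an Euler fan. -/
theorem isEulerFan (h : BalancedSphere K D.chains D.κ (Finset.Icc 1 Φ.dim)) (h1 : 1 ≤ Φ.dim) :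
    IsEulerFan Φ := by
  constructor
  · rintro C ⟨hC, hmax⟩
    by_cases h0 : C = {0}
    · obtain ⟨E, hE, hd⟩ := Φ.exists_dim ⟨C, hC⟩
      rw [hmax E hE (by rw [h0]; simpa using (Φ.convex hE).1)] at hd
      exact hd
    · obtain ⟨v, rfl⟩ := D.surj C hC h0
      obtain ⟨H, hH, hvH, hi⟩ := h.ext {v} (by
        intro x hx y hy
        rw [Finset.mem_singleton.1 hx, Finset.mem_singleton.1 hy]
        exact Or.inl subset_rfl)
      obtain ⟨w, hw, hwk⟩ := Finset.mem_image.1 (hi.symm ▸ Finset.mem_Icc.2 ⟨h1, le_rfl⟩)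
      rcases hH v (hvH (by simp)) w hw with h2 | h2
      · rw [← hmax _ (D.mem w) h2]; exact hwk
      · refine le_antisymm (Φ.coneDim_le hC) ?_
        rw [← hwk]
        exact Submodule.finrank_mono (Submodule.span_mono h2)
  · intro C hC
    have key := D.sum_cones_above h hC
    let S := Φ.finite.toFinset.filter fun E => C ⊆ E
    have hS : S = insert C ((D.between C ∅).image D.e) := by
      ext E
      simp only [S, Finset.mem_filter, Set.Finite.mem_toFinset, Finset.mem_insert,
        Finset.mem_image, between, Finset.mem_univ, true_and]
      constructor
      · rintro ⟨hE, hCE⟩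
        by_cases he : E = C
        · exact Or.inl he
        · right
          have hss : C ⊂ E := lt_of_le_of_ne hCE (Ne.symm he)
          obtain ⟨v, rfl⟩ := D.surj E hE (by
            rintro rfl
            refine he (subset_antisymm ?_ hCE)
            simpa using (Φ.convex hC).1)
          exact ⟨v, ⟨hss, by simp⟩, rfl⟩
      · rintro (rfl | ⟨v, ⟨hv, -⟩, rfl⟩)
        · exact ⟨hC, subset_rfl⟩
        · exact ⟨D.mem v, hv.1⟩
    have hsum : ∑ E ∈ S, (-1 : ℤ) ^ coneDim E = (-1) ^ Φ.dim := by
      rw [hS, Finset.sum_insert, Finset.sum_image D.inj.injOn]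
      · exact key
      · intro hm
        obtain ⟨v, hv, hvC⟩ := Finset.mem_image.1 hm
        exact (Finset.mem_filter.1 hv).2.1.ne hvC.symm
    have hrho : fanRho Φ C = ∑ E ∈ S, (-1 : ℤ) ^ (coneDim E + 1) := by
      rw [← Finset.sum_fiberwise_of_maps_to (t := Finset.range (Φ.dim + 1)) (g := coneDim)]
      · refine Finset.sum_congr rfl fun i _ => ?_
        have hc : Nat.card {E : Set (Fin d → ℝ) // E ∈ Φ.cones ∧ C ⊆ E ∧ coneDim E = i} =
            (S.filter fun E => coneDim E = i).card := by
          exact Nat.subtype_card _ fun E => by simp [S, and_assoc]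
        rw [hc, Finset.sum_congr rfl (g := fun _ => (-1 : ℤ) ^ (i + 1)), Finset.sum_const,
          nsmul_eq_mul, mul_comm]
        intro E hE
        rw [(Finset.mem_filter.1 hE).2]
      · intro E hE
        have := Φ.coneDim_le (Φ.finite.mem_toFinset.1 (Finset.mem_filter.1 hE).1)
        exact Finset.mem_range.2 (by omega)
    rw [hrho]
    simp only [pow_succ, ← Finset.sum_mul, hsum]
    obtain ⟨j, hj⟩ := Nat.exists_eq_add_of_le' h1
    rw [hj, Nat.add_sub_cancel, pow_succ]; ring

end FanData

section LatticePoints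

variable {d : ℕ}

lemma Z2R_add (x y : Fin d → ℤ) : Z2R (x + y) = Z2R x + Z2R y := by ext; simp [Z2R]

lemma Z2R_sub (x y : Fin d → ℤ) : Z2R (x - y) = Z2R x - Z2R y := by ext; simp [Z2R]

lemma Z2R_zero : Z2R (0 : Fin d → ℤ) = 0 := by ext; simp [Z2R]

lemma Z2R_nsmul (n : ℕ) (x : Fin d → ℤ) : Z2R (n • x) = (n : ℝ) • Z2R x := by ext; simp [Z2R]

lemma Z2R_injective : Function.Injective (Z2R : (Fin d → ℤ) → Fin d → ℝ) := fun x y h => by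
  ext i
  have := congrFun h i
  simpa [Z2R] using this

lemma Z2R_sum {ι : Type*} (s : Finset ι) (f : ι → Fin d → ℤ) :
    Z2R (∑ i ∈ s, f i) = ∑ i ∈ s, Z2R (f i) := by ext; simp [Z2R]

/-- Two lattice points lie in a common cone of the fan. -/
def Fan.Compat (Φ : Fan d) (x y : Fin d → ℤ) : Prop := ∃ C ∈ Φ.cones, Z2R x ∈ C ∧ Z2R y ∈ C

lemma Fan.Compat.symm {Φ : Fan d} {x y : Fin d → ℤ} (h : Φ.Compat x y) : Φ.Compat y x := by
  obtain ⟨C, hC, h1, h2⟩ := h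
  exact ⟨C, hC, h2, h1⟩

lemma Fan.Compat.left {Φ : Fan d} {x y : Fin d → ℤ} (h : Φ.Compat x y) : x ∈ Φ.supp := by
  obtain ⟨C, hC, h1, h2⟩ := h
  exact ⟨C, hC, h1⟩

lemma Fan.Compat.right {Φ : Fan d} {x y : Fin d → ℤ} (h : Φ.Compat x y) : y ∈ Φ.supp := h.symm.left

lemma Fan.Compat.add_mem {Φ : Fan d} {x y : Fin d → ℤ} (h : Φ.Compat x y) : x + y ∈ Φ.supp := by
  obtain ⟨C, hC, h1, h2⟩ := h
  exact ⟨C, hC, by rw [Z2R_add]; exact (Φ.convex hC).2.1 _ h1 _ h2⟩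

end LatticePoints

namespace FanData

variable {d N : ℕ} {Φ : Fan d} (D : FanData Φ N)

lemma a_mem_supp (v : Fin N) : D.a v ∈ Φ.supp := ⟨_, D.mem v, D.a_mem v⟩

/-- The chain coordinates of a lattice point of the support. -/
def tau (x : Fin d → ℤ) : Fin N → ℝ :=
  if h : x ∈ Φ.supp then (D.exists_rep (x := Z2R x) (by
    obtain ⟨C, hC, hx⟩ := h
    exact ⟨C, hC, hx⟩)).choose else 0

lemma isRep_tau (x : Fin d → ℤ) : D.IsRep (D.tau x) := by
  unfold tau
  split_ifs with h
  · exact (D.exists_rep (x := Z2R x) (by obtain ⟨C, hC, hx⟩ := h; exact ⟨C, hC, hx⟩)).choose_spec.1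
  · exact IsRep.zero

lemma comb_tau {x : Fin d → ℤ} (h : x ∈ Φ.supp) : D.comb (D.tau x) = Z2R x := by
  unfold tau
  rw [dif_pos h]
  exact (D.exists_rep (x := Z2R x) (by obtain ⟨C, hC, hx⟩ := h; exact ⟨C, hC, hx⟩)).choose_spec.2

lemma tau_nonneg (x : Fin d → ℤ) (v : Fin N) : 0 ≤ D.tau x v := (D.isRep_tau x).nonneg v

lemma tau_inj {x y : Fin d → ℤ} (hx : x ∈ Φ.supp) (hy : y ∈ Φ.supp) (h : D.tau x = D.tau y) :
    x = y := Z2R_injective (by rw [← D.comb_tau hx, ← D.comb_tau hy, h])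

/-- The support of the chain coordinates. -/
def car (x : Fin d → ℤ) : Finset (Fin N) := Finset.univ.filter fun v => D.tau x v ≠ 0

lemma mem_car {x : Fin d → ℤ} {v : Fin N} : v ∈ D.car x ↔ D.tau x v ≠ 0 := by simp [car]

lemma mem_car_iff_pos {x : Fin d → ℤ} {v : Fin N} : v ∈ D.car x ↔ 0 < D.tau x v :=
  D.mem_car.trans (D.tau_nonneg x v).lt_iff_ne'.symm

lemma car_mem (x : Fin d → ℤ) : D.car x ∈ D.chains := (D.isRep_tau x).supp_mem

lemma subset_of_car {x : Fin d → ℤ} (hx : x ∈ Φ.supp) {C : Set (Fin d → ℝ)} (hC : C ∈ Φ.cones)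
    (h : Z2R x ∈ C) {v : Fin N} (hv : v ∈ D.car x) : D.e v ⊆ C := by
  obtain ⟨C', hC', h'⟩ := (D.isRep_tau x).exists_cone ⟨C, hC⟩
  exact D.subset_of_comb_mem (D.tau_nonneg x) hC hC' h' (by rwa [D.comb_tau hx]) v (D.mem_car.1 hv)

lemma mem_of_car {x : Fin d → ℤ} (hx : x ∈ Φ.supp) {C : Set (Fin d → ℝ)} (hC : C ∈ Φ.cones)
    (h : ∀ v ∈ D.car x, D.e v ⊆ C) : Z2R x ∈ C := by
  rw [← D.comb_tau hx]
  exact D.comb_mem (D.tau_nonneg x) hC fun v hv => h v (D.mem_car.2 hv)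

variable [hΦ : Nonempty Φ.cones]

lemma tau_eq {x : Fin d → ℤ} {t : Fin N → ℝ} (ht : D.IsRep t) (h : D.comb t = Z2R x) :
    x ∈ Φ.supp ∧ D.tau x = t := by
  obtain ⟨C, hC, hCt⟩ := ht.exists_cone (Set.nonempty_coe_sort.1 hΦ)
  have hx : x ∈ Φ.supp := ⟨C, hC, h ▸ D.comb_mem ht.nonneg hC hCt⟩
  exact ⟨hx, (D.isRep_tau x).unique ht (by rw [D.comb_tau hx, h])⟩

lemma isRep_of_subset {t : Fin N → ℝ} (h0 : ∀ v, 0 ≤ t v) {G : Finset (Fin N)} (hG : G ∈ D.chains)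
    (h : ∀ v, t v ≠ 0 → v ∈ G) : D.IsRep t :=
  ⟨h0, fun v w hv hw => hG v (h v hv) w (h w hw)⟩

lemma tau_zero : (0 : Fin d → ℤ) ∈ Φ.supp ∧ D.tau 0 = 0 :=
  D.tau_eq IsRep.zero (by rw [D.comb_zero, Z2R_zero])

lemma tau_add {x y : Fin d → ℤ} (hx : x ∈ Φ.supp) (hy : y ∈ Φ.supp)
    (h : D.car x ∪ D.car y ∈ D.chains) :
    x + y ∈ Φ.supp ∧ D.tau (x + y) = D.tau x + D.tau y := by
  refine D.tau_eq (D.isRep_of_subset (fun v => add_nonneg (D.tau_nonneg x v) (D.tau_nonneg y v)) h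
    fun v hv => ?_) (by rw [D.comb_add, D.comb_tau hx, D.comb_tau hy, Z2R_add])
  by_contra hn
  simp only [Finset.mem_union, D.mem_car, not_or, not_not] at hn
  exact hv (by simp [hn.1, hn.2])

lemma car_eq_union {x y z : Fin d → ℤ} (h : D.tau z = D.tau x + D.tau y) :
    D.car z = D.car x ∪ D.car y := by
  ext v
  simp only [Finset.mem_union, D.mem_car_iff_pos, h, Pi.add_apply]
  have h1 := D.tau_nonneg x v
  have h2 := D.tau_nonneg y v
  constructor
  · intro h
    by_contra hn
    push Not at hn
    linarith [hn.1, hn.2]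
  · rintro (h | h) <;> linarith

lemma tau_a (v : Fin N) : D.tau (D.a v) = Pi.single v 1 := by
  refine (D.tau_eq (D.isRep_of_subset (G := {v}) (fun w => ?_) ?_ fun w hw => ?_) ?_).2
  · by_cases h : w = v
    · subst h; simp
    · simp [Pi.single_eq_of_ne h]
  · intro x hx y hy
    rw [Finset.mem_singleton.1 hx, Finset.mem_singleton.1 hy]
    exact Or.inl subset_rfl
  · by_contra h
    exact hw (Pi.single_eq_of_ne (by simpa using h) _)
  · rw [D.comb_single, one_smul]; rfl

lemma car_a (v : Fin N) : D.car (D.a v) = {v} := by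
  ext w
  rw [D.mem_car, D.tau_a, Finset.mem_singleton]
  by_cases h : w = v
  · subst h; simp
  · simp [h]

lemma a_ne_zero (v : Fin N) : D.a v ≠ 0 := fun h => D.vec_ne_zero v (by rw [vec, h, Z2R_zero])

/-- Removing lattice points along the support of the coordinates. -/
lemma tau_sub_of_le {x y : Fin d → ℤ} (hx : x ∈ Φ.supp) (hy : y ∈ Φ.supp)
    (h : ∀ v, D.tau y v ≤ D.tau x v) :
    x - y ∈ Φ.supp ∧ D.tau (x - y) = D.tau x - D.tau y := by
  refine D.tau_eq (D.isRep_of_subset (G := D.car x) (fun v => sub_nonneg.2 (h v)) (D.car_mem x)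
    fun v hv => ?_) (by rw [D.comb_sub, D.comb_tau hx, D.comb_tau hy, Z2R_sub])
  rw [D.mem_car]
  intro h0
  have h1 := h v
  have h2 := D.tau_nonneg y v
  exact hv (by simp only [Pi.sub_apply]; linarith)

lemma tau_sub_a {x : Fin d → ℤ} (hx : x ∈ Φ.supp) {v : Fin N} (h : 1 ≤ D.tau x v) :
    x - D.a v ∈ Φ.supp ∧ D.tau (x - D.a v) = D.tau x - Pi.single v 1 := by
  rw [← D.tau_a v]
  refine D.tau_sub_of_le hx (D.a_mem_supp v) fun w => ?_
  rw [D.tau_a]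
  by_cases hw : w = v
  · subst hw; simpa using h
  · rw [Pi.single_eq_of_ne hw]; exact D.tau_nonneg x w

lemma tau_sum {G : Finset (Fin N)} (hG : G ∈ D.chains) (m : Fin N → ℕ) :
    ∑ v ∈ G, m v • D.a v ∈ Φ.supp ∧
      D.tau (∑ v ∈ G, m v • D.a v) = fun v => if v ∈ G then (m v : ℝ) else 0 := by
  refine D.tau_eq (D.isRep_of_subset (G := G) (fun v => ?_) hG fun v hv => ?_) ?_
  · split_ifs <;> simp
  · by_contra h; simp [h] at hv
  · rw [comb, Z2R_sum]
    simp only [ite_smul, zero_smul, Finset.sum_ite_mem, Finset.univ_inter, Z2R_nsmul]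
    rfl

lemma tau_sum_a {G : Finset (Fin N)} (hG : G ∈ D.chains) :
    ∑ v ∈ G, D.a v ∈ Φ.supp ∧
      D.tau (∑ v ∈ G, D.a v) = fun v => if v ∈ G then (1 : ℝ) else 0 := by
  simpa using D.tau_sum hG fun _ => 1

lemma compat_iff {x y : Fin d → ℤ} (hx : x ∈ Φ.supp) (hy : y ∈ Φ.supp) :
    Φ.Compat x y ↔ ∃ C ∈ Φ.cones, ∀ v ∈ D.car x ∪ D.car y, D.e v ⊆ C := by
  constructor
  · rintro ⟨C, hC, h1, h2⟩
    refine ⟨C, hC, fun v hv => ?_⟩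
    rcases Finset.mem_union.1 hv with h | h
    · exact D.subset_of_car hx hC h1 h
    · exact D.subset_of_car hy hC h2 h
  · rintro ⟨C, hC, h⟩
    exact ⟨C, hC, D.mem_of_car hx hC fun v hv => h v (Finset.mem_union_left _ hv),
      D.mem_of_car hy hC fun v hv => h v (Finset.mem_union_right _ hv)⟩

lemma compat_of_chain {x y : Fin d → ℤ} (hx : x ∈ Φ.supp) (hy : y ∈ Φ.supp)
    (h : D.car x ∪ D.car y ∈ D.chains) : Φ.Compat x y := by
  obtain ⟨hm, ht⟩ := D.tau_add hx hy h
  obtain ⟨C, hC, hC'⟩ := hm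
  refine (D.compat_iff hx hy).2 ⟨C, hC, fun v hv => ?_⟩
  rw [← D.car_eq_union ht] at hv
  exact D.subset_of_car ⟨C, hC, hC'⟩ hC hC' hv

end FanData

namespace FanData

variable {d N : ℕ} {Φ : Fan d} (D : FanData Φ N) [hΦ : Nonempty Φ.cones]

/-- Two nonzero cones, neither of which contains the other. -/
def Incomp (v w : Fin N) : Prop := ¬ D.e v ⊆ D.e w ∧ ¬ D.e w ⊆ D.e v

/-- The sum of two interior points of incomparable cones is positive on a larger cone. -/
lemma exists_exchange {v w : Fin N} (h : D.Incomp v w) {C : Set (Fin d → ℝ)} (hC : C ∈ Φ.cones)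
    (hv : D.e v ⊆ C) (hw : D.e w ⊆ C) :
    ∃ (E : Fin N) (ε : ℝ), 0 < ε ∧ D.κ v < D.κ E ∧ D.κ w < D.κ E ∧
      (∀ C ∈ Φ.cones, D.e v ⊆ C → D.e w ⊆ C → D.e E ⊆ C) ∧
      ∀ ε', 0 < ε' → ε' ≤ ε → ∃ r : Fin N → ℝ, (∀ u, 0 ≤ r u) ∧ (∀ u, r u ≠ 0 → D.e u ⊆ D.e E) ∧
        D.vec v + D.vec w = ε' • D.vec E + D.comb r := by
  have hcC := Φ.convex hC
  have hsum : D.vec v + D.vec w ∈ C := hcC.2.1 _ (hv (D.vec_mem v)) _ (hw (D.vec_mem w))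
  obtain ⟨E, hE, hxE, hmin⟩ := Φ.exists_carrier (x := D.vec v + D.vec w) ⟨C, hC, hsum⟩
  have hvwE : D.e v ⊆ E ∧ D.e w ⊆ E := by
    have hf := Φ.isFaceOf_of_subset hE hC (hmin C hC hsum)
    have := hf.2.2 _ (hv (D.vec_mem v)) _ (hw (D.vec_mem w)) hxE
    exact ⟨D.subset_of_vec_mem hE this.1, D.subset_of_vec_mem hE this.2⟩
  have hcE := Φ.convex hE
  obtain ⟨E, rfl⟩ := D.surj E hE (by
    rintro rfl
    exact D.vec_ne_zero v (by simpa using hvwE.1 (D.vec_mem v)))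
  have hface := isFaceOf_feasible hcE hxE
  have hcar : D.e E ⊆ {x | x ∈ D.e E ∧ ∃ ε : ℝ, 0 < ε ∧ D.vec v + D.vec w - ε • x ∈ D.e E} :=
    hmin _ (Φ.faces_mem _ hE _ hface) ⟨hxE, 1, one_pos, by simpa using hcE.1⟩
  obtain ⟨-, ε, hε, hεE⟩ := hcar (D.vec_mem E)
  refine ⟨E, ε, hε, D.κ_lt hvwE.1 ?_, D.κ_lt hvwE.2 ?_, fun C' hC' h1 h2 => ?_, ?_⟩
  · rintro rfl; exact h.2 hvwE.2
  · rintro rfl; exact h.1 hvwE.1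
  · exact hmin C' hC' ((Φ.convex hC').2.1 _ (h1 (D.vec_mem v)) _ (h2 (D.vec_mem w)))
  · intro ε' h0 hle
    have hmem : D.vec v + D.vec w - ε' • D.vec E ∈ D.e E := by
      have : D.vec v + D.vec w - ε' • D.vec E =
          (D.vec v + D.vec w - ε • D.vec E) + (ε - ε') • D.vec E := by
        rw [sub_smul]; abel
      rw [this]
      exact hcE.2.1 _ hεE _ (hcE.2.2 _ (D.vec_mem E) _ (by linarith))
    obtain ⟨r, hr, hrx⟩ := D.exists_rep ⟨_, hE, hmem⟩
    obtain ⟨C', hC', hrC'⟩ := hr.exists_cone ⟨_, hE⟩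
    exact ⟨r, hr.nonneg, D.subset_of_comb_mem hr.nonneg hE hC' hrC' (by rwa [hrx]), by
      rw [hrx]; abel⟩

lemma exists_uniform_exchange : ∃ ε : ℝ, 0 < ε ∧ ∀ v w, D.Incomp v w →
    (∃ C ∈ Φ.cones, D.e v ⊆ C ∧ D.e w ⊆ C) →
    ∃ (E : Fin N) (r : Fin N → ℝ), D.κ v < D.κ E ∧ D.κ w < D.κ E ∧
      (∀ C ∈ Φ.cones, D.e v ⊆ C → D.e w ⊆ C → D.e E ⊆ C) ∧
      (∀ u, 0 ≤ r u) ∧ (∀ u, r u ≠ 0 → D.e u ⊆ D.e E) ∧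
        D.vec v + D.vec w = ε • D.vec E + D.comb r := by
  have : ∀ p : Fin N × Fin N, ∃ ε : ℝ, 0 < ε ∧ (D.Incomp p.1 p.2 →
      (∃ C ∈ Φ.cones, D.e p.1 ⊆ C ∧ D.e p.2 ⊆ C) → ∀ ε', 0 < ε' → ε' ≤ ε →
      ∃ (E : Fin N) (r : Fin N → ℝ), D.κ p.1 < D.κ E ∧ D.κ p.2 < D.κ E ∧
      (∀ C ∈ Φ.cones, D.e p.1 ⊆ C → D.e p.2 ⊆ C → D.e E ⊆ C) ∧
      (∀ u, 0 ≤ r u) ∧ (∀ u, r u ≠ 0 → D.e u ⊆ D.e E) ∧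
        D.vec p.1 + D.vec p.2 = ε' • D.vec E + D.comb r) := by
    intro p
    by_cases h : D.Incomp p.1 p.2 ∧ ∃ C ∈ Φ.cones, D.e p.1 ⊆ C ∧ D.e p.2 ⊆ C
    · obtain ⟨h1, C, hC, hv, hw⟩ := h
      obtain ⟨E, ε, hε, h2, h3, h4, h5⟩ := D.exists_exchange h1 hC hv hw
      refine ⟨ε, hε, fun _ _ ε' h0 hle => ?_⟩
      obtain ⟨r, hr⟩ := h5 ε' h0 hle
      exact ⟨E, r, h2, h3, h4, hr⟩
    · exact ⟨1, one_pos, fun h1 h2 => absurd ⟨h1, h2⟩ h⟩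
  choose f hf hf' using this
  rcases (Finset.univ : Finset (Fin N × Fin N)).eq_empty_or_nonempty with h0 | hne
  · exact ⟨1, one_pos, fun v w => absurd (Finset.mem_univ (v, w)) (by rw [h0]; simp)⟩
  · obtain ⟨p, -, hp⟩ := Finset.exists_min_image _ f hne
    exact ⟨f p, hf p, fun v w h1 h2 => hf' (v, w) h1 h2 _ (hf p) (hp _ (Finset.mem_univ _))⟩

/-- A uniform exchange constant. -/
def exc : ℝ := D.exists_uniform_exchange.choose

lemma exc_pos : 0 < D.exc := D.exists_uniform_exchange.choose_spec.1

/-- Weights which increase under exchange. -/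
structure GoodWt (W : Fin N → ℝ) : Prop where
  nonneg : ∀ v, 0 ≤ W v
  lt : ∀ v w E, D.κ v < D.κ E → D.κ w < D.κ E → W v + W w < D.exc * W E

/-- Exchange inside a nonnegative combination. -/
lemma exchange_step {t : Fin N → ℝ} (h0 : ∀ v, 0 ≤ t v) {C : Set (Fin d → ℝ)} (hC : C ∈ Φ.cones)
    (ht : ∀ v, t v ≠ 0 → D.e v ⊆ C) {v w : Fin N} (h : D.Incomp v w) (hv : t v ≠ 0)
    (hw : t w ≠ 0) :
    ∃ (t' : Fin N → ℝ) (s : ℝ) (E : Fin N), 0 < s ∧ D.κ v < D.κ E ∧ D.κ w < D.κ E ∧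
      (∀ u, 0 ≤ t' u) ∧ (∀ u, t' u ≠ 0 → D.e u ⊆ C) ∧ D.comb t' = D.comb t ∧
      ∀ W : Fin N → ℝ, (∀ u, 0 ≤ W u) →
        ∑ u, W u * t u + s * (D.exc * W E - W v - W w) ≤ ∑ u, W u * t' u := by
  obtain ⟨E, r, h1, h2, h3, h4, h5, h6⟩ :=
    D.exists_uniform_exchange.choose_spec.2 v w h ⟨C, hC, ht v hv, ht w hw⟩
  change D.vec v + D.vec w = D.exc • D.vec E + D.comb r at h6
  have hvw : v ≠ w := by rintro rfl; exact h.1 subset_rfl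
  have hEC : D.e E ⊆ C := h3 C hC (ht v hv) (ht w hw)
  have hpv := (h0 v).lt_of_ne' hv
  have hpw := (h0 w).lt_of_ne' hw
  have hexc := D.exc_pos
  let s := min (t v) (t w)
  have hs : 0 < s := lt_min hpv hpw
  let q : Fin N → ℝ := t - (Pi.single v s + Pi.single w s : Fin N → ℝ)
  have hq0 : ∀ u, 0 ≤ q u := by
    intro u
    simp only [q, Pi.sub_apply, Pi.add_apply]
    by_cases huv : u = v
    · subst huv
      rw [Pi.single_eq_same, Pi.single_eq_of_ne hvw]
      linarith [min_le_left (t u) (t w)]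
    · by_cases huw : u = w
      · subst huw
        rw [Pi.single_eq_same, Pi.single_eq_of_ne huv]
        linarith [min_le_right (t v) (t u)]
      · rw [Pi.single_eq_of_ne huv, Pi.single_eq_of_ne huw]
        linarith [h0 u]
  have hqt : ∀ u, t u = 0 → q u = 0 := by
    intro u hu
    have huv : u ≠ v := by rintro rfl; exact hv hu
    have huw : u ≠ w := by rintro rfl; exact hw hu
    simp [q, hu, huv, huw]
  refine ⟨q + (Pi.single E (s * D.exc) + s • r : Fin N → ℝ), s, E, hs, h1, h2, fun u => ?_,
    fun u hu => ?_, ?_, fun W hW => ?_⟩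
  · have h8 : (0 : ℝ) ≤ (Pi.single E (s * D.exc) : Fin N → ℝ) u := by
      by_cases huE : u = E
      · subst huE; rw [Pi.single_eq_same]; positivity
      · rw [Pi.single_eq_of_ne huE]
    have h9 := mul_nonneg hs.le (h4 u)
    have := hq0 u
    simp only [Pi.add_apply, Pi.smul_apply, smul_eq_mul]
    linarith
  · by_cases h8 : t u = 0
    · by_cases huE : u = E
      · subst huE; exact hEC
      · refine (h5 u fun hr => hu ?_).trans hEC
        simp [hqt u h8, hr, huE]
    · exact ht u h8
  · simp only [q, D.comb_add, D.comb_sub, D.comb_single, D.comb_smul]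
    have : s • D.comb r = s • (D.vec v + D.vec w) - (s * D.exc) • D.vec E := by
      rw [h6, smul_add, mul_smul]; abel
    rw [this, smul_add]; abel
  · have key : ∑ u, W u * (q + (Pi.single E (s * D.exc) + s • r : Fin N → ℝ)) u =
        ∑ u, W u * t u + s * (D.exc * W E - W v - W w) + s * ∑ u, W u * r u := by
      simp only [q, Pi.add_apply, Pi.sub_apply, Pi.smul_apply, smul_eq_mul, mul_add, mul_sub,
        Finset.sum_add_distrib, Finset.sum_sub_distrib, Finset.mul_sum]
      simp only [Pi.single_apply, mul_ite, mul_zero, Finset.sum_ite_eq', Finset.mem_univ, if_true]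
      have : ∑ u, W u * (s * r u) = ∑ u, s * (W u * r u) :=
        Finset.sum_congr rfl fun u _ => by ring
      rw [this]; ring
    rw [key]
    have : 0 ≤ s * ∑ u, W u * r u :=
      mul_nonneg hs.le (Finset.sum_nonneg fun u _ => mul_nonneg (hW u) (h4 u))
    linarith

/-- Among all nonnegative combinations in a cone the chain combination has the largest weight. -/
lemma GoodWt.le {W : Fin N → ℝ} (hW : D.GoodWt W) {t t' : Fin N → ℝ} (h0 : ∀ v, 0 ≤ t v)
    {C : Set (Fin d → ℝ)} (hC : C ∈ Φ.cones) (ht : ∀ v, t v ≠ 0 → D.e v ⊆ C) (ht' : D.IsRep t')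
    (he : D.comb t' = D.comb t) : ∑ u, W u * t u ≤ ∑ u, W u * t' u := by
  let P : Set (Fin N → ℝ) :=
    {p | (∀ v, 0 ≤ p v) ∧ (∀ v, ¬ D.e v ⊆ C → p v = 0) ∧ D.comb p = D.comb t}
  have hclosed : IsClosed P := by
    refine IsClosed.inter (s₁ := {p : Fin N → ℝ | ∀ v, 0 ≤ p v}) ?_ (IsClosed.inter
      (s₁ := {p : Fin N → ℝ | ∀ v, ¬ D.e v ⊆ C → p v = 0}) ?_ ?_)
    · simp only [Set.ofPred_forall]
      exact isClosed_iInter fun v => isClosed_le continuous_const (continuous_apply v)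
    · simp only [Set.ofPred_forall]
      exact isClosed_iInter fun v => isClosed_iInter fun _ =>
        isClosed_eq (continuous_apply v) continuous_const
    · exact isClosed_eq D.continuous_comb continuous_const
  obtain ⟨B, hB, hBd⟩ := exists_coeff_bound (Φ.convex hC) (Φ.isPointed hC) D.vec D.vec_ne_zero
  have hcomp : IsCompact P := by
    refine IsCompact.of_isClosed_subset (isCompact_univ_pi fun _ : Fin N =>
      isCompact_Icc (a := (0 : ℝ)) (b := B * ‖D.comb t‖)) hclosed fun p hp v _ => ⟨hp.1 v, ?_⟩
    refine (Finset.single_le_sum (fun u _ => hp.1 u) (Finset.mem_univ v)).trans ?_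
    rw [← hp.2.2]
    exact hBd p hp.1 fun u hu => by
      by_contra hn
      exact hu (hp.2.1 u fun h => hn (h (D.vec_mem u)))
  have htP : t ∈ P := ⟨h0, fun v hv => by by_contra hn; exact hv (ht v hn), rfl⟩
  obtain ⟨p, hp, hmax⟩ := hcomp.exists_isMaxOn ⟨t, htP⟩
    (f := fun p : Fin N → ℝ => ∑ u, W u * p u) (by fun_prop)
  have hpC : ∀ v, p v ≠ 0 → D.e v ⊆ C := fun v hv => by
    by_contra hn; exact hv (hp.2.1 v hn)
  have hrep : D.IsRep p := by
    refine ⟨hp.1, fun v w hv hw => ?_⟩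
    by_contra hn
    push Not at hn
    obtain ⟨q, s, E, hs, h1, h2, h3, h4, h5, h6⟩ := D.exchange_step hp.1 hC hpC hn hv hw
    have h7 := h6 W hW.nonneg
    have h8 := hmax (a := q) ⟨h3, fun u hu => by by_contra hn; exact hu (h4 u hn), h5.trans hp.2.2⟩
    have h9 := hW.lt v w E h1 h2
    have h10 : 0 < s * (D.exc * W E - W v - W w) := mul_pos hs (by linarith)
    simp only [Set.mem_ofPred_eq] at h8
    linarith
  have hpt : p = t' := hrep.unique ht' (hp.2.2.trans he.symm)
  have := hmax htP
  rw [← hpt]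
  exact this

/-- Weights depending on the colour, set to zero below a given colour. -/
def truncWt (W : ℕ → ℝ) (i : ℕ) (v : Fin N) : ℝ := if i ≤ D.κ v then W (D.κ v) else 0

/-- A colour weight function all of whose truncations are monotone under exchange. -/
structure ColorWt (W : ℕ → ℝ) : Prop where
  pos : ∀ j, 0 < W j
  lt : ∀ j j', j < j' → 2 * W j < D.exc * W j'

variable {D}

lemma ColorWt.truncWt_nonneg {W : ℕ → ℝ} (hW : D.ColorWt W) (i : ℕ) (v : Fin N) :
    0 ≤ D.truncWt W i v := by
  unfold truncWt; split_ifs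
  exacts [(hW.pos _).le, le_rfl]

lemma ColorWt.le {W : ℕ → ℝ} (hW : D.ColorWt W) (i : ℕ) {t t' : Fin N → ℝ} (h0 : ∀ v, 0 ≤ t v)
    {C : Set (Fin d → ℝ)} (hC : C ∈ Φ.cones) (ht : ∀ v, t v ≠ 0 → D.e v ⊆ C) (ht' : D.IsRep t')
    (he : D.comb t' = D.comb t) :
    ∑ u, D.truncWt W i u * t u ≤ ∑ u, D.truncWt W i u * t' u := by
  let f : Fin N → ℝ → ℝ := fun u s => if i ≤ D.κ u then 1 else s
  have key : ∀ s : ℝ, 0 < s → s ≤ 1 →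
      ∑ u, (W (D.κ u) * f u s) * t u ≤ ∑ u, (W (D.κ u) * f u s) * t' u := by
    intro s hs hs1
    have hf : ∀ u, 0 < f u s := fun u => by simp only [f]; split_ifs <;> linarith
    refine GoodWt.le D ⟨fun v => (mul_pos (hW.pos _) (hf v)).le, fun v w E h1 h2 => ?_⟩
      h0 hC ht ht' he
    have hmono : ∀ u, D.κ u < D.κ E → f u s ≤ f E s := by
      intro u hu
      simp only [f]
      split_ifs <;> linarith
    have h3 := hW.lt _ _ h1
    have h4 := hW.lt _ _ h2
    have h5 := mul_le_mul_of_nonneg_left (hmono v h1) (hW.pos (D.κ v)).le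
    have h6 := mul_le_mul_of_nonneg_left (hmono w h2) (hW.pos (D.κ w)).le
    have h7 := mul_lt_mul_of_pos_right h3 (hf E)
    have h8 := mul_lt_mul_of_pos_right h4 (hf E)
    nlinarith
  have hlim : ∀ q : Fin N → ℝ, ∑ u, D.truncWt W i u * q u = ∑ u, (W (D.κ u) * f u 0) * q u := by
    intro q
    refine Finset.sum_congr rfl fun u _ => ?_
    simp only [f, truncWt]; split_ifs <;> simp
  rw [hlim, hlim]
  have hc : ∀ q : Fin N → ℝ, Continuous fun s : ℝ => ∑ u, (W (D.κ u) * f u s) * q u := by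
    intro q
    refine continuous_finsetSum _ fun u _ => ?_
    have : Continuous (f u) := by
      by_cases h : i ≤ D.κ u
      · simp only [f, if_pos h]; exact continuous_const
      · simp only [f, if_neg h]; exact continuous_id
    fun_prop
  refine le_of_tendsto_of_tendsto (b := nhdsWithin (0 : ℝ) (Set.Ioi 0))
    (((hc t).tendsto 0).mono_left nhdsWithin_le_nhds)
    (((hc t').tendsto 0).mono_left nhdsWithin_le_nhds) ?_
  filter_upwards [Ioc_mem_nhdsGT (zero_lt_one' ℝ)] with s hs
  exact key s hs.1 hs.2

lemma ColorWt.lt_of_incomp {W : ℕ → ℝ} (hW : D.ColorWt W) (i : ℕ) {t t' : Fin N → ℝ}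
    (h0 : ∀ v, 0 ≤ t v) {C : Set (Fin d → ℝ)} (hC : C ∈ Φ.cones) (ht : ∀ v, t v ≠ 0 → D.e v ⊆ C)
    (ht' : D.IsRep t') (he : D.comb t' = D.comb t) {v w : Fin N} (h : D.Incomp v w) (hv : t v ≠ 0)
    (hw : t w ≠ 0) (hi : i ≤ D.κ v ∨ i ≤ D.κ w) :
    ∑ u, D.truncWt W i u * t u < ∑ u, D.truncWt W i u * t' u := by
  obtain ⟨q, s, E, hs, h1, h2, h3, h4, h5, h6⟩ := D.exchange_step h0 hC ht h hv hw
  have h7 := h6 _ (hW.truncWt_nonneg i)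
  have h8 := hW.le i h3 hC h4 ht' (he.trans h5.symm)
  have h9 := hW.lt _ _ h1
  have h10 := hW.lt _ _ h2
  have hle : ∀ u, D.truncWt W i u ≤ W (D.κ u) := by
    intro u; unfold truncWt; split_ifs
    exacts [le_rfl, (hW.pos _).le]
  have hE : D.truncWt W i E = W (D.κ E) := if_pos (by omega)
  have h11 : 0 < s * (D.exc * D.truncWt W i E - D.truncWt W i v - D.truncWt W i w) := by
    rw [hE]
    exact mul_pos hs (by linarith [hle v, hle w])
  linarith

end FanData

namespace FanData

variable {d N : ℕ} {Φ : Fan d} (D : FanData Φ N) [hΦ : Nonempty Φ.cones]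

/-- The lattice points all of whose chain coordinates are at most one. -/
def boxPts : Set (Fin d → ℤ) := {x | x ∈ Φ.supp ∧ ∀ v, D.tau x v ≤ 1}

lemma abs_coord_le {x : Fin d → ℤ} (hx : x ∈ Φ.supp) (i : Fin d) :
    |(x i : ℝ)| ≤ ∑ v, D.tau x v * |D.vec v i| := by
  have h := congrFun (D.comb_tau hx) i
  simp only [comb, Finset.sum_apply, Pi.smul_apply, smul_eq_mul] at h
  have h2 : (x i : ℝ) = Z2R x i := rfl
  rw [h2, ← h]
  refine (Finset.abs_sum_le_sum_abs _ _).trans (Finset.sum_le_sum fun v _ => ?_)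
  rw [abs_mul, abs_of_nonneg (D.tau_nonneg x v)]

lemma boxPts_finite : D.boxPts.Finite := by
  let B : ℤ := ⌈∑ v, ∑ i, |D.vec v i|⌉
  refine (Set.Finite.pi' fun _ : Fin d => Set.finite_Icc (-B) B).subset fun x hx i => ?_
  have h1 : |(x i : ℝ)| ≤ B := by
    refine ((D.abs_coord_le hx.1 i).trans (Finset.sum_le_sum fun v _ => ?_)).trans (Int.le_ceil _)
    refine (mul_le_of_le_one_left (abs_nonneg _) (hx.2 v)).trans ?_
    exact Finset.single_le_sum (f := fun i => |D.vec v i|) (fun _ _ => abs_nonneg _)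
      (Finset.mem_univ i)
  rw [← Int.cast_abs] at h1
  exact abs_le.1 (by exact_mod_cast h1)

/-- Splitting a lattice point into its fractional and integral parts. -/
lemma exists_frac {x : Fin d → ℤ} (hx : x ∈ Φ.supp) : ∃ (b : Fin d → ℤ) (m : Fin N → ℕ),
    b ∈ D.boxPts ∧ (∀ v, D.tau x v = D.tau b v + m v) ∧ x = b + ∑ v ∈ D.car x, m v • D.a v := by
  let m : Fin N → ℕ := fun v => ⌊D.tau x v⌋₊
  have hm : ∀ v, (m v : ℝ) ≤ D.tau x v := fun v => Nat.floor_le (D.tau_nonneg x v)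
  obtain ⟨h1, h2⟩ := D.tau_sum (D.car_mem x) m
  have h3 : ∀ v, D.tau (∑ v ∈ D.car x, m v • D.a v) v = m v := by
    intro v
    rw [h2]
    show (if v ∈ D.car x then (m v : ℝ) else 0) = m v
    split_ifs with h
    · rfl
    · rw [D.mem_car, not_not] at h
      simp [m, h]
  obtain ⟨h4, h5⟩ := D.tau_sub_of_le hx h1 fun v => by rw [h3]; exact hm v
  refine ⟨_, m, ⟨h4, fun v => ?_⟩, fun v => ?_, (sub_add_cancel _ _).symm⟩
  · rw [h5, Pi.sub_apply, h3]
    linarith [(Nat.lt_floor_add_one (D.tau x v)).le]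
  · rw [h5, Pi.sub_apply, h3]; ring

lemma tau_nsmul {x : Fin d → ℤ} (hx : x ∈ Φ.supp) (n : ℕ) :
    n • x ∈ Φ.supp ∧ D.tau (n • x) = (n : ℝ) • D.tau x := by
  refine D.tau_eq ((D.isRep_tau x).smul (Nat.cast_nonneg n)) ?_
  rw [D.comb_smul, D.comb_tau hx, Z2R_nsmul]

/-- The chain coordinates of lattice points have bounded denominators. -/
lemma exists_denominator : ∃ M : ℕ, 0 < M ∧ ∀ x ∈ Φ.supp, ∀ v, ∃ n : ℕ, (M : ℝ) * D.tau x v = n := by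
  let B := D.boxPts_finite.toFinset
  refine ⟨B.card.factorial, Nat.factorial_pos _, fun x hx v => ?_⟩
  choose b m hb hbm _ using fun j : ℕ => D.exists_frac (D.tau_nsmul hx j).1
  obtain ⟨j, hj, j', hj', hne, heq⟩ := Finset.exists_ne_map_eq_of_card_lt_of_maps_to
    (s := Finset.range (B.card + 1)) (t := B) (by simp) (f := b)
    (fun j _ => D.boxPts_finite.mem_toFinset.2 (hb j))
  wlog hlt : j < j' generalizing j j'
  · exact this j' hj' j hj hne.symm heq.symm (lt_of_le_of_ne (not_lt.1 hlt) hne.symm)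
  have h1 := hbm j v
  have h2 := hbm j' v
  rw [(D.tau_nsmul hx _).2, Pi.smul_apply, smul_eq_mul] at h1 h2
  rw [heq] at h1
  have h3 : ((j' - j : ℕ) : ℝ) * D.tau x v = m j' v - m j v := by
    rw [Nat.cast_sub hlt.le]; linarith
  have h4 : (m j v : ℝ) ≤ m j' v := by
    have := mul_nonneg (Nat.cast_nonneg (α := ℝ) (j' - j)) (D.tau_nonneg x v)
    linarith
  have h5 : m j v ≤ m j' v := by exact_mod_cast h4
  obtain ⟨c, hc⟩ : j' - j ∣ B.card.factorial :=
    Nat.dvd_factorial (by omega) (by have := Finset.mem_range.1 hj'; omega)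
  refine ⟨c * (m j' v - m j v), ?_⟩
  rw [hc]
  push_cast [Nat.cast_sub h5]
  rw [← h3]; ring

/-- Integral weights on colours together with the induced levels of lattice points. -/
structure Level where
  W : ℕ → ℤ
  ω : ℕ → (Fin d → ℤ) → ℤ
  wt : D.ColorWt fun j => (W j : ℝ)
  ω_eq : ∀ i x, x ∈ Φ.supp → (ω i x : ℝ) = ∑ u, D.truncWt (fun j => (W j : ℝ)) i u * D.tau x u

lemma exists_level : Nonempty D.Level := by
  obtain ⟨M, hM, hden⟩ := D.exists_denominator
  obtain ⟨c, hc⟩ := exists_nat_gt (2 / D.exc)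
  have hexc := D.exc_pos
  have hc0 : 0 < c := by
    have : (0 : ℝ) < c := (by positivity : 0 < 2 / D.exc).trans hc
    exact_mod_cast this
  have hc2 : 2 < D.exc * c := by
    rw [div_lt_iff₀ hexc] at hc; linarith
  choose! n hn using hden
  refine ⟨⟨fun j => M * c ^ j, fun i x => ∑ u, (if i ≤ D.κ u then (c : ℤ) ^ (D.κ u) else 0) * n x u,
    ⟨fun j => by push_cast; positivity, fun j j' h => ?_⟩, fun i x hx => ?_⟩⟩
  · have h1 : (c : ℝ) ^ (j + 1) ≤ c ^ j' :=
      pow_le_pow_right₀ (by exact_mod_cast hc0) h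
    have hM' : (0 : ℝ) < M := by exact_mod_cast hM
    have hcj : (0 : ℝ) < (c : ℝ) ^ j := by positivity
    push_cast
    calc 2 * ((M : ℝ) * c ^ j) < (D.exc * c) * (M * c ^ j) :=
          mul_lt_mul_of_pos_right hc2 (by positivity)
      _ = D.exc * (M * c ^ (j + 1)) := by ring
      _ ≤ D.exc * (M * c ^ j') := by gcongr
  · push_cast
    refine Finset.sum_congr rfl fun u _ => ?_
    rw [← hn x hx u, truncWt]
    split_ifs <;> ring

variable {D}

namespace Level

variable (L : D.Level)

lemma W_pos (j : ℕ) : 0 < L.W j := by exact_mod_cast L.wt.pos j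

lemma ω_add_eq (i : ℕ) {x y z : Fin d → ℤ} (hx : x ∈ Φ.supp) (hy : y ∈ Φ.supp) (hz : z ∈ Φ.supp)
    (h : D.tau z = D.tau x + D.tau y) : L.ω i z = L.ω i x + L.ω i y := by
  have : (L.ω i z : ℝ) = L.ω i x + L.ω i y := by
    rw [L.ω_eq i z hz, L.ω_eq i x hx, L.ω_eq i y hy, h]
    simp [mul_add, Finset.sum_add_distrib]
  exact_mod_cast this

lemma ω_add_le (i : ℕ) {x y : Fin d → ℤ} (h : Φ.Compat x y) :
    L.ω i x + L.ω i y ≤ L.ω i (x + y) := by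
  obtain ⟨C, hC, hC'⟩ := (D.compat_iff h.left h.right).1 h
  have := L.wt.le i (t := D.tau x + D.tau y) (t' := D.tau (x + y))
    (fun v => add_nonneg (D.tau_nonneg x v) (D.tau_nonneg y v)) hC (fun v hv => hC' v ?_)
    (D.isRep_tau _) (by
      rw [D.comb_add, D.comb_tau h.left, D.comb_tau h.right, D.comb_tau h.add_mem, Z2R_add])
  · simp only [Pi.add_apply, mul_add, Finset.sum_add_distrib] at this
    rw [← L.ω_eq i x h.left, ← L.ω_eq i y h.right, ← L.ω_eq i _ h.add_mem] at this
    exact_mod_cast this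
  · by_contra hn
    simp only [Finset.mem_union, D.mem_car, not_or, not_not] at hn
    exact hv (by simp [hn.1, hn.2])

lemma ω_add_lt (i : ℕ) {x y : Fin d → ℤ} (h : Φ.Compat x y) {v w : Fin N} (hv : v ∈ D.car x)
    (hw : w ∈ D.car y) (hvw : D.Incomp v w) (hi : i ≤ D.κ v ∨ i ≤ D.κ w) :
    L.ω i x + L.ω i y < L.ω i (x + y) := by
  obtain ⟨C, hC, hC'⟩ := (D.compat_iff h.left h.right).1 h
  have h1 := D.mem_car_iff_pos.1 hv
  have h2 := D.mem_car_iff_pos.1 hw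
  have := L.wt.lt_of_incomp i (t := D.tau x + D.tau y) (t' := D.tau (x + y))
    (fun v => add_nonneg (D.tau_nonneg x v) (D.tau_nonneg y v)) hC (fun v hv => hC' v ?_)
    (D.isRep_tau _) (by
      rw [D.comb_add, D.comb_tau h.left, D.comb_tau h.right, D.comb_tau h.add_mem, Z2R_add])
    hvw (add_pos_of_pos_of_nonneg h1 (D.tau_nonneg y v)).ne'
    (add_pos_of_nonneg_of_pos (D.tau_nonneg x w) h2).ne' hi
  · simp only [Pi.add_apply, mul_add, Finset.sum_add_distrib] at this
    rw [← L.ω_eq i x h.left, ← L.ω_eq i y h.right, ← L.ω_eq i _ h.add_mem] at this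
    exact_mod_cast this
  · by_contra hn
    simp only [Finset.mem_union, D.mem_car, not_or, not_not] at hn
    exact hv (by simp [hn.1, hn.2])

lemma ω_a {i : ℕ} {v : Fin N} (h : i ≤ D.κ v) : L.ω i (D.a v) = L.W (D.κ v) := by
  have : (L.ω i (D.a v) : ℝ) = L.W (D.κ v) := by
    rw [L.ω_eq i _ (D.a_mem_supp v), D.tau_a, Finset.sum_eq_single_of_mem v (Finset.mem_univ v)]
    · simp [truncWt, h]
    · intro w _ hw; simp [Pi.single_eq_of_ne hw]
  exact_mod_cast this

lemma ω_nonneg (i : ℕ) {x : Fin d → ℤ} (hx : x ∈ Φ.supp) : 0 ≤ L.ω i x := by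
  have : (0 : ℝ) ≤ L.ω i x := by
    rw [L.ω_eq i x hx]
    exact Finset.sum_nonneg fun u _ => mul_nonneg (L.wt.truncWt_nonneg i u) (D.tau_nonneg x u)
  exact_mod_cast this

end Level

end FanData

namespace ToricRing

variable (K : Type) [Field K] {d : ℕ} (Φ : Fan d)

/-- All variables of the monomial belong to a common cone. -/
def Good (m : ↥Φ.supp →₀ ℕ) : Prop := ∃ C ∈ Φ.cones, ∀ a ∈ m.support, Z2R a.1 ∈ C

/-- The lattice degree of a monomial. -/
def deg (m : ↥Φ.supp →₀ ℕ) : Fin d → ℤ := m.sum fun a n => n • a.1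

lemma deg_add (m m' : ↥Φ.supp →₀ ℕ) : deg Φ (m + m') = deg Φ m + deg Φ m' :=
  Finsupp.sum_add_index' (by simp) (by intros; simp [add_smul])

lemma deg_single (a : ↥Φ.supp) : deg Φ (Finsupp.single a 1) = a.1 := by simp [deg]

/-- The linear map sending a monomial to its class, in terms of the monomial basis. -/
def polyCoeffs : Φ.polyRing K →ₗ[K] ((Fin d → ℤ) →₀ K) :=
  (Finsupp.lsum K fun m => if Good Φ m then Finsupp.lsingle (deg Φ m) else 0) ∘ₗ
    (AddMonoidAlgebra.coeffLinearEquiv K).toLinearMap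

lemma polyCoeffs_single (m : ↥Φ.supp →₀ ℕ) (c : K) :
    polyCoeffs K Φ (AddMonoidAlgebra.single m c) =
      if Good Φ m then Finsupp.single (deg Φ m) c else 0 := by
  have : polyCoeffs K Φ (AddMonoidAlgebra.single m c) =
    Finsupp.lsum K (fun m => if Good Φ m then Finsupp.lsingle (M := K) (R := K) (deg Φ m) else 0)
      (Finsupp.single m c) := rfl
  rw [this, Finsupp.lsum_single]
  split_ifs <;> simp

variable {Φ} in
lemma face_mem {C : Set (Fin d → ℝ)} (hC : C ∈ Φ.cones) {a b : Fin d → ℤ} (h : Φ.Compat a b)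
    (hab : Z2R (a + b) ∈ C) : Z2R a ∈ C ∧ Z2R b ∈ C := by
  obtain ⟨C', hC', h1, h2⟩ := h
  have := (Φ.inter_face C hC C' hC').2.2.2 _ h1 _ h2
    ⟨by rwa [← Z2R_add], (Φ.convex hC').2.1 _ h1 _ h2⟩
  exact ⟨this.1.1, this.2.1⟩

lemma good_add_single {m : ↥Φ.supp →₀ ℕ} {a : ↥Φ.supp} :
    Good Φ (m + Finsupp.single a 1) ↔
      ∃ C ∈ Φ.cones, (∀ b ∈ m.support, Z2R b.1 ∈ C) ∧ Z2R a.1 ∈ C := by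
  have : (m + Finsupp.single a 1).support = m.support ∪ {a} := by
    ext b
    by_cases h : b = a
    · subst h; simp
    · simp [h]
  simp only [Good, this, Finset.mem_union, Finset.mem_singleton]
  constructor
  · rintro ⟨C, hC, h⟩
    exact ⟨C, hC, fun b hb => h b (Or.inl hb), h a (Or.inr rfl)⟩
  · rintro ⟨C, hC, h, h'⟩
    exact ⟨C, hC, fun b hb => hb.elim (h b) fun e => e ▸ h'⟩

lemma good_add_single_single {m : ↥Φ.supp →₀ ℕ} {a a' : ↥Φ.supp} :
    Good Φ (m + (Finsupp.single a 1 + Finsupp.single a' 1)) ↔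
      ∃ C ∈ Φ.cones, (∀ b ∈ m.support, Z2R b.1 ∈ C) ∧ Z2R a.1 ∈ C ∧ Z2R a'.1 ∈ C := by
  rw [← add_assoc, good_add_single]
  refine exists_congr fun C => and_congr_right fun hC => ?_
  have : (m + Finsupp.single a 1).support = m.support ∪ {a} := by
    ext b
    by_cases h : b = a
    · subst h; simp
    · simp [h]
  simp only [this, Finset.mem_union, Finset.mem_singleton]
  constructor
  · rintro ⟨h, h'⟩
    exact ⟨fun b hb => h b (Or.inl hb), h a (Or.inr rfl), h'⟩
  · rintro ⟨h, h', h''⟩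
    exact ⟨fun b hb => hb.elim (h b) fun e => e ▸ h', h''⟩

lemma polyCoeffs_relIdeal {z : Φ.polyRing K} (hz : z ∈ Φ.relIdeal K) : polyCoeffs K Φ z = 0 := by
  have key : ∀ g ∈ ({z | ∃ a b : ↥Φ.supp, (∃ C ∈ Φ.cones, Z2R a.1 ∈ C ∧ Z2R b.1 ∈ C) ∧
        z = Φ.X K a * Φ.X K b - Φ.Xaux K (a.1 + b.1)} ∪
     {z | ∃ a b : ↥Φ.supp, (¬ ∃ C ∈ Φ.cones, Z2R a.1 ∈ C ∧ Z2R b.1 ∈ C) ∧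
        z = Φ.X K a * Φ.X K b} ∪
     {z | ∃ a : ↥Φ.supp, a.1 = 0 ∧ z = Φ.X K a - 1} : Set (Φ.polyRing K)),
      ∀ p : Φ.polyRing K, polyCoeffs K Φ (p * g) = 0 := by
    intro g hg p
    induction p using AddMonoidAlgebra.induction_linear with
    | zero => simp
    | add x y hx hy => rw [add_mul, map_add, hx, hy, add_zero]
    | single m c =>
      rcases hg with (⟨a, b, hab, rfl⟩ | ⟨a, b, hab, rfl⟩) | ⟨a, ha, rfl⟩
      · have hm : a.1 + b.1 ∈ Φ.supp := Fan.Compat.add_mem hab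
        rw [Fan.Xaux, dif_pos hm, mul_sub, Fan.X, Fan.X, Fan.X,
          AddMonoidAlgebra.single_mul_single, AddMonoidAlgebra.single_mul_single,
          AddMonoidAlgebra.single_mul_single, map_sub, polyCoeffs_single, polyCoeffs_single]
        have : Good Φ (m + (Finsupp.single a 1 + Finsupp.single b 1)) ↔
            Good Φ (m + Finsupp.single ⟨a.1 + b.1, hm⟩ 1) := by
          rw [good_add_single_single, good_add_single]
          refine exists_congr fun C => and_congr_right fun hC => and_congr_right fun _ => ?_
          constructor
          · rintro ⟨h1, h2⟩
            show Z2R (a.1 + b.1) ∈ C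
            rw [Z2R_add]
            exact (Φ.convex hC).2.1 _ h1 _ h2
          · exact face_mem hC hab
        simp only [this, deg_add, deg_single, mul_one, sub_self]
      · rw [Fan.X, Fan.X, AddMonoidAlgebra.single_mul_single, AddMonoidAlgebra.single_mul_single,
          polyCoeffs_single, if_neg]
        rw [good_add_single_single]
        rintro ⟨C, hC, _, h⟩
        exact hab ⟨C, hC, h⟩
      · rw [mul_sub, mul_one, Fan.X, AddMonoidAlgebra.single_mul_single, map_sub,
          polyCoeffs_single, polyCoeffs_single]
        have : Good Φ (m + Finsupp.single a 1) ↔ Good Φ m := by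
          rw [good_add_single]
          refine exists_congr fun C => and_congr_right fun hC => and_iff_left ?_
          rw [ha, Z2R_zero]
          exact (Φ.convex hC).1
        simp only [this, deg_add, deg_single, ha, add_zero, mul_one, sub_self]
  have := Submodule.span_induction (p := fun z _ => ∀ p, polyCoeffs K Φ (p * z) = 0)
    (fun g hg => key g hg) (by simp) (fun x y _ _ hx hy p => by
      rw [mul_add, map_add, hx, hy, add_zero])
    (fun r x _ hx p => by rw [smul_eq_mul, ← mul_assoc]; exact hx _) hz 1
  rwa [one_mul] at this

/-- The class of a polynomial in the toric face ring. -/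
def toRing : Φ.polyRing K →ₐ[K] ToricFaceRing K Φ := Ideal.Quotient.mkₐ K (Φ.relIdeal K)

lemma toRing_surjective : Function.Surjective (toRing K Φ) := Ideal.Quotient.mkₐ_surjective _ _

lemma toRing_eq_zero {z : Φ.polyRing K} : toRing K Φ z = 0 ↔ z ∈ Φ.relIdeal K :=
  Ideal.Quotient.eq_zero_iff_mem

lemma toRing_Xaux (a : Fin d → ℤ) : toRing K Φ (Φ.Xaux K a) = xpow K Φ a := rfl

lemma toRing_X (a : ↥Φ.supp) : toRing K Φ (Φ.X K a) = xpow K Φ a.1 := by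
  rw [← toRing_Xaux, Fan.Xaux, dif_pos a.2]

/-- The coefficients of an element of the toric face ring in the monomial basis. -/
def coeffs : ToricFaceRing K Φ →ₗ[K] ((Fin d → ℤ) →₀ K) where
  toFun := QuotientAddGroup.lift (Φ.relIdeal K).toAddSubgroup (polyCoeffs K Φ).toAddMonoidHom
    fun _ hz => polyCoeffs_relIdeal K Φ hz
  map_add' := map_add _
  map_smul' c x := by
    obtain ⟨z, rfl⟩ := toRing_surjective K Φ x
    exact (polyCoeffs K Φ).map_smul c z

lemma coeffs_toRing (z : Φ.polyRing K) : coeffs K Φ (toRing K Φ z) = polyCoeffs K Φ z := rfl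

variable {Φ}

lemma coeffs_xpow {a : Fin d → ℤ} (ha : a ∈ Φ.supp) :
    coeffs K Φ (xpow K Φ a) = Finsupp.single a 1 := by
  rw [← toRing_X K Φ ⟨a, ha⟩, coeffs_toRing, Fan.X, polyCoeffs_single, if_pos, deg_single]
  obtain ⟨C, hC, h⟩ := ha
  refine ⟨C, hC, fun b hb => ?_⟩
  have := Finsupp.support_single_subset hb
  rw [Finset.mem_singleton] at this
  rw [this]; exact h

lemma xpow_of_notMem {a : Fin d → ℤ} (ha : a ∉ Φ.supp) : xpow K Φ a = 0 := by
  rw [← toRing_Xaux, Fan.Xaux, dif_neg ha, map_zero]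

lemma xpow_mul_of_compat {a b : Fin d → ℤ} (h : Φ.Compat a b) :
    xpow K Φ a * xpow K Φ b = xpow K Φ (a + b) := by
  rw [← toRing_X K Φ ⟨a, h.left⟩, ← toRing_X K Φ ⟨b, h.right⟩, ← toRing_Xaux, ← map_mul, ← sub_eq_zero,
    ← map_sub, toRing_eq_zero]
  exact Ideal.subset_span (Or.inl (Or.inl ⟨⟨a, h.left⟩, ⟨b, h.right⟩, h, rfl⟩))

lemma xpow_mul_of_not_compat {a b : Fin d → ℤ} (h : ¬ Φ.Compat a b) :
    xpow K Φ a * xpow K Φ b = 0 := by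
  by_cases ha : a ∈ Φ.supp
  · by_cases hb : b ∈ Φ.supp
    · rw [← toRing_X K Φ ⟨a, ha⟩, ← toRing_X K Φ ⟨b, hb⟩, ← map_mul, toRing_eq_zero]
      exact Ideal.subset_span (Or.inl (Or.inr ⟨⟨a, ha⟩, ⟨b, hb⟩, h, rfl⟩))
    · rw [xpow_of_notMem K hb, mul_zero]
  · rw [xpow_of_notMem K ha, zero_mul]

lemma xpow_zero (h : (0 : Fin d → ℤ) ∈ Φ.supp) : xpow K Φ 0 = 1 := by
  rw [← toRing_X K Φ ⟨0, h⟩, ← map_one (toRing K Φ), ← sub_eq_zero, ← map_sub, toRing_eq_zero]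
  exact Ideal.subset_span (Or.inr ⟨⟨0, h⟩, rfl, rfl⟩)

lemma sum_mul {ι : Type*} (s : Finset ι) (f : ι → ToricFaceRing K Φ) (x : ToricFaceRing K Φ) :
    (∑ i ∈ s, f i) * x = ∑ i ∈ s, f i * x := Finset.sum_mul ..

lemma mul_sum {ι : Type*} (s : Finset ι) (f : ι → ToricFaceRing K Φ) (x : ToricFaceRing K Φ) :
    x * ∑ i ∈ s, f i = ∑ i ∈ s, x * f i := Finset.mul_sum ..

/-- Products of monomials are monomials or zero. -/
lemma xpow_mul_mem (a b : Fin d → ℤ) :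
    xpow K Φ a * xpow K Φ b = xpow K Φ (a + b) ∨ xpow K Φ a * xpow K Φ b = 0 := by
  by_cases h : Φ.Compat a b
  · exact Or.inl (xpow_mul_of_compat K h)
  · exact Or.inr (xpow_mul_of_not_compat K h)

lemma toRing_single_mem (h0 : (0 : Fin d → ℤ) ∈ Φ.supp) (m : ↥Φ.supp →₀ ℕ) :
    ∃ x ∈ Set.range (xpow K Φ) ∪ {0}, toRing K Φ (AddMonoidAlgebra.single m 1) = x := by
  have key : ∀ (n : ℕ) (m : ↥Φ.supp →₀ ℕ) (a : ↥Φ.supp),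
      toRing K Φ (AddMonoidAlgebra.single m 1) ∈ Set.range (xpow K Φ) ∪ {0} →
      toRing K Φ (AddMonoidAlgebra.single (Finsupp.single a n + m) 1) ∈
        Set.range (xpow K Φ) ∪ {0} := by
    intro n m a hm
    induction n with
    | zero => simpa using hm
    | succ n ih =>
      have : AddMonoidAlgebra.single (Finsupp.single a (n + 1) + m) (1 : K) =
          Φ.X K a * AddMonoidAlgebra.single (Finsupp.single a n + m) 1 := by
        rw [Fan.X, AddMonoidAlgebra.single_mul_single, mul_one, ← add_assoc,
          ← Finsupp.single_add, add_comm 1 n]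
      rw [this, map_mul, toRing_X]
      rcases ih with ⟨b, hb⟩ | hb
      · rw [← hb]
        rcases xpow_mul_mem K (Φ := Φ) a.1 b with h | h
        · exact Or.inl ⟨_, h.symm⟩
        · exact Or.inr h
      · rw [Set.mem_singleton_iff.1 hb, mul_zero]; exact Or.inr rfl
  refine ⟨_, ?_, rfl⟩
  induction m using Finsupp.induction with
  | zero => exact Or.inl ⟨0, by rw [xpow_zero K h0]; exact (map_one (toRing K Φ)).symm⟩
  | single_add a n m _ _ ih => exact key n m a ih

/-- An element is the combination of monomials given by its coefficients. -/
lemma eq_sum_coeffs (h0 : (0 : Fin d → ℤ) ∈ Φ.supp) (x : ToricFaceRing K Φ) :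
    x = (coeffs K Φ x).sum fun a c => c • xpow K Φ a := by
  obtain ⟨z, rfl⟩ := toRing_surjective K Φ x
  induction z using AddMonoidAlgebra.induction_linear with
  | zero => simp
  | add x y hx hy =>
    rw [map_add, map_add, Finsupp.sum_add_index' (by simp) (by intros; rw [add_smul]), ← hx, ← hy]
  | single m c =>
    have : AddMonoidAlgebra.single m c = c • AddMonoidAlgebra.single m (1 : K) := by simp
    rw [this, map_smul, map_smul]
    obtain ⟨y, ⟨a, rfl⟩ | hy, h⟩ := toRing_single_mem K h0 m
    · rw [h]
      by_cases ha : a ∈ Φ.supp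
      · rw [coeffs_xpow K ha]; simp
      · rw [xpow_of_notMem K ha]; simp
    · rw [h, Set.mem_singleton_iff.1 hy]; simp

lemma coeffs_support (h0 : (0 : Fin d → ℤ) ∈ Φ.supp) {x : ToricFaceRing K Φ} {a : Fin d → ℤ}
    (h : coeffs K Φ x a ≠ 0) : a ∈ Φ.supp := by
  by_contra ha
  apply h
  conv_lhs => rw [eq_sum_coeffs K h0 x]
  rw [Finsupp.sum, map_sum, Finsupp.finsetSum_apply]
  refine Finset.sum_eq_zero fun b _ => ?_
  by_cases hb : b ∈ Φ.supp
  · rw [map_smul, coeffs_xpow K hb, Finsupp.smul_apply, Finsupp.single_apply, if_neg, smul_zero]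
    rintro rfl; exact ha hb
  · rw [xpow_of_notMem K hb]; simp

lemma span_xpow (h0 : (0 : Fin d → ℤ) ∈ Φ.supp) :
    Submodule.span K (xpow K Φ '' Φ.supp) = ⊤ := by
  rw [eq_top_iff]
  intro x _
  rw [eq_sum_coeffs K h0 x]
  refine Submodule.sum_mem _ fun a ha => Submodule.smul_mem _ _ (Submodule.subset_span ⟨a, ?_, rfl⟩)
  exact coeffs_support K h0 (Finsupp.mem_support_iff.1 ha)

end ToricRing

lemma Fan.zero_mem_supp {d : ℕ} (Φ : Fan d) [hΦ : Nonempty Φ.cones] : (0 : Fin d → ℤ) ∈ Φ.supp := by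
  obtain ⟨C, hC⟩ := hΦ
  exact ⟨C, hC, by rw [Z2R_zero]; exact (Φ.convex hC).1⟩

lemma ToricRing.xpow_nsmul (K : Type) [Field K] {d : ℕ} {Φ : Fan d} [hΦ : Nonempty Φ.cones]
    {x : Fin d → ℤ} (hx : x ∈ Φ.supp) (n : ℕ) : xpow K Φ (n • x) = xpow K Φ x ^ n := by
  induction n with
  | zero => rw [zero_smul, pow_zero, ToricRing.xpow_zero K Φ.zero_mem_supp]
  | succ n ih =>
    obtain ⟨C, hC, h⟩ := hx
    rw [pow_succ, ← ih, succ_nsmul, ToricRing.xpow_mul_of_compat K]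
    refine ⟨C, hC, ?_, h⟩
    rw [Z2R_nsmul]
    exact (Φ.convex hC).2.2 _ h _ (Nat.cast_nonneg n)

namespace FanData

variable {d N : ℕ} {Φ : Fan d} (D : FanData Φ N) [hΦ : Nonempty Φ.cones] (K : Type) [Field K]

lemma xpow_mul_of_chain {x y : Fin d → ℤ} (hx : x ∈ Φ.supp) (hy : y ∈ Φ.supp)
    (h : D.car x ∪ D.car y ∈ D.chains) : xpow K Φ x * xpow K Φ y = xpow K Φ (x + y) :=
  ToricRing.xpow_mul_of_compat K (D.compat_of_chain hx hy h)

lemma car_sum_subset {G : Finset (Fin N)} (hG : G ∈ D.chains) (m : Fin N → ℕ) :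
    D.car (∑ v ∈ G, m v • D.a v) ⊆ G := fun v hv => by
  by_contra h
  rw [D.mem_car, (D.tau_sum hG m).2] at hv
  simp [h] at hv

lemma xpow_sum {G : Finset (Fin N)} (hG : G ∈ D.chains) (m : Fin N → ℕ) :
    xpow K Φ (∑ v ∈ G, m v • D.a v) = ∏ v ∈ G, xpow K Φ (D.a v) ^ m v := by
  induction G using Finset.induction_on with
  | empty => simp [ToricRing.xpow_zero K D.tau_zero.1]
  | insert v G hv ih =>
    have hG' := D.chains_down hG (Finset.subset_insert v G)
    have hv' : ({v} : Finset (Fin N)) ∈ D.chains := D.chains_down hG (by simp)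
    have h1 := D.tau_sum hv' m
    have h2 := D.car_sum_subset hv' m
    rw [Finset.sum_singleton] at h1 h2
    rw [Finset.sum_insert hv, Finset.prod_insert hv, ← ih hG', ← ToricRing.xpow_nsmul K (D.a_mem_supp v),
      D.xpow_mul_of_chain K h1.1 (D.tau_sum hG' m).1]
    refine D.chains_down hG (Finset.union_subset (h2.trans (by simp)) ?_)
    exact (D.car_sum_subset hG' m).trans (Finset.subset_insert v G)

lemma finiteType {d N : ℕ} {Φ : Fan d} (D : FanData Φ N) [hΦ : Nonempty Φ.cones] (K : Type) [Field K] :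
    Algebra.FiniteType K (ToricFaceRing K Φ) := by
  let B : Set (ToricFaceRing K Φ) := xpow K Φ '' (D.boxPts ∪ Set.range D.a)
  have hB : B.Finite := (D.boxPts_finite.union (Set.finite_range _)).image _
  refine ⟨⟨hB.toFinset, ?_⟩⟩
  rw [hB.coe_toFinset, ← Algebra.toSubmodule_eq_top, eq_top_iff, ← ToricRing.span_xpow K D.tau_zero.1,
    Submodule.span_le]
  rintro _ ⟨x, hx, rfl⟩
  rw [SetLike.mem_coe, Subalgebra.mem_toSubmodule]
  obtain ⟨b, m, hb, hm, hxb⟩ := D.exists_frac hx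
  have h1 := D.tau_sum (D.car_mem x) m
  rw [hxb, ← D.xpow_mul_of_chain K hb.1 h1.1, D.xpow_sum K (D.car_mem x)]
  · refine mul_mem (Algebra.subset_adjoin ⟨b, Or.inl hb, rfl⟩) (prod_mem fun v _ => pow_mem ?_ _)
    exact Algebra.subset_adjoin ⟨_, Or.inr ⟨v, rfl⟩, rfl⟩
  · refine D.chains_down (D.car_mem x) (Finset.union_subset (fun v hv => ?_)
      (D.car_sum_subset (D.car_mem x) m))
    rw [D.mem_car_iff_pos] at hv ⊢
    rw [hm]
    exact add_pos_of_pos_of_nonneg hv (Nat.cast_nonneg _)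

lemma isNoetherianRing {d N : ℕ} {Φ : Fan d} (D : FanData Φ N) [hΦ : Nonempty Φ.cones] (K : Type)
    [Field K] : IsNoetherianRing (ToricFaceRing K Φ) :=
  have := D.finiteType K
  Algebra.FiniteType.isNoetherianRing K _

end FanData

lemma ToricRing.exists_coeffs (K : Type) [Field K] {d : ℕ} {Φ : Fan d} (f : (Fin d → ℤ) → K)
    (hf : (Function.support f).Finite) (hs : Function.support f ⊆ Φ.supp) :
    ∃ x : ToricFaceRing K Φ, ∀ a, coeffs K Φ x a = f a := by
  refine ⟨∑ a ∈ hf.toFinset, f a • xpow K Φ a, fun b => ?_⟩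
  have h : ∀ a ∈ hf.toFinset, coeffs K Φ (f a • xpow K Φ a) b = if b = a then f a else 0 := by
    intro a ha
    rw [map_smul, coeffs_xpow K (hs (hf.mem_toFinset.1 ha)), Finsupp.smul_apply,
      Finsupp.single_apply]
    by_cases h : a = b
    · simp [h]
    · simp [h, Ne.symm h]
  rw [map_sum, Finsupp.finsetSum_apply, Finset.sum_congr rfl h, Finset.sum_ite_eq]
  split_ifs with h
  · rfl
  · rw [hf.mem_toFinset, Function.mem_support, not_not] at h
    exact h.symm

namespace FanData

variable {d N : ℕ} {Φ : Fan d} (D : FanData Φ N) (K : Type) [Field K]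

/-- The sum of the monomials of the interior points of the cones of dimension `l`. -/
def θ (l : ℕ) : ToricFaceRing K Φ := ∑ v with D.κ v = l, xpow K Φ (D.a v)

variable {K}

/-- Multiplication by `θ l` on leading coefficients. -/
def th (l : ℕ) (f : (Fin d → ℤ) → K) (c : Fin d → ℤ) : K :=
  ∑ v with D.κ v = l, if v ∈ D.car c ∧ 1 ≤ D.tau c v then f (c - D.a v) else 0

lemma th_congr {l : ℕ} {f g : (Fin d → ℤ) → K} {c : Fin d → ℤ}
    (h : ∀ v ∈ D.car c, D.κ v = l → 1 ≤ D.tau c v → f (c - D.a v) = g (c - D.a v)) :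
    D.th l f c = D.th l g c := by
  refine Finset.sum_congr rfl fun v hv => ?_
  split_ifs with h1
  · exact h v h1.1 (Finset.mem_filter.1 hv).2 h1.2
  · rfl

lemma th_eq_zero {l : ℕ} {f : (Fin d → ℤ) → K} {c : Fin d → ℤ}
    (h : ∀ v ∈ D.car c, D.κ v = l → 1 ≤ D.tau c v → f (c - D.a v) = 0) : D.th l f c = 0 := by
  refine Finset.sum_eq_zero fun v hv => ?_
  split_ifs with h1
  · exact h v h1.1 (Finset.mem_filter.1 hv).2 h1.2
  · rfl

lemma th_eq {l : ℕ} {f : (Fin d → ℤ) → K} {c : Fin d → ℤ} {v : Fin N} (hv : v ∈ D.car c)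
    (hl : D.κ v = l) (h : 1 ≤ D.tau c v) : D.th l f c = f (c - D.a v) := by
  rw [th, Finset.sum_eq_single_of_mem v (by simp [hl]), if_pos ⟨hv, h⟩]
  intro w hw hwv
  rw [if_neg]
  rintro ⟨h1, -⟩
  exact hwv (D.κ_injOn (D.car_mem c) (Finset.mem_coe.2 h1) (Finset.mem_coe.2 hv)
    ((Finset.mem_filter.1 hw).2.trans hl.symm))

lemma mem_supp_of_car {c : Fin d → ℤ} {v : Fin N} (h : v ∈ D.car c) : c ∈ Φ.supp := by
  by_contra hc
  rw [mem_car, tau, dif_neg hc] at h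
  exact h rfl

variable [hΦ : Nonempty Φ.cones] (K) {D}

namespace Level

variable (L : D.Level) (i : ℕ)

/-- The filtration of the toric face ring by levels. -/
def F (n : ℤ) : Submodule K (ToricFaceRing K Φ) where
  carrier := {x | ∀ a, ToricRing.coeffs K Φ x a ≠ 0 → n ≤ L.ω i a}
  zero_mem' := fun a h => absurd (by simp) h
  add_mem' := fun {x y} hx hy a h => by
    by_cases hxa : ToricRing.coeffs K Φ x a = 0
    · refine hy a fun h0 => h ?_
      rw [map_add, Finsupp.add_apply, hxa, h0, add_zero]
    · exact hx a hxa
  smul_mem' := fun c x hx a h => hx a fun h0 => h (by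
    rw [map_smul, Finsupp.smul_apply, h0, smul_zero])

lemma F_anti {n m : ℤ} (h : n ≤ m) : L.F K i m ≤ L.F K i n := fun _ hx a ha => h.trans (hx a ha)

lemma mem_F_of_nonpos {n : ℤ} (h : n ≤ 0) (x : ToricFaceRing K Φ) : x ∈ L.F K i n := fun _ ha =>
  h.trans (L.ω_nonneg i (ToricRing.coeffs_support K Φ.zero_mem_supp ha))

lemma xpow_mem_F {n : ℤ} {a : Fin d → ℤ} (h : n ≤ L.ω i a) : xpow K Φ a ∈ L.F K i n := by
  by_cases ha : a ∈ Φ.supp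
  · intro b hb
    rw [ToricRing.coeffs_xpow K ha, Finsupp.single_apply] at hb
    rwa [show b = a by by_contra h; exact hb (if_neg (Ne.symm h))]
  · rw [ToricRing.xpow_of_notMem K ha]; exact zero_mem _

lemma mul_mem_F {n m : ℤ} {x y : ToricFaceRing K Φ} (hx : x ∈ L.F K i n) (hy : y ∈ L.F K i m) :
    x * y ∈ L.F K i (n + m) := by
  rw [ToricRing.eq_sum_coeffs K Φ.zero_mem_supp x, ToricRing.eq_sum_coeffs K Φ.zero_mem_supp y,
    Finsupp.sum, Finsupp.sum, ToricRing.sum_mul]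
  refine Submodule.sum_mem _ fun a ha => ?_
  rw [ToricRing.mul_sum]
  refine Submodule.sum_mem _ fun b hb => ?_
  rw [smul_mul_smul_comm]
  refine Submodule.smul_mem _ _ ?_
  by_cases h : Φ.Compat a b
  · rw [ToricRing.xpow_mul_of_compat K h]
    refine L.xpow_mem_F K i (le_trans ?_ (L.ω_add_le i h))
    exact add_le_add (hx a (Finsupp.mem_support_iff.1 ha)) (hy b (Finsupp.mem_support_iff.1 hb))
  · rw [ToricRing.xpow_mul_of_not_compat K h]; exact zero_mem _

lemma θ_mem_F {l : ℕ} (h : i ≤ l) : D.θ K l ∈ L.F K i (L.W l) := by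
  refine Submodule.sum_mem _ fun v hv => L.xpow_mem_F K i ?_
  have hv' := (Finset.mem_filter.1 hv).2
  rw [L.ω_a (hv'.symm ▸ h), hv']

/-- Elements of level `n` without coefficients of level exactly `n` lie one level higher. -/
lemma mem_F_succ {n : ℤ} {x : ToricFaceRing K Φ} (hx : x ∈ L.F K i n)
    (h : ∀ a ∈ Φ.supp, L.ω i a = n → ToricRing.coeffs K Φ x a = 0) : x ∈ L.F K i (n + 1) := by
  intro a ha
  have h1 := hx a ha
  have h2 : L.ω i a ≠ n := fun h' => ha (h a (ToricRing.coeffs_support K Φ.zero_mem_supp ha) h')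
  omega

lemma coeffs_eq_zero {n : ℤ} {x : ToricFaceRing K Φ} (hx : x ∈ L.F K i n) {a : Fin d → ℤ}
    (h : L.ω i a < n) : ToricRing.coeffs K Φ x a = 0 := by
  by_contra h'
  exact absurd (hx a h') (not_le.2 h)

lemma ω_sub_a {c : Fin d → ℤ} (hc : c ∈ Φ.supp) {v : Fin N} (h : 1 ≤ D.tau c v) (hv : i ≤ D.κ v) :
    L.ω i (c - D.a v) = L.ω i c - L.W (D.κ v) := by
  obtain ⟨h1, h2⟩ := D.tau_sub_a hc h
  have := L.ω_add_eq i h1 (D.a_mem_supp v) hc (by rw [h2, D.tau_a, sub_add_cancel])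
  rw [this, L.ω_a hv]; ring

lemma coeffs_xpow_mul_xpow {v : Fin N} (hv : i ≤ D.κ v) {b c : Fin d → ℤ} (hb : b ∈ Φ.supp)
    (hc : c ∈ Φ.supp) (h : L.ω i c ≤ L.ω i b + L.W (D.κ v)) :
    ToricRing.coeffs K Φ (xpow K Φ (D.a v) * xpow K Φ b) c =
      if v ∈ D.car c ∧ 1 ≤ D.tau c v ∧ b = c - D.a v then 1 else 0 := by
  by_cases hcomp : Φ.Compat (D.a v) b
  · rw [ToricRing.xpow_mul_of_compat K hcomp, ToricRing.coeffs_xpow K hcomp.add_mem,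
      Finsupp.single_apply]
    refine if_congr ⟨fun e => ?_, fun e => ?_⟩ rfl rfl
    · have hch : D.car (D.a v) ∪ D.car b ∈ D.chains := by
        rw [D.car_a]
        by_contra hn
        have : ∃ w ∈ D.car b, D.Incomp v w := by
          by_contra hn'
          push Not at hn'
          refine hn fun x hx y hy => ?_
          simp only [Finset.mem_union, Finset.mem_singleton] at hx hy
          have key : ∀ w ∈ D.car b, D.e v ⊆ D.e w ∨ D.e w ⊆ D.e v := fun w hw => by
            by_contra h'
            push Not at h'
            exact hn' w hw h'
          rcases hx with rfl | hx <;> rcases hy with rfl | hy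
          · exact Or.inl subset_rfl
          · exact key y hy
          · exact (key x hx).symm
          · exact D.car_mem b x hx y hy
        obtain ⟨w, hw, hvw⟩ := this
        have := L.ω_add_lt i hcomp (v := v) (w := w) (by rw [D.car_a]; simp) hw hvw (Or.inl hv)
        rw [e, L.ω_a hv] at this
        omega
      obtain ⟨-, ht⟩ := D.tau_add (D.a_mem_supp v) hb hch
      rw [e, D.tau_a] at ht
      have h1 : 1 ≤ D.tau c v := by
        rw [ht]
        simpa using D.tau_nonneg b v
      exact ⟨D.mem_car_iff_pos.2 (by linarith), h1, by rw [← e]; simp⟩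
    · rw [e.2.2]; simp
  · rw [ToricRing.xpow_mul_of_not_compat K hcomp, if_neg, map_zero, Finsupp.zero_apply]
    rintro ⟨h1, h2, rfl⟩
    refine hcomp (D.compat_of_chain (D.a_mem_supp v) hb (D.chains_down (D.car_mem c) ?_))
    rw [D.car_a]
    refine Finset.union_subset (by simpa using h1) fun w hw => ?_
    rw [D.mem_car_iff_pos, (D.tau_sub_a hc h2).2, Pi.sub_apply] at hw
    rw [D.mem_car_iff_pos]
    have : (0 : ℝ) ≤ (Pi.single v 1 : Fin N → ℝ) w := by
      by_cases h : w = v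
      · subst h; simp
      · simp [h]
    linarith

/-- The leading coefficients of a multiple of `θ l`. -/
lemma coeffs_θ_mul {n : ℤ} {l : ℕ} (hl : i ≤ l) {x : ToricFaceRing K Φ} (hx : x ∈ L.F K i n)
    {c : Fin d → ℤ} (hc : c ∈ Φ.supp) (h : L.ω i c = n + L.W l) :
    ToricRing.coeffs K Φ (D.θ K l * x) c = D.th l (ToricRing.coeffs K Φ x) c := by
  rw [θ, ToricRing.sum_mul, map_sum, Finsupp.finsetSum_apply, th]
  refine Finset.sum_congr rfl fun v hv => ?_
  have hv' := (Finset.mem_filter.1 hv).2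
  have key : ∀ b ∈ (ToricRing.coeffs K Φ x).support,
      ToricRing.coeffs K Φ (ToricRing.coeffs K Φ x b • (xpow K Φ (D.a v) * xpow K Φ b)) c =
        if c - D.a v = b then
          (if v ∈ D.car c ∧ 1 ≤ D.tau c v then ToricRing.coeffs K Φ x b else 0) else 0 := by
    intro b hb
    have hb' := Finsupp.mem_support_iff.1 hb
    rw [map_smul, Finsupp.smul_apply, L.coeffs_xpow_mul_xpow K i (hv'.symm ▸ hl)
      (ToricRing.coeffs_support K Φ.zero_mem_supp hb') hc (by rw [hv', h]; linarith [hx b hb'])]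
    by_cases h1 : c - D.a v = b
    · simp only [h1, and_true, if_true]
      split_ifs <;> simp
    · rw [if_neg fun h2 => h1 h2.2.2.symm, if_neg h1, smul_zero]
  conv_lhs => rw [ToricRing.eq_sum_coeffs K Φ.zero_mem_supp x]
  rw [Finsupp.sum, ToricRing.mul_sum]
  simp only [mul_smul_comm]
  rw [map_sum, Finsupp.finsetSum_apply, Finset.sum_congr rfl key, Finset.sum_ite_eq]
  by_cases h1 : c - D.a v ∈ (ToricRing.coeffs K Φ x).support
  · rw [if_pos h1]
  · rw [if_neg h1]
    rw [Finsupp.mem_support_iff, not_not] at h1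
    rw [h1, ite_self]

/-- Combinations of the `θ l` with coefficients in prescribed levels. -/
def J (S : Finset ℕ) (n : ℤ) : Submodule K (ToricFaceRing K Φ) where
  carrier := {x | ∃ y : ℕ → ToricFaceRing K Φ, (∀ l ∈ S, y l ∈ L.F K i (n - L.W l)) ∧
    x = ∑ l ∈ S, D.θ K l * y l}
  zero_mem' := ⟨0, fun _ _ => zero_mem _, by simp⟩
  add_mem' := by
    rintro _ _ ⟨y, hy, rfl⟩ ⟨z, hz, rfl⟩
    exact ⟨y + z, fun l hl => add_mem (hy l hl) (hz l hl), by
      simp [mul_add, Finset.sum_add_distrib]⟩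
  smul_mem' := by
    rintro c _ ⟨y, hy, rfl⟩
    exact ⟨c • y, fun l hl => Submodule.smul_mem _ _ (hy l hl), by simp [Finset.smul_sum]⟩

variable {i}

lemma J_anti {S : Finset ℕ} {n m : ℤ} (h : n ≤ m) : L.J K i S m ≤ L.J K i S n := by
  rintro _ ⟨y, hy, rfl⟩
  exact ⟨y, fun l hl => L.F_anti K i (by omega) (hy l hl), rfl⟩

lemma J_mono {S T : Finset ℕ} (h : S ⊆ T) (n : ℤ) : L.J K i S n ≤ L.J K i T n := by
  rintro _ ⟨y, hy, rfl⟩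
  refine ⟨fun l => if l ∈ S then y l else 0, fun l hl => ?_, ?_⟩
  · by_cases h : l ∈ S
    · simpa [h] using hy l h
    · simp [h]
  · simp only [mul_ite, mul_zero, Finset.sum_ite_mem]
    rw [Finset.inter_eq_right.2 h]

lemma J_le_F {S : Finset ℕ} (hS : ∀ l ∈ S, i ≤ l) (n : ℤ) : L.J K i S n ≤ L.F K i n := by
  rintro _ ⟨y, hy, rfl⟩
  refine Submodule.sum_mem _ fun l hl => ?_
  have := L.mul_mem_F K i (L.θ_mem_F K i (hS l hl)) (hy l hl)
  rwa [add_sub_cancel] at this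

lemma mul_mem_J {S : Finset ℕ} {n m : ℤ} {x y : ToricFaceRing K Φ} (hx : x ∈ L.F K i m)
    (hy : y ∈ L.J K i S n) : x * y ∈ L.J K i S (m + n) := by
  obtain ⟨z, hz, rfl⟩ := hy
  refine ⟨fun l => x * z l, fun l hl => ?_, by rw [ToricRing.mul_sum]; simp only [mul_left_comm]⟩
  have := L.mul_mem_F K i hx (hz l hl)
  rwa [← add_sub_assoc] at this

lemma θ_mul_mem_J {S : Finset ℕ} {n : ℤ} {l : ℕ} (hl : l ∈ S) {x : ToricFaceRing K Φ}
    (hx : x ∈ L.F K i (n - L.W l)) : D.θ K l * x ∈ L.J K i S n := by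
  refine ⟨Pi.single l x, fun l' hl' => ?_, ?_⟩
  · by_cases h : l' = l
    · subst h; simpa using hx
    · simp [h]
  · rw [Finset.sum_eq_single_of_mem l hl]
    · simp
    · intro b _ hb; simp [hb]

end Level

end FanData

lemma ToricRing.sub_mem (K : Type) [Field K] {d : ℕ} {Φ : Fan d}
    {p : Submodule K (ToricFaceRing K Φ)} {x y : ToricFaceRing K Φ} (hx : x ∈ p) (hy : y ∈ p) :
    x - y ∈ p := by
  have h := p.add_mem hx (p.smul_mem (-1 : K) hy)
  have e : (-1 : K) • y = -y := by rw [Algebra.smul_def, map_neg, map_one, neg_one_mul]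
  rwa [e, ← sub_eq_add_neg] at h

namespace FanData

variable {d N : ℕ} {Φ : Fan d} (D : FanData Φ N)

/-- The lattice point obtained from `p` by adding the interior points along `G`. -/
def ext (p : Fin d → ℤ) (G : Finset (Fin N)) : Fin d → ℤ := p + ∑ v ∈ G \ D.car p, D.a v

lemma ext_sub {p : Fin d → ℤ} {G : Finset (Fin N)} {v : Fin N} (hv : v ∈ G) (hp : v ∉ D.car p) :
    D.ext p G - D.a v = D.ext p (G.erase v) := by
  have : (G.erase v) \ D.car p = (G \ D.car p).erase v := Finset.erase_sdiff_comm G (D.car p) v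
  rw [ext, ext, this, ← Finset.add_sum_erase _ _ (Finset.mem_sdiff.2 ⟨hv, hp⟩)]
  abel

lemma erase_eq_colErase {G : Finset (Fin N)} (hG : G ∈ D.chains) {v : Fin N} (hv : v ∈ G) :
    G.erase v = colErase D.κ (D.κ v) G := by
  ext w
  rw [Finset.mem_erase, mem_colErase]
  constructor
  · rintro ⟨h1, h2⟩; exact ⟨h2, fun he => h1 (D.κ_injOn hG h2 hv he)⟩
  · rintro ⟨h1, h2⟩; exact ⟨by rintro rfl; exact h2 rfl, h1⟩

variable [hΦ : Nonempty Φ.cones]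

section

variable {p : Fin d → ℤ} (hp : p ∈ Φ.supp) {G : Finset (Fin N)} (hG : G ∈ D.chains)
  (hpG : D.car p ⊆ G)

lemma tau_ext (hp : p ∈ Φ.supp) (hG : G ∈ D.chains) (hpG : D.car p ⊆ G) :
    D.ext p G ∈ Φ.supp ∧
      D.tau (D.ext p G) = fun v => D.tau p v + if v ∈ G \ D.car p then 1 else 0 := by
  have h1 := D.tau_sum_a (D.chains_down hG (Finset.sdiff_subset (s := G) (t := D.car p)))
  have h2 : D.car (∑ v ∈ G \ D.car p, D.a v) ⊆ G := fun v hv => by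
    by_contra h
    rw [D.mem_car, h1.2] at hv
    simp [h] at hv
  obtain ⟨h3, h4⟩ := D.tau_add hp h1.1 (D.chains_down hG (Finset.union_subset hpG h2))
  exact ⟨h3, by rw [ext, h4, h1.2]; rfl⟩

lemma car_ext (hp : p ∈ Φ.supp) (hG : G ∈ D.chains) (hpG : D.car p ⊆ G) :
    D.car (D.ext p G) = G := by
  ext v
  rw [D.mem_car_iff_pos, (D.tau_ext hp hG hpG).2]
  have h0 := D.tau_nonneg p v
  by_cases hv : v ∈ D.car p
  · simp only [Finset.mem_sdiff, hv, not_true, and_false, if_false, add_zero, hpG hv, iff_true]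
    exact D.mem_car_iff_pos.1 hv
  · simp only [Finset.mem_sdiff, hv, not_false_eq_true, and_true]
    rw [D.mem_car, not_not] at hv
    rw [hv]
    split_ifs with h <;> simp [h]

lemma tau_ext_of_notMem (hp : p ∈ Φ.supp) (hG : G ∈ D.chains) (hpG : D.car p ⊆ G) {v : Fin N}
    (hv : v ∈ G) (hvp : v ∉ D.car p) : D.tau (D.ext p G) v = 1 := by
  rw [(D.tau_ext hp hG hpG).2]
  have : D.tau p v = 0 := by rwa [D.mem_car, not_not] at hvp
  simp [this, hv, hvp]

end

/-- The extensions of `p` along chains with the additional colours `T`. -/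
def grp (p : Fin d → ℤ) (T : Finset ℕ) : Set (Fin d → ℤ) :=
  {b | ∃ G ∈ D.chains, D.car p ⊆ G ∧ G.image D.κ = (D.car p).image D.κ ∪ T ∧ b = D.ext p G}

lemma grp_finite (p : Fin d → ℤ) (T : Finset ℕ) : (D.grp p T).Finite :=
  (Set.finite_range (D.ext p)).subset (by rintro _ ⟨G, -, -, -, rfl⟩; exact ⟨G, rfl⟩)

lemma sdiff_image {F G : Finset (Fin N)} {T : Finset ℕ} (hG : G ∈ D.chains) (hF : F ⊆ G)
    (hT : Disjoint T (F.image D.κ)) (h : G.image D.κ = F.image D.κ ∪ T) :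
    (G \ F).image D.κ = T := by
  ext c
  simp only [Finset.mem_image, Finset.mem_sdiff]
  constructor
  · rintro ⟨v, ⟨h1, h2⟩, rfl⟩
    have := Finset.mem_image_of_mem D.κ h1
    rw [h, Finset.mem_union] at this
    refine this.resolve_left fun h3 => h2 ?_
    obtain ⟨w, hw, hwv⟩ := Finset.mem_image.1 h3
    rwa [← D.κ_injOn hG (hF hw) h1 hwv]
  · intro hc
    have : c ∈ G.image D.κ := h ▸ Finset.mem_union_right _ hc
    obtain ⟨v, hv, rfl⟩ := Finset.mem_image.1 this
    exact ⟨v, ⟨hv, fun h3 => Finset.disjoint_left.1 hT hc (Finset.mem_image_of_mem _ h3)⟩, rfl⟩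

variable {K : Type} [Field K] {D}

lemma th_grp {p : Fin d → ℤ} (hp : p ∈ Φ.supp) {T : Finset ℕ}
    (hT : Disjoint T ((D.car p).image D.κ)) {l : ℕ} (hl : l ∈ T) (y : Finset (Fin N) → K)
    (b : Fin d → ℤ) :
    D.th l (fun b => if b ∈ D.grp p (T.erase l) then y (D.car b) else 0) b =
      if b ∈ D.grp p T then y (colErase D.κ l (D.car b)) else 0 := by
  have hlp : l ∉ (D.car p).image D.κ := Finset.disjoint_left.1 hT hl
  split_ifs with hb
  · obtain ⟨G, hG, hpG, hGT, rfl⟩ := hb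
    have hlG : l ∈ G.image D.κ := by rw [hGT]; exact Finset.mem_union_right _ hl
    obtain ⟨v, hv, rfl⟩ := Finset.mem_image.1 hlG
    have hvp : v ∉ D.car p := fun h => hlp (Finset.mem_image_of_mem _ h)
    have hpG' : D.car p ⊆ G.erase v := fun w hw =>
      Finset.mem_erase.2 ⟨fun h => hvp (h ▸ hw), hpG hw⟩
    have hG' := D.chains_down hG (Finset.erase_subset v G)
    rw [D.th_eq (v := v) (by rwa [D.car_ext hp hG hpG]) rfl
      (D.tau_ext_of_notMem hp hG hpG hv hvp).ge, D.ext_sub hv hvp, if_pos,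
      D.car_ext hp hG' hpG', D.car_ext hp hG hpG, D.erase_eq_colErase hG hv]
    refine ⟨G.erase v, hG', hpG', ?_, rfl⟩
    rw [D.erase_eq_colErase hG hv, colErase_image, hGT, Finset.erase_union_distrib,
      Finset.erase_eq_of_notMem hlp]
  · refine D.th_eq_zero fun v hv hvl h1 => if_neg fun hmem => hb ?_
    obtain ⟨G, hG, hpG, hGT, he⟩ := hmem
    have hbs := D.mem_supp_of_car hv
    have hvG : v ∉ G := fun h => by
      have : l ∈ G.image D.κ := hvl ▸ Finset.mem_image_of_mem _ h
      rw [hGT, Finset.mem_union] at this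
      exact this.elim hlp (by simp)
    have hvp : v ∉ D.car p := fun h => hvG (hpG h)
    have hcar : D.car b = insert v G := by
      have := D.car_eq_union (x := b - D.a v) (y := D.a v) (z := b) (by
        rw [(D.tau_sub_a hbs h1).2, D.tau_a, sub_add_cancel])
      rw [this, he, D.car_ext hp hG hpG, D.car_a, Finset.union_comm, ← Finset.insert_eq]
    refine ⟨insert v G, hcar ▸ D.car_mem b, hpG.trans (Finset.subset_insert v G), ?_, ?_⟩
    · rw [Finset.image_insert, hGT, hvl, ← Finset.union_insert, Finset.insert_erase hl]
    · have := D.ext_sub (p := p) (Finset.mem_insert_self v G) hvp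
      rw [Finset.erase_insert hvG, ← he] at this
      exact (sub_left_injective this).symm

variable (K)

namespace Level

variable (L : D.Level) {i : ℕ}

lemma ω_ext {p : Fin d → ℤ} (hp : p ∈ Φ.supp) {G : Finset (Fin N)} (hG : G ∈ D.chains)
    (hpG : D.car p ⊆ G) {T : Finset ℕ} (hT : Disjoint T ((D.car p).image D.κ))
    (hGT : G.image D.κ = (D.car p).image D.κ ∪ T) (hi : ∀ l ∈ T, i ≤ l) :
    L.ω i (D.ext p G) = L.ω i p + ∑ l ∈ T, L.W l := by
  have h1 := D.sdiff_image hG hpG hT hGT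
  have h2 : Set.InjOn D.κ (G \ D.car p : Finset (Fin N)) :=
    (D.κ_injOn hG).mono (by exact_mod_cast Finset.sdiff_subset)
  have h3 := D.tau_ext hp hG hpG
  have : (L.ω i (D.ext p G) : ℝ) = L.ω i p + ∑ l ∈ T, (L.W l : ℝ) := by
    rw [L.ω_eq i _ h3.1, L.ω_eq i p hp, h3.2, ← h1, Finset.sum_image h2]
    simp only [mul_add, Finset.sum_add_distrib, mul_ite, mul_one, mul_zero, Finset.sum_ite_mem,
      Finset.univ_inter]
    congr 1
    refine Finset.sum_congr rfl fun v hv => ?_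
    rw [truncWt, if_pos (hi _ (h1 ▸ Finset.mem_image_of_mem _ hv))]
  exact_mod_cast this

lemma mem_sup_of_coeffs {S : Finset ℕ} (hS : ∀ l ∈ S, i ≤ l) {n : ℤ} {x : ToricFaceRing K Φ}
    (hx : x ∈ L.F K i n) (z : ℕ → ToricFaceRing K Φ) (hz : ∀ l ∈ S, z l ∈ L.F K i (n - L.W l))
    (h : ∀ b ∈ Φ.supp, L.ω i b = n → ToricRing.coeffs K Φ x b =
      ∑ l ∈ S, D.th l (ToricRing.coeffs K Φ (z l)) b) : x ∈ L.J K i S n ⊔ L.F K i (n + 1) := by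
  have hJ : ∑ l ∈ S, D.θ K l * z l ∈ L.J K i S n := ⟨z, hz, rfl⟩
  rw [← add_sub_cancel (∑ l ∈ S, D.θ K l * z l) x]
  refine Submodule.add_mem_sup hJ (L.mem_F_succ K i (ToricRing.sub_mem K hx (L.J_le_F K hS n hJ))
    fun b hb hbn => ?_)
  rw [map_sub, Finsupp.sub_apply, h b hb hbn, map_sum, Finsupp.finsetSum_apply, sub_eq_zero]
  refine Finset.sum_congr rfl fun l hl => ?_
  rw [L.coeffs_θ_mul K i (hS l hl) (hz l hl) hb (by rw [hbn]; ring)]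

lemma coeffs_of_mem_sup {S : Finset ℕ} (hS : ∀ l ∈ S, i ≤ l) {n : ℤ} {x : ToricFaceRing K Φ}
    (hx : x ∈ L.J K i S n ⊔ L.F K i (n + 1)) :
    ∃ z : ℕ → ToricFaceRing K Φ, (∀ l ∈ S, z l ∈ L.F K i (n - L.W l)) ∧
      ∀ b ∈ Φ.supp, L.ω i b = n → ToricRing.coeffs K Φ x b =
        ∑ l ∈ S, D.th l (ToricRing.coeffs K Φ (z l)) b := by
  obtain ⟨_, ⟨z, hz, rfl⟩, w, hw, rfl⟩ := Submodule.mem_sup.1 hx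
  refine ⟨z, hz, fun b hb hbn => ?_⟩
  rw [map_add, Finsupp.add_apply, L.coeffs_eq_zero K i hw (by omega), add_zero, map_sum,
    Finsupp.finsetSum_apply]
  refine Finset.sum_congr rfl fun l hl => ?_
  rw [L.coeffs_θ_mul K i (hS l hl) (hz l hl) hb (by rw [hbn]; ring)]

/-- Combinatorial solutions on a group of lattice points give ring elements. -/
lemma grp_mem_sup {p : Fin d → ℤ} (hp : p ∈ Φ.supp) {T S : Finset ℕ} (hTS : T ⊆ S)
    (hT : Disjoint T ((D.car p).image D.κ)) (hS : ∀ l ∈ S, i ≤ l) {n : ℤ}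
    (hn : L.ω i p + ∑ l ∈ T, L.W l = n) (y : ℕ → Finset (Fin N) → K) {x : ToricFaceRing K Φ}
    (hx : ∀ b, ToricRing.coeffs K Φ x b =
      if b ∈ D.grp p T then ∑ l ∈ T, y l (colErase D.κ l (D.car b)) else 0) :
    x ∈ L.J K i S n ⊔ L.F K i (n + 1) := by
  have hω : ∀ T' ⊆ T, ∀ b ∈ D.grp p T', b ∈ Φ.supp ∧ L.ω i b = L.ω i p + ∑ l ∈ T', L.W l := by
    rintro T' hT' _ ⟨G, hG, hpG, hGT, rfl⟩
    exact ⟨(D.tau_ext hp hG hpG).1, L.ω_ext hp hG hpG (Finset.disjoint_of_subset_left hT' hT) hGT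
      fun l hl => hS l (hTS (hT' hl))⟩
  have hex : ∀ l, ∃ z : ToricFaceRing K Φ, ∀ b, ToricRing.coeffs K Φ z b =
      if b ∈ D.grp p (T.erase l) then y l (D.car b) else 0 := fun l => by
    have hs : (Function.support fun b => if b ∈ D.grp p (T.erase l) then y l (D.car b) else 0) ⊆
        D.grp p (T.erase l) := fun b hb => by
      by_contra h
      exact hb (if_neg h)
    exact ToricRing.exists_coeffs K _ ((D.grp_finite p _).subset hs) fun b hb =>
      (hω _ (Finset.erase_subset l T) b (hs hb)).1
  choose z hz using hex
  refine sup_le_sup_right (L.J_mono K hTS n) _ (L.mem_sup_of_coeffs K (fun l hl => hS l (hTS hl))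
    (fun b hb => ?_) z (fun l hl b hb => ?_) fun b hb hbn => ?_)
  · rw [hx] at hb
    rw [(hω T subset_rfl b (by by_contra h; exact hb (if_neg h))).2, hn]
  · rw [hz] at hb
    rw [(hω _ (Finset.erase_subset l T) b (by by_contra h; exact hb (if_neg h))).2, ← hn,
      ← Finset.add_sum_erase T _ hl]
    linarith
  · rw [hx]
    have : ∀ l ∈ T, D.th l (ToricRing.coeffs K Φ (z l)) b =
        if b ∈ D.grp p T then y l (colErase D.κ l (D.car b)) else 0 := fun l hl => by
      rw [← D.th_grp hp hT hl]
      exact D.th_congr fun v _ _ _ => hz l _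
    rw [Finset.sum_congr rfl this]
    split_ifs <;> simp

end Level

end FanData

namespace FanData

variable {d N : ℕ} {Φ : Fan d} {D : FanData Φ N} [hΦ : Nonempty Φ.cones]

/-- Removing interior points with coordinate one from a lattice point. -/
lemma mem_grp_sub {a : Fin d → ℤ} (ha : a ∈ Φ.supp) {R : Finset (Fin N)} (hR : R ⊆ D.car a)
    (h1 : ∀ v ∈ R, D.tau a v = 1) :
    ∃ p ∈ Φ.supp, D.car p = D.car a \ R ∧ (∀ v ∈ D.car p, D.tau p v = D.tau a v) ∧
      Disjoint (R.image D.κ) ((D.car p).image D.κ) ∧ a ∈ D.grp p (R.image D.κ) := by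
  obtain ⟨hs, ht⟩ := D.tau_sum_a (D.chains_down (D.car_mem a) hR)
  obtain ⟨hp, hpt⟩ := D.tau_sub_of_le ha hs fun v => by
    rw [ht]
    dsimp only
    split_ifs with h
    · rw [h1 v h]
    · exact D.tau_nonneg a v
  have hcar : D.car (a - ∑ v ∈ R, D.a v) = D.car a \ R := by
    ext v
    rw [D.mem_car, Finset.mem_sdiff, D.mem_car, hpt, ht, Pi.sub_apply]
    by_cases h : v ∈ R
    · simp [h, h1 v h]
    · simp [h]
  have hdiff : D.car a \ (D.car a \ R) = R := by
    rw [sdiff_sdiff_right_self, Finset.inf_eq_inter, Finset.inter_eq_right.2 hR]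
  refine ⟨_, hp, hcar, fun v hv => ?_, ?_, D.car a, D.car_mem a, ?_, ?_, ?_⟩
  · rw [hcar, Finset.mem_sdiff] at hv
    rw [hpt, ht, Pi.sub_apply, if_neg hv.2, sub_zero]
  · rw [hcar, Finset.disjoint_left]
    intro c hc hc'
    obtain ⟨v, hv, rfl⟩ := Finset.mem_image.1 hc
    obtain ⟨w, hw, hwv⟩ := Finset.mem_image.1 hc'
    rw [Finset.mem_sdiff] at hw
    exact hw.2 (D.κ_injOn (D.car_mem a) hw.1 (hR hv) hwv ▸ hv)
  · rw [hcar]; exact Finset.sdiff_subset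
  · rw [hcar, ← Finset.image_union, Finset.sdiff_union_of_subset hR]
  · rw [ext, hcar, hdiff, sub_add_cancel]

lemma tau_add_a {b : Fin d → ℤ} (hb : b ∈ Φ.supp) {v : Fin N} (hv : v ∈ D.car b) :
    b + D.a v ∈ Φ.supp ∧ D.tau (b + D.a v) = D.tau b + Pi.single v 1 ∧
      D.car (b + D.a v) = D.car b := by
  have hu : D.car b ∪ D.car (D.a v) = D.car b := by
    rw [D.car_a, Finset.union_eq_left, Finset.singleton_subset_iff]; exact hv
  obtain ⟨h1, h2⟩ := D.tau_add hb (D.a_mem_supp v) (hu.symm ▸ D.car_mem b)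
  refine ⟨h1, by rw [h2, D.tau_a], by rw [D.car_eq_union h2, hu]⟩

namespace Level

variable (K : Type) [Field K] (L : D.Level) {i : ℕ}

lemma piece_large {S : Finset ℕ} (hS : ∀ l ∈ S, i ≤ l) {n : ℤ} {a : Fin d → ℤ} (ha : a ∈ Φ.supp)
    (han : L.ω i a = n) {v : Fin N} (hv : D.κ v ∈ S) (h1 : 1 < D.tau a v) (c : K) :
    ∃ q ∈ L.J K i S n, ∀ b ∈ Φ.supp, L.ω i b = n →
      ToricRing.coeffs K Φ q b = if b = a then c else 0 := by
  obtain ⟨hm, ht⟩ := D.tau_sub_a ha h1.le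
  have hF : c • xpow K Φ (a - D.a v) ∈ L.F K i (n - L.W (D.κ v)) :=
    Submodule.smul_mem _ _ (L.xpow_mem_F K i (by rw [L.ω_sub_a i ha h1.le (hS _ hv), han]))
  refine ⟨_, L.θ_mul_mem_J K hv hF, fun b hb hbn => ?_⟩
  rw [L.coeffs_θ_mul K i (hS _ hv) hF hb (by rw [hbn]; ring), map_smul, ToricRing.coeffs_xpow K hm]
  have hvm : v ∈ D.car (a - D.a v) := by
    rw [D.mem_car_iff_pos, ht]
    simpa using h1
  split_ifs with hba
  · subst hba
    rw [D.th_eq (v := v) (D.mem_car_iff_pos.2 (by linarith)) rfl h1.le]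
    simp
  · refine D.th_eq_zero fun w hw hwv hw1 => ?_
    rw [Finsupp.smul_apply, Finsupp.single_apply, if_neg, smul_zero]
    intro he
    have hvb : v ∈ D.car b := by
      have h2 := (D.tau_sub_a hb hw1).2
      rw [← he] at h2
      rw [D.mem_car_iff_pos, h2, Pi.sub_apply] at hvm
      rw [D.mem_car_iff_pos]
      have : (0 : ℝ) ≤ (Pi.single w 1 : Fin N → ℝ) v := by
        by_cases h : v = w
        · subst h; simp
        · simp [h]
      linarith
    have hwv' : w = v := D.κ_injOn (D.car_mem b) hw hvb hwv
    subst hwv'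
    exact hba (sub_left_injective he).symm

/-- The part supported on lattice points involving the colour `j`. -/
lemma piece_color {S : Finset ℕ} (hS : ∀ l ∈ S, i ≤ l) {j : ℕ} (hij : i ≤ j) (hj : j ∉ S) {n : ℤ}
    {u : ToricFaceRing K Φ} (hu : u ∈ L.F K i n) (g : ℕ → ToricFaceRing K Φ)
    (hg : ∀ l ∈ S, g l ∈ L.F K i (n + L.W j - L.W l))
    (hE : ∀ c ∈ Φ.supp, L.ω i c = n + L.W j → D.th j (ToricRing.coeffs K Φ u) c =
      ∑ l ∈ S, D.th l (ToricRing.coeffs K Φ (g l)) c) :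
    ∃ q ∈ L.J K i S n ⊔ L.F K i (n + 1), ∀ b, ToricRing.coeffs K Φ q b =
      if ∃ v ∈ D.car b, D.κ v = j then ToricRing.coeffs K Φ u b else 0 := by
  have hsupp : ∀ (x : ToricFaceRing K Φ) {a}, ToricRing.coeffs K Φ x a ≠ 0 → a ∈ Φ.supp :=
    fun x a h => ToricRing.coeffs_support K Φ.zero_mem_supp h
  obtain ⟨q, hq⟩ := ToricRing.exists_coeffs K (Φ := Φ)
    (fun b => if ∃ v ∈ D.car b, D.κ v = j then ToricRing.coeffs K Φ u b else 0)
    ((ToricRing.coeffs K Φ u).hasFiniteSupport.subset fun b hb => by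
      rw [Function.mem_support] at hb ⊢
      exact fun h => hb (by rw [h, ite_self]))
    fun b hb => hsupp u fun h => hb (by simp only [h, ite_self])
  set f : ℕ → (Fin d → ℤ) → K := fun l b => ∑ v with D.κ v = j,
    if v ∈ D.car b then ToricRing.coeffs K Φ (g l) (b + D.a v) else 0 with hf
  have hf1 : ∀ l b v, v ∈ D.car b → D.κ v = j →
      f l b = ToricRing.coeffs K Φ (g l) (b + D.a v) := by
    intro l b v hv hvj
    simp only [hf]
    rw [Finset.sum_eq_single_of_mem v (by simp [hvj]), if_pos hv]
    intro w hw hwv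
    refine if_neg fun hw' => hwv ?_
    exact D.κ_injOn (D.car_mem b) hw' hv ((Finset.mem_filter.1 hw).2.trans hvj.symm)
  have hf0 : ∀ l b, f l b ≠ 0 → ∃ v ∈ D.car b, D.κ v = j ∧
      ToricRing.coeffs K Φ (g l) (b + D.a v) ≠ 0 := by
    intro l b h
    obtain ⟨v, hv, h'⟩ := Finset.exists_ne_zero_of_sum_ne_zero h
    have hvb : v ∈ D.car b := by by_contra h0; exact h' (if_neg h0)
    rw [if_pos hvb] at h'
    exact ⟨v, hvb, (Finset.mem_filter.1 hv).2, h'⟩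
  have hz : ∀ l, ∃ z : ToricFaceRing K Φ, ∀ b, ToricRing.coeffs K Φ z b = f l b := by
    intro l
    refine ToricRing.exists_coeffs K _ ?_ fun b hb => ?_
    · refine (Set.finite_iUnion fun v : Fin N =>
        ((ToricRing.coeffs K Φ (g l)).hasFiniteSupport.image fun c => c - D.a v)).subset ?_
      intro b hb
      obtain ⟨v, -, -, h⟩ := hf0 l b hb
      exact Set.mem_iUnion.2 ⟨v, b + D.a v, h, add_sub_cancel_right _ _⟩
    · obtain ⟨v, hv, -⟩ := hf0 l b hb
      exact D.mem_supp_of_car hv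
  choose z hz using hz
  refine ⟨q, L.mem_sup_of_coeffs K hS (fun b hb => ?_) z (fun l hl b hb => ?_) ?_, hq⟩
  · rw [hq] at hb
    exact hu b fun h => hb (by rw [h, ite_self])
  · rw [hz] at hb
    obtain ⟨v, hv, hvj, h⟩ := hf0 l b hb
    have h1 := hg l hl _ h
    obtain ⟨h2, h3, -⟩ := D.tau_add_a (D.mem_supp_of_car hv) hv
    rw [L.ω_add_eq i (D.mem_supp_of_car hv) (D.a_mem_supp v) h2 (by rw [h3, D.tau_a]),
      L.ω_a (hvj.symm ▸ hij), hvj] at h1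
    linarith
  · intro b hb hbn
    rw [hq]
    split_ifs with hex
    · obtain ⟨v, hv, hvj⟩ := hex
      obtain ⟨h2, h3, h4⟩ := D.tau_add_a hb hv
      have hω : L.ω i (b + D.a v) = n + L.W j := by
        rw [L.ω_add_eq i hb (D.a_mem_supp v) h2 (by rw [h3, D.tau_a]),
          L.ω_a (hvj.symm ▸ hij), hvj, hbn]
      have h5 := hE _ h2 hω
      rw [D.th_eq (v := v) (by rw [h4]; exact hv) hvj (by
        rw [h3]; simpa using D.tau_nonneg b v), add_sub_cancel_right] at h5
      rw [h5]
      refine Finset.sum_congr rfl fun l hl => ?_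
      rw [th, th]
      refine Finset.sum_congr rfl fun w hw => ?_
      have hwl := (Finset.mem_filter.1 hw).2
      have hwv : w ≠ v := by rintro rfl; exact hj (by rwa [← hvj, hwl])
      rw [h4, h3, Pi.add_apply, Pi.single_eq_of_ne hwv, add_zero]
      refine if_ctx_congr Iff.rfl (fun hw' => ?_) fun _ => rfl
      have hvw : v ∈ D.car (b - D.a w) := by
        rw [D.mem_car, (D.tau_sub_a hb hw'.2).2, Pi.sub_apply, Pi.single_eq_of_ne hwv.symm,
          sub_zero]
        exact D.mem_car.1 hv
      rw [hz, hf1 l _ v hvw hvj]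
      congr 1; abel
    · symm
      refine Finset.sum_eq_zero fun l hl => D.th_eq_zero fun w hw hwl hw1 => ?_
      rw [hz]
      by_contra h
      obtain ⟨v, hv, hvj, -⟩ := hf0 l _ h
      have hwb := D.mem_supp_of_car hw
      refine hex ⟨v, ?_, hvj⟩
      rw [D.mem_car_iff_pos, (D.tau_sub_a hwb hw1).2, Pi.sub_apply] at hv
      rw [D.mem_car_iff_pos]
      have : (0 : ℝ) ≤ (Pi.single w 1 : Fin N → ℝ) v := by
        by_cases h : v = w
        · subst h; simp
        · simp [h]
      linarith

/-- The part supported on a group of lattice points without the colour `j`. -/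
lemma piece_group {k : ℕ} (B : BalancedSphere K D.chains D.κ (Finset.Icc 1 k)) (hi : 1 ≤ i)
    {S : Finset ℕ} (hS : S ⊆ Finset.Icc i k) {j : ℕ} (hij : j ∈ Finset.Icc i k) (hj : j ∉ S)
    {n : ℤ} {u : ToricFaceRing K Φ} (g : ℕ → ToricFaceRing K Φ)
    (hE : ∀ c ∈ Φ.supp, L.ω i c = n + L.W j → D.th j (ToricRing.coeffs K Φ u) c =
      ∑ l ∈ S, D.th l (ToricRing.coeffs K Φ (g l)) c)
    {a : Fin d → ℤ} (ha : a ∈ Φ.supp) (han : L.ω i a = n) (haj : ∀ v ∈ D.car a, D.κ v ≠ j)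
    (h1 : ∀ v ∈ D.car a, D.κ v ∈ S → D.tau a v ≤ 1) :
    ∃ q ∈ L.J K i S n ⊔ L.F K i (n + 1), ∃ A : Set (Fin d → ℤ), a ∈ A ∧
      ∀ b, ToricRing.coeffs K Φ q b = if b ∈ A then ToricRing.coeffs K Φ u b else 0 := by
  have hS' : ∀ l ∈ S, i ≤ l := fun l hl => (Finset.mem_Icc.1 (hS hl)).1
  have hsub : Finset.Icc i k ⊆ Finset.Icc 1 k := Finset.Icc_subset_Icc_left hi
  set R := (D.car a).filter fun v => D.κ v ∈ S ∧ D.tau a v = 1 with hR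
  obtain ⟨p, hp, hcar, hpt, hdisj, hag⟩ := D.mem_grp_sub ha (R := R) (Finset.filter_subset _ _)
    fun v hv => (Finset.mem_filter.1 hv).2.2
  set T := R.image D.κ with hT
  have hTS : T ⊆ S := by
    intro c hc
    obtain ⟨v, hv, rfl⟩ := Finset.mem_image.1 hc
    exact (Finset.mem_filter.1 hv).2.1
  have hjp : j ∉ (D.car p).image D.κ := fun h => by
    obtain ⟨v, hv, hvj⟩ := Finset.mem_image.1 h
    rw [hcar] at hv
    exact haj v (Finset.mem_sdiff.1 hv).1 hvj
  have hpn : L.ω i p + ∑ l ∈ T, L.W l = n := by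
    obtain ⟨G, hG, hpG, hGT, rfl⟩ := hag
    rw [← L.ω_ext hp hG hpG hdisj hGT fun l hl => hS' l (hTS hl), han]
  obtain ⟨y, hy⟩ := B.color_regular (D.car_mem p) (hTS.trans (hS.trans hsub)) (hsub hij)
    (fun h => hj (hTS h)) hdisj hjp (fun G => ToricRing.coeffs K Φ u (D.ext p G))
    (fun l G => ToricRing.coeffs K Φ (g l) (D.ext p G)) (by
      intro G hG hpG hGT
      have hdisj' : Disjoint (insert j T) ((D.car p).image D.κ) :=
        Finset.disjoint_insert_left.2 ⟨hjp, hdisj⟩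
      have hω : L.ω i (D.ext p G) = n + L.W j := by
        rw [L.ω_ext hp hG hpG hdisj' hGT, Finset.sum_insert fun h => hj (hTS h), ← hpn]
        · ring
        · intro l hl
          rcases Finset.mem_insert.1 hl with rfl | hl
          · exact (Finset.mem_Icc.1 hij).1
          · exact hS' l (hTS hl)
      have key : ∀ l ∈ insert j T, ∀ f : (Fin d → ℤ) → K,
          D.th l f (D.ext p G) = f (D.ext p (colErase D.κ l G)) := by
        intro l hl f
        have : l ∈ G.image D.κ := by rw [hGT]; exact Finset.mem_union_right _ hl
        obtain ⟨v, hv, rfl⟩ := Finset.mem_image.1 this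
        have hvp : v ∉ D.car p := fun h =>
          Finset.disjoint_left.1 hdisj' hl (Finset.mem_image_of_mem _ h)
        rw [D.th_eq (v := v) (by rwa [D.car_ext hp hG hpG]) rfl
          (D.tau_ext_of_notMem hp hG hpG hv hvp).ge, D.ext_sub hv hvp, D.erase_eq_colErase hG hv]
      have h2 := hE _ (D.tau_ext hp hG hpG).1 hω
      rw [key j (Finset.mem_insert_self j T)] at h2
      refine h2.trans ?_
      rw [← Finset.sum_subset hTS, Finset.sum_congr rfl fun l hl =>
        key l (Finset.mem_insert_of_mem hl) _]
      intro l hl hlT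
      refine D.th_eq_zero fun v hv hvl hv1 => ?_
      exfalso
      rw [D.car_ext hp hG hpG] at hv
      have h3 := Finset.mem_image_of_mem D.κ hv
      rw [hGT, hvl, Finset.mem_union, Finset.mem_insert] at h3
      rcases h3 with h3 | h3 | h3
      · obtain ⟨w, hw, hwl⟩ := Finset.mem_image.1 h3
        have hwv : w = v := D.κ_injOn hG (hpG hw) hv (hwl.trans hvl.symm)
        subst hwv
        rw [(D.tau_ext hp hG hpG).2] at hv1
        simp only [Finset.mem_sdiff, hw, not_true, and_false, if_false, add_zero] at hv1
        rw [hpt w hw] at hv1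
        rw [hcar, Finset.mem_sdiff] at hw
        exact hw.2 (Finset.mem_filter.2 ⟨hw.1, hvl.symm ▸ hl,
          le_antisymm (h1 w hw.1 (hvl.symm ▸ hl)) hv1⟩)
      · exact hj (h3 ▸ hl)
      · exact hlT h3)
  obtain ⟨q, hq⟩ := ToricRing.exists_coeffs K (Φ := Φ)
    (fun b => if b ∈ D.grp p T then ToricRing.coeffs K Φ u b else 0)
    ((ToricRing.coeffs K Φ u).hasFiniteSupport.subset fun b hb => by
      rw [Function.mem_support] at hb ⊢
      exact fun h => hb (by rw [h, ite_self]))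
    fun b hb => ToricRing.coeffs_support K Φ.zero_mem_supp (x := u) fun h =>
      hb (by simp only [h, ite_self])
  refine ⟨q, L.grp_mem_sup K hp hTS hdisj hS' hpn y fun b => ?_, _, hag, hq⟩
  rw [hq]
  refine if_ctx_congr Iff.rfl (fun hb => ?_) fun _ => rfl
  obtain ⟨G, hG, hpG, hGT, rfl⟩ := hb
  rw [hy G hG hpG hGT, D.car_ext hp hG hpG]

end Level

end FanData

namespace FanData

variable {d N : ℕ} {Φ : Fan d} {D : FanData Φ N} [hΦ : Nonempty Φ.cones]

namespace Level

variable (K : Type) [Field K] (L : D.Level) {i : ℕ}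

/-- Elements of level `n` can be tested by removing parts of their leading coefficients. -/
lemma peel {n : ℤ} {M : Submodule K (ToricFaceRing K Φ)} (hM : L.F K i (n + 1) ≤ M)
    (Q : ToricFaceRing K Φ → Prop) (hQ : ∀ u, Q u → u ∈ L.F K i n)
    (hstep : ∀ u, Q u → ∀ a ∈ Φ.supp, L.ω i a = n → ToricRing.coeffs K Φ u a ≠ 0 →
      ∃ q ∈ M, Q (u - q) ∧ ∃ A : Set (Fin d → ℤ), a ∈ A ∧ ∀ b ∈ Φ.supp, L.ω i b = n →
        ToricRing.coeffs K Φ q b = if b ∈ A then ToricRing.coeffs K Φ u b else 0)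
    {u : ToricFaceRing K Φ} (hu : Q u) : u ∈ M := by
  induction h : ((ToricRing.coeffs K Φ u).support.filter fun a => L.ω i a = n).card using
    Nat.strong_induction_on generalizing u with
  | _ m ih =>
    by_cases hex : ∃ a ∈ Φ.supp, L.ω i a = n ∧ ToricRing.coeffs K Φ u a ≠ 0
    · obtain ⟨a, ha, han, hau⟩ := hex
      obtain ⟨q, hq, hQq, A, haA, hA⟩ := hstep u hu a ha han hau
      have h1 := ih _ ?_ hQq rfl
      · simpa using M.add_mem h1 hq
      · rw [← h]
        have hc : ∀ b ∈ Φ.supp, L.ω i b = n → ToricRing.coeffs K Φ (u - q) b =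
            if b ∈ A then 0 else ToricRing.coeffs K Φ u b := by
          intro b hb hbn
          rw [map_sub, Finsupp.sub_apply, hA b hb hbn]
          split_ifs <;> simp
        refine Finset.card_lt_card (Finset.ssubset_iff_of_subset ?_ |>.2 ⟨a, ?_, ?_⟩)
        · intro b hb
          rw [Finset.mem_filter, Finsupp.mem_support_iff] at hb ⊢
          refine ⟨fun h0 => hb.1 ?_, hb.2⟩
          rw [hc b (ToricRing.coeffs_support K Φ.zero_mem_supp hb.1) hb.2, h0, ite_self]
        · rw [Finset.mem_filter, Finsupp.mem_support_iff]; exact ⟨hau, han⟩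
        · rw [Finset.mem_filter, Finsupp.mem_support_iff, hc a ha han, if_pos haA]
          simp
    · push Not at hex
      exact hM (L.mem_F_succ K i (hQ u hu) hex)

variable {k : ℕ} (B : BalancedSphere K D.chains D.κ (Finset.Icc 1 k)) (hi : 1 ≤ i) {S : Finset ℕ}
  (hS : S ⊆ Finset.Icc i k)

lemma θ_mul_sup {j : ℕ} (hj : i ≤ j) {n : ℤ} {q : ToricFaceRing K Φ}
    (hq : q ∈ L.J K i S n ⊔ L.F K i (n + 1)) :
    D.θ K j * q ∈ L.J K i S (n + L.W j) ⊔ L.F K i (n + L.W j + 1) := by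
  obtain ⟨q1, h1, q2, h2, rfl⟩ := Submodule.mem_sup.1 hq
  rw [mul_add]
  refine Submodule.add_mem_sup ?_ ?_
  · rw [add_comm]; exact L.mul_mem_J K (L.θ_mem_F K i hj) h1
  · have := L.mul_mem_F K i (L.θ_mem_F K i hj) h2
    rwa [show L.W j + (n + 1) = n + L.W j + 1 by ring] at this

/-- Regularity of `θ j` on the leading coefficients modulo the other elements. -/
lemma mem_sup_of_θ_mul (B : BalancedSphere K D.chains D.κ (Finset.Icc 1 k)) (hi : 1 ≤ i)
    (hS : S ⊆ Finset.Icc i k) {j : ℕ} (hij : j ∈ Finset.Icc i k) (hj : j ∉ S) {n : ℤ}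
    {u : ToricFaceRing K Φ} (hu : u ∈ L.F K i n)
    (h : D.θ K j * u ∈ L.J K i S (n + L.W j) ⊔ L.F K i (n + L.W j + 1)) :
    u ∈ L.J K i S n ⊔ L.F K i (n + 1) := by
  have hS' : ∀ l ∈ S, i ≤ l := fun l hl => (Finset.mem_Icc.1 (hS hl)).1
  have hj' := (Finset.mem_Icc.1 hij).1
  refine L.peel K le_sup_right (fun u => u ∈ L.F K i n ∧
    D.θ K j * u ∈ L.J K i S (n + L.W j) ⊔ L.F K i (n + L.W j + 1)) (fun u h => h.1) ?_ ⟨hu, h⟩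
  rintro u ⟨hu, h⟩ a ha han hau
  suffices hs : ∃ q ∈ L.J K i S n ⊔ L.F K i (n + 1), ∃ A : Set (Fin d → ℤ), a ∈ A ∧
      ∀ b ∈ Φ.supp, L.ω i b = n →
        ToricRing.coeffs K Φ q b = if b ∈ A then ToricRing.coeffs K Φ u b else 0 by
    obtain ⟨q, hq, A, haA, hA⟩ := hs
    refine ⟨q, hq, ⟨ToricRing.sub_mem K hu ?_, ?_⟩, A, haA, hA⟩
    · exact sup_le (L.J_le_F K hS' n) (L.F_anti K i (by omega)) hq
    · rw [mul_sub]
      exact ToricRing.sub_mem K h (L.θ_mul_sup K hj' hq)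
  obtain ⟨g, hg, hE⟩ := L.coeffs_of_mem_sup K hS' h
  have hE' : ∀ c ∈ Φ.supp, L.ω i c = n + L.W j → D.th j (ToricRing.coeffs K Φ u) c =
      ∑ l ∈ S, D.th l (ToricRing.coeffs K Φ (g l)) c := fun c hc hcn => by
    rw [← hE c hc hcn, L.coeffs_θ_mul K i hj' hu hc hcn]
  by_cases h1 : ∃ v ∈ D.car a, D.κ v = j
  · obtain ⟨q, hq, hq'⟩ := L.piece_color K hS' hj' hj hu g hg hE'
    exact ⟨q, hq, {b | ∃ v ∈ D.car b, D.κ v = j}, h1, fun b _ _ => by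
      by_cases e : ∃ v ∈ D.car b, D.κ v = j
      · rw [hq' b, if_pos e]; exact (if_pos e).symm
      · rw [hq' b, if_neg e]; exact (if_neg e).symm⟩
  · push Not at h1
    by_cases h2 : ∃ v, D.κ v ∈ S ∧ 1 < D.tau a v
    · obtain ⟨v, hv, hv1⟩ := h2
      obtain ⟨q, hq, hq'⟩ := L.piece_large K hS' ha han hv hv1 (ToricRing.coeffs K Φ u a)
      refine ⟨q, le_sup_left (a := L.J K i S n) hq, {a}, rfl, fun b hb hbn => ?_⟩
      rw [hq' b hb hbn]
      by_cases e : b = a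
      · rw [if_pos e, if_pos (Set.mem_singleton_iff.2 e), e]
      · rw [if_neg e, if_neg (mt Set.mem_singleton_iff.1 e)]
    · push Not at h2
      obtain ⟨q, hq, A, haA, hA⟩ := L.piece_group K B hi hS hij hj g hE' ha han h1
        fun v _ hv => h2 v hv
      exact ⟨q, hq, A, haA, fun b _ _ => hA b⟩

lemma J_insert {j : ℕ} (hj : j ∉ S) {n : ℤ} {x : ToricFaceRing K Φ}
    (hx : x ∈ L.J K i (insert j S) n) :
    ∃ y ∈ L.F K i (n - L.W j), ∃ x' ∈ L.J K i S n, x = D.θ K j * y + x' := by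
  obtain ⟨y, hy, rfl⟩ := hx
  exact ⟨y j, hy j (Finset.mem_insert_self j S), _,
    ⟨y, fun l hl => hy l (Finset.mem_insert_of_mem hl), rfl⟩, Finset.sum_insert hj⟩

lemma J_inf_F_succ (B : BalancedSphere K D.chains D.κ (Finset.Icc 1 k)) (hi : 1 ≤ i)
    (hS : S ⊆ Finset.Icc i k) {n : ℤ} {x : ToricFaceRing K Φ} (hx : x ∈ L.J K i S n)
    (hxF : x ∈ L.F K i (n + 1)) : x ∈ L.J K i S (n + 1) := by
  induction S using Finset.induction_on generalizing x with
  | empty =>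
    obtain ⟨y, -, rfl⟩ := hx
    rw [Finset.sum_empty]; exact zero_mem _
  | insert j S hj ih =>
    have hjk := hS (Finset.mem_insert_self j S)
    have hj' := (Finset.mem_Icc.1 hjk).1
    have hS1 := (Finset.subset_insert j S).trans hS
    obtain ⟨y, hy, x', hx', rfl⟩ := L.J_insert K hj hx
    have h1 := L.mem_sup_of_θ_mul K B hi hS1 hjk hj hy (by
      rw [sub_add_cancel, show D.θ K j * y = (0 - x') + (D.θ K j * y + x') by ring]
      exact Submodule.add_mem_sup (ToricRing.sub_mem K (zero_mem _) hx') hxF)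
    obtain ⟨y1, hy1, y2, hy2, rfl⟩ := Submodule.mem_sup.1 h1
    have h2 := L.mul_mem_J K (L.θ_mem_F K i hj') hy1
    rw [add_sub_cancel] at h2
    have h3 := L.mul_mem_F K i (L.θ_mem_F K i hj') hy2
    rw [show L.W j + (n - L.W j + 1) = n + 1 by ring] at h3
    have h4 : D.θ K j * y1 + x' ∈ L.J K i S (n + 1) := by
      refine ih hS1 (add_mem h2 hx') ?_
      rw [show D.θ K j * y1 + x' = (D.θ K j * (y1 + y2) + x') - D.θ K j * y2 by ring]
      exact ToricRing.sub_mem K hxF h3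
    rw [show D.θ K j * (y1 + y2) + x' = D.θ K j * y2 + (D.θ K j * y1 + x') by ring]
    refine add_mem (L.θ_mul_mem_J K (Finset.mem_insert_self j S) ?_)
      (L.J_mono K (Finset.subset_insert j S) _ h4)
    rwa [show n + 1 - L.W j = n - L.W j + 1 by ring]

/-- Elements of the ideal lying in a filtration step have coefficients in the right steps. -/
lemma J_inf_F (B : BalancedSphere K D.chains D.κ (Finset.Icc 1 k)) (hi : 1 ≤ i)
    (hS : S ⊆ Finset.Icc i k) {m n : ℤ} {x : ToricFaceRing K Φ} (hx : x ∈ L.J K i S m)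
    (hxF : x ∈ L.F K i n) : x ∈ L.J K i S n := by
  rcases le_total n m with h | h
  · exact L.J_anti K h hx
  · revert hxF
    induction n, h using Int.leInduction with
    | base => exact fun _ => hx
    | succ n hn ih => exact fun hxF =>
        L.J_inf_F_succ K B hi hS (ih (L.F_anti K i (by omega) hxF)) hxF

/-- The ideal generated by the `θ l` for `l ∈ S`. -/
lemma mem_span_θ_iff {x : ToricFaceRing K Φ} :
    x ∈ Ideal.span (D.θ K '' (S : Set ℕ)) ↔ x ∈ L.J K i S 0 := by
  rw [Ideal.span, Submodule.mem_span_image_finset_iff_exists_fun]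
  constructor
  · rintro ⟨c, rfl⟩
    refine ⟨fun l => if h : l ∈ S then c ⟨l, h⟩ else 0,
      fun l _ => L.mem_F_of_nonpos K i (by linarith [L.W_pos l]) _, ?_⟩
    rw [← Finset.sum_coe_sort S]
    exact Finset.sum_congr rfl fun l _ => by
      dsimp only
      rw [dif_pos l.2, smul_eq_mul, mul_comm]
  · rintro ⟨y, -, rfl⟩
    rw [← Finset.sum_coe_sort S]
    exact ⟨fun l => y l, Finset.sum_congr rfl fun l _ => mul_comm _ _⟩

end Level

end FanData

section RegularSequences

lemma Ideal.mem_of_mul_mem_of_approx {R : Type*} [CommRing R] [IsNoetherianRing R] (J : Ideal R)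
    (t : R) (h : ∀ z r, t ^ r * z ∈ J → ∃ z', z - t * z' ∈ J) {z : R} (hz : t * z ∈ J) :
    z ∈ J := by
  let I : ℕ →o Ideal R :=
    { toFun := fun r => Submodule.comap (LinearMap.mulLeft R (t ^ r)) J
      monotone' := monotone_nat_of_le_succ fun r x hx => by
        simp only [Submodule.mem_comap, LinearMap.mulLeft_apply] at hx ⊢
        rw [pow_succ', mul_assoc]
        exact J.mul_mem_left t hx }
  have hI : ∀ r x, x ∈ I r ↔ t ^ r * x ∈ J := fun r x => Iff.rfl
  obtain ⟨n, hn⟩ := monotone_stabilizes_iff_noetherian.2 ‹IsNoetherianRing R› I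
  have hall : ∀ r x, x ∈ I r → x ∈ I n := fun r x hx => by
    rcases le_total r n with hr | hr
    · exact I.monotone hr hx
    · rw [hn r hr]; exact hx
  have key : ∀ r, ∃ z' ∈ I n, z - t ^ r * z' ∈ J := by
    intro r
    induction r with
    | zero => exact ⟨z, hall 1 z (by rw [hI, pow_one]; exact hz), by simp⟩
    | succ r ih =>
      obtain ⟨z', hz', h'⟩ := ih
      obtain ⟨y, hy⟩ := h z' n hz'
      refine ⟨y, hall (n + 1) y ?_, ?_⟩
      · rw [hI, show t ^ (n + 1) * y = t ^ n * z' - t ^ n * (z' - t * y) by ring]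
        exact J.sub_mem hz' (J.mul_mem_left _ hy)
      · rw [show z - t ^ (r + 1) * y = (z - t ^ r * z') + t ^ r * (z' - t * y) by ring]
        exact J.add_mem h' (J.mul_mem_left _ hy)
  obtain ⟨z', hz', h'⟩ := key n
  rw [show z = (z - t ^ n * z') + t ^ n * z' by ring]
  exact J.add_mem h' hz'

lemma isRegSeqIn_of_forall {R : Type} [CommRing R] (I : Ideal R) (l : List R)
    (hI : ∀ x ∈ l, x ∈ I)
    (h : ∀ l₁ x l₂, l = l₁ ++ x :: l₂ → ∀ y, x * y ∈ Ideal.span {z | z ∈ l₁} →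
      y ∈ Ideal.span {z | z ∈ l₁}) : IsRegSeqIn R I l := by
  unfold IsRegSeqIn
  induction hn : l.length generalizing R with
  | zero => exact List.length_eq_zero_iff.1 hn
  | succ n ih =>
    match l, hn, hI, h with
    | x :: xs, hn, hI, h =>
      refine ⟨x, xs, rfl, hI x (by simp), ?_, ?_⟩
      · refine mem_nonZeroDivisors_iff.2 ⟨fun y hy => ?_, fun y hy => ?_⟩
        · simpa using h [] x xs rfl y (by simp [hy])
        · simpa using h [] x xs rfl y (by simp [mul_comm x y, hy])
      · refine ih _ _ ?_ ?_ (by simpa using hn)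
        · intro y hy
          obtain ⟨y, hy, rfl⟩ := List.mem_map.1 hy
          exact Ideal.mem_map_of_mem _ (hI y (List.mem_cons_of_mem x ‹y ∈ xs›))
        · intro l₁ x' l₂ hl y hy
          obtain ⟨m₁, m₂, rfl, rfl, hm⟩ := List.map_eq_append_iff.1 hl
          obtain ⟨w, m₃, rfl, rfl, rfl⟩ := List.map_eq_cons_iff.1 hm
          obtain ⟨y, rfl⟩ := Ideal.Quotient.mk_surjective y
          have hset : {z | z ∈ m₁.map (Ideal.Quotient.mk (Ideal.span {x}))} =
              Ideal.Quotient.mk (Ideal.span {x}) '' {z | z ∈ m₁} := by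
            ext z; simp
          have hset' : {z | z ∈ x :: m₁} = {x} ∪ {z | z ∈ m₁} := by
            ext z; simp
          rw [hset, ← Ideal.map_span] at hy ⊢
          rw [← map_mul] at hy
          have h1 := h (x :: m₁) w m₃ rfl y (by
            rw [hset', Ideal.span_union]
            have := Ideal.mem_comap.2 hy
            rwa [Ideal.comap_map_of_surjective' _ Ideal.Quotient.mk_surjective,
              Ideal.mk_ker, sup_comm] at this)
          rw [← Ideal.mem_comap, Ideal.comap_map_of_surjective' _ Ideal.Quotient.mk_surjective,
            Ideal.mk_ker, sup_comm, ← Ideal.span_union, ← hset']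
          exact h1

end RegularSequences

namespace FanData

variable {d N : ℕ} {Φ : Fan d} {D : FanData Φ N} [hΦ : Nonempty Φ.cones] (K : Type) [Field K]

lemma exists_top {b : Fin d → ℤ} (hb : b ∈ Φ.supp) (h0 : b ≠ 0) :
    ∃ E ∈ D.car b, Z2R b ∈ D.e E := by
  have hne : (D.car b).Nonempty := by
    rw [Finset.nonempty_iff_ne_empty]
    intro h
    refine h0 (D.tau_inj hb D.tau_zero.1 ?_)
    rw [D.tau_zero.2]
    ext v
    by_contra hv
    exact absurd (D.mem_car.2 hv) (h ▸ Finset.notMem_empty v)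
  obtain ⟨E, hE, hmax⟩ := Finset.exists_max_image (D.car b) D.κ hne
  refine ⟨E, hE, D.mem_of_car hb (D.mem E) fun w hw => ?_⟩
  rcases D.car_mem b w hw E hE with h | h
  · exact h
  · by_cases hEw : E = w
    · rw [hEw]
    · exact absurd (hmax w hw) (not_le.2 (D.κ_lt h hEw))

lemma exists_κ_lt {v w : Fin N} (hne : v ≠ w) (hκ : D.κ w = D.κ v)
    (h : Φ.Compat (D.a v) (D.a w)) : ∃ E ∈ D.car (D.a v + D.a w), D.κ v < D.κ E := by
  obtain ⟨C, hC, hv, hw⟩ := h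
  have hb := Fan.Compat.add_mem ⟨C, hC, hv, hw⟩
  have hsum : Z2R (D.a v + D.a w) = Z2R (D.a v) + Z2R (D.a w) := Z2R_add _ _
  have hface : ∀ E, Z2R (D.a v + D.a w) ∈ D.e E → D.e v ⊆ D.e E ∧ D.e w ⊆ D.e E := by
    intro E hE
    have hf := Φ.inter_face C hC _ (D.mem E)
    have h1 := hf.1.2.2 _ hv _ hw ⟨(Φ.convex hC).2.1 _ hv _ hw, hsum ▸ hE⟩
    exact ⟨D.subset_of_vec_mem (D.mem E) h1.1.2, D.subset_of_vec_mem (D.mem E) h1.2.2⟩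
  have h0 : D.a v + D.a w ≠ 0 := by
    intro h0
    have h1 := (hface v (by rw [h0, Z2R_zero]; exact (Φ.convex (D.mem v)).1)).2
    exact absurd (D.κ_lt h1 hne.symm) (by omega)
  obtain ⟨E, hE, hbE⟩ := D.exists_top hb h0
  obtain ⟨h1, h2⟩ := hface E hbE
  refine ⟨E, hE, D.κ_lt h1 ?_⟩
  rintro rfl
  exact absurd (D.κ_lt h2 hne.symm) (by omega)

/-- Monomials whose support contains a cone with nilpotent interior monomial are nilpotent. -/
lemma xpow_mem_radical {I : Ideal (ToricFaceRing K Φ)} {v : Fin N}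
    (hv : xpow K Φ (D.a v) ∈ I.radical) {b : Fin d → ℤ} (hb : v ∈ D.car b) :
    xpow K Φ b ∈ I.radical := by
  have hbs := D.mem_supp_of_car hb
  obtain ⟨M, hM, hM'⟩ := D.exists_denominator
  obtain ⟨n, hn⟩ := hM' b hbs v
  obtain ⟨h1, h2⟩ := D.tau_nsmul hbs M
  have hn1 : 1 ≤ D.tau (M • b) v := by
    rw [h2, Pi.smul_apply, smul_eq_mul, hn]
    have : (0 : ℝ) < n := by
      rw [← hn]; exact mul_pos (by exact_mod_cast hM) (D.mem_car_iff_pos.1 hb)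
    exact_mod_cast this
  obtain ⟨h3, h4⟩ := D.tau_sub_a h1 hn1
  have hcar : D.car (D.a v) ∪ D.car (M • b - D.a v) = D.car (M • b) := by
    refine (D.car_eq_union ?_).symm
    rw [h4, D.tau_a, add_sub_cancel]
  have hmul := D.xpow_mul_of_chain K (D.a_mem_supp v) h3 (hcar ▸ D.car_mem _)
  rw [add_sub_cancel, ToricRing.xpow_nsmul K hbs] at hmul
  refine Ideal.mem_radical_of_pow_mem (m := M) ?_
  rw [← hmul]
  exact Ideal.mul_mem_right _ _ hv

lemma xpow_a_mem_radical {i k : ℕ} (hk : ∀ v, D.κ v ≤ k) (v : Fin N) (hv : i ≤ D.κ v) :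
    xpow K Φ (D.a v) ∈
      (Ideal.span (D.θ K '' (Finset.Icc i k : Finset ℕ)) : Ideal (ToricFaceRing K Φ)).radical := by
  set I : Ideal (ToricFaceRing K Φ) := Ideal.span (D.θ K '' (Finset.Icc i k : Finset ℕ))
  induction h : k - D.κ v using Nat.strong_induction_on generalizing v with
  | _ m ih =>
    have hmem : v ∈ Finset.univ.filter fun w => D.κ w = D.κ v := by simp
    have hθ : D.θ K (D.κ v) = xpow K Φ (D.a v) +
        ∑ w ∈ (Finset.univ.filter fun w => D.κ w = D.κ v).erase v, xpow K Φ (D.a w) :=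
      (Finset.add_sum_erase _ _ hmem).symm
    have h1 : xpow K Φ (D.a v) * D.θ K (D.κ v) ∈ I.radical :=
      Ideal.mul_mem_left _ _ (Ideal.le_radical (Ideal.subset_span ⟨_, by simp [hv, hk v], rfl⟩))
    rw [hθ, mul_add, ToricRing.mul_sum] at h1
    have h2 : ∑ w ∈ (Finset.univ.filter fun w => D.κ w = D.κ v).erase v,
        xpow K Φ (D.a v) * xpow K Φ (D.a w) ∈ I.radical := by
      refine Ideal.sum_mem _ fun w hw => ?_
      rw [Finset.mem_erase, Finset.mem_filter] at hw
      by_cases hc : Φ.Compat (D.a v) (D.a w)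
      · rw [ToricRing.xpow_mul_of_compat K hc]
        obtain ⟨E, hE, hlt⟩ := D.exists_κ_lt hw.1.symm hw.2.2 hc
        have := hk E
        exact D.xpow_mem_radical K (ih _ (by omega) E (by omega) rfl) hE
      · rw [ToricRing.xpow_mul_of_not_compat K hc]; exact zero_mem _
    have h3 := (Ideal.add_mem_iff_left _ h2).1 h1
    rw [← pow_two] at h3
    exact (Ideal.radical_isRadical I) ⟨2, h3⟩

lemma Level.exists_F_le (L : D.Level) {i k : ℕ} (hk : ∀ v, D.κ v ≤ k) :
    ∃ n, ∀ x ∈ L.F K i n, x ∈ Ideal.span (D.θ K '' (Finset.Icc i k : Finset ℕ)) := by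
  set I : Ideal (ToricFaceRing K Φ) := Ideal.span (D.θ K '' (Finset.Icc i k : Finset ℕ))
  have h1 : ∀ v, ∃ m : ℕ, i ≤ D.κ v → xpow K Φ (D.a v) ^ m ∈ I := fun v => by
    by_cases hv : i ≤ D.κ v
    · obtain ⟨m, hm⟩ := D.xpow_a_mem_radical K hk v hv
      exact ⟨m, fun _ => hm⟩
    · exact ⟨0, fun h => absurd h hv⟩
  choose m hm using h1
  refine ⟨(∑ v, L.W (D.κ v) * m v) + 1, fun x hx => ?_⟩
  rw [ToricRing.eq_sum_coeffs K Φ.zero_mem_supp x, Finsupp.sum]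
  refine Ideal.sum_mem _ fun a ha => ?_
  have ha' := Finsupp.mem_support_iff.1 ha
  have has := ToricRing.coeffs_support K Φ.zero_mem_supp ha'
  rw [Algebra.smul_def]
  refine Ideal.mul_mem_left _ _ ?_
  obtain ⟨v, hv, hvm⟩ : ∃ v, i ≤ D.κ v ∧ (m v : ℝ) ≤ D.tau a v := by
    by_contra hcon
    push Not at hcon
    have h2 : (L.ω i a : ℝ) ≤ ∑ v, (L.W (D.κ v) : ℝ) * m v := by
      rw [L.ω_eq i a has]
      refine Finset.sum_le_sum fun v _ => ?_
      have hW : (0 : ℝ) ≤ L.W (D.κ v) := by exact_mod_cast (L.W_pos _).le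
      unfold truncWt
      split_ifs with h
      · exact mul_le_mul_of_nonneg_left (hcon v h).le hW
      · rw [zero_mul]; positivity
    have h3 := hx a ha'
    have h4 : L.ω i a ≤ ∑ v, L.W (D.κ v) * m v := by exact_mod_cast h2
    omega
  obtain ⟨h2, h3⟩ := D.tau_nsmul (D.a_mem_supp v) (m v)
  obtain ⟨h4, h5⟩ := D.tau_sub_of_le has h2 fun w => by
    rw [h3, D.tau_a, Pi.smul_apply]
    by_cases h : w = v
    · subst h; simpa using hvm
    · simpa [Pi.single_eq_of_ne h] using D.tau_nonneg a w
  have hcar : D.car (m v • D.a v) ∪ D.car (a - m v • D.a v) = D.car a := by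
    refine (D.car_eq_union ?_).symm
    rw [h5, add_sub_cancel]
  have hmul := D.xpow_mul_of_chain K h2 h4 (hcar ▸ D.car_mem _)
  rw [add_sub_cancel, ToricRing.xpow_nsmul K (D.a_mem_supp v)] at hmul
  rw [← hmul]
  exact Ideal.mul_mem_right _ _ (hm v hv)

end FanData

namespace FanData

variable {d N : ℕ} {Φ : Fan d} {D : FanData Φ N} [hΦ : Nonempty Φ.cones]

namespace Level

variable (K : Type) [Field K] (L : D.Level) {i : ℕ}

lemma mem_span_of_mem_J {S : Finset ℕ} {n : ℤ} {x : ToricFaceRing K Φ} (hx : x ∈ L.J K i S n) :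
    x ∈ Ideal.span (D.θ K '' (S : Set ℕ)) := by
  obtain ⟨y, -, rfl⟩ := hx
  exact Ideal.sum_mem _ fun l hl =>
    Ideal.mul_mem_right _ _ (Ideal.subset_span ⟨l, Finset.mem_coe.2 hl, rfl⟩)

lemma θ_pow_mul_mem_F {j : ℕ} (hj : i ≤ j) (r : ℕ) {n : ℤ} {u : ToricFaceRing K Φ}
    (hu : u ∈ L.F K i n) : D.θ K j ^ r * u ∈ L.F K i (n + r * L.W j) := by
  induction r with
  | zero => simpa using hu
  | succ r ih =>
    have := L.mul_mem_F K i (L.θ_mem_F K i hj) ih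
    rw [← mul_assoc, ← pow_succ'] at this
    rwa [show n + ((r + 1 : ℕ) : ℤ) * L.W j = L.W j + (n + r * L.W j) by push_cast; ring]

lemma mem_sup_of_θ_pow_mul {k : ℕ} (B : BalancedSphere K D.chains D.κ (Finset.Icc 1 k))
    (hi : 1 ≤ i) {S : Finset ℕ} (hS : S ⊆ Finset.Icc i k) {j : ℕ} (hij : j ∈ Finset.Icc i k)
    (hj : j ∉ S) (r : ℕ) {n : ℤ} {u : ToricFaceRing K Φ} (hu : u ∈ L.F K i n)
    (h : D.θ K j ^ r * u ∈ L.J K i S (n + r * L.W j) ⊔ L.F K i (n + r * L.W j + 1)) :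
    u ∈ L.J K i S n ⊔ L.F K i (n + 1) := by
  induction r with
  | zero => simpa using h
  | succ r ih =>
    refine ih (L.mem_sup_of_θ_mul K B hi hS hij hj
      (L.θ_pow_mul_mem_F K (Finset.mem_Icc.1 hij).1 r hu) ?_)
    rw [← mul_assoc, ← pow_succ', show n + r * L.W j + L.W j = n + ((r + 1 : ℕ) : ℤ) * L.W j by
      push_cast; ring]
    exact h

/-- Each `θ i` is regular modulo the later ones. -/
lemma mem_span_of_θ_mul (L : D.Level) {k : ℕ} (hk : ∀ v, D.κ v ≤ k)
    (B : BalancedSphere K D.chains D.κ (Finset.Icc 1 k)) (hi : i ∈ Finset.Icc 1 k)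
    {z : ToricFaceRing K Φ}
    (hz : D.θ K i * z ∈ Ideal.span (D.θ K '' (Finset.Icc (i + 1) k : Finset ℕ))) :
    z ∈ Ideal.span (D.θ K '' (Finset.Icc (i + 1) k : Finset ℕ)) := by
  obtain ⟨hi1, hik⟩ := Finset.mem_Icc.1 hi
  have hS : Finset.Icc (i + 1) k ⊆ Finset.Icc i k := Finset.Icc_subset_Icc_left (Nat.le_succ i)
  have hiS : i ∉ Finset.Icc (i + 1) k := by simp
  have := D.isNoetherianRing K
  refine Ideal.mem_of_mul_mem_of_approx _ _ (fun z r hr => ?_) hz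
  have key : ∀ n : ℕ, ∃ w ∈ L.F K i n,
      z - w ∈ Ideal.span (D.θ K '' (Finset.Icc (i + 1) k : Finset ℕ)) := by
    intro n
    induction n with
    | zero => exact ⟨z, L.mem_F_of_nonpos K i le_rfl z, by simp⟩
    | succ n ih =>
      obtain ⟨w, hw, hzw⟩ := ih
      have h1 : D.θ K i ^ r * w ∈ Ideal.span (D.θ K '' (Finset.Icc (i + 1) k : Finset ℕ)) := by
        rw [show D.θ K i ^ r * w = D.θ K i ^ r * z - D.θ K i ^ r * (z - w) by ring]
        exact Ideal.sub_mem _ hr (Ideal.mul_mem_left _ _ hzw)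
      have h2 := L.J_inf_F K B hi1 hS ((L.mem_span_θ_iff K).1 h1)
        (L.θ_pow_mul_mem_F K le_rfl r hw)
      obtain ⟨y, hy, w', hw', e⟩ := Submodule.mem_sup.1 (L.mem_sup_of_θ_pow_mul K B hi1 hS
        (Finset.left_mem_Icc.2 hik) hiS r hw (le_sup_left (a := L.J K i _ _) h2))
      refine ⟨w', by exact_mod_cast hw', ?_⟩
      rw [show z - w' = (z - w) + y by rw [← e]; ring]
      exact Ideal.add_mem _ hzw (L.mem_span_of_mem_J K hy)
  obtain ⟨n, hn⟩ := L.exists_F_le K (i := i) hk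
  obtain ⟨w, hw, hzw⟩ := key n.toNat
  have h1 := hn w (L.F_anti K i (Int.self_le_toNat n) hw)
  rw [show ((Finset.Icc i k : Finset ℕ) : Set ℕ) =
      insert i ((Finset.Icc (i + 1) k : Finset ℕ) : Set ℕ) by
    ext l; simp only [Finset.coe_Icc, Set.mem_Icc, Set.mem_insert_iff]; omega,
    Set.image_insert_eq, Ideal.mem_span_insert] at h1
  obtain ⟨a, b, hb, rfl⟩ := h1
  refine ⟨a, ?_⟩
  rw [show z - D.θ K i * a = (z - (a * D.θ K i + b)) + b by ring]
  exact Ideal.add_mem _ hzw hb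

end Level

/-- The system of parameters. -/
def params (D : FanData Φ N) (K : Type) [Field K] (k : ℕ) : List (ToricFaceRing K Φ) :=
  (List.range k).map fun m => D.θ K (k - m)

lemma length_params (K : Type) [Field K] (k : ℕ) : (D.params K k).length = k := by
  simp [params]

lemma setOf_mem_params (K : Type) [Field K] (k : ℕ) :
    {x | x ∈ D.params K k} = D.θ K '' (Finset.Icc 1 k : Finset ℕ) := by
  ext x
  simp only [params, List.mem_map, List.mem_range, Set.mem_ofPred_eq, Set.mem_image,
    Finset.coe_Icc, Set.mem_Icc]
  constructor
  · rintro ⟨m, hm, rfl⟩; exact ⟨k - m, by omega, rfl⟩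
  · rintro ⟨l, hl, rfl⟩; exact ⟨k - l, by omega, by congr 1; omega⟩

lemma θ_mem_gradedMaxIdeal (K : Type) [Field K] (l : ℕ) : D.θ K l ∈ gradedMaxIdeal K Φ :=
  Ideal.sum_mem _ fun v _ => Ideal.subset_span ⟨D.a v, D.a_ne_zero v, rfl⟩

lemma isRegSeqIn_params (K : Type) [Field K] {k : ℕ} (hk : ∀ v, D.κ v ≤ k)
    (B : BalancedSphere K D.chains D.κ (Finset.Icc 1 k)) :
    IsRegSeqIn (ToricFaceRing K Φ) (gradedMaxIdeal K Φ) (D.params K k) := by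
  obtain ⟨L⟩ := D.exists_level
  refine isRegSeqIn_of_forall _ _ (fun x hx => ?_) fun l₁ x l₂ hl y hy => ?_
  · obtain ⟨m, -, rfl⟩ := List.mem_map.1 hx
    exact D.θ_mem_gradedMaxIdeal K _
  · have hlen := congrArg List.length hl
    rw [D.length_params, List.length_append, List.length_cons] at hlen
    have hget : ∀ (m : ℕ) (hm : m < k), (l₁ ++ x :: l₂)[m]? = some (D.θ K (k - m)) := by
      intro m hm
      rw [← hl]; simp [params, hm]
    have hx : x = D.θ K (k - l₁.length) := by
      have := hget l₁.length (by omega)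
      simpa using this
    have hset : {z | z ∈ l₁} =
        D.θ K '' (Finset.Icc (k - l₁.length + 1) k : Finset ℕ) := by
      have h1 : l₁ = (List.range l₁.length).map fun m => D.θ K (k - m) := by
        have := congrArg (List.take l₁.length) hl
        rw [List.take_left, params, ← List.map_take, List.take_range,
          min_eq_left (by omega)] at this
        exact this.symm
      ext z
      rw [Set.mem_ofPred_eq, h1]
      simp only [List.mem_map, List.mem_range, Set.mem_image, Finset.coe_Icc, Set.mem_Icc,
        List.length_map, List.length_range]
      constructor
      · rintro ⟨m, hm, rfl⟩; exact ⟨k - m, by omega, rfl⟩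
      · rintro ⟨l, hl, rfl⟩; exact ⟨k - l, by omega, by congr 1; omega⟩
    rw [hset] at hy ⊢
    rw [hx] at hy
    exact L.mem_span_of_θ_mul K hk B (Finset.mem_Icc.2 (by omega)) hy

end FanData

section TopCochains

variable {V : Type} [LinearOrder V] {K : Type} [Field K] {Δ : Set (Finset V)} {κ : V → ℕ}
  {C : Finset ℕ}

/-- Cochains on the facets are coboundaries exactly when they are combinations of functions of
the codimension one faces. -/
lemma BalancedSphere.exists_color_iff (h : BalancedSphere K Δ κ C) (f : Finset V → K) :
    (∃ y : ℕ → Finset V → K, ∀ H ∈ Δ, H.image κ = C → f H = ∑ l ∈ C, y l (colErase κ l H)) ↔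
      ∃ g, ∀ H ∈ Δ, (if H.image κ = C then f H else 0) = cobd K g H := by
  constructor
  · rintro ⟨y, hy⟩
    refine ⟨fun G => ∑ l ∈ C, if G.image κ = C.erase l then csgn K l C * y l G else 0,
      fun H hH => ?_⟩
    rw [h.cobd_color hH]
    split_ifs with hC
    · rw [hy H hH hC, hC]
      refine Finset.sum_congr rfl fun l hl => ?_
      rw [Finset.sum_eq_single_of_mem l hl, if_pos (by rw [colErase_image, hC]), ← mul_assoc,
        csgn_sq, one_mul]
      intro m hm hml
      rw [if_neg]
      rw [colErase_image, hC]
      intro he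
      have : l ∈ C.erase m := Finset.mem_erase.2 ⟨hml.symm, hl⟩
      rw [← he] at this
      simp at this
    · refine (Finset.sum_eq_zero fun c hc => ?_).symm
      rw [Finset.sum_eq_zero, mul_zero]
      intro l hl
      rw [if_neg]
      rw [colErase_image]
      intro he
      apply hC
      have hcC : c ∈ C := by
        obtain ⟨v, hv, rfl⟩ := Finset.mem_image.1 hc
        exact h.sub H hH v hv
      have hcl : c = l := by
        by_contra hne
        have : c ∈ C.erase l := Finset.mem_erase.2 ⟨hne, hcC⟩
        rw [← he] at this
        simp at this
      subst hcl
      rw [← Finset.insert_erase hc, he, Finset.insert_erase hcC]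
  · rintro ⟨g, hg⟩
    refine ⟨fun l G => csgn K l C * g G, fun H hH hC => ?_⟩
    have := hg H hH
    rwa [if_pos hC, h.cobd_color hH, hC] at this

lemma BalancedSphere.cobd_top (h : BalancedSphere K Δ κ C) (f : Finset V → K) {G : Finset V}
    (hG : G ∈ Δ) : cobd K (fun H => if H.image κ = C then f H else 0) G = 0 := by
  rw [h.cobd_color hG]
  refine Finset.sum_eq_zero fun c hc => ?_
  rw [if_neg, mul_zero]
  rw [colErase_image]
  rintro he
  have hcC : c ∈ C := by
    obtain ⟨v, hv, rfl⟩ := Finset.mem_image.1 hc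
    exact h.sub G hG v hv
  rw [← he] at hcC
  simp at hcC

end TopCochains

namespace FanData

variable {d N : ℕ} {Φ : Fan d} {D : FanData Φ N} [hΦ : Nonempty Φ.cones]

lemma car_zero : D.car (0 : Fin d → ℤ) = ∅ := by
  ext v
  rw [D.mem_car, D.tau_zero.2]
  simp

lemma tau_ext_zero {H : Finset (Fin N)} (hH : H ∈ D.chains) :
    D.ext 0 H ∈ Φ.supp ∧ D.tau (D.ext 0 H) = fun v => if v ∈ H then 1 else 0 := by
  have h := D.tau_ext Φ.zero_mem_supp hH (by rw [car_zero]; exact Finset.empty_subset _)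
  refine ⟨h.1, h.2.trans ?_⟩
  funext v
  rw [D.tau_zero.2, car_zero, Finset.sdiff_empty]
  simp

lemma car_ext_zero {H : Finset (Fin N)} (hH : H ∈ D.chains) : D.car (D.ext 0 H) = H :=
  D.car_ext Φ.zero_mem_supp hH (by rw [car_zero]; exact Finset.empty_subset _)

namespace Level

variable (K : Type) [Field K] (L : D.Level)

lemma coeffs_xpow_mul_xpow_top {e b w : Fin d → ℤ} (he : e ∈ Φ.supp) (hb : b ∈ Φ.supp)
    (hw : w ∈ Φ.supp) (h : L.ω 1 w ≤ L.ω 1 e + L.ω 1 b) :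
    ToricRing.coeffs K Φ (xpow K Φ e * xpow K Φ b) w =
      if (∀ v, D.tau e v ≤ D.tau w v) ∧ w - e = b then 1 else 0 := by
  by_cases hcomp : Φ.Compat e b
  · rw [ToricRing.xpow_mul_of_compat K hcomp, ToricRing.coeffs_xpow K hcomp.add_mem,
      Finsupp.single_apply]
    by_cases heq : e + b = w
    · subst heq
      rw [if_pos rfl, if_pos]
      refine ⟨?_, by abel⟩
      have hch : D.car e ∪ D.car b ∈ D.chains := by
        intro x hx y hy
        by_contra hxy
        push Not at hxy
        rw [Finset.mem_union] at hx hy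
        rcases hx with hx | hx <;> rcases hy with hy | hy
        · exact (D.car_mem e x hx y hy).elim hxy.1 hxy.2
        · exact absurd h (not_le.2 (L.ω_add_lt 1 hcomp hx hy hxy (Or.inl (D.κ_pos x))))
        · exact absurd h (not_le.2 (L.ω_add_lt 1 hcomp hy hx hxy.symm (Or.inl (D.κ_pos y))))
        · exact (D.car_mem b x hx y hy).elim hxy.1 hxy.2
      intro v
      rw [(D.tau_add he hb hch).2, Pi.add_apply]
      linarith [D.tau_nonneg b v]
    · rw [if_neg heq, if_neg]
      rintro ⟨-, rfl⟩
      exact heq (by abel)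
  · rw [ToricRing.xpow_mul_of_not_compat K hcomp, map_zero, Finsupp.zero_apply, if_neg]
    rintro ⟨h1, rfl⟩
    refine hcomp (D.compat_of_chain he hb (D.chains_down (D.car_mem w) ?_))
    have ht := (D.tau_sub_of_le hw he h1).2
    refine Finset.union_subset (fun v hv => ?_) fun v hv => ?_
    · exact D.mem_car_iff_pos.2 ((D.mem_car_iff_pos.1 hv).trans_le (h1 v))
    · rw [D.mem_car_iff_pos, ht, Pi.sub_apply] at hv
      rw [D.mem_car_iff_pos]
      linarith [D.tau_nonneg e v]

/-- The leading coefficients of a monomial multiple. -/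
lemma coeffs_xpow_mul {n : ℤ} {u : ToricFaceRing K Φ} (hu : u ∈ L.F K 1 n) {e w : Fin d → ℤ}
    (he : e ∈ Φ.supp) (hw : w ∈ Φ.supp) (h : L.ω 1 w = L.ω 1 e + n) :
    ToricRing.coeffs K Φ (xpow K Φ e * u) w =
      if ∀ v, D.tau e v ≤ D.tau w v then ToricRing.coeffs K Φ u (w - e) else 0 := by
  have key : ∀ b ∈ (ToricRing.coeffs K Φ u).support,
      ToricRing.coeffs K Φ (ToricRing.coeffs K Φ u b • (xpow K Φ e * xpow K Φ b)) w =
        if w - e = b then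
          (if ∀ v, D.tau e v ≤ D.tau w v then ToricRing.coeffs K Φ u b else 0) else 0 := by
    intro b hb
    have hb' := Finsupp.mem_support_iff.1 hb
    rw [map_smul, Finsupp.smul_apply, L.coeffs_xpow_mul_xpow_top K he
      (ToricRing.coeffs_support K Φ.zero_mem_supp hb') hw (by linarith [hu b hb'])]
    by_cases h1 : w - e = b
    · simp only [h1, and_true, if_true]
      split_ifs <;> simp
    · rw [if_neg fun h2 => h1 h2.2, if_neg h1, smul_zero]
  conv_lhs => rw [ToricRing.eq_sum_coeffs K Φ.zero_mem_supp u]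
  rw [Finsupp.sum, ToricRing.mul_sum]
  simp only [mul_smul_comm]
  rw [map_sum, Finsupp.finsetSum_apply, Finset.sum_congr rfl key, Finset.sum_ite_eq]
  by_cases h1 : w - e ∈ (ToricRing.coeffs K Φ u).support
  · rw [if_pos h1]
  · rw [if_neg h1]
    rw [Finsupp.mem_support_iff, not_not] at h1
    rw [h1, ite_self]

/-- The level of the facets. -/
def top (k : ℕ) : ℤ := ∑ l ∈ Finset.Icc 1 k, L.W l

lemma ω_one_eq {x : Fin d → ℤ} (hx : x ∈ Φ.supp) :
    (L.ω 1 x : ℝ) = ∑ v ∈ D.car x, (L.W (D.κ v) : ℝ) * D.tau x v := by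
  rw [L.ω_eq 1 x hx]
  have h1 : ∀ v, D.truncWt (fun j => (L.W j : ℝ)) 1 v = (L.W (D.κ v) : ℝ) := fun v =>
    if_pos (D.κ_pos v)
  simp only [h1]
  refine (Finset.sum_subset (Finset.subset_univ _) fun v _ hv => ?_).symm
  rw [D.mem_car, not_not] at hv
  rw [hv, mul_zero]

lemma sum_W_image {G : Finset (Fin N)} (hG : G ∈ D.chains) :
    ∑ v ∈ G, L.W (D.κ v) = ∑ l ∈ G.image D.κ, L.W l :=
  (Finset.sum_image (f := fun l => L.W l) (D.κ_injOn hG)).symm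

/-- Lattice points of top level with small coordinates are sums over facets. -/
lemma mem_grp_of_top_le {k : ℕ} (hk : ∀ v, D.κ v ≤ k) {a : Fin d → ℤ} (ha : a ∈ Φ.supp)
    (hn : L.top k ≤ L.ω 1 a) (h1 : ∀ v ∈ D.car a, D.tau a v ≤ 1) :
    L.ω 1 a = L.top k ∧ a ∈ D.grp 0 (Finset.Icc 1 k) := by
  have hW : ∀ v, (0 : ℝ) < L.W (D.κ v) := fun v => by exact_mod_cast L.W_pos _
  have hsub : (D.car a).image D.κ ⊆ Finset.Icc 1 k := fun c hc => by
    obtain ⟨v, -, rfl⟩ := Finset.mem_image.1 hc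
    exact Finset.mem_Icc.2 ⟨D.κ_pos v, hk v⟩
  have h2 : (L.ω 1 a : ℝ) ≤ ∑ v ∈ D.car a, (L.W (D.κ v) : ℝ) := by
    rw [L.ω_one_eq ha]
    exact Finset.sum_le_sum fun v hv => mul_le_of_le_one_right (hW v).le (h1 v hv)
  have h2' : L.ω 1 a ≤ ∑ v ∈ D.car a, L.W (D.κ v) := by exact_mod_cast h2
  have h3 : ∑ v ∈ D.car a, L.W (D.κ v) ≤ L.top k := by
    rw [L.sum_W_image (D.car_mem a)]
    exact Finset.sum_le_sum_of_subset_of_nonneg hsub fun l _ _ => (L.W_pos l).le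
  have himg : (D.car a).image D.κ = Finset.Icc 1 k := by
    refine Finset.Subset.antisymm hsub fun l hl => ?_
    by_contra hl'
    have : ∑ l ∈ (D.car a).image D.κ, L.W l < L.top k :=
      Finset.sum_lt_sum_of_subset hsub hl hl' (L.W_pos l) fun j _ _ => (L.W_pos j).le
    rw [← L.sum_W_image (D.car_mem a)] at this
    omega
  have heq : ∀ v ∈ D.car a, D.tau a v = 1 := by
    intro v hv
    by_contra hne
    have hlt := lt_of_le_of_ne (h1 v hv) hne
    have : (L.ω 1 a : ℝ) < ∑ v ∈ D.car a, (L.W (D.κ v) : ℝ) := by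
      rw [L.ω_one_eq ha]
      exact Finset.sum_lt_sum (fun v hv => mul_le_of_le_one_right (hW v).le (h1 v hv))
        ⟨v, hv, mul_lt_of_lt_one_right (hW v) hlt⟩
    have : L.ω 1 a < ∑ v ∈ D.car a, L.W (D.κ v) := by exact_mod_cast this
    omega
  refine ⟨by omega, ?_⟩
  obtain ⟨p, hp, hcar, -, -, hag⟩ := D.mem_grp_sub ha subset_rfl heq
  rw [sdiff_self] at hcar
  have hp0 : p = 0 := by
    by_contra h0
    obtain ⟨E, hE, -⟩ := D.exists_top hp h0
    rw [hcar] at hE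
    exact absurd hE (Finset.notMem_empty E)
  rwa [hp0, himg] at hag

lemma ω_ext_zero {k : ℕ} {H : Finset (Fin N)} (hH : H ∈ D.chains)
    (hC : H.image D.κ = Finset.Icc 1 k) : L.ω 1 (D.ext 0 H) = L.top k := by
  have h := L.ω_one_eq (D.tau_ext_zero hH).1
  rw [car_ext_zero hH, (tau_ext_zero hH).2] at h
  have h2 : (L.ω 1 (D.ext 0 H) : ℝ) = ∑ v ∈ H, (L.W (D.κ v) : ℝ) := by
    rw [h]; exact Finset.sum_congr rfl fun v hv => by simp [hv]
  have h3 : L.ω 1 (D.ext 0 H) = ∑ v ∈ H, L.W (D.κ v) := by exact_mod_cast h2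
  rw [h3, L.sum_W_image hH, hC, top]

end Level

end FanData

namespace FanData

variable {d N : ℕ} {Φ : Fan d} {D : FanData Φ N} [hΦ : Nonempty Φ.cones]

namespace Level

variable (K : Type) [Field K]

/-- Elements above the top level vanish modulo the parameters. -/
lemma mem_span_of_top_lt (L : D.Level) {k : ℕ} (hk : ∀ v, D.κ v ≤ k) {x : ToricFaceRing K Φ}
    (hx : x ∈ L.F K 1 (L.top k + 1)) :
    x ∈ Ideal.span (D.θ K '' (Finset.Icc 1 k : Finset ℕ)) := by
  obtain ⟨m, hm⟩ := L.exists_F_le K (i := 1) hk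
  have hS : ∀ l ∈ Finset.Icc 1 k, 1 ≤ l := fun l hl => (Finset.mem_Icc.1 hl).1
  have hstep : ∀ n, L.top k + 1 ≤ n → ∀ x ∈ L.F K 1 n,
      x ∈ L.J K 1 (Finset.Icc 1 k) n ⊔ L.F K 1 (n + 1) := by
    intro n hn x hx
    refine L.peel K le_sup_right (fun u => u ∈ L.F K 1 n) (fun u h => h) ?_ hx
    intro u hu a ha han hau
    obtain ⟨v, hv, hv1⟩ : ∃ v ∈ D.car a, 1 < D.tau a v := by
      by_contra hcon
      push Not at hcon
      have := (L.mem_grp_of_top_le hk ha (by omega) hcon).1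
      omega
    obtain ⟨q, hq, hq'⟩ := L.piece_large K hS ha han
      (Finset.mem_Icc.2 ⟨D.κ_pos v, hk v⟩) hv1 (ToricRing.coeffs K Φ u a)
    refine ⟨q, le_sup_left (a := L.J K 1 _ _) hq,
      ToricRing.sub_mem K hu (L.J_le_F K hS n hq), {a}, rfl, fun b hb hbn => ?_⟩
    rw [hq' b hb hbn]
    by_cases e : b = a
    · rw [if_pos e, if_pos (Set.mem_singleton_iff.2 e), e]
    · rw [if_neg e, if_neg (mt Set.mem_singleton_iff.1 e)]
  have key : ∀ r : ℕ, ∃ w ∈ L.F K 1 (L.top k + 1 + r),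
      x - w ∈ Ideal.span (D.θ K '' (Finset.Icc 1 k : Finset ℕ)) := by
    intro r
    induction r with
    | zero => exact ⟨x, by simpa using hx, by simp⟩
    | succ r ih =>
      obtain ⟨w, hw, hxw⟩ := ih
      obtain ⟨y, hy, w', hw', e⟩ := Submodule.mem_sup.1 (hstep _ (by omega) w hw)
      refine ⟨w', by rwa [show L.top k + 1 + ((r + 1 : ℕ) : ℤ) = L.top k + 1 + r + 1 by
        push_cast; ring], ?_⟩
      rw [show x - w' = (x - w) + y by rw [← e]; ring]
      exact Ideal.add_mem _ hxw (L.mem_span_of_mem_J K hy)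
  obtain ⟨w, hw, hxw⟩ := key (m - (L.top k + 1)).toNat
  rw [show x = (x - w) + w by ring]
  exact Ideal.add_mem _ hxw (hm w (L.F_anti K 1 (by
    have := Int.self_le_toNat (m - (L.top k + 1)); omega) hw))

lemma top_coeffs_of_mem_sup (L : D.Level) {k : ℕ} {x : ToricFaceRing K Φ}
    (hx : x ∈ L.J K 1 (Finset.Icc 1 k) (L.top k) ⊔ L.F K 1 (L.top k + 1)) :
    ∃ y : ℕ → Finset (Fin N) → K, ∀ H ∈ D.chains, H.image D.κ = Finset.Icc 1 k →
      ToricRing.coeffs K Φ x (D.ext 0 H) = ∑ l ∈ Finset.Icc 1 k, y l (colErase D.κ l H) := by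
  have hS : ∀ l ∈ Finset.Icc 1 k, 1 ≤ l := fun l hl => (Finset.mem_Icc.1 hl).1
  obtain ⟨z, -, hz⟩ := L.coeffs_of_mem_sup K hS hx
  refine ⟨fun l G => ToricRing.coeffs K Φ (z l) (D.ext 0 G), fun H hH hC => ?_⟩
  rw [hz _ (D.tau_ext_zero hH).1 (L.ω_ext_zero hH hC)]
  refine Finset.sum_congr rfl fun l hl => ?_
  rw [← hC] at hl
  obtain ⟨v, hv, rfl⟩ := Finset.mem_image.1 hl
  have h0 : v ∉ D.car (0 : Fin d → ℤ) := by rw [car_zero]; exact Finset.notMem_empty v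
  rw [D.th_eq (v := v) (by rwa [D.car_ext_zero hH]) rfl
    (by rw [(D.tau_ext_zero hH).2]; simp [hv]), D.ext_sub hv h0, D.erase_eq_colErase hH hv]

lemma mem_sup_of_top_coeffs (L : D.Level) {k : ℕ} (hk : ∀ v, D.κ v ≤ k) {x : ToricFaceRing K Φ}
    (hx : x ∈ L.F K 1 (L.top k))
    (h : ∃ y : ℕ → Finset (Fin N) → K, ∀ H ∈ D.chains, H.image D.κ = Finset.Icc 1 k →
      ToricRing.coeffs K Φ x (D.ext 0 H) = ∑ l ∈ Finset.Icc 1 k, y l (colErase D.κ l H)) :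
    x ∈ L.J K 1 (Finset.Icc 1 k) (L.top k) ⊔ L.F K 1 (L.top k + 1) := by
  have hS : ∀ l ∈ Finset.Icc 1 k, 1 ≤ l := fun l hl => (Finset.mem_Icc.1 hl).1
  refine L.peel K le_sup_right (fun x => x ∈ L.F K 1 (L.top k) ∧
    ∃ y : ℕ → Finset (Fin N) → K, ∀ H ∈ D.chains, H.image D.κ = Finset.Icc 1 k →
      ToricRing.coeffs K Φ x (D.ext 0 H) = ∑ l ∈ Finset.Icc 1 k, y l (colErase D.κ l H))
    (fun u h => h.1) ?_ ⟨hx, h⟩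
  rintro u ⟨hu, y, hy⟩ a ha han hau
  by_cases h1 : ∃ v ∈ D.car a, 1 < D.tau a v
  · obtain ⟨v, hv, hv1⟩ := h1
    obtain ⟨q, hq, hq'⟩ := L.piece_large K hS ha han
      (Finset.mem_Icc.2 ⟨D.κ_pos v, hk v⟩) hv1 (ToricRing.coeffs K Φ u a)
    refine ⟨q, le_sup_left (a := L.J K 1 _ _) hq,
      ⟨ToricRing.sub_mem K hu (L.J_le_F K hS _ hq), y, fun H hH hC => ?_⟩, {a}, rfl,
      fun b hb hbn => ?_⟩
    · rw [map_sub, Finsupp.sub_apply, hq' _ (D.tau_ext_zero hH).1 (L.ω_ext_zero hH hC), if_neg,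
        sub_zero, hy H hH hC]
      rintro rfl
      rw [(D.tau_ext_zero hH).2] at hv1
      dsimp only at hv1
      split_ifs at hv1 <;> linarith
    · rw [hq' b hb hbn]
      by_cases e : b = a
      · rw [if_pos e, if_pos (Set.mem_singleton_iff.2 e), e]
      · rw [if_neg e, if_neg (mt Set.mem_singleton_iff.1 e)]
  · push Not at h1
    have hag := (L.mem_grp_of_top_le hk ha han.ge h1).2
    obtain ⟨q, hq⟩ := ToricRing.exists_coeffs K (Φ := Φ)
      (fun b => if b ∈ D.grp 0 (Finset.Icc 1 k) then ToricRing.coeffs K Φ u b else 0)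
      ((ToricRing.coeffs K Φ u).hasFiniteSupport.subset fun b hb => by
        rw [Function.mem_support] at hb ⊢
        exact fun h => hb (by rw [h, ite_self]))
      fun b hb => ToricRing.coeffs_support K Φ.zero_mem_supp (x := u) fun h =>
        hb (by simp only [h, ite_self])
    have h0 : (0 : Fin d → ℤ) ∈ Φ.supp := Φ.zero_mem_supp
    have hω0 : L.ω 1 (0 : Fin d → ℤ) = 0 := by
      have := L.ω_one_eq h0
      rw [car_zero, Finset.sum_empty] at this
      exact_mod_cast this
    have hqm : q ∈ L.J K 1 (Finset.Icc 1 k) (L.top k) ⊔ L.F K 1 (L.top k + 1) := by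
      refine L.grp_mem_sup K h0 subset_rfl (by rw [car_zero]; simp) hS
        (by rw [hω0, zero_add, top]) y fun b => ?_
      rw [hq]
      refine if_ctx_congr Iff.rfl (fun hb => ?_) fun _ => rfl
      obtain ⟨G, hG, -, hGC, rfl⟩ := hb
      rw [car_zero, Finset.image_empty, Finset.empty_union] at hGC
      rw [hy G hG hGC, D.car_ext_zero hG]
    refine ⟨q, hqm, ⟨ToricRing.sub_mem K hu
      (sup_le (L.J_le_F K hS _) (L.F_anti K 1 (by omega)) hqm), 0, fun H hH hC => ?_⟩, _, hag,
      fun b _ _ => hq b⟩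
    rw [map_sub, Finsupp.sub_apply, hq, if_pos, sub_self]
    · simp
    · exact ⟨H, hH, by rw [car_zero]; exact Finset.empty_subset _,
        by rw [car_zero, Finset.image_empty, Finset.empty_union, hC], rfl⟩

variable (L : D.Level) {k : ℕ}

lemma top_mem_sup_of_mem_span (B : BalancedSphere K D.chains D.κ (Finset.Icc 1 k))
    {x : ToricFaceRing K Φ} (hx : x ∈ L.F K 1 (L.top k))
    (h : x ∈ Ideal.span (D.θ K '' (Finset.Icc 1 k : Finset ℕ))) :
    x ∈ L.J K 1 (Finset.Icc 1 k) (L.top k) ⊔ L.F K 1 (L.top k + 1) :=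
  le_sup_left (a := L.J K 1 _ _)
    (L.J_inf_F K B le_rfl subset_rfl ((L.mem_span_θ_iff K).1 h) hx)

lemma mem_span_of_mem_sup_top (hk : ∀ v, D.κ v ≤ k) {x : ToricFaceRing K Φ}
    (h : x ∈ L.J K 1 (Finset.Icc 1 k) (L.top k) ⊔ L.F K 1 (L.top k + 1)) :
    x ∈ Ideal.span (D.θ K '' (Finset.Icc 1 k : Finset ℕ)) := by
  obtain ⟨y, hy, z, hz, rfl⟩ := Submodule.mem_sup.1 h
  exact Ideal.add_mem _ (L.mem_span_of_mem_J K hy) (L.mem_span_of_top_lt K hk hz)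

/-- The monomial of a facet generates the socle. -/
lemma exists_socle (hk : ∀ v, D.κ v ≤ k) (B : BalancedSphere K D.chains D.κ (Finset.Icc 1 k)) :
    ∃ s : ToricFaceRing K Φ, s ∉ Ideal.span (D.θ K '' (Finset.Icc 1 k : Finset ℕ)) ∧
      ∀ x ∈ L.F K 1 (L.top k), ∃ c : K,
        x - c • s ∈ Ideal.span (D.θ K '' (Finset.Icc 1 k : Finset ℕ)) := by
  obtain ⟨H₀, hH₀, -, hC₀⟩ := B.ext ∅ B.empty_mem
  have hmax := B.isMaxFace hH₀ hC₀
  have hne : H₀.Nonempty := by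
    rw [Finset.nonempty_iff_ne_empty]
    rintro rfl
    have := B.nonempty
    rw [← hC₀] at this
    simp at this
  have hs : ∀ H ∈ D.chains, ToricRing.coeffs K Φ (xpow K Φ (D.ext 0 H₀)) (D.ext 0 H) =
      if H = H₀ then 1 else 0 := by
    intro H hH
    rw [ToricRing.coeffs_xpow K (D.tau_ext_zero hH₀).1, Finsupp.single_apply]
    refine if_congr ⟨fun h => ?_, fun h => by rw [h]⟩ rfl rfl
    rw [← D.car_ext_zero hH, ← h, D.car_ext_zero hH₀]
  have hsF : xpow K Φ (D.ext 0 H₀) ∈ L.F K 1 (L.top k) :=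
    L.xpow_mem_F K 1 (L.ω_ext_zero hH₀ hC₀).ge
  refine ⟨xpow K Φ (D.ext 0 H₀), fun hmem => ?_, fun x hx => ?_⟩
  · obtain ⟨g, hg⟩ := (B.exists_color_iff _).1
      (L.top_coeffs_of_mem_sup K (L.top_mem_sup_of_mem_span K B hsF hmem))
    refine B.indicator_not_coboundary hmax ⟨g, fun G hG => ?_⟩
    rw [← hg G hG, hs G hG]
    by_cases h : G = H₀
    · subst h; rw [if_pos rfl, if_pos hC₀]
    · rw [if_neg h, ite_self]
  · obtain ⟨c, u, hu⟩ := B.maxFace_rep hmax hne (fun G hG =>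
      B.cobd_top (fun H => ToricRing.coeffs K Φ x (D.ext 0 H)) hG)
    refine ⟨c, L.mem_span_of_mem_sup_top K hk (L.mem_sup_of_top_coeffs K hk
      (ToricRing.sub_mem K hx (Submodule.smul_mem _ c hsF)) ?_)⟩
    rw [B.exists_color_iff (fun H => ToricRing.coeffs K Φ (x - c • xpow K Φ (D.ext 0 H₀))
      (D.ext 0 H))]
    refine ⟨u, fun H hH => ?_⟩
    have h1 := hu H hH
    rw [← sub_eq_iff_eq_add'] at h1
    rw [← h1, map_sub, Finsupp.sub_apply, map_smul, Finsupp.smul_apply, hs H hH, smul_eq_mul]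
    by_cases h : H = H₀
    · subst h; simp [hC₀]
    · simp [h]

end Level

end FanData

namespace FanData

variable {d N : ℕ} {Φ : Fan d} {D : FanData Φ N} [hΦ : Nonempty Φ.cones]

namespace Level

variable (K : Type) [Field K] (L : D.Level) {k : ℕ}

/-- The complementary monomial detecting a nonzero class on a group of lattice points. -/
lemma exists_xpow_mul_notMem (B : BalancedSphere K D.chains D.κ (Finset.Icc 1 k)) {n : ℤ}
    {u : ToricFaceRing K Φ} (hu : u ∈ L.F K 1 n) {p : Fin d → ℤ} (hp : p ∈ Φ.supp)
    (hp1 : ∀ v, D.tau p v < 1) {T : Finset ℕ} (hT : T ⊆ Finset.Icc 1 k)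
    (hTp : Disjoint T ((D.car p).image D.κ)) (hn : L.ω 1 p + ∑ l ∈ T, L.W l = n)
    (h : ¬ ∃ y : ℕ → Finset (Fin N) → K, ∀ G ∈ D.chains, D.car p ⊆ G →
      G.image D.κ = (D.car p).image D.κ ∪ T →
      ToricRing.coeffs K Φ u (D.ext p G) = ∑ l ∈ T, y l (colErase D.κ l G)) :
    ∃ e ∈ Φ.supp, L.ω 1 e + n = L.top k ∧
      xpow K Φ e * u ∉ Ideal.span (D.θ K '' (Finset.Icc 1 k : Finset ℕ)) := by
  set F := D.car p with hF
  have hFch : F ∈ D.chains := D.car_mem p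
  have hFC : F.image D.κ ⊆ Finset.Icc 1 k := fun c hc => by
    obtain ⟨v, hv, rfl⟩ := Finset.mem_image.1 hc
    exact B.sub F hFch v hv
  obtain ⟨G', hG', hno⟩ := B.color_duality _ F hFch T hT hTp rfl
    (fun G => ToricRing.coeffs K Φ u (D.ext p G)) h
  have hFG : F ∪ G' ∈ D.chains := by
    by_contra hcon
    refine hno ⟨0, fun H hH => ?_⟩
    rw [if_neg]
    · simp [cobd]
    · rintro ⟨h1, h2, -⟩
      exact hcon (D.chains_down hH (Finset.union_subset h1 h2))
  have hdisj : Disjoint F G' := by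
    rw [Finset.disjoint_left]
    intro v hv hv'
    have := Finset.mem_image_of_mem D.κ hv'
    rw [hG', Finset.mem_sdiff] at this
    exact this.2 (Finset.mem_union_left _ (Finset.mem_image_of_mem _ hv))
  obtain ⟨hb, hbt⟩ := D.tau_ext_zero hFG
  have hple : ∀ v, D.tau p v ≤ D.tau (D.ext 0 (F ∪ G')) v := by
    intro v
    rw [hbt]
    by_cases hv : v ∈ F
    · simpa [hv] using (hp1 v).le
    · have h0 : D.tau p v = 0 := by rwa [hF, D.mem_car, not_not] at hv
      rw [h0]
      dsimp only
      split_ifs <;> norm_num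
  obtain ⟨he, het⟩ := D.tau_sub_of_le hb hp hple
  set e := D.ext 0 (F ∪ G') - p with he_def
  have hωe : L.ω 1 e + n = L.top k := by
    have h1 := L.ω_add_eq 1 he hp hb (by rw [het, sub_add_cancel])
    have h2 : L.ω 1 (D.ext 0 (F ∪ G')) = L.ω 1 (0 : Fin d → ℤ) +
        ∑ l ∈ (F ∪ G').image D.κ, L.W l :=
      L.ω_ext Φ.zero_mem_supp hFG (by rw [car_zero]; exact Finset.empty_subset _)
        (by rw [car_zero]; simp) (by rw [car_zero]; simp) fun l hl => by
          obtain ⟨v, -, rfl⟩ := Finset.mem_image.1 hl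
          exact D.κ_pos v
    have h3 : L.ω 1 (0 : Fin d → ℤ) = 0 := by
      have := L.ω_one_eq Φ.zero_mem_supp
      rw [car_zero, Finset.sum_empty] at this
      exact_mod_cast this
    have h4 : (F ∪ G').image D.κ = Finset.Icc 1 k \ T := by
      rw [Finset.image_union, hG']
      ext c
      simp only [Finset.mem_union, Finset.mem_sdiff, not_or]
      constructor
      · rintro (h | h)
        · exact ⟨hFC h, fun h' => Finset.disjoint_left.1 hTp h' h⟩
        · exact ⟨h.1, h.2.2⟩
      · rintro ⟨h, h'⟩
        by_cases hc : c ∈ F.image D.κ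
        · exact Or.inl hc
        · exact Or.inr ⟨h, hc, h'⟩
    have h5 := Finset.sum_sdiff (f := fun l => L.W l) hT
    rw [← h4] at h5
    rw [top]
    linarith
  refine ⟨e, he, hωe, fun hmem => ?_⟩
  have hxF : xpow K Φ e * u ∈ L.F K 1 (L.top k) := by
    rw [← hωe]; exact L.mul_mem_F K 1 (L.xpow_mem_F K 1 le_rfl) hu
  obtain ⟨g, hg⟩ := (B.exists_color_iff _).1
    (L.top_coeffs_of_mem_sup K (L.top_mem_sup_of_mem_span K B hxF hmem))
  refine hno ⟨g, fun H hH => ?_⟩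
  rw [← hg H hH]
  by_cases hHC : H.image D.κ = Finset.Icc 1 k
  · rw [if_pos hHC, L.coeffs_xpow_mul K hu he (D.tau_ext_zero hH).1
      (by rw [L.ω_ext_zero hH hHC, hωe])]
    by_cases hs : F ⊆ H ∧ G' ⊆ H
    · rw [if_pos ⟨hs.1, hs.2, hHC⟩, if_pos]
      · congr 1
        have h1 : H \ (F ∪ G') = (H \ G') \ F := by
          ext v; simp only [Finset.mem_sdiff, Finset.mem_union]; tauto
        have h2 := Finset.sum_sdiff (f := D.a) (Finset.union_subset hs.1 hs.2)
        rw [he_def, ext, ext, ext, car_zero, Finset.sdiff_empty, Finset.sdiff_empty, ← hF, ← h1,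
          ← h2]
        abel
      · intro v
        rw [het, hbt, (D.tau_ext_zero hH).2, Pi.sub_apply]
        have h0 := D.tau_nonneg p v
        dsimp only
        by_cases hv : v ∈ F ∪ G'
        · rw [if_pos hv, if_pos (Finset.union_subset hs.1 hs.2 hv)]; linarith
        · rw [if_neg hv]; split_ifs <;> linarith
    · rw [if_neg fun h => hs ⟨h.1, h.2.1⟩, if_neg]
      intro hle
      have hsub : F ∪ G' ⊆ H := by
        intro v hv
        by_contra hvH
        have h1 := hle v
        rw [het, hbt, (D.tau_ext_zero hH).2, Pi.sub_apply] at h1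
        dsimp only at h1
        rw [if_pos hv, if_neg hvH] at h1
        linarith [hp1 v]
      exact hs ⟨Finset.subset_union_left.trans hsub, Finset.subset_union_right.trans hsub⟩
  · rw [if_neg hHC, if_neg fun h => hHC h.2.2]

end Level

end FanData

namespace FanData

variable {d N : ℕ} {Φ : Fan d} {D : FanData Φ N} [hΦ : Nonempty Φ.cones]

namespace Level

variable (K : Type) [Field K] (L : D.Level) {k : ℕ}

lemma xpow_mul_mem_span (hk : ∀ v, D.κ v ≤ k) {n : ℤ} {q : ToricFaceRing K Φ}
    (hq : q ∈ L.J K 1 (Finset.Icc 1 k) n ⊔ L.F K 1 (n + 1)) {e : Fin d → ℤ}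
    (hen : L.ω 1 e + n = L.top k) :
    xpow K Φ e * q ∈ Ideal.span (D.θ K '' (Finset.Icc 1 k : Finset ℕ)) := by
  obtain ⟨y, hy, z, hz, rfl⟩ := Submodule.mem_sup.1 hq
  rw [mul_add]
  refine Ideal.add_mem _ (Ideal.mul_mem_left _ _ (L.mem_span_of_mem_J K hy))
    (L.mem_span_of_top_lt K hk ?_)
  rw [← hen, add_assoc]
  exact L.mul_mem_F K 1 (L.xpow_mem_F K 1 le_rfl) hz

/-- An element whose multiples in the top level vanish has a representative of higher level. -/
lemma mem_sup_of_xpow_mul_mem (hk : ∀ v, D.κ v ≤ k)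
    (B : BalancedSphere K D.chains D.κ (Finset.Icc 1 k)) {n : ℤ}
    {u : ToricFaceRing K Φ} (hu : u ∈ L.F K 1 n)
    (h : ∀ e ∈ Φ.supp, L.ω 1 e + n = L.top k →
      xpow K Φ e * u ∈ Ideal.span (D.θ K '' (Finset.Icc 1 k : Finset ℕ))) :
    u ∈ L.J K 1 (Finset.Icc 1 k) n ⊔ L.F K 1 (n + 1) := by
  have hS : ∀ l ∈ Finset.Icc 1 k, 1 ≤ l := fun l hl => (Finset.mem_Icc.1 hl).1
  refine L.peel K le_sup_right (fun u => u ∈ L.F K 1 n ∧ ∀ e ∈ Φ.supp,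
    L.ω 1 e + n = L.top k → xpow K Φ e * u ∈ Ideal.span (D.θ K '' (Finset.Icc 1 k : Finset ℕ)))
    (fun u h => h.1) ?_ ⟨hu, h⟩
  rintro u ⟨hu, h⟩ a ha han -
  suffices hq : ∃ q ∈ L.J K 1 (Finset.Icc 1 k) n ⊔ L.F K 1 (n + 1), q ∈ L.F K 1 n ∧
      ∃ A : Set (Fin d → ℤ), a ∈ A ∧ ∀ b ∈ Φ.supp, L.ω 1 b = n →
        ToricRing.coeffs K Φ q b = if b ∈ A then ToricRing.coeffs K Φ u b else 0 by
    obtain ⟨q, hq, hqF, hA⟩ := hq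
    refine ⟨q, hq, ⟨ToricRing.sub_mem K hu hqF, fun e he hen => ?_⟩, hA⟩
    rw [mul_sub]
    exact Ideal.sub_mem _ (h e he hen) (L.xpow_mul_mem_span K hk hq hen)
  by_cases hlarge : ∃ v ∈ D.car a, 1 < D.tau a v
  · obtain ⟨v, -, hv1⟩ := hlarge
    obtain ⟨q, hq, hq'⟩ := L.piece_large K hS ha han
      (Finset.mem_Icc.2 ⟨D.κ_pos v, hk v⟩) hv1 (ToricRing.coeffs K Φ u a)
    refine ⟨q, le_sup_left (a := L.J K 1 _ _) hq, L.J_le_F K hS n hq, {a}, rfl,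
      fun b hb hbn => ?_⟩
    rw [hq' b hb hbn]
    by_cases e : b = a
    · rw [if_pos e, if_pos (Set.mem_singleton_iff.2 e), e]
    · rw [if_neg e, if_neg (mt Set.mem_singleton_iff.1 e)]
  push Not at hlarge
  set R := (D.car a).filter fun v => D.tau a v = 1 with hR
  obtain ⟨p, hp, hcar, hpt, hdisj, hag⟩ := D.mem_grp_sub ha (R := R) (Finset.filter_subset _ _)
    fun v hv => (Finset.mem_filter.1 hv).2
  have hp1 : ∀ v, D.tau p v < 1 := by
    intro v
    by_cases hv : v ∈ D.car p
    · rw [hpt v hv]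
      rw [hcar, hR, Finset.mem_sdiff, Finset.mem_filter, not_and] at hv
      exact lt_of_le_of_ne (hlarge v hv.1) (hv.2 hv.1)
    · rw [D.mem_car, not_not] at hv
      rw [hv]; exact one_pos
  set T := R.image D.κ with hT
  have hTk : T ⊆ Finset.Icc 1 k := by
    intro c hc
    obtain ⟨v, -, rfl⟩ := Finset.mem_image.1 hc
    exact Finset.mem_Icc.2 ⟨D.κ_pos v, hk v⟩
  have hpn : L.ω 1 p + ∑ l ∈ T, L.W l = n := by
    obtain ⟨G, hG, hpG, hGT, rfl⟩ := hag
    rw [← L.ω_ext hp hG hpG hdisj hGT fun l hl => hS l (hTk hl), han]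
  by_cases hy : ∃ y : ℕ → Finset (Fin N) → K, ∀ G ∈ D.chains, D.car p ⊆ G →
      G.image D.κ = (D.car p).image D.κ ∪ T →
      ToricRing.coeffs K Φ u (D.ext p G) = ∑ l ∈ T, y l (colErase D.κ l G)
  · obtain ⟨y, hy⟩ := hy
    obtain ⟨q, hq⟩ := ToricRing.exists_coeffs K (Φ := Φ)
      (fun b => if b ∈ D.grp p T then ToricRing.coeffs K Φ u b else 0)
      ((ToricRing.coeffs K Φ u).hasFiniteSupport.subset fun b hb => by
        rw [Function.mem_support] at hb ⊢
        exact fun h => hb (by rw [h, ite_self]))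
      fun b hb => ToricRing.coeffs_support K Φ.zero_mem_supp (x := u) fun h =>
        hb (by simp only [h, ite_self])
    refine ⟨q, L.grp_mem_sup K hp hTk hdisj hS hpn y fun b => ?_, fun b hb => ?_, _, hag,
      fun b _ _ => hq b⟩
    · rw [hq]
      refine if_ctx_congr Iff.rfl (fun hb => ?_) fun _ => rfl
      obtain ⟨G, hG, hpG, hGT, rfl⟩ := hb
      rw [hy G hG hpG hGT, D.car_ext hp hG hpG]
    · rw [hq] at hb
      exact hu b fun h => hb (by rw [h, ite_self])
  · obtain ⟨e, he, hen, hne⟩ := L.exists_xpow_mul_notMem K B hu hp hp1 hTk hdisj hpn hy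
    exact absurd (h e he hen) hne

/-- Every element outside the parameter ideal has a multiple generating the socle. -/
lemma exists_mul_sub_smul_mem (hk : ∀ v, D.κ v ≤ k)
    (B : BalancedSphere K D.chains D.κ (Finset.Icc 1 k)) {s : ToricFaceRing K Φ}
    (hs : ∀ x ∈ L.F K 1 (L.top k), ∃ c : K,
      x - c • s ∈ Ideal.span (D.θ K '' (Finset.Icc 1 k : Finset ℕ)))
    {z : ToricFaceRing K Φ} (hz : z ∉ Ideal.span (D.θ K '' (Finset.Icc 1 k : Finset ℕ))) :
    ∃ r : ToricFaceRing K Φ, ∃ c : K, c ≠ 0 ∧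
      r * z - c • s ∈ Ideal.span (D.θ K '' (Finset.Icc 1 k : Finset ℕ)) := by
  by_contra hcon
  push Not at hcon
  have key : ∀ n : ℕ, ∃ w ∈ L.F K 1 n,
      z - w ∈ Ideal.span (D.θ K '' (Finset.Icc 1 k : Finset ℕ)) := by
    intro n
    induction n with
    | zero => exact ⟨z, L.mem_F_of_nonpos K 1 (by simp) z, by simp⟩
    | succ n ih =>
      obtain ⟨w, hw, hzw⟩ := ih
      obtain ⟨y, hy, w', hw', e⟩ := Submodule.mem_sup.1
        (L.mem_sup_of_xpow_mul_mem K hk B hw fun e he hen => by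
          have hF : xpow K Φ e * w ∈ L.F K 1 (L.top k) := by
            rw [← hen]; exact L.mul_mem_F K 1 (L.xpow_mem_F K 1 le_rfl) hw
          obtain ⟨c, hc⟩ := hs _ hF
          have h0 : c = 0 := by
            by_contra hc0
            refine hcon (xpow K Φ e) c hc0 ?_
            rw [show xpow K Φ e * z - c • s = xpow K Φ e * (z - w) + (xpow K Φ e * w - c • s) by
              ring]
            exact Ideal.add_mem _ (Ideal.mul_mem_left _ _ hzw) hc
          simpa [h0] using hc)
      refine ⟨w', by push_cast; exact hw', ?_⟩
      rw [show z - w' = (z - w) + y by rw [← e]; ring]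
      exact Ideal.add_mem _ hzw (L.mem_span_of_mem_J K hy)
  obtain ⟨w, hw, hzw⟩ := key (L.top k + 1).toNat
  refine hz ?_
  rw [show z = (z - w) + w by ring]
  exact Ideal.add_mem _ hzw (L.mem_span_of_top_lt K hk (L.F_anti K 1 (Int.self_le_toNat _) hw))

end Level

/-- The zero ideal is irreducible modulo the parameters. -/
lemma irreducible_mod_params (K : Type) [Field K] {k : ℕ} (hk : ∀ v, D.κ v ≤ k)
    (B : BalancedSphere K D.chains D.κ (Finset.Icc 1 k))
    (P Q : Ideal (ToricFaceRing K Φ ⧸ Ideal.span {x | x ∈ D.params K k})) (h : P ⊓ Q = ⊥) :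
    P = ⊥ ∨ Q = ⊥ := by
  obtain ⟨L⟩ := D.exists_level
  obtain ⟨s, hsI, hs⟩ := L.exists_socle K hk B
  have key : ∀ P : Ideal (ToricFaceRing K Φ ⧸ Ideal.span {x | x ∈ D.params K k}), P ≠ ⊥ →
      Ideal.Quotient.mk _ s ∈ P := by
    intro P hP
    obtain ⟨z, hzP, hz0⟩ := Submodule.exists_mem_ne_zero_of_ne_bot hP
    obtain ⟨z, rfl⟩ := Ideal.Quotient.mk_surjective z
    rw [Ne, Ideal.Quotient.eq_zero_iff_mem, D.setOf_mem_params] at hz0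
    obtain ⟨r, c, hc, hrc⟩ := L.exists_mul_sub_smul_mem K hk B hs hz0
    have h1 : Ideal.Quotient.mk (Ideal.span {x | x ∈ D.params K k}) s =
        Ideal.Quotient.mk _ (algebraMap K _ c⁻¹ * r) * Ideal.Quotient.mk _ z := by
      rw [← map_mul, eq_comm, Ideal.Quotient.eq, D.setOf_mem_params]
      have h2 := Ideal.mul_mem_left (Ideal.span (D.θ K '' (Finset.Icc 1 k : Finset ℕ)))
        (algebraMap K _ c⁻¹) hrc
      have h3 : algebraMap K (ToricFaceRing K Φ) c⁻¹ * algebraMap K _ c = 1 := by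
        rw [← map_mul, inv_mul_cancel₀ hc, map_one]
      rw [Algebra.smul_def, mul_sub, ← mul_assoc, ← mul_assoc, h3, one_mul] at h2
      exact h2
    rw [h1]
    exact P.mul_mem_left _ hzP
  by_contra hcon
  push Not at hcon
  have h0 : Ideal.Quotient.mk (Ideal.span {x | x ∈ D.params K k}) s ∈ P ⊓ Q :=
    ⟨key P hcon.1, key Q hcon.2⟩
  rw [h, Submodule.mem_bot, Ideal.Quotient.eq_zero_iff_mem, D.setOf_mem_params] at h0
  exact hsI h0

end FanData

lemma length_le_ringKrullDim_of_isRegSeqIn {R : Type} [CommRing R] (I : Ideal R) (l : List R)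
    (h : IsRegSeqIn R I l) (hl : Ideal.span {x | x ∈ l} ≠ ⊤) :
    (l.length : WithBot (WithTop ℕ)) ≤ ringKrullDim R := by
  unfold IsRegSeqIn at h
  induction hn : l.length generalizing R with
  | zero =>
    have : Nontrivial R := by
      by_contra hR
      rw [not_nontrivial_iff_subsingleton] at hR
      exact hl (Subsingleton.elim _ _)
    exact ringKrullDim_nonneg_of_nontrivial
  | succ n ih =>
    rw [hn] at h
    obtain ⟨x, xs, rfl, -, hx, h⟩ := h
    have hn' : xs.length = n := by simpa using hn
    have h1 := ih (R := R ⧸ Ideal.span {x}) _ (xs.map (Ideal.Quotient.mk (Ideal.span {x})))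
      (by rwa [List.length_map, hn']) (fun htop => hl ?_) (by rw [List.length_map, hn'])
    · refine le_trans ?_ (ringKrullDim_quotient_succ_le_of_nonZeroDivisor hx)
      push_cast
      exact add_le_add_left h1 1
    · have h2 : {y | y ∈ xs.map (Ideal.Quotient.mk (Ideal.span {x}))} =
          Ideal.Quotient.mk (Ideal.span {x}) '' {y | y ∈ xs} := by
        ext y; simp
      rw [h2, ← Ideal.map_span] at htop
      have h3 := congrArg (Ideal.comap (Ideal.Quotient.mk (Ideal.span {x}))) htop
      rw [Ideal.comap_map_of_surjective' _ Ideal.Quotient.mk_surjective, Ideal.mk_ker,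
        Ideal.comap_top] at h3
      rw [eq_top_iff, ← h3]
      refine sup_le (Ideal.span_mono fun y hy => List.mem_cons_of_mem _ hy) ?_
      rw [Ideal.span_singleton_le_iff_mem]
      exact Ideal.subset_span (by simp)

lemma ringKrullDim_le_of_isIntegral (R S : Type*) [CommRing R] [CommRing S] [Algebra R S]
    [Algebra.IsIntegral R S] : ringKrullDim S ≤ ringKrullDim R := by
  refine Order.krullDim_le_of_strictMono (PrimeSpectrum.comap (algebraMap R S)) fun p q hpq => ?_
  obtain ⟨x, hxq, hxp⟩ := SetLike.exists_of_lt (PrimeSpectrum.asIdeal_lt_asIdeal p q |>.2 hpq)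
  rw [← PrimeSpectrum.asIdeal_lt_asIdeal]
  exact Ideal.comap_lt_comap_of_integral_mem_sdiff (PrimeSpectrum.asIdeal_lt_asIdeal p q |>.2 hpq).le
    ⟨hxq, hxp⟩ (Algebra.IsIntegral.isIntegral x)

/-- Polynomial growth bounds the Krull dimension of a finitely generated algebra. -/
lemma ringKrullDim_le_of_growth {K R : Type*} [Field K] [CommRing R] [Nontrivial R] [Algebra K R]
    [Algebra.FiniteType K R] {k : ℕ} (G : ℕ → Submodule K R) (hmono : Monotone G)
    (h1 : 1 ∈ G 0) (hmul : ∀ m n, ∀ x ∈ G m, ∀ y ∈ G n, x * y ∈ G (m + n))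
    (hG : ∀ x, ∃ m, x ∈ G m) (hfin : ∀ m, Module.Finite K (G m)) (c : ℕ)
    (hc : ∀ m, Module.finrank K (G m) ≤ c * (m + 1) ^ k) : ringKrullDim R ≤ k := by
  obtain ⟨s, g, hg, hgf⟩ := exists_finite_inj_algHom_of_fg K R
  have hs : s ≤ k := by
    choose f hf using fun i : Fin s => hG (g (MvPolynomial.X i))
    set m := Finset.univ.sup f with hm
    have hX : ∀ i, g (MvPolynomial.X i) ∈ G m := fun i =>
      hmono (Finset.le_sup (Finset.mem_univ i)) (hf i)
    have hpow : ∀ x ∈ G m, ∀ n, x ^ n ∈ G (n * m) := by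
      intro x hx n
      induction n with
      | zero => simpa using h1
      | succ n ih => rw [pow_succ, add_mul, one_mul]; exact hmul _ _ _ ih _ hx
    have hmon : ∀ (e : Fin s →₀ ℕ) (T : Finset (Fin s)),
        ∏ i ∈ T, g (MvPolynomial.X i) ^ e i ∈ G ((∑ i ∈ T, e i) * m) := by
      intro e T
      induction T using Finset.induction_on with
      | empty => simpa using h1
      | insert i T hi ih =>
        rw [Finset.prod_insert hi, Finset.sum_insert hi, add_mul]
        exact hmul _ _ _ (hpow _ (hX i) _) _ ih
    have hcount : ∀ n : ℕ, (n + 1) ^ s ≤ c * (s * n * m + 1) ^ k := by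
      intro n
      let E : (Fin s → Fin (n + 1)) → (Fin s →₀ ℕ) := fun e =>
        Finsupp.equivFunOnFinite.symm fun i => (e i : ℕ)
      have hE : Function.Injective E := by
        intro e e' h
        funext i
        exact Fin.ext (by simpa [E] using DFunLike.congr_fun h i)
      have hmem : ∀ e, g (MvPolynomial.monomial (E e) 1) ∈ G (s * n * m) := by
        intro e
        rw [MvPolynomial.monomial_eq, map_one, one_mul, Finsupp.prod_fintype _ _ (by simp), map_prod]
        simp only [map_pow]
        refine hmono (Nat.mul_le_mul_right m ?_) (hmon (E e) Finset.univ)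
        calc ∑ i, (E e) i ≤ ∑ _i : Fin s, n :=
              Finset.sum_le_sum fun i _ => Nat.le_of_lt_succ (e i).2
          _ = s * n := by simp
      have hli : LinearIndependent K fun e => g (MvPolynomial.monomial (E e) 1) := by
        have h2 := ((MvPolynomial.basisMonomials (Fin s) K).linearIndependent.comp E hE).map'
          g.toLinearMap (LinearMap.ker_eq_bot.2 hg)
        simpa [Function.comp_def] using h2
      have hli' : LinearIndependent K fun e => (⟨_, hmem e⟩ : G (s * n * m)) :=
        LinearIndependent.of_comp (G (s * n * m)).subtype hli
      have := hfin (s * n * m)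
      have h3 := hli'.fintype_card_le_finrank
      simp only [Fintype.card_pi, Fintype.card_fin, Finset.prod_const, Finset.card_univ] at h3
      exact h3.trans (hc _)
    by_contra hks
    push Not at hks
    set q := c * (s * m + 1) ^ k with hq
    have h2 := hcount q
    have h3 : (s * q * m + 1) ^ k ≤ (s * m + 1) ^ k * (q + 1) ^ k := by
      rw [← mul_pow]
      exact Nat.pow_le_pow_left (by nlinarith [Nat.zero_le (s * m), Nat.zero_le q]) k
    have h4 : (q + 1) ^ (k + 1) ≤ (q + 1) ^ s := Nat.pow_le_pow_right (by omega) hks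
    have h5 : c * (s * q * m + 1) ^ k ≤ q * (q + 1) ^ k := by
      calc c * (s * q * m + 1) ^ k ≤ c * ((s * m + 1) ^ k * (q + 1) ^ k) := Nat.mul_le_mul_left c h3
        _ = q * (q + 1) ^ k := by rw [← mul_assoc, ← hq]
    have h6 : 0 < (q + 1) ^ k := by positivity
    rw [pow_succ] at h4
    nlinarith
  let _ : Algebra (MvPolynomial (Fin s) K) R := g.toRingHom.toAlgebra
  have : Algebra.IsIntegral (MvPolynomial (Fin s) K) R := ⟨(RingHom.Finite.to_isIntegral hgf)⟩
  refine (ringKrullDim_le_of_isIntegral (MvPolynomial (Fin s) K) R).trans ?_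
  rw [MvPolynomial.ringKrullDim_of_isNoetherianRing, ringKrullDim_eq_zero_of_field, zero_add,
    Nat.card_eq_fintype_card, Fintype.card_fin]
  exact_mod_cast hs

/-- The lattice points in a cube of side `2 * m`. -/
def latticeCube (d m : ℕ) : Finset (Fin d → ℤ) :=
  Fintype.piFinset fun _ => Finset.Icc (-(m : ℤ)) m

lemma mem_latticeCube {d m : ℕ} {a : Fin d → ℤ} : a ∈ latticeCube d m ↔ ∀ i, |a i| ≤ m := by
  simp [latticeCube, abs_le]

lemma card_latticeCube_filter_le {d : ℕ} (W : Submodule ℝ (Fin d → ℝ)) {k : ℕ}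
    (hW : Module.finrank ℝ W ≤ k) (m : ℕ) :
    ((latticeCube d m).filter fun a => Z2R a ∈ W).card ≤ (2 * m + 1) ^ k := by
  let π : Fin d → Module.Dual ℝ W := fun i => (LinearMap.proj i).comp W.subtype
  obtain ⟨ι, f, hf, hspan, hli⟩ := exists_linearIndependent' ℝ π
  have : Fintype ι := Fintype.ofInjective f hf
  have hcard : Fintype.card ι ≤ k :=
    (hli.fintype_card_le_finrank.trans_eq Subspace.dual_finrank_eq).trans hW
  have hinj : ∀ x ∈ W, (∀ j, x (f j) = 0) → x = 0 := by
    intro x hx h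
    have : ∀ φ ∈ Submodule.span ℝ (Set.range π), φ ⟨x, hx⟩ = 0 := by
      rw [← hspan]
      intro φ hφ
      induction hφ using Submodule.span_induction with
      | mem φ hφ => obtain ⟨j, rfl⟩ := hφ; exact h j
      | zero => rfl
      | add φ ψ _ _ h1 h2 => rw [LinearMap.add_apply, h1, h2, add_zero]
      | smul c φ _ h1 => rw [LinearMap.smul_apply, h1, smul_zero]
    funext i
    exact this (π i) (Submodule.subset_span ⟨i, rfl⟩)
  calc ((latticeCube d m).filter fun a => Z2R a ∈ W).card
      ≤ (Fintype.piFinset fun _ : ι => Finset.Icc (-(m : ℤ)) m).card := by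
        refine Finset.card_le_card_of_injOn (fun a j => a (f j)) (fun a ha => ?_)
          fun a ha b hb hab => ?_
        · have ha' := mem_latticeCube.1 (Finset.mem_filter.1 (Finset.mem_coe.1 ha)).1
          rw [Finset.mem_coe, Fintype.mem_piFinset]
          exact fun j => Finset.mem_Icc.2 (abs_le.1 (ha' (f j)))
        · have h := hinj _ (W.sub_mem (Finset.mem_filter.1 (Finset.mem_coe.1 ha)).2
            (Finset.mem_filter.1 (Finset.mem_coe.1 hb)).2) fun j => by
              have := congrFun hab j
              dsimp only at this
              simp [Z2R, this]
          funext i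
          have h2 := congrFun h i
          simp only [Pi.sub_apply, Z2R, Pi.zero_apply, sub_eq_zero] at h2
          exact_mod_cast h2
    _ = (2 * m + 1) ^ Fintype.card ι := by
        rw [Fintype.card_piFinset, Finset.prod_const, Int.card_Icc, Finset.card_univ]
        congr 1; omega
    _ ≤ (2 * m + 1) ^ k := Nat.pow_le_pow_right (by omega) hcard

lemma Fan.card_latticeCube_filter_le {d : ℕ} (Φ : Fan d) (m : ℕ) :
    ((latticeCube d m).filter fun a => a ∈ Φ.supp).card ≤
      (Φ.finite.toFinset.card * 2 ^ Φ.dim) * (m + 1) ^ Φ.dim := by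
  calc ((latticeCube d m).filter fun a => a ∈ Φ.supp).card
      ≤ (Φ.finite.toFinset.biUnion fun C =>
          (latticeCube d m).filter fun a => Z2R a ∈ Submodule.span ℝ C).card := by
        refine Finset.card_le_card fun a ha => ?_
        obtain ⟨h1, C, hC, h2⟩ := Finset.mem_filter.1 ha
        exact Finset.mem_biUnion.2 ⟨C, Φ.finite.mem_toFinset.2 hC,
          Finset.mem_filter.2 ⟨h1, Submodule.subset_span h2⟩⟩
    _ ≤ Φ.finite.toFinset.card * (2 * m + 1) ^ Φ.dim :=
        Finset.card_biUnion_le_card_mul _ _ _ fun C hC =>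
          _root_.card_latticeCube_filter_le _ (Φ.coneDim_le (Φ.finite.mem_toFinset.1 hC)) m
    _ ≤ (Φ.finite.toFinset.card * 2 ^ Φ.dim) * (m + 1) ^ Φ.dim := by
        rw [mul_assoc, ← mul_pow]
        exact Nat.mul_le_mul_left _ (Nat.pow_le_pow_left (by omega) _)

lemma FanData.ringKrullDim_le {d N : ℕ} {Φ : Fan d} (D : FanData Φ N) [hΦ : Nonempty Φ.cones]
    (K : Type) [Field K] [Nontrivial (ToricFaceRing K Φ)] :
    ringKrullDim (ToricFaceRing K Φ) ≤ Φ.dim := by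
  have := D.finiteType K
  let G : ℕ → Submodule K (ToricFaceRing K Φ) := fun m =>
    Submodule.span K (((latticeCube d m).filter fun a => a ∈ Φ.supp).image (xpow K Φ) :
      Finset (ToricFaceRing K Φ))
  have hx : ∀ {m : ℕ} {a : Fin d → ℤ}, (∀ i, |a i| ≤ m) → xpow K Φ a ∈ G m := by
    intro m a h
    by_cases ha : a ∈ Φ.supp
    · exact Submodule.subset_span (Finset.mem_coe.2 (Finset.mem_image_of_mem _
        (Finset.mem_filter.2 ⟨mem_latticeCube.2 h, ha⟩)))
    · rw [ToricRing.xpow_of_notMem K ha]; exact (G m).zero_mem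
  have hmono : Monotone G := by
    intro m n hmn
    refine Submodule.span_le.2 fun x hx' => ?_
    obtain ⟨a, ha, rfl⟩ := Finset.mem_image.1 (Finset.mem_coe.1 hx')
    exact hx fun i => (mem_latticeCube.1 (Finset.mem_filter.1 ha).1 i).trans (by exact_mod_cast hmn)
  refine ringKrullDim_le_of_growth G hmono ?_ ?_ ?_ (fun m => ?_) _ fun m =>
    (finrank_span_finset_le_card _).trans (Finset.card_image_le.trans
      (Φ.card_latticeCube_filter_le m))
  · rw [← ToricRing.xpow_zero K Φ.zero_mem_supp]
    exact hx (by simp)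
  · intro m n x hxm y hyn
    have hle : G m * G n ≤ G (m + n) := by
      rw [Submodule.span_mul_span, Submodule.span_le]
      rintro _ ⟨x, hx', y, hy', rfl⟩
      obtain ⟨a, ha, rfl⟩ := Finset.mem_image.1 (Finset.mem_coe.1 hx')
      obtain ⟨b, hb, rfl⟩ := Finset.mem_image.1 (Finset.mem_coe.1 hy')
      have ha' := mem_latticeCube.1 (Finset.mem_filter.1 ha).1
      have hb' := mem_latticeCube.1 (Finset.mem_filter.1 hb).1
      rcases ToricRing.xpow_mul_mem K (Φ := Φ) a b with h | h
      · simp only [h]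
        refine hx fun i => (abs_add_le _ _).trans ?_
        push_cast
        exact add_le_add (ha' i) (hb' i)
      · simp only [h]
        exact (G (m + n)).zero_mem
    exact hle (Submodule.mul_mem_mul hxm hyn)
  · intro x
    have htop : x ∈ Submodule.span K (Set.range (xpow K Φ)) := by
      rw [ToricRing.eq_sum_coeffs K Φ.zero_mem_supp x]
      exact Submodule.sum_mem _ fun a _ => Submodule.smul_mem _ _ (Submodule.subset_span ⟨a, rfl⟩)
    induction htop using Submodule.span_induction with
    | mem x hx' =>
      obtain ⟨a, rfl⟩ := hx'
      refine ⟨∑ i, (a i).natAbs, hx fun i => ?_⟩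
      rw [Int.abs_eq_natAbs]
      exact_mod_cast Finset.single_le_sum (f := fun i => (a i).natAbs) (fun _ _ => Nat.zero_le _)
        (Finset.mem_univ i)
    | zero => exact ⟨0, (G 0).zero_mem⟩
    | add x y _ _ h1 h2 =>
      obtain ⟨m, hm⟩ := h1
      obtain ⟨n, hn⟩ := h2
      exact ⟨max m n, (G _).add_mem (hmono (le_max_left m n) hm) (hmono (le_max_right m n) hn)⟩
    | smul c x _ h1 =>
      obtain ⟨m, hm⟩ := h1
      exact ⟨m, (G m).smul_mem c hm⟩
  · exact Module.Finite.iff_fg.2 ⟨_, rfl⟩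

/-- If `|Γ_Φ|` is homeomorphic to a `(dim Φ − 1)`-dimensional sphere, then
`Φ` is an Euler fan and `K[Φ]` is Gorenstein for every field `K`. -/
theorem euler_and_gorenstein_of_sphere {d : ℕ} (Φ : Fan d)
    (h : Nonempty (↥(GammaSet Φ.cones) ≃ₜ ↥(sphereModel (Fan.dim Φ - 1)))) :
    IsEulerFan Φ ∧ ∀ (K : Type) [Field K],
      IsGorensteinRingWrt (ToricFaceRing K Φ) (gradedMaxIdeal K Φ) := by
  have hdim := Fan.one_le_dim (Fan.gamma_nonempty h)
  obtain ⟨N, ⟨D⟩⟩ := Fan.exists_fanData Φ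
  refine ⟨D.isEulerFan (D.balancedSphere h ℚ) hdim, fun K _ => ?_⟩
  have hΦ : Nonempty Φ.cones := by
    obtain ⟨x, hx⟩ := Fan.gamma_nonempty h
    obtain ⟨C, hC, -⟩ := hx.1
    exact ⟨C, hC⟩
  have B := D.balancedSphere h K
  have hk : ∀ v, D.κ v ≤ Φ.dim := D.κ_le
  obtain ⟨L⟩ := D.exists_level
  obtain ⟨s, hs, -⟩ := L.exists_socle K hk B
  have hreg := D.isRegSeqIn_params K hk B
  have hne : Ideal.span {x | x ∈ D.params K Φ.dim} ≠ ⊤ := by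
    rw [D.setOf_mem_params]
    intro htop
    exact hs (htop ▸ Submodule.mem_top)
  have hnt : Nontrivial (ToricFaceRing K Φ) := by
    by_contra hR
    rw [not_nontrivial_iff_subsingleton] at hR
    exact hne (Subsingleton.elim _ _)
  have hlen : ((D.params K Φ.dim).length : WithBot (WithTop ℕ)) = ringKrullDim (ToricFaceRing K Φ) := by
    refine le_antisymm (length_le_ringKrullDim_of_isRegSeqIn _ _ hreg hne) ?_
    rw [D.length_params]
    exact D.ringKrullDim_le K
  exact ⟨⟨_, hreg, hlen⟩, _, hreg, hlen, D.irreducible_mod_params K hk B⟩
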